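/- Let S ⊆ ℝ⁴ be a semialgebraic set with 0 ∈ S such that for every sufficiently small ε > 0 the Hausdorff dimension of S ∩ B(0,ε) equals 2 (a semialgebraic surface germ at 0). Then there exists a sequence (Xᵢ)_{i∈ℕ} of semialgebraic subsets of ℝ⁴ with 0 ∈ Xᵢ such that: (1) for every i, the germs at 0 of Xᵢ and S are ambient topologically equivalent; (2) for all i, j, the germs at 0 of Xᵢ and Xⱼ are bi-Lipschitz equivalent with respect to the outer metric; (3) for all i, j, the germs at 0 of the tangent cones of Xᵢ and Xⱼ at 0 are ambient topologically equivalent; (4) for all i ≠ j, the germs at 0 of Xᵢ and Xⱼ are NOT ambient Lipschitz equivalent. -/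

import Mathlib

open Set Metric

noncomputable section

/-- A set `s ⊆ ℝⁿ` is semialgebraic if it is a finite union of basic sets
`{x : p(x) = 0, q₁(x) > 0, …, q_m(x) > 0}` with `p, q₁, …, q_m` real polynomials. -/
def IsSemialgebraic {n : ℕ} (s : Set (EuclideanSpace ℝ (Fin n))) : Prop :=
  ∃ (N : ℕ) (P : Fin N → MvPolynomial (Fin n) ℝ) (M : Fin N → ℕ)
    (Q : (i : Fin N) → Fin (M i) → MvPolynomial (Fin n) ℝ),
    s = ⋃ i : Fin N,
      {x : EuclideanSpace ℝ (Fin n) |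
        MvPolynomial.eval (fun j => x j) (P i) = 0 ∧
        ∀ j : Fin (M i), 0 < MvPolynomial.eval (fun j => x j) (Q i j)}

/-- The germs at `0` of `X` and `Y` are bi-Lipschitz equivalent with respect to the
outer metric: there are `ε > 0`, `δ > 0`, `λ ≥ 1` and a map `f : X ∩ B(0,ε) → Y` with
`f 0 = 0`, bi-Lipschitz with constant `λ`, whose image covers `Y ∩ B(0,δ)`. -/
def OuterLipGermEquiv {n : ℕ} (X Y : Set (EuclideanSpace ℝ (Fin n))) : Prop :=
  ∃ ε > (0 : ℝ), ∃ δ > (0 : ℝ), ∃ lam : ℝ, 1 ≤ lam ∧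
    ∃ f : EuclideanSpace ℝ (Fin n) → EuclideanSpace ℝ (Fin n),
      f 0 = 0 ∧
      Set.MapsTo f (X ∩ Metric.ball 0 ε) Y ∧
      (∀ p ∈ X ∩ Metric.ball 0 ε, ∀ q ∈ X ∩ Metric.ball 0 ε,
        lam⁻¹ * ‖p - q‖ ≤ ‖f p - f q‖ ∧ ‖f p - f q‖ ≤ lam * ‖p - q‖) ∧
      Y ∩ Metric.ball 0 δ ⊆ f '' (X ∩ Metric.ball 0 ε)

/-- The germs at `0` of `X` and `Y` are ambient topologically equivalent: there exist open
neighborhoods `U, V` of `0` and a homeomorphism `h : U → V` (with continuous inverse `g`)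
such that `h 0 = 0` and `h (X ∩ U) = Y ∩ V`. -/
def AmbientTopEquiv {n : ℕ} (X Y : Set (EuclideanSpace ℝ (Fin n))) : Prop :=
  ∃ U V : Set (EuclideanSpace ℝ (Fin n)), IsOpen U ∧ IsOpen V ∧ 0 ∈ U ∧ 0 ∈ V ∧
    ∃ h g : EuclideanSpace ℝ (Fin n) → EuclideanSpace ℝ (Fin n),
      ContinuousOn h U ∧ ContinuousOn g V ∧
      Set.MapsTo h U V ∧ Set.MapsTo g V U ∧
      (∀ x ∈ U, g (h x) = x) ∧ (∀ y ∈ V, h (g y) = y) ∧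
      h 0 = 0 ∧ h '' (X ∩ U) = Y ∩ V

/-- The germs at `0` of `X` and `Y` are ambient Lipschitz equivalent: there exist open
neighborhoods `U, V` of `0` and a homeomorphism `h : U → V` (with inverse `g`) such that
`h` and `g = h⁻¹` are Lipschitz, `h 0 = 0` and `h (X ∩ U) = Y ∩ V`. -/
def AmbientLipEquiv {n : ℕ} (X Y : Set (EuclideanSpace ℝ (Fin n))) : Prop :=
  ∃ U V : Set (EuclideanSpace ℝ (Fin n)), IsOpen U ∧ IsOpen V ∧ 0 ∈ U ∧ 0 ∈ V ∧
    ∃ h g : EuclideanSpace ℝ (Fin n) → EuclideanSpace ℝ (Fin n),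
      Set.MapsTo h U V ∧ Set.MapsTo g V U ∧
      (∀ x ∈ U, g (h x) = x) ∧ (∀ y ∈ V, h (g y) = y) ∧
      (∃ K : NNReal, LipschitzOnWith K h U ∧ LipschitzOnWith K g V) ∧
      h 0 = 0 ∧ h '' (X ∩ U) = Y ∩ V

open Polynomial in
/-- `φ` matches the signs of `p` with those of `q`. -/
def SignMatch (φ : ℝ ≃o ℝ) (p q : ℝ[X]) : Prop :=
  ∀ y, SignType.sign (p.eval y) = SignType.sign (q.eval (φ y))

/-- `a` and `b` lie on the same side of every point of `Z`. -/
def SameSide (Z : Finset ℝ) (a b : ℝ) : Prop :=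
  ∀ z ∈ Z, (z < a ∧ z < b) ∨ (a < z ∧ b < z)

theorem exists_bump {l u a b : ℝ} (hla : l < a) (hau : a < u) (hlb : l < b) (hbu : b < u) :
    ∃ ψ : ℝ ≃o ℝ, ψ a = b ∧ ∀ y, y ≤ l ∨ u ≤ y → ψ y = y := by
  let f : ℝ → ℝ → ℝ → ℝ := fun a b y => if y ≤ l then y else if y ≤ a then
    l + (y - l) * ((b - l) / (a - l)) else if y ≤ u then u - (u - y) * ((u - b) / (u - a)) else y
  have key : ∀ a b : ℝ, l < a → a < u → l < b → b < u → ∀ y,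
      (y ≤ l → f a b y = y) ∧ (l < y → y ≤ a → l < f a b y ∧ f a b y ≤ b ∧
        f a b y = l + (y - l) * ((b - l) / (a - l))) ∧
      (a < y → y ≤ u → b < f a b y ∧ f a b y ≤ u ∧
        f a b y = u - (u - y) * ((u - b) / (u - a))) ∧ (u < y → f a b y = y) := by
    intro a b hla hau hlb hbu y
    refine ⟨fun h => by simp [f, h], fun h1 h2 => ?_, fun h1 h2 => ?_, fun h => ?_⟩
    · have e : f a b y = l + (y - l) * ((b - l) / (a - l)) := by simp [f, h2, not_le.2 h1]
      have hp : 0 < (b - l) / (a - l) := div_pos (by linarith) (by linarith)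
      have hc : (a - l) * ((b - l) / (a - l)) = b - l := by
        have : a - l ≠ 0 := by linarith
        field_simp
      refine ⟨?_, ?_, e⟩ <;> rw [e]
      · nlinarith [mul_pos (sub_pos.2 h1) hp]
      · nlinarith [mul_le_mul_of_nonneg_right (sub_le_sub_right h2 l) hp.le]
    · have e : f a b y = u - (u - y) * ((u - b) / (u - a)) := by
        simp [f, h2, not_le.2 h1, not_le.2 (hla.trans h1)]
      have hp : 0 < (u - b) / (u - a) := div_pos (by linarith) (by linarith)
      have hc : (u - a) * ((u - b) / (u - a)) = u - b := by
        have : u - a ≠ 0 := by linarith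
        field_simp
      refine ⟨?_, ?_, e⟩ <;> rw [e]
      · nlinarith [mul_lt_mul_of_pos_right (sub_lt_sub_left h1 u) hp]
      · nlinarith [mul_nonneg (sub_nonneg.2 h2) hp.le]
    · simp [f, not_le.2 h, not_le.2 ((hla.trans hau).trans h), not_le.2 (hau.trans h)]
  have inv : ∀ a b : ℝ, l < a → a < u → l < b → b < u → ∀ y, f b a (f a b y) = y := by
    intro a b hla hau hlb hbu y
    obtain ⟨k1, k2, k3, k4⟩ := key a b hla hau hlb hbu y
    have h1 : a - l ≠ 0 := by linarith
    have h2 : u - a ≠ 0 := by linarith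
    have h3 : b - l ≠ 0 := by linarith
    have h4 : u - b ≠ 0 := by linarith
    rcases le_or_gt y l with h | h
    · rw [k1 h, (key b a hlb hbu hla hau y).1 h]
    rcases le_or_gt y a with h' | h'
    · obtain ⟨m1, m2, m3⟩ := k2 h h'
      rw [((key b a hlb hbu hla hau _).2.1 m1 m2).2.2, m3]; field_simp; ring
    rcases le_or_gt y u with h'' | h''
    · obtain ⟨m1, m2, m3⟩ := k3 h' h''
      rw [((key b a hlb hbu hla hau _).2.2.1 m1 m2).2.2, m3]; field_simp; ring
    · rw [k4 h'', (key b a hlb hbu hla hau y).2.2.2 h'']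
  have mono : StrictMono (f a b) := by
    intro y z hyz
    obtain ⟨k1, k2, k3, k4⟩ := key a b hla hau hlb hbu y
    obtain ⟨m1, m2, m3, m4⟩ := key a b hla hau hlb hbu z
    have hp : 0 < (b - l) / (a - l) := div_pos (by linarith) (by linarith)
    have hq : 0 < (u - b) / (u - a) := div_pos (by linarith) (by linarith)
    rcases le_or_gt y l with h | h <;> [have k1 := k1 h; skip] <;>
    rcases le_or_gt z l with i | i <;> [have m1 := m1 i; skip; have m1 := m1 i; skip] <;>
    try linarith
    all_goals
      rcases le_or_gt z a with i' | i'
      · have := m2 i i'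
        rcases le_or_gt y a with h' | h'
        · first | linarith | (have := k2 h h'; nlinarith [mul_lt_mul_of_pos_right hyz hp])
        · linarith
      rcases le_or_gt z u with i'' | i''
      · have := m3 i' i''
        first
        | linarith
        | rcases le_or_gt y a with h' | h'
          · have := k2 h h'; linarith
          · have := k3 h' (by linarith); nlinarith [mul_lt_mul_of_pos_right hyz hq]
      · have := m4 i''
        first
        | linarith
        | rcases le_or_gt y a with h' | h'
          · have := k2 h h'; linarith
          rcases le_or_gt y u with h'' | h''
          · have := k3 h' h''; linarith
          · have := k4 h''; linarith
  refine ⟨mono.orderIsoOfRightInverse (f a b) (f b a) (inv b a hlb hbu hla hau), ?_, ?_⟩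
  · change f a b a = b
    have h1 : a - l ≠ 0 := by linarith
    rw [((key a b hla hau hlb hbu a).2.1 hla le_rfl).2.2]; field_simp; ring
  · intro y hy
    change f a b y = y
    rcases hy with h | h
    · exact (key a b hla hau hlb hbu y).1 h
    · rcases h.lt_or_eq with h | h
      · exact (key a b hla hau hlb hbu y).2.2.2 h
      · subst h
        rw [((key a b hla hau hlb hbu u).2.2.1 hau le_rfl).2.2]; ring

theorem SameSide.symm {Z : Finset ℝ} {a b : ℝ} (h : SameSide Z a b) : SameSide Z b a :=
  fun z hz => (h z hz).imp And.symm And.symm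

theorem SameSide.trans {Z : Finset ℝ} {a b c : ℝ} (h : SameSide Z a b) (h' : SameSide Z b c) :
    SameSide Z a c := fun z hz => by
  rcases h z hz with h1 | h1 <;> rcases h' z hz with h2 | h2
  · exact Or.inl ⟨h1.1, h2.2⟩
  · linarith [h1.2, h2.1]
  · linarith [h1.2, h2.1]
  · exact Or.inr ⟨h1.1, h2.2⟩

theorem SameSide.of_mem_uIcc {Z : Finset ℝ} {a b c : ℝ} (h : SameSide Z a b) (hc : c ∈ uIcc a b) :
    SameSide Z a c := fun z hz => by
  rw [mem_uIcc] at hc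
  rcases h z hz with h1 | h1 <;> rcases hc with h2 | h2
  · exact Or.inl ⟨h1.1, by linarith [h1.1]⟩
  · exact Or.inl ⟨h1.1, by linarith [h1.2]⟩
  · exact Or.inr ⟨h1.1, by linarith [h1.2]⟩
  · exact Or.inr ⟨h1.1, by linarith [h1.1]⟩

theorem SameSide.refl_iff {Z : Finset ℝ} {a : ℝ} : SameSide Z a a ↔ a ∉ Z :=
  ⟨fun h ha => by rcases h a ha with h | h <;> exact lt_irrefl _ h.1, fun h z hz => by
    rcases lt_trichotomy z a with h1 | h1 | h1
    · exact Or.inl ⟨h1, h1⟩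
    · exact absurd (h1 ▸ hz) h
    · exact Or.inr ⟨h1, h1⟩⟩

theorem SameSide.map {Z : Finset ℝ} {a b : ℝ} (φ : ℝ ≃o ℝ) :
    SameSide (Z.image φ) (φ a) (φ b) ↔ SameSide Z a b := by
  simp [SameSide]

open Polynomial

theorem sign_const_of_sameSide {Z : Finset ℝ} {q : ℝ[X]} (hZ : ∀ y, q.eval y = 0 → y ∈ Z)
    {a b : ℝ} (h : SameSide Z a b) : SignType.sign (q.eval a) = SignType.sign (q.eval b) := by
  have hne : ∀ c ∈ uIcc a b, q.eval c ≠ 0 := fun c hc h0 => by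
    have := (h.of_mem_uIcc hc).symm.trans (h.of_mem_uIcc hc)
    exact SameSide.refl_iff.1 this (hZ _ h0)
  have hiv := intermediate_value_uIcc (a := a) (b := b) (f := fun x => q.eval x)
      q.continuous.continuousOn
  have h0 : (0 : ℝ) ∉ uIcc (q.eval a) (q.eval b) := fun h0 => by
    obtain ⟨c, hc, hc0⟩ := hiv h0
    exact hne c hc hc0
  rw [mem_uIcc] at h0
  push Not at h0
  rcases lt_or_gt_of_ne (hne a left_mem_uIcc) with ha | ha <;>
    rcases lt_or_gt_of_ne (hne b right_mem_uIcc) with hb | hb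
  · simp [ha, hb]
  · linarith [h0.1 ha.le]
  · linarith [h0.2 hb.le]
  · simp [ha, hb]

theorem strictMonoOn_of_sign {p : ℝ[X]} {a b : ℝ}
    (h : ∀ c ∈ Ioo a b, 0 < p.derivative.eval c) : StrictMonoOn (fun x => p.eval x) (Icc a b) := by
  apply strictMonoOn_of_deriv_pos (convex_Icc a b) p.continuous.continuousOn
  intro x hx
  rw [interior_Icc] at hx
  simpa using h x hx

theorem tendsto_abs_eval_atBot {p : ℝ[X]} (hp : 0 < p.natDegree) :
    Filter.Tendsto (fun x => |p.eval x|) Filter.atBot Filter.atTop := by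
  have h1 : 0 < (p.comp (-X)).degree := by
    rw [← natDegree_pos_iff_degree_pos, natDegree_comp]; simpa using hp
  have := (Polynomial.abs_tendsto_atTop _ h1).comp Filter.tendsto_neg_atBot_atTop
  refine this.congr fun x => ?_
  simp

/-- If `p` is increasing and negative at `y`, then `q` is negative somewhere in the matching
component. -/
theorem exists_neg_of_match {Z : Finset ℝ} {φ : ℝ ≃o ℝ} {p q : ℝ[X]} (hq : 0 < q.natDegree)
    (hZ : ∀ y, p.derivative.eval y = 0 → y ∈ Z)
    (hd : SignMatch φ p.derivative q.derivative)
    (hs : ∀ z ∈ Z, SignType.sign (p.eval z) = SignType.sign (q.eval (φ z)))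
    {y : ℝ} (hyZ : y ∉ Z) (hy' : 0 < p.derivative.eval y) (hy : p.eval y < 0) :
    ∃ c, SameSide Z y c ∧ q.eval (φ c) < 0 := by
  have hyy := SameSide.refl_iff.2 hyZ
  by_cases hl : ∃ z ∈ Z, z < y
  · have hne : (Z.filter (· < y)).Nonempty := by
      obtain ⟨z, h1, h2⟩ := hl; exact ⟨z, by simp [h1, h2]⟩
    set l := (Z.filter (· < y)).max' hne with hldef
    have hlm := Finset.max'_mem _ hne
    rw [← hldef, Finset.mem_filter] at hlm
    have hlmax : ∀ z ∈ Z, z < y → z ≤ l := fun z h1 h2 => Finset.le_max' _ _ (by simp [h1, h2])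
    have hss : ∀ c, l < c → c ≤ y → SameSide Z y c := fun c h1 h2 z hz => by
      rcases hyy z hz with h | h
      · exact Or.inl ⟨h.1, (hlmax z hz h.1).trans_lt h1⟩
      · exact Or.inr ⟨h.1, by linarith [h.1]⟩
    have hmono := strictMonoOn_of_sign (p := p) (a := l) (b := y) (fun c hc => by
      have := sign_const_of_sameSide hZ (hss c hc.1 hc.2.le)
      rw [sign_pos hy'] at this
      exact sign_eq_one_iff.1 this.symm)
    have h1 : p.eval l < 0 := (hmono (left_mem_Icc.2 hlm.2.le) (right_mem_Icc.2 hlm.2.le)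
        hlm.2).trans hy
    have h2 : q.eval (φ l) < 0 := by
      have := hs l hlm.1
      rw [sign_neg h1] at this
      exact sign_eq_neg_one_iff.1 this.symm
    have h3 : ∀ᶠ c in nhdsWithin l (Ioi l), q.eval (φ c) < 0 :=
      ((q.continuous.comp φ.continuous).continuousAt.eventually_lt continuousAt_const
          h2).filter_mono
        nhdsWithin_le_nhds
    obtain ⟨c, hc1, hc2⟩ := (h3.and (Ioc_mem_nhdsGT hlm.2)).exists
    exact ⟨c, hss c hc2.1 hc2.2, hc1⟩
  · push Not at hl
    have hss : ∀ c ≤ y, SameSide Z y c := fun c h2 z hz => by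
      rcases hyy z hz with h | h
      · linarith [hl z hz]
      · exact Or.inr ⟨h.1, by linarith [h.1]⟩
    have hmono : ∀ a b, a < b → b ≤ φ y → q.eval a < q.eval b := fun a b hab hb => by
      refine strictMonoOn_of_sign (p := q) (a := a) (b := b) (fun c hc => ?_)
        (left_mem_Icc.2 hab.le) (right_mem_Icc.2 hab.le) hab
      have h1 := sign_const_of_sameSide hZ (hss (φ.symm c) (by
        rw [OrderIso.symm_apply_le]; linarith [hc.2]))
      have h2 := hd (φ.symm c)
      rw [sign_pos hy'] at h1
      rw [← h1, OrderIso.apply_symm_apply] at h2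
      exact sign_eq_one_iff.1 h2.symm
    have := (tendsto_abs_eval_atBot hq).eventually_gt_atTop |q.eval (φ y)|
    obtain ⟨c, hc1, hc2⟩ := (this.and (Filter.eventually_lt_atBot (φ y))).exists
    refine ⟨φ.symm c, hss _ ?_, ?_⟩
    · rw [OrderIso.symm_apply_le]; exact hc2.le
    · rw [OrderIso.apply_symm_apply]
      have := hmono c (φ y) hc2 le_rfl
      by_contra hcon
      push Not at hcon
      rw [abs_of_nonneg hcon, abs_of_nonneg (by linarith)] at hc1
      linarith

theorem SignMatch.neg {φ : ℝ ≃o ℝ} {p q : ℝ[X]} (h : SignMatch φ p q) : SignMatch φ (-p) (-q) :=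
  fun y => by simp [Left.sign_neg, h y]

theorem SignMatch.symm {φ : ℝ ≃o ℝ} {p q : ℝ[X]} (h : SignMatch φ p q) :
    SignMatch φ.symm q p := fun y => by simp [h (φ.symm y)]

/-- The order isomorphism `φ` conjugated by negation. -/
def reflectIso (φ : ℝ ≃o ℝ) : ℝ ≃o ℝ where
  toFun y := -φ (-y)
  invFun y := -φ.symm (-y)
  left_inv y := by simp
  right_inv y := by simp
  map_rel_iff' := by simp

theorem exists_pos_of_match {Z : Finset ℝ} {φ : ℝ ≃o ℝ} {p q : ℝ[X]} (hq : 0 < q.natDegree)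
    (hZ : ∀ y, p.derivative.eval y = 0 → y ∈ Z)
    (hd : SignMatch φ p.derivative q.derivative)
    (hs : ∀ z ∈ Z, SignType.sign (p.eval z) = SignType.sign (q.eval (φ z)))
    {y : ℝ} (hyZ : y ∉ Z) (hy' : 0 < p.derivative.eval y) (hy : 0 < p.eval y) :
    ∃ c, SameSide Z y c ∧ 0 < q.eval (φ c) := by
  have hder : ∀ p : ℝ[X], derivative (-(p.comp (-X))) = p.derivative.comp (-X) := fun p => by
    simp [derivative_comp]
  obtain ⟨c, hc1, hc2⟩ := exists_neg_of_match (Z := Z.image (fun z => -z)) (φ := reflectIso φ)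
    (p := -(p.comp (-X))) (q := -(q.comp (-X))) (y := -y)
    (by rw [natDegree_neg, natDegree_comp]; simpa using hq)
    (fun y h => by
      rw [hder] at h
      simp only [eval_comp, eval_neg, eval_X] at h
      exact Finset.mem_image.2 ⟨-y, hZ _ h, by simp⟩)
    (fun y => by
      rw [hder, hder]
      simpa [reflectIso] using hd (-y))
    (fun z hz => by
      obtain ⟨w, hw, rfl⟩ := Finset.mem_image.1 hz
      simp [reflectIso, Left.sign_neg, hs w hw])
    (by simpa using hyZ) (by rw [hder]; simpa using hy') (by simpa using hy)
  refine ⟨-c, fun z hz => ?_, by simpa [reflectIso] using hc2⟩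
  rcases hc1 (-z) (Finset.mem_image_of_mem _ hz) with h | h
  · exact Or.inr ⟨by linarith [h.1], by linarith [h.2]⟩
  · exact Or.inl ⟨by linarith [h.1], by linarith [h.2]⟩

/-- The data of a pair of polynomials whose derivatives match under `φ` and whose signs agree on
a finite set containing the critical points. -/
structure PreMatch (Z : Finset ℝ) (φ : ℝ ≃o ℝ) (p q : ℝ[X]) : Prop where
  degp : 0 < p.natDegree
  degq : 0 < q.natDegree
  crit : ∀ y, p.derivative.eval y = 0 → y ∈ Z
  der : SignMatch φ p.derivative q.derivative
  sgn : ∀ z ∈ Z, SignType.sign (p.eval z) = SignType.sign (q.eval (φ z))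

namespace PreMatch

variable {Z : Finset ℝ} {φ : ℝ ≃o ℝ} {p q : ℝ[X]}

theorem neg (h : PreMatch Z φ p q) : PreMatch Z φ (-p) (-q) where
  degp := by simpa using h.degp
  degq := by simpa using h.degq
  crit y hy := h.crit y (by simpa using hy)
  der := by simpa using h.der.neg
  sgn z hz := by simp [Left.sign_neg, h.sgn z hz]

theorem symm (h : PreMatch Z φ p q) : PreMatch (Z.image φ) φ.symm q p where
  degp := h.degq
  degq := h.degp
  crit y hy := by
    refine Finset.mem_image.2 ⟨φ.symm y, h.crit _ ?_, by simp⟩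
    have := h.der (φ.symm y)
    simp only [OrderIso.apply_symm_apply, hy, sign_zero] at this
    exact sign_eq_zero_iff.1 this
  der := h.der.symm
  sgn z hz := by
    obtain ⟨w, hw, rfl⟩ := Finset.mem_image.1 hz
    simp [h.sgn w hw]

theorem eq_of_roots (h : PreMatch Z φ p q) {a b : ℝ} (hab : SameSide Z a b)
    (ha : p.eval a = p.eval b) : a = b := by
  by_contra hne
  wlog hlt : a < b generalizing a b
  · exact this hab.symm ha.symm (Ne.symm hne) (lt_of_le_of_ne (not_lt.1 hlt) (Ne.symm hne))
  obtain ⟨c, hc, hc0⟩ := exists_deriv_eq_zero hlt p.continuous.continuousOn ha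
  have := hab.of_mem_uIcc (c := c) (by rw [uIcc_of_le hlt.le]; exact ⟨hc.1.le, hc.2.le⟩)
  exact SameSide.refl_iff.1 (this.symm.trans this) (h.crit c (by simpa using hc0))

theorem lt_of_lt (h : PreMatch Z φ p q) {a b : ℝ} (hab : SameSide Z a b) (hlt : a < b)
    (ha : 0 < p.derivative.eval a) : p.eval a < p.eval b := by
  refine strictMonoOn_of_sign (p := p) (a := a) (b := b) (fun c hc => ?_)
    (left_mem_Icc.2 hlt.le) (right_mem_Icc.2 hlt.le) hlt
  have := sign_const_of_sameSide h.crit (hab.of_mem_uIcc (c := c)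
    (by rw [uIcc_of_le hlt.le]; exact ⟨hc.1.le, hc.2.le⟩))
  rw [sign_pos ha] at this
  exact sign_eq_one_iff.1 this.symm

theorem exists_root (h : PreMatch Z φ p q) {y : ℝ} (hy : y ∉ Z) (hy0 : p.eval y = 0) :
    ∃ c, SameSide Z y c ∧ q.eval (φ c) = 0 := by
  wlog hd : 0 < p.derivative.eval y generalizing p q
  · have h1 := this h.neg (by simpa using hy0) (by
      have : p.derivative.eval y ≠ 0 := fun h0 => hy (h.crit y h0)
      simpa using lt_of_le_of_ne (not_lt.1 hd) this)
    simpa using h1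
  have hop : ∀ᶠ c in nhds y, SameSide Z y c := by
    have : ∀ᶠ c in nhds y, ∀ z ∈ Z, (z < y ∧ z < c) ∨ (y < z ∧ c < z) := by
      rw [Filter.eventually_all_finset]
      intro z hz
      rcases lt_trichotomy z y with h | h | h
      · filter_upwards [lt_mem_nhds h] with c hc using Or.inl ⟨h, hc⟩
      · exact absurd (h ▸ hz) hy
      · filter_upwards [gt_mem_nhds h] with c hc using Or.inr ⟨h, hc⟩
    exact this
  obtain ⟨a, ha1, ha2⟩ := ((hop.filter_mono nhdsWithin_le_nhds).and
    (self_mem_nhdsWithin (a := y) (s := Iio y))).exists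
  obtain ⟨b, hb1, hb2⟩ := ((hop.filter_mono nhdsWithin_le_nhds).and
    (self_mem_nhdsWithin (a := y) (s := Ioi y))).exists
  have hpos : ∀ c, SameSide Z y c → 0 < p.derivative.eval c ∧ c ∉ Z := fun c hc => by
    have := sign_const_of_sameSide h.crit hc
    rw [sign_pos hd] at this
    exact ⟨sign_eq_one_iff.1 this.symm, SameSide.refl_iff.1 (hc.symm.trans hc)⟩
  have hpa := h.lt_of_lt ha1.symm ha2 (hpos a ha1).1
  have hpb := h.lt_of_lt hb1 hb2 hd
  obtain ⟨c, hc1, hc2⟩ := exists_neg_of_match h.degq h.crit h.der h.sgn (hpos a ha1).2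
    (hpos a ha1).1 (by linarith)
  obtain ⟨d, hd1, hd2⟩ := exists_pos_of_match h.degq h.crit h.der h.sgn (hpos b hb1).2
    (hpos b hb1).1 (by linarith)
  have hcd : SameSide Z c d := (ha1.trans hc1).symm.trans (hb1.trans hd1)
  have hiv := intermediate_value_uIcc (a := c) (b := d) (f := fun x => q.eval (φ x))
    (q.continuous.comp φ.continuous).continuousOn
  obtain ⟨e, he, he0⟩ := hiv (show (0 : ℝ) ∈ _ by rw [mem_uIcc]; left; exact ⟨hc2.le, hd2.le⟩)
  exact ⟨e, (ha1.trans hc1).trans (hcd.of_mem_uIcc he), he0⟩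

theorem not_pos_neg (h : PreMatch Z φ p q) {y : ℝ} (hy : y ∉ Z)
    (hr : ∀ ξ, ξ ∉ Z → p.eval ξ = 0 → q.eval (φ ξ) = 0) (hd : 0 < p.derivative.eval y)
    (hp : 0 < p.eval y) (hq : q.eval (φ y) < 0) : False := by
  have hs := h.symm
  have hyZ : φ y ∉ Z.image φ := by simpa using hy
  have hd' : 0 < q.derivative.eval (φ y) := by
    have := h.der y
    rw [sign_pos hd] at this
    exact sign_eq_one_iff.1 this.symm
  obtain ⟨c, hc1, hc2⟩ := exists_neg_of_match hs.degq hs.crit hs.der hs.sgn hyZ hd' hq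
  have hc1' : SameSide Z y (φ.symm c) := by
    rw [← SameSide.map φ]; simpa using hc1
  have hiv := intermediate_value_uIcc (a := φ.symm c) (b := y) (f := fun x => p.eval x)
    p.continuous.continuousOn
  obtain ⟨e, he, he0⟩ := hiv (show (0 : ℝ) ∈ _ by rw [mem_uIcc]; left; exact ⟨hc2.le, hp.le⟩)
  have hye : SameSide Z y e := hc1'.of_mem_uIcc (by rwa [uIcc_comm])
  have heZ := SameSide.refl_iff.1 (hye.symm.trans hye)
  have h0 := hr e heZ he0
  have he0 : p.eval e = 0 := he0
  have hlt : e < y := by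
    rcases lt_trichotomy e y with h1 | h1 | h1
    · exact h1
    · subst h1; linarith
    · have := h.lt_of_lt hye h1 hd; linarith
  have := hs.lt_of_lt ((SameSide.map φ).2 hye.symm) (φ.strictMono hlt) (by
    have h1 := sign_const_of_sameSide hs.crit ((SameSide.map φ).2 hye)
    rw [sign_pos hd'] at h1
    exact sign_eq_one_iff.1 h1.symm)
  linarith

theorem signMatch (h : PreMatch Z φ p q)
    (hr : ∀ ξ, ξ ∉ Z → p.eval ξ = 0 → q.eval (φ ξ) = 0) : SignMatch φ p q := by
  have hr' : ∀ ξ, ξ ∉ Z.image φ → q.eval ξ = 0 → p.eval (φ.symm ξ) = 0 := fun ξ hξ h0 => by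
    obtain ⟨c, hc1, hc2⟩ := h.symm.exists_root hξ h0
    have hc1' : SameSide Z (φ.symm ξ) (φ.symm c) := by
      rw [← SameSide.map φ]; simpa using hc1
    have := hr _ (SameSide.refl_iff.1 (hc1'.symm.trans hc1')) hc2
    rw [OrderIso.apply_symm_apply] at this
    rw [h.symm.eq_of_roots hc1 (by rw [h0, this])]
    exact hc2
  intro y
  by_cases hy : y ∈ Z
  · exact h.sgn y hy
  wlog hd : 0 < p.derivative.eval y generalizing p q
  · have h1 := this h.neg (by simpa using hr) (by simpa using hr') (by
      have : p.derivative.eval y ≠ 0 := fun h0 => hy (h.crit y h0)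
      simpa using lt_of_le_of_ne (not_lt.1 hd) this)
    simpa [Left.sign_neg] using h1
  have hyZ : φ y ∉ Z.image φ := by simpa using hy
  have hd' : 0 < q.derivative.eval (φ y) := by
    have := h.der y
    rw [sign_pos hd] at this
    exact sign_eq_one_iff.1 this.symm
  rcases lt_trichotomy (p.eval y) 0 with h1 | h1 | h1 <;>
    rcases lt_trichotomy (q.eval (φ y)) 0 with h2 | h2 | h2
  · simp [h1, h2]
  · have := hr' _ hyZ h2; simp at this; linarith
  · exact (h.symm.not_pos_neg hyZ hr' hd' h2 (by simpa using h1)).elim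
  · have := hr _ hy h1; linarith
  · simp [h1, h2]
  · have := hr _ hy h1; linarith
  · exact (h.not_pos_neg hy hr hd h1 h2).elim
  · have := hr' _ hyZ h2; simp at this; linarith
  · simp [h1, h2]

end PreMatch

/-- Extending a matching of a finite family of pairs of polynomials by one more pair. -/
theorem exists_signMatch_insert {ι : Type*} (L : Finset ι) (P Q : ι → ℝ[X]) {p q : ℝ[X]}
    (hp : 0 < p.natDegree) (hq : 0 < q.natDegree) {d : ι} (hd : d ∈ L)
    (hdP : P d = p.derivative) (hdQ : Q d = q.derivative) (φ : ℝ ≃o ℝ)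
    (hφ : ∀ i ∈ L, SignMatch φ (P i) (Q i))
    (hs : ∀ i ∈ L, P i ≠ 0 → ∀ y, (P i).eval y = 0 →
      SignType.sign (p.eval y) = SignType.sign (q.eval (φ y))) :
    ∃ φ' : ℝ ≃o ℝ, SignMatch φ' p q ∧ ∀ i ∈ L, SignMatch φ' (P i) (Q i) := by
  classical
  set Z : Finset ℝ := L.biUnion fun i => (P i).roots.toFinset with hZ
  have memZ : ∀ i ∈ L, P i ≠ 0 → ∀ y, (P i).eval y = 0 → y ∈ Z := fun i hi h0 y hy =>
    Finset.mem_biUnion.2 ⟨i, hi, by simp [h0, hy]⟩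
  have Zmem : ∀ y ∈ Z, ∃ i ∈ L, P i ≠ 0 ∧ (P i).eval y = 0 := fun y hy => by
    obtain ⟨i, hi, h⟩ := Finset.mem_biUnion.1 hy
    simp only [Multiset.mem_toFinset, mem_roots', IsRoot] at h
    exact ⟨i, hi, h.1, h.2⟩
  have hp' : p.derivative ≠ 0 := fun h => by
    have := derivative_eq_zero.1 h; omega
  have pre : ∀ χ : ℝ ≃o ℝ, (∀ i ∈ L, SignMatch χ (P i) (Q i)) → (∀ z ∈ Z, χ z = φ z) →
      PreMatch Z χ p q := fun χ hχ hz =>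
    ⟨hp, hq, fun y hy => memZ d hd (hdP ▸ hp') y (hdP ▸ hy), hdP ▸ hdQ ▸ hχ d hd, fun z hzZ => by
      obtain ⟨i, hi, h1, h2⟩ := Zmem z hzZ
      rw [hz z hzZ]; exact hs i hi h1 z h2⟩
  have hp0 : p ≠ 0 := fun h => by simp [h] at hp
  have main : ∀ T : Finset ℝ, (∀ ξ ∈ T, ξ ∉ Z ∧ p.eval ξ = 0) → ∃ χ : ℝ ≃o ℝ,
      (∀ i ∈ L, SignMatch χ (P i) (Q i)) ∧ (∀ z ∈ Z, χ z = φ z) ∧ ∀ ξ ∈ T, q.eval (χ ξ) = 0 := by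
    intro T
    induction T using Finset.induction_on with
    | empty => exact fun _ => ⟨φ, hφ, fun _ _ => rfl, by simp⟩
    | insert ξ T hξT ih =>
      intro hT
      obtain ⟨χ, h1, h2, h3⟩ := ih fun η hη => hT η (Finset.mem_insert_of_mem hη)
      have hpre := pre χ h1 h2
      obtain ⟨hξZ, hξ0⟩ := hT ξ (Finset.mem_insert_self _ _)
      obtain ⟨c, hc1, hc2⟩ := hpre.exists_root hξZ hξ0
      have hop : ∀ a, a ∉ Z → ∃ δ > 0, ∀ c, |c - χ a| ≤ δ → SameSide (Z.image χ) (χ a) c := by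
        intro a ha
        have : ∀ᶠ c in nhds (χ a), ∀ z ∈ Z.image χ, (z < χ a ∧ z < c) ∨ (χ a < z ∧ c < z) := by
          rw [Filter.eventually_all_finset]
          intro z hz
          rcases lt_trichotomy z (χ a) with h | h | h
          · filter_upwards [lt_mem_nhds h] with c hc using Or.inl ⟨h, hc⟩
          · refine absurd hz ?_; rw [h]; simpa using ha
          · filter_upwards [gt_mem_nhds h] with c hc using Or.inr ⟨h, hc⟩
        obtain ⟨δ, hδ, hball⟩ := Metric.eventually_nhds_iff.1 this
        exact ⟨δ / 2, by positivity, fun c hc => hball (by rw [Real.dist_eq]; linarith)⟩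
      obtain ⟨δ, hδ, hδ'⟩ := hop ξ hξZ
      obtain ⟨δ₁, hδ₁, hδ₁'⟩ := hop c (SameSide.refl_iff.1 (hc1.symm.trans hc1))
      have hc1' := (SameSide.map χ).2 hc1
      have e1 := hδ' (χ ξ - δ) (by simp [abs_of_pos hδ])
      have e2 := hδ' (χ ξ + δ) (by simp [abs_of_pos hδ])
      have e3 := hc1'.trans (hδ₁' (χ c - δ₁) (by simp [abs_of_pos hδ₁]))
      have e4 := hc1'.trans (hδ₁' (χ c + δ₁) (by simp [abs_of_pos hδ₁]))
      obtain ⟨l, hl⟩ : ∃ l, l = min (χ ξ - δ) (χ c - δ₁) := ⟨_, rfl⟩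
      obtain ⟨u, hu⟩ : ∃ u, u = max (χ ξ + δ) (χ c + δ₁) := ⟨_, rfl⟩
      have el : SameSide (Z.image χ) (χ ξ) l := by
        rcases min_choice (χ ξ - δ) (χ c - δ₁) with h | h <;> rw [hl, h] <;> assumption
      have eu : SameSide (Z.image χ) (χ ξ) u := by
        rcases max_choice (χ ξ + δ) (χ c + δ₁) with h | h <;> rw [hu, h] <;> assumption
      have l1 : l < χ ξ := by linarith [min_le_left (χ ξ - δ) (χ c - δ₁)]
      have l2 : l < χ c := by linarith [min_le_right (χ ξ - δ) (χ c - δ₁)]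
      have u1 : χ ξ < u := by linarith [le_max_left (χ ξ + δ) (χ c + δ₁)]
      have u2 : χ c < u := by linarith [le_max_right (χ ξ + δ) (χ c + δ₁)]
      obtain ⟨ψ, hψ1, hψ2⟩ := exists_bump l1 u1 l2 u2
      have inside : ∀ y, l ≤ y → y ≤ u → SameSide (Z.image χ) (χ ξ) y := fun y hy1 hy2 =>
        el.trans ((el.symm.trans eu).of_mem_uIcc (by rw [mem_uIcc]; left; exact ⟨hy1, hy2⟩))
      have stay : ∀ y, l < y → y < u → l < ψ y ∧ ψ y < u := fun y hy1 hy2 => by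
        have := ψ.strictMono hy1
        have := ψ.strictMono hy2
        rw [hψ2 l (Or.inl le_rfl)] at *
        rw [hψ2 u (Or.inr le_rfl)] at *
        constructor <;> assumption
      refine ⟨χ.trans ψ, fun i hi y => ?_, fun z hz => ?_, fun η hη => ?_⟩
      · rw [h1 i hi y, OrderIso.trans_apply]
        by_cases hy : l < χ y ∧ χ y < u
        · by_cases hQ : Q i = 0
          · simp [hQ]
          · obtain ⟨s1, s2⟩ := stay _ hy.1 hy.2
            refine sign_const_of_sameSide (Z := Z.image χ) (fun w hw => ?_)
              ((inside _ hy.1.le hy.2.le).symm.trans (inside _ s1.le s2.le))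
            refine Finset.mem_image.2 ⟨χ.symm w, memZ i hi ?_ _ ?_, by simp⟩
            · rintro h0
              apply hQ
              refine Polynomial.funext fun w => ?_
              have := h1 i hi (χ.symm w)
              rw [h0, OrderIso.apply_symm_apply] at this
              simp only [eval_zero, sign_zero] at this
              rw [eval_zero]; exact sign_eq_zero_iff.1 this.symm
            · have := h1 i hi (χ.symm w)
              rw [OrderIso.apply_symm_apply, hw, sign_zero] at this
              exact sign_eq_zero_iff.1 this
        · rw [hψ2]
          rcases not_and_or.1 hy with h | h
          · exact Or.inl (not_lt.1 h)
          · exact Or.inr (not_lt.1 h)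
      · rw [OrderIso.trans_apply, hψ2, h2 z hz]
        by_contra hcon
        push Not at hcon
        have := inside _ hcon.1.le hcon.2.le
        exact SameSide.refl_iff.1 (this.symm.trans this) (Finset.mem_image_of_mem _ hz)
      · rw [OrderIso.trans_apply]
        rcases Finset.mem_insert.1 hη with rfl | hη'
        · rw [hψ1, hc2]
        · rw [hψ2, h3 η hη']
          by_contra hcon
          push Not at hcon
          have := (SameSide.map χ).1 (inside _ hcon.1.le hcon.2.le)
          have := hpre.eq_of_roots this (by rw [hξ0, (hT η hη).2])
          exact hξT (this ▸ hη')
  obtain ⟨χ, h1, h2, h3⟩ := main (p.roots.toFinset.filter (· ∉ Z)) (fun ξ hξ => by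
    simp only [Finset.mem_filter, Multiset.mem_toFinset, mem_roots', IsRoot] at hξ
    exact ⟨hξ.2, hξ.1.2⟩)
  refine ⟨χ, (pre χ h1 h2).signMatch fun ξ hξ h0 => h3 ξ ?_, h1⟩
  simp [hξ, h0, hp0]

open Polynomial

theorem exists_pseudo_rem {R : Type*} [CommRing R] (q : R[X]) (hq : 0 < q.natDegree) (p : R[X]) :
    ∃ (k : ℕ) (r : R[X]), r.natDegree < q.natDegree ∧ q ∣ C q.leadingCoeff ^ (2 * k) * p - r := by
  suffices h : ∀ n, ∀ p : R[X], p.natDegree < n →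
      ∃ (k : ℕ) (r : R[X]), r.natDegree < q.natDegree ∧ q ∣ C q.leadingCoeff ^ k * p - r by
    obtain ⟨k, r, h1, h2⟩ := h _ p (Nat.lt_succ_self _)
    refine ⟨k, C q.leadingCoeff ^ k * r, ?_, ?_⟩
    · rw [← C_pow]; exact (natDegree_C_mul_le _ _).trans_lt h1
    · have : C q.leadingCoeff ^ (2 * k) * p - C q.leadingCoeff ^ k * r =
        C q.leadingCoeff ^ k * (C q.leadingCoeff ^ k * p - r) := by ring
      rw [this]; exact Dvd.dvd.mul_left h2 _
  intro n
  induction n with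
  | zero => intro p hp; omega
  | succ n ih =>
    intro p hp
    by_cases hlt : p.natDegree < q.natDegree
    · exact ⟨0, p, hlt, by simp⟩
    push Not at hlt
    set p₁ := C q.leadingCoeff * p - C p.leadingCoeff * X ^ (p.natDegree - q.natDegree) * q with hp1
    have hle : p₁.natDegree ≤ p.natDegree := by
      refine (natDegree_sub_le _ _).trans (max_le (natDegree_C_mul_le _ _) ?_)
      rw [mul_assoc]
      refine (natDegree_C_mul_le _ _).trans (natDegree_mul_le.trans ?_)
      have := natDegree_X_pow_le (R := R) (p.natDegree - q.natDegree)
      omega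
    have hc : p₁.coeff p.natDegree = 0 := by
      have e : p.natDegree = q.natDegree + (p.natDegree - q.natDegree) := by omega
      rw [hp1, coeff_sub, coeff_C_mul, mul_assoc, coeff_C_mul, coeff_X_pow_mul']
      rw [if_pos (by omega), show p.natDegree - (p.natDegree - q.natDegree) = q.natDegree by omega]
      simp only [coeff_natDegree]; ring
    have hlt1 : p₁.natDegree < n := by
      rcases hle.lt_or_eq with h | h
      · omega
      · rw [← h, coeff_natDegree, leadingCoeff_eq_zero] at hc
        rw [hc, natDegree_zero] at h; omega
    obtain ⟨k, r, h1, h2⟩ := ih p₁ hlt1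
    refine ⟨k + 1, r, h1, ?_⟩
    have : C q.leadingCoeff ^ (k + 1) * p - r = (C q.leadingCoeff ^ k * p₁ - r) +
        q * (C q.leadingCoeff ^ k * (C p.leadingCoeff * X ^ (p.natDegree - q.natDegree))) := by
      rw [hp1]; ring
    rw [this]
    exact dvd_add h2 (dvd_mul_right _ _)

/-- A pseudo-remainder of `p` by `q`. -/
def pseudoRem {R : Type*} [CommRing R] (p q : R[X]) : R[X] := by
  classical exact if hq : 0 < q.natDegree then (exists_pseudo_rem q hq p).choose_spec.choose else 0

theorem exists_truncation {R : Type*} [CommRing R] (f : R →+* ℝ) (q : R[X]) (hq : q.map f ≠ 0) :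
    ∃ k ≤ q.support.card, (eraseLead^[k] q).map f = q.map f ∧
      f (eraseLead^[k] q).leadingCoeff ≠ 0 := by
  suffices h : ∀ n, ∀ q : R[X], q.support.card ≤ n → q.map f ≠ 0 →
    ∃ k ≤ q.support.card, (eraseLead^[k] q).map f = q.map f ∧
      f (eraseLead^[k] q).leadingCoeff ≠ 0 from h _ q le_rfl hq
  intro n
  induction n with
  | zero =>
    intro q h0 hq
    have : q = 0 := by simpa using h0
    simp [this] at hq
  | succ n ih =>
    intro q h0 hq
    by_cases hl : f q.leadingCoeff = 0
    · have hq0 : q ≠ 0 := by rintro rfl; simp at hq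
      have he : q.eraseLead.map f = q.map f := by
        have := congrArg (map f) (eraseLead_add_monomial_natDegree_leadingCoeff q)
        rwa [Polynomial.map_add, map_monomial, hl, monomial_zero_right, add_zero] at this
      have hcard := eraseLead_support_card_lt hq0
      obtain ⟨k, h1, h2, h3⟩ := ih q.eraseLead (by omega) (he ▸ hq)
      exact ⟨k + 1, by omega, by rw [Function.iterate_succ_apply, h2, he], by
        rwa [Function.iterate_succ_apply]⟩
    · exact ⟨0, by omega, by simp, by simpa using hl⟩

variable {σ : Type*}

/-- The signs of finitely many polynomials in the parameters determine the sign behaviour of the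
family `F` of polynomials in one more variable, up to an order isomorphism of the line. -/
def SignDetermined (F : Finset (MvPolynomial σ ℝ)[X]) : Prop :=
  ∃ D : Finset (MvPolynomial σ ℝ), ∀ x x' : σ → ℝ,
    (∀ c ∈ D, SignType.sign (MvPolynomial.eval x c) = SignType.sign (MvPolynomial.eval x' c)) →
    ∃ φ : ℝ ≃o ℝ, ∀ p ∈ F, SignMatch φ (p.map (MvPolynomial.eval x)) (p.map (MvPolynomial.eval x'))

theorem SignDetermined.mono {F G : Finset (MvPolynomial σ ℝ)[X]} (h : SignDetermined G)
    (hFG : F ⊆ G) : SignDetermined F := by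
  obtain ⟨D, hD⟩ := h
  refine ⟨D, fun x x' hx => ?_⟩
  obtain ⟨φ, hφ⟩ := hD x x' hx
  exact ⟨φ, fun p hp => hφ p (hFG hp)⟩

open Classical in
theorem signDetermined_insert (G : Finset (MvPolynomial σ ℝ)[X]) (p : (MvPolynomial σ ℝ)[X])
    (H : Finset (MvPolynomial σ ℝ)[X]) (hH : SignDetermined H) (hG : G ⊆ H)
    (hp : 0 < p.natDegree) (hpd : p.derivative ∈ G) (hpe : p.eraseLead ∈ H)
    (hcl : ∀ q ∈ G, ∀ k ≤ q.support.card, eraseLead^[k] q ∈ H ∧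
      C (eraseLead^[k] q).leadingCoeff ∈ H ∧ pseudoRem p (eraseLead^[k] q) ∈ H) :
    SignDetermined (insert p G) := by
  classical
  obtain ⟨D, hD⟩ := hH
  refine ⟨insert p.leadingCoeff D, fun x x' hx => ?_⟩
  obtain ⟨φ, hφ⟩ := hD x x' fun c hc => hx c (Finset.mem_insert_of_mem hc)
  have hlead := hx p.leadingCoeff (Finset.mem_insert_self _ _)
  have drop : ∀ x : σ → ℝ, MvPolynomial.eval x p.leadingCoeff = 0 →
      p.map (MvPolynomial.eval x) = p.eraseLead.map (MvPolynomial.eval x) := fun x h => by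
    have := congrArg (map (MvPolynomial.eval x)) (eraseLead_add_monomial_natDegree_leadingCoeff p)
    rw [Polynomial.map_add, map_monomial, h, monomial_zero_right, add_zero] at this
    exact this.symm
  by_cases h0 : MvPolynomial.eval x p.leadingCoeff = 0
  · have h0' : MvPolynomial.eval x' p.leadingCoeff = 0 := by
      rw [h0, sign_zero] at hlead; exact sign_eq_zero_iff.1 hlead.symm
    refine ⟨φ, fun q hq => ?_⟩
    rcases Finset.mem_insert.1 hq with rfl | hq
    · rw [drop x h0, drop x' h0']; exact hφ _ hpe
    · exact hφ q (hG hq)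
  have h0' : MvPolynomial.eval x' p.leadingCoeff ≠ 0 := fun h => h0 (by
    rw [h, sign_zero] at hlead; exact sign_eq_zero_iff.1 hlead)
  obtain ⟨φ', h1, h2⟩ := exists_signMatch_insert G (fun q => q.map (MvPolynomial.eval x))
    (fun q => q.map (MvPolynomial.eval x')) (p := p.map (MvPolynomial.eval x))
    (q := p.map (MvPolynomial.eval x'))
    (by rwa [natDegree_map_of_leadingCoeff_ne_zero _ h0])
    (by rwa [natDegree_map_of_leadingCoeff_ne_zero _ h0']) hpd
    (by rw [derivative_map]) (by rw [derivative_map]) φ (fun q hq => hφ q (hG hq)) (by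
      intro q hq hqx y hy
      obtain ⟨k, hk, hk1, hk2⟩ := exists_truncation (MvPolynomial.eval x) q hqx
      obtain ⟨m1, m2, m3⟩ := hcl q hq k hk
      set s := eraseLead^[k] q with hs
      have hsd : 0 < s.natDegree := by
        by_contra hcon
        have hcon : s.natDegree = 0 := by omega
        rw [eq_C_of_natDegree_eq_zero hcon] at hk1
        rw [← hk1] at hy hqx
        simp only [Polynomial.map_C, eval_C] at hy
        simp [hy] at hqx
      have e1 := hφ _ m1 y
      have e2 := hφ _ m2 0
      have e3 := hφ _ m3 y
      simp only [Polynomial.map_C, eval_C] at e2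
      have hk2' : MvPolynomial.eval x' s.leadingCoeff ≠ 0 := fun h => hk2 (by
        rw [h, sign_zero] at e2; exact sign_eq_zero_iff.1 e2)
      have hs0 : (s.map (MvPolynomial.eval x)).eval y = 0 := by rw [hk1]; exact hy
      have hs0' : (s.map (MvPolynomial.eval x')).eval (φ y) = 0 := by
        rw [hs0, sign_zero] at e1; exact sign_eq_zero_iff.1 e1.symm
      have key : ∀ (x : σ → ℝ) (y : ℝ), MvPolynomial.eval x s.leadingCoeff ≠ 0 →
          (s.map (MvPolynomial.eval x)).eval y = 0 →
          SignType.sign ((p.map (MvPolynomial.eval x)).eval y) =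
          SignType.sign (((pseudoRem p s).map (MvPolynomial.eval x)).eval y) := by
        intro x y hl hs0
        have hr := (exists_pseudo_rem s hsd p).choose_spec.choose_spec.2
        have hr' : s ∣ C s.leadingCoeff ^ (2 * (exists_pseudo_rem s hsd p).choose) * p -
            pseudoRem p s := by
          rw [pseudoRem, dif_pos hsd]; exact hr
        obtain ⟨a, ha⟩ := hr'
        have := congrArg (fun f => (f.map (MvPolynomial.eval x)).eval y) ha
        simp only [Polynomial.map_sub, Polynomial.map_mul, Polynomial.map_pow, Polynomial.map_C,
          eval_sub, eval_mul, eval_pow, eval_C, hs0, zero_mul, sub_eq_zero] at this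
        have hpos : 0 < MvPolynomial.eval x s.leadingCoeff ^
            (2 * (exists_pseudo_rem s hsd p).choose) := by rw [pow_mul]; positivity
        rw [← this, sign_mul, sign_pos hpos, one_mul]
      rw [key x y hk2 hs0, key x' (φ y) hk2' hs0', e3])
  refine ⟨φ', fun q hq => ?_⟩
  rcases Finset.mem_insert.1 hq with rfl | hq
  · exact h1
  · exact h2 q hq

theorem pseudoRem_natDegree {R : Type*} [CommRing R] (p q : R[X]) {d : ℕ} (hd : 0 < d)
    (hq : q.natDegree ≤ d) : (pseudoRem p q).natDegree < d := by
  rw [pseudoRem]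
  split_ifs with h
  · exact (exists_pseudo_rem q h p).choose_spec.choose_spec.1.trans_le hq
  · simpa using hd

theorem signDetermined (F : Finset (MvPolynomial σ ℝ)[X]) : SignDetermined F := by
  classical
  suffices h : ∀ d, ∀ F : Finset (MvPolynomial σ ℝ)[X], (∀ p ∈ F, p.natDegree < d) →
      SignDetermined F from h (F.sup natDegree + 1) F fun p hp =>
        Nat.lt_succ_of_le (Finset.le_sup (f := natDegree) hp)
  intro d
  induction d with
  | zero =>
    intro F hF
    have : F = ∅ := Finset.eq_empty_of_forall_notMem fun p hp => by simpa using hF p hp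
    exact ⟨∅, fun _ _ _ => ⟨OrderIso.refl ℝ, by simp [this]⟩⟩
  | succ d ih =>
    intro F hF
    rcases Nat.eq_zero_or_pos d with rfl | hd
    · refine ⟨F.image fun p => p.coeff 0, fun x x' hx => ⟨OrderIso.refl ℝ, fun p hp y => ?_⟩⟩
      have h0 : p.natDegree = 0 := by have := hF p hp; omega
      have := hx _ (Finset.mem_image_of_mem (fun p => p.coeff 0) hp)
      rw [eq_C_of_natDegree_eq_zero h0]
      simpa using this
    have main : ∀ B A : Finset (MvPolynomial σ ℝ)[X], (∀ p ∈ B, p.natDegree = d) →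
        (∀ p ∈ A, p.natDegree < d) → SignDetermined (B ∪ A) := by
      intro B
      induction B using Finset.induction_on with
      | empty => intro A _ hA; simpa using ih A hA
      | insert p B hpB ihB =>
        intro A hB hA
        set G := insert p.derivative (B ∪ A) with hGdef
        have hpd := hB p (Finset.mem_insert_self _ _)
        have hder : p.derivative.natDegree < d := by
          rw [← hpd]; exact natDegree_derivative_lt (by omega)
        have hGd : ∀ q ∈ G, q.natDegree ≤ d := fun q hq => by
          simp only [hGdef, Finset.mem_insert, Finset.mem_union] at hq
          rcases hq with rfl | hq | hq
          · exact hder.le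
          · exact (hB q (Finset.mem_insert_of_mem hq)).le
          · exact (hA q hq).le
        have hit : ∀ (k : ℕ) (q : (MvPolynomial σ ℝ)[X]), q.natDegree ≤ d →
            (eraseLead^[k] q).natDegree ≤ d := fun k => by
          induction k with
          | zero => exact fun q h => h
          | succ k ih => exact fun q h => ih _ ((eraseLead_natDegree_le q).trans (by omega))
        set T : Finset ((MvPolynomial σ ℝ)[X]) := G.biUnion fun q =>
          (Finset.range (q.support.card + 1)).biUnion fun k =>
            {eraseLead^[k] (eraseLead q), C (eraseLead^[k] q).leadingCoeff,
              pseudoRem p (eraseLead^[k] q)} with hT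
        have hTd : ∀ q ∈ T, q.natDegree < d := fun q hq => by
          simp only [hT, Finset.mem_biUnion, Finset.mem_insert, Finset.mem_singleton] at hq
          obtain ⟨g, hg, k, -, h | h | h⟩ := hq
          · rw [h]
            have h1 := eraseLead_natDegree_le g
            have h2 := hGd g hg
            have hit' : ∀ (k : ℕ) (q : (MvPolynomial σ ℝ)[X]), q.natDegree < d →
                (eraseLead^[k] q).natDegree < d := fun k => by
              induction k with
              | zero => exact fun q h => h
              | succ k ih => exact fun q h => ih _ ((eraseLead_natDegree_le q).trans_lt (by omega))
            exact hit' k _ (by omega)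
          · rw [h, natDegree_C]; exact hd
          · rw [h]; exact pseudoRem_natDegree _ _ hd (hit k g (hGd g hg))
        have hH := ihB (insert p.derivative (insert p.eraseLead (A ∪ T)))
          (fun q hq => hB q (Finset.mem_insert_of_mem hq)) (fun q hq => by
            simp only [Finset.mem_insert, Finset.mem_union] at hq
            rcases hq with rfl | rfl | hq | hq
            · exact hder
            · exact (eraseLead_natDegree_le p).trans_lt (by omega)
            · exact hA q hq
            · exact hTd q hq)
        refine (signDetermined_insert G p _ hH ?_ (by omega) (Finset.mem_insert_self _ _)
          (by simp) ?_).mono ?_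
        · intro q hq
          simp only [hGdef, Finset.mem_insert, Finset.mem_union] at hq ⊢
          tauto
        · intro q hq k hk
          have hmem : ∀ r, r = C (eraseLead^[k] q).leadingCoeff ∨ r = pseudoRem p (eraseLead^[k] q)
              →
              r ∈ T := fun r hr => by
            simp only [hT, Finset.mem_biUnion, Finset.mem_insert, Finset.mem_singleton]
            exact ⟨q, hq, k, by simpa using Nat.lt_succ_of_le hk, by tauto⟩
          refine ⟨?_, ?_, ?_⟩
          · rcases k with _ | k
            · simp only [hGdef, Finset.mem_insert, Finset.mem_union] at hq
              simp only [Function.iterate_zero_apply, Finset.mem_union, Finset.mem_insert]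
              tauto
            · have : eraseLead^[k + 1] q ∈ T := by
                simp only [hT, Finset.mem_biUnion, Finset.mem_insert, Finset.mem_singleton]
                exact ⟨q, hq, k, by simp; omega, by simp⟩
              simp only [Finset.mem_union, Finset.mem_insert]
              tauto
          · have := hmem _ (Or.inl rfl)
            simp only [Finset.mem_union, Finset.mem_insert]; tauto
          · have := hmem _ (Or.inr rfl)
            simp only [Finset.mem_union, Finset.mem_insert]; tauto
        · intro q hq
          simp only [hGdef, Finset.mem_insert, Finset.mem_union] at hq ⊢
          tauto
    refine (main (F.filter fun p => p.natDegree = d) (F.filter fun p => p.natDegree < d)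
      (by simp) (by simp)).mono fun p hp => ?_
    have := hF p hp
    simp only [Finset.mem_union, Finset.mem_filter, hp, true_and]; omega

section SemiAlg

variable {ι κ : Type*}

/-- A predicate on `ℝ^ι` determined by the signs of finitely many polynomials. -/
def SemiAlg (P : (ι → ℝ) → Prop) : Prop :=
  ∃ F : Finset (MvPolynomial ι ℝ), ∀ x y : ι → ℝ,
    (∀ p ∈ F, SignType.sign (MvPolynomial.eval x p) = SignType.sign (MvPolynomial.eval y p)) →
    P x → P y

/-- Functions given by a polynomial. -/
def IsPolyFun (f : (ι → ℝ) → ℝ) : Prop := ∃ p : MvPolynomial ι ℝ, ∀ x, MvPolynomial.eval x p = f x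

namespace IsPolyFun

theorem coord (i : ι) : IsPolyFun fun x : ι → ℝ => x i := ⟨MvPolynomial.X i, by simp⟩

theorem const (c : ℝ) : IsPolyFun fun _ : ι → ℝ => c := ⟨MvPolynomial.C c, by simp⟩

theorem add {f g : (ι → ℝ) → ℝ} (hf : IsPolyFun f) (hg : IsPolyFun g) :
    IsPolyFun fun x => f x + g x := by
  obtain ⟨p, hp⟩ := hf; obtain ⟨q, hq⟩ := hg; exact ⟨p + q, by simp [hp, hq]⟩

theorem sub {f g : (ι → ℝ) → ℝ} (hf : IsPolyFun f) (hg : IsPolyFun g) :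
    IsPolyFun fun x => f x - g x := by
  obtain ⟨p, hp⟩ := hf; obtain ⟨q, hq⟩ := hg; exact ⟨p - q, by simp [hp, hq]⟩

theorem mul {f g : (ι → ℝ) → ℝ} (hf : IsPolyFun f) (hg : IsPolyFun g) :
    IsPolyFun fun x => f x * g x := by
  obtain ⟨p, hp⟩ := hf; obtain ⟨q, hq⟩ := hg; exact ⟨p * q, by simp [hp, hq]⟩

theorem pow {f : (ι → ℝ) → ℝ} (hf : IsPolyFun f) (n : ℕ) : IsPolyFun fun x => f x ^ n := by
  obtain ⟨p, hp⟩ := hf; exact ⟨p ^ n, by simp [hp]⟩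

theorem comp {f : (κ → ℝ) → ℝ} (hf : IsPolyFun f) {g : κ → (ι → ℝ) → ℝ}
    (hg : ∀ k, IsPolyFun (g k)) : IsPolyFun fun x => f fun k => g k x := by
  obtain ⟨p, hp⟩ := hf
  choose q hq using hg
  refine ⟨MvPolynomial.bind₁ q p, fun x => ?_⟩
  change _ = f fun k => g k x
  rw [← hp, MvPolynomial.eval, MvPolynomial.eval₂Hom_bind₁]
  congr 2
  funext k
  exact hq k x

end IsPolyFun

namespace SemiAlg

variable {P Q : (ι → ℝ) → Prop}

theorem of_sign {f : (ι → ℝ) → ℝ} (hf : IsPolyFun f) (A : SignType → Prop) :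
    SemiAlg fun x => A (SignType.sign (f x)) := by
  obtain ⟨p, hp⟩ := hf
  refine ⟨{p}, fun x x' h => ?_⟩
  have := h p (by simp)
  rw [hp, hp] at this
  change A _ → A _
  rw [this]; exact id

theorem not (h : SemiAlg P) : SemiAlg fun x => ¬P x := by
  obtain ⟨F, hF⟩ := h
  exact ⟨F, fun x x' h hx hx' => hx (hF x' x (fun p hp => (h p hp).symm) hx')⟩

theorem and (hP : SemiAlg P) (hQ : SemiAlg Q) : SemiAlg fun x => P x ∧ Q x := by
  classical
  obtain ⟨F, hF⟩ := hP; obtain ⟨G, hG⟩ := hQ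
  exact ⟨F ∪ G, fun x x' h hx =>
    ⟨hF x x' (fun p hp => h p (Finset.mem_union_left _ hp)) hx.1,
      hG x x' (fun p hp => h p (Finset.mem_union_right _ hp)) hx.2⟩⟩

theorem congr (hP : SemiAlg P) (h : ∀ x, Q x ↔ P x) : SemiAlg Q := by
  have : Q = P := funext fun x => propext (h x)
  rwa [this]

theorem or (hP : SemiAlg P) (hQ : SemiAlg Q) : SemiAlg fun x => P x ∨ Q x :=
  (hP.not.and hQ.not).not.congr fun x => by tauto

theorem imp (hP : SemiAlg P) (hQ : SemiAlg Q) : SemiAlg fun x => P x → Q x :=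
  (hP.not.or hQ).congr fun x => by tauto

theorem lt {f g : (ι → ℝ) → ℝ} (hf : IsPolyFun f) (hg : IsPolyFun g) :
    SemiAlg fun x => f x < g x :=
  (of_sign (hg.sub hf) (· = 1)).congr fun x => by rw [sign_eq_one_iff, sub_pos]

theorem le {f g : (ι → ℝ) → ℝ} (hf : IsPolyFun f) (hg : IsPolyFun g) :
    SemiAlg fun x => f x ≤ g x := (lt hg hf).not.congr fun x => by rw [not_lt]

theorem eq {f g : (ι → ℝ) → ℝ} (hf : IsPolyFun f) (hg : IsPolyFun g) :
    SemiAlg fun x => f x = g x :=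
  (of_sign (hg.sub hf) (· = 0)).congr fun x => by rw [sign_eq_zero_iff, sub_eq_zero, eq_comm]

theorem comp {P : (κ → ℝ) → Prop} (hP : SemiAlg P) {g : κ → (ι → ℝ) → ℝ}
    (hg : ∀ k, IsPolyFun (g k)) : SemiAlg fun x => P fun k => g k x := by
  classical
  obtain ⟨F, hF⟩ := hP
  have : ∀ p : MvPolynomial κ ℝ, ∃ q : MvPolynomial ι ℝ, ∀ x, MvPolynomial.eval x q =
      MvPolynomial.eval (fun k => g k x) p := fun p =>
    IsPolyFun.comp (f := fun y => MvPolynomial.eval y p) ⟨p, fun _ => rfl⟩ hg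
  choose t ht using this
  exact ⟨F.image t, fun x x' h hx => hF _ _ (fun p hp => by
    have := h (t p) (Finset.mem_image_of_mem _ hp)
    rwa [ht, ht] at this) hx⟩

theorem eval_optionEquivLeft (z : Option ι → ℝ) (p : MvPolynomial (Option ι) ℝ) :
    ((MvPolynomial.optionEquivLeft ℝ ι p).map
      (MvPolynomial.eval fun i => z (some i))).eval (z none) = MvPolynomial.eval z p := by
  induction p using MvPolynomial.induction_on with
  | C a => simp [MvPolynomial.optionEquivLeft_C]
  | add p q hp hq => simp [hp, hq]
  | mul_X p i hp =>
    rw [map_mul, Polynomial.map_mul, Polynomial.eval_mul, hp, map_mul]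
    cases i <;> simp [MvPolynomial.optionEquivLeft_X_none, MvPolynomial.optionEquivLeft_X_some]

/-- Tarski–Seidenberg: projections of semialgebraic predicates are semialgebraic. -/
theorem ex {P : (ι → ℝ) → ℝ → Prop}
    (h : SemiAlg fun z : Option ι → ℝ => P (fun i => z (some i)) (z none)) :
    SemiAlg fun x => ∃ y, P x y := by
  classical
  obtain ⟨F, hF⟩ := h
  obtain ⟨D, hD⟩ := signDetermined (F.image (MvPolynomial.optionEquivLeft ℝ ι))
  refine ⟨D, fun x x' hx ⟨y, hy⟩ => ?_⟩
  obtain ⟨φ, hφ⟩ := hD x x' hx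
  refine ⟨φ y, ?_⟩
  refine hF (fun i => i.elim y x) (fun i => i.elim (φ y) x') (fun p hp => ?_) hy
  have := hφ _ (Finset.mem_image_of_mem _ hp) y
  rw [← eval_optionEquivLeft, ← eval_optionEquivLeft]
  exact this

theorem all {P : (ι → ℝ) → ℝ → Prop}
    (h : SemiAlg fun z : Option ι → ℝ => P (fun i => z (some i)) (z none)) :
    SemiAlg fun x => ∀ y, P x y :=
  (ex (P := fun x y => ¬P x y) h.not).not.congr fun x => by push Not; rfl

theorem finAnd {α : Type*} [Finite α] {P : α → (ι → ℝ) → Prop} (h : ∀ a, SemiAlg (P a)) :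
    SemiAlg fun x => ∀ a, P a x := by
  classical
  have := Fintype.ofFinite α
  choose F hF using h
  exact ⟨Finset.univ.biUnion F, fun x x' h hx a => hF a x x' (fun p hp =>
    h p (Finset.mem_biUnion.2 ⟨a, Finset.mem_univ _, hp⟩)) (hx a)⟩

theorem finOr {α : Type*} [Finite α] {P : α → (ι → ℝ) → Prop} (h : ∀ a, SemiAlg (P a)) :
    SemiAlg fun x => ∃ a, P a x :=
  (finAnd fun a => (h a).not).not.congr fun x => by push Not; rfl

end SemiAlg

theorem isSemialgebraic_iff {n : ℕ} {s : Set (EuclideanSpace ℝ (Fin n))} :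
    IsSemialgebraic s ↔ SemiAlg fun x : Fin n → ℝ => WithLp.toLp 2 x ∈ s := by
  classical
  constructor
  · rintro ⟨N, P, M, Q, rfl⟩
    refine SemiAlg.congr (P := fun x => ∃ i : Fin N, MvPolynomial.eval x (P i) = 0 ∧
      ∀ j : Fin (M i), 0 < MvPolynomial.eval x (Q i j)) (SemiAlg.finOr fun i => ?_) (by simp)
    exact (SemiAlg.eq ⟨P i, fun _ => rfl⟩ (IsPolyFun.const 0)).and
      (SemiAlg.finAnd fun j => SemiAlg.lt (IsPolyFun.const 0) ⟨Q i j, fun _ => rfl⟩)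
  · rintro ⟨F, hF⟩
    let sg : (Fin n → ℝ) → F → SignType := fun x p => SignType.sign (MvPolynomial.eval x p.1)
    let T := {τ : F → SignType // ∃ x : Fin n → ℝ, WithLp.toLp 2 x ∈ s ∧ sg x = τ}
    let e := Fintype.equivFin T
    let e' := Fintype.equivFin F
    refine ⟨Fintype.card T, fun i => ∑ p : F, if (e.symm i).1 p = 0 then p.1 ^ 2 else 0,
      fun _ => Fintype.card F, fun i j => if (e.symm i).1 (e'.symm j) = 0 then 1 else
        if (e.symm i).1 (e'.symm j) = 1 then (e'.symm j).1 else -(e'.symm j).1, ?_⟩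
    have key : ∀ (x : Fin n → ℝ) (τ : F → SignType),
        (MvPolynomial.eval x (∑ p : F, if τ p = 0 then p.1 ^ 2 else 0) = 0 ∧
        ∀ p : F, 0 < MvPolynomial.eval x (if τ p = 0 then 1 else if τ p = 1 then p.1 else -p.1)) ↔
        sg x = τ := by
      intro x τ
      rw [map_sum, Finset.sum_eq_zero_iff_of_nonneg, funext_iff]
      · simp only [Finset.mem_univ, true_imp_iff, ← forall_and]
        refine forall_congr' fun p => ?_
        simp only [sg]
        rcases h : τ p with _ | _ | _ <;> simp [sign_eq_one_iff, sign_eq_neg_one_iff]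
      · intro p _
        split_ifs <;> simp [sq_nonneg]
    ext x
    simp only [mem_iUnion, mem_ofPred_eq]
    have key' : ∀ i : Fin (Fintype.card T), (MvPolynomial.eval (fun j => x j)
        (∑ p : F, if (e.symm i).1 p = 0 then p.1 ^ 2 else 0) = 0 ∧
        ∀ j : Fin (Fintype.card F), 0 < MvPolynomial.eval (fun j => x j)
          (if (e.symm i).1 (e'.symm j) = 0 then 1 else
          if (e.symm i).1 (e'.symm j) = 1 then (e'.symm j).1 else -(e'.symm j).1)) ↔
        sg (fun j => x j) = (e.symm i).1 := fun i => by
      rw [← key, e'.symm.forall_congr_left]; simp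
    simp only [key']
    constructor
    · intro hx
      exact ⟨e ⟨sg (fun j => x j), _, hx, rfl⟩, by simp⟩
    · rintro ⟨i, hi⟩
      obtain ⟨y, hy, hy'⟩ := (e.symm i).2
      have := hF y (fun j => x j) (fun p hp => by
        have := congrFun (hy'.trans hi.symm) ⟨p, hp⟩; exact this) hy
      exact this

end SemiAlg

section Germs
open Polynomial Filter Topology

theorem Polynomial.eventually_sign (p : ℝ[X]) :
    ∃ s, ∀ᶠ r in 𝓝[>] (0 : ℝ), SignType.sign (p.eval r) = s := by
  by_cases hp : p = 0
  · exact ⟨0, by simp [hp]⟩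
  obtain ⟨q, hq, hq0⟩ := exists_eq_pow_rootMultiplicity_mul_and_not_dvd p hp 0
  rw [dvd_iff_isRoot, IsRoot] at hq0
  refine ⟨SignType.sign (q.eval 0), ?_⟩
  have h1 : ∀ᶠ r in 𝓝 (0 : ℝ), SignType.sign (q.eval r) = SignType.sign (q.eval 0) := by
    rcases lt_or_gt_of_ne hq0 with h | h
    · filter_upwards [q.continuous.continuousAt.eventually_lt continuousAt_const h] with r hr
      rw [sign_neg hr, sign_neg h]
    · filter_upwards [continuousAt_const.eventually_lt q.continuous.continuousAt h] with r hr
      rw [sign_pos hr, sign_pos h]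
  filter_upwards [h1.filter_mono nhdsWithin_le_nhds, self_mem_nhdsWithin] with r hr hr0
  rw [hq]
  simp only [C_0, sub_zero, eval_mul, eval_pow, eval_X, sign_mul]
  rw [sign_pos (pow_pos (mem_Ioi.1 hr0) _), one_mul, hr]

/-- A lower bound by a monomial for a nonzero polynomial near `0`. -/
theorem Polynomial.exists_lower_bound {p : ℝ[X]} (hp : p ≠ 0) :
    ∃ c > 0, ∃ k : ℕ, ∀ᶠ r in 𝓝[>] (0 : ℝ), c * r ^ k ≤ |p.eval r| := by
  obtain ⟨q, hq, hq0⟩ := exists_eq_pow_rootMultiplicity_mul_and_not_dvd p hp 0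
  rw [dvd_iff_isRoot, IsRoot] at hq0
  refine ⟨|q.eval 0| / 2, by positivity, rootMultiplicity 0 p, ?_⟩
  have h1 : ∀ᶠ r in 𝓝 (0 : ℝ), |q.eval 0| / 2 < |q.eval r| :=
    continuousAt_const.eventually_lt (by fun_prop) (by have := abs_pos.2 hq0; linarith)
  filter_upwards [h1.filter_mono nhdsWithin_le_nhds, self_mem_nhdsWithin] with r hr hr0
  have hr0 := mem_Ioi.1 hr0
  conv_rhs => rw [hq]
  simp only [C_0, sub_zero, eval_mul, eval_pow, eval_X, abs_mul, abs_pow, abs_of_pos hr0]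
  have := pow_pos hr0 (rootMultiplicity 0 p)
  nlinarith

theorem SemiAlg.dichotomy {P : ℝ → Prop} (h : SemiAlg fun x : Fin 1 → ℝ => P (x 0)) :
    (∀ᶠ r in 𝓝[>] (0 : ℝ), P r) ∨ ∀ᶠ r in 𝓝[>] (0 : ℝ), ¬P r := by
  obtain ⟨F, hF⟩ := h
  have key : ∀ p : MvPolynomial (Fin 1) ℝ, ∃ s, ∀ᶠ r in 𝓝[>] (0 : ℝ),
      SignType.sign (MvPolynomial.eval (fun _ => r) p) = s := fun p => by
    obtain ⟨s, hs⟩ := Polynomial.eventually_sign (MvPolynomial.aeval (fun _ => X) p)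
    refine ⟨s, hs.mono fun r hr => ?_⟩
    rw [← hr]
    have : (MvPolynomial.eval fun _ => r : MvPolynomial (Fin 1) ℝ →+* ℝ) = (evalRingHom r).comp
        (MvPolynomial.aeval fun _ => X : MvPolynomial (Fin 1) ℝ →ₐ[ℝ] ℝ[X]).toRingHom := by
      apply MvPolynomial.ringHom_ext <;> simp
    rw [this]; rfl
  choose s hs using key
  have hall : ∀ᶠ r in 𝓝[>] (0 : ℝ), ∀ p ∈ F,
      SignType.sign (MvPolynomial.eval (fun _ => r) p) = s p :=
    (Filter.eventually_all_finset F).2 fun p _ => hs p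
  by_cases hex : ∃ᶠ r in 𝓝[>] (0 : ℝ), P r
  · left
    obtain ⟨r₀, hr₀, hP⟩ := (hex.and_eventually hall).exists
    filter_upwards [hall] with r hr
    exact hF (fun _ => r₀) (fun _ => r) (fun p hp => by rw [hP p hp, hr p hp]) hr₀
  · exact Or.inr (not_frequently.1 hex)

theorem exists_monomial_region_sign (p : MvPolynomial (Fin 2) ℝ) :
    ∃ (m : ℕ) (s : SignType), ∀ᶠ r in 𝓝[>] (0 : ℝ), ∀ l, 0 < l → l < r ^ m →
      SignType.sign (MvPolynomial.eval ![r, l] p) = s := by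
  set f : ℝ[X][X] := MvPolynomial.aeval ![C X, X] p with hf
  have ef : ∀ r l, MvPolynomial.eval ![r, l] p = (f.map (evalRingHom r)).eval l := by
    intro r l
    have : (MvPolynomial.eval ![r, l] : MvPolynomial (Fin 2) ℝ →+* ℝ) =
        ((evalRingHom l).comp (mapRingHom (evalRingHom r))).comp
          (MvPolynomial.aeval ![C X, X] : MvPolynomial (Fin 2) ℝ →ₐ[ℝ] ℝ[X][X]).toRingHom := by
      apply MvPolynomial.ringHom_ext
      · intro a; simp [Polynomial.algebraMap_apply]
      · intro i; fin_cases i <;> simp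
    rw [this]; rfl
  by_cases h0 : f = 0
  · exact ⟨0, 0, Eventually.of_forall fun r l _ _ => by rw [ef, h0]; simp⟩
  obtain ⟨g, hg, hg0⟩ := exists_eq_pow_rootMultiplicity_mul_and_not_dvd f h0 0
  rw [C_0, sub_zero, X_dvd_iff] at hg0
  set k := rootMultiplicity 0 f
  obtain ⟨c, hc, j, hcj⟩ := exists_lower_bound hg0
  obtain ⟨s, hs⟩ := eventually_sign (g.coeff 0)
  have hcont : Continuous fun z : ℝ × ℝ => (g.divX.map (evalRingHom z.1)).eval z.2 := by
    simp only [eval_map, eval₂_eq_sum_range]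
    refine continuous_finsetSum _ fun i _ => ?_
    simp only [coe_evalRingHom]
    exact ((g.divX.coeff i).continuous.comp continuous_fst).mul (continuous_snd.pow i)
  obtain ⟨H, hH⟩ := (isCompact_Icc (a := ((0 : ℝ), (0 : ℝ))) (b := (1,
      1))).exists_bound_of_continuousOn
    hcont.continuousOn
  have hcH : 0 < c / (|H| + 1) := by positivity
  refine ⟨j + 1, s, ?_⟩
  filter_upwards [hcj, hs, self_mem_nhdsWithin, nhdsWithin_le_nhds (gt_mem_nhds hcH),
    nhdsWithin_le_nhds (gt_mem_nhds (zero_lt_one' ℝ))] with r h1 h2 h3 h4 h5 l hl hl'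
  have h3 := mem_Ioi.1 h3
  rw [ef, hg]
  simp only [C_0, sub_zero, Polynomial.map_mul, Polynomial.map_pow, map_X, eval_mul, eval_pow,
    eval_X, sign_mul]
  rw [sign_pos (pow_pos hl _), one_mul, ← h2]
  have e : (g.map (evalRingHom r)).eval l = (g.coeff 0).eval r +
      l * (g.divX.map (evalRingHom r)).eval l := by
    conv_lhs => rw [← divX_mul_X_add g]
    simp; ring
  have hb : |(g.divX.map (evalRingHom r)).eval l| ≤ |H| := by
    refine (hH (r, l) ⟨⟨h3.le, hl.le⟩, ⟨h5.le, ?_⟩⟩).trans (le_abs_self H)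
    exact hl'.le.trans (pow_le_one₀ h3.le h5.le)
  have hsm : |l * (g.divX.map (evalRingHom r)).eval l| < |(g.coeff 0).eval r| := by
    rw [abs_mul, abs_of_pos hl]
    refine lt_of_le_of_lt (mul_le_mul hl'.le hb (abs_nonneg _) (by positivity)) (lt_of_lt_of_le ?_
        h1)
    rw [lt_div_iff₀ (by positivity)] at h4
    have := pow_pos h3 j
    rw [pow_succ]
    nlinarith [abs_nonneg H]
  rw [e]
  rcases lt_trichotomy ((g.coeff 0).eval r) 0 with h | h | h
  · rw [sign_neg h, sign_neg]
    rw [abs_of_neg h] at hsm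
    linarith [le_abs_self (l * (g.divX.map (evalRingHom r)).eval l)]
  · rw [h, abs_zero] at hsm; exact absurd hsm (not_lt.2 (abs_nonneg _))
  · rw [sign_pos h, sign_pos]
    rw [abs_of_pos h] at hsm
    linarith [neg_abs_le (l * (g.divX.map (evalRingHom r)).eval l)]

/-- A planar semialgebraic predicate is constant on a region `0 < l < r ^ m` near the origin. -/
theorem SemiAlg.dichotomy₂ {P : ℝ → ℝ → Prop} (h : SemiAlg fun x : Fin 2 → ℝ => P (x 0) (x 1)) :
    ∃ m : ℕ, (∀ᶠ r in 𝓝[>] (0 : ℝ), ∀ l, 0 < l → l < r ^ m → P r l) ∨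
      ∀ᶠ r in 𝓝[>] (0 : ℝ), ∀ l, 0 < l → l < r ^ m → ¬P r l := by
  obtain ⟨F, hF⟩ := h
  choose m s hs using exists_monomial_region_sign
  have hall : ∀ᶠ r in 𝓝[>] (0 : ℝ), ∀ p ∈ F, ∀ l, 0 < l → l < r ^ (F.sup m) →
      SignType.sign (MvPolynomial.eval ![r, l] p) = s p := by
    refine (Filter.eventually_all_finset F).2 fun p hp => ?_
    filter_upwards [hs p, self_mem_nhdsWithin, nhdsWithin_le_nhds (gt_mem_nhds (zero_lt_one' ℝ))]
      with r hr h0 h1 l hl hl'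
    exact hr l hl (hl'.trans_le (pow_le_pow_of_le_one (mem_Ioi.1 h0).le h1.le (Finset.le_sup hp)))
  refine ⟨F.sup m, ?_⟩
  by_cases hex : ∃ᶠ r in 𝓝[>] (0 : ℝ), ∃ l, 0 < l ∧ l < r ^ (F.sup m) ∧ P r l
  · left
    obtain ⟨r₀, ⟨l₀, hl₀, hl₀', hP⟩, hr₀⟩ := (hex.and_eventually hall).exists
    filter_upwards [hall] with r hr l hl hl'
    exact hF ![r₀, l₀] ![r, l] (fun p hp => by rw [hr₀ p hp l₀ hl₀ hl₀', hr p hp l hl hl']) hP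
  · right
    filter_upwards [not_frequently.1 hex] with r hr l hl hl' hP
    exact hr ⟨l, hl, hl', hP⟩

end Germs

section Cells
open Polynomial Filter Topology

/-- The specialization of a polynomial in one parameter and one variable. -/
def evalTwo (p : (MvPolynomial (Fin 1) ℝ)[X]) (r y : ℝ) : ℝ :=
  (p.map (MvPolynomial.eval fun _ => r)).eval y

theorem contDiff_evalTwo (p : (MvPolynomial (Fin 1) ℝ)[X]) :
    ContDiff ℝ 1 fun z : ℝ × ℝ => evalTwo p z.1 z.2 := by
  have h1 : ∀ c : MvPolynomial (Fin 1) ℝ, ContDiff ℝ 1 fun r : ℝ => MvPolynomial.eval (fun _ => r)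
      c := by
    intro c
    induction c using MvPolynomial.induction_on with
    | C a => simpa using contDiff_const
    | add p q hp hq => simpa using hp.add hq
    | mul_X p i hp => simpa using hp.mul contDiff_id
  simp only [evalTwo, eval_map, eval₂_eq_sum_range]
  refine ContDiff.sum fun i _ => ?_
  exact ((h1 _).comp contDiff_fst).mul (contDiff_snd.pow i)

theorem hasDerivAt_evalTwo (p : (MvPolynomial (Fin 1) ℝ)[X]) (r y : ℝ) :
    HasDerivAt (fun y => evalTwo p r y) (evalTwo p.derivative r y) y := by
  have := (p.map (MvPolynomial.eval fun _ => r)).hasDerivAt y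
  rwa [derivative_map] at this

theorem lipschitz_of_strictFDeriv {f : ℝ × ℝ → ℝ} {f' : ℝ × ℝ →L[ℝ] ℝ} {z₀ : ℝ × ℝ}
    (hf : HasStrictFDerivAt f f' z₀) (h : f' (0, 1) ≠ 0) :
    ∃ K : ℝ, 0 ≤ K ∧ ∀ᶠ p in 𝓝 z₀ ×ˢ 𝓝 z₀, f p.1 = f p.2 →
      |p.1.2 - p.2.2| ≤ K * |p.1.1 - p.2.1| := by
  set b := |f' (0, 1)| with hb
  have hb0 : 0 < b := abs_pos.2 h
  set a := |f' (1, 0)| with ha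
  refine ⟨(a + b / 2) / (b / 2), by positivity, ?_⟩
  have hlo := hf.isLittleO.def (c := b / 2) (by positivity)
  rw [nhds_prod_eq] at hlo
  refine hlo.mono fun ⟨z, w⟩ hw hzw => ?_
  simp only at hzw ⊢
  simp only [hzw, sub_self, zero_sub, norm_neg] at hw
  have e : f' (z - w) = (z.1 - w.1) * f' (1, 0) + (z.2 - w.2) * f' (0, 1) := by
    have : z - w = (z.1 - w.1) • ((1 : ℝ), (0 : ℝ)) + (z.2 - w.2) • ((0 : ℝ), (1 : ℝ)) := by
      ext <;> simp
    rw [this, map_add, map_smul, map_smul]; rfl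
  have hn : ‖z - w‖ ≤ |z.1 - w.1| + |z.2 - w.2| := by
    rw [Prod.norm_def]
    exact max_le (by simp) (by simp)
  rw [e, Real.norm_eq_abs] at hw
  have h1 : |z.2 - w.2| * b ≤ |(z.1 - w.1) * f' (1, 0) + (z.2 - w.2) * f' (0, 1)| +
      |z.1 - w.1| * a := by
    rw [hb, ha, ← abs_mul, ← abs_mul]
    have := abs_sub ((z.1 - w.1) * f' (1, 0) + (z.2 - w.2) * f' (0, 1)) ((z.1 - w.1) * f' (1, 0))
    simpa using this
  rw [div_mul_eq_mul_div, le_div_iff₀ (by positivity)]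
  nlinarith

theorem SemiAlg.swap_fin {P : ℝ → ℝ → Prop} (h : SemiAlg fun x : Fin 2 → ℝ => P (x 0) (x 1)) :
    SemiAlg fun z : Option (Fin 1) → ℝ => P (z (some 0)) (z none) :=
  h.comp (g := ![fun z => z (some 0), fun z => z none]) fun k => by
    fin_cases k
    · exact IsPolyFun.coord _
    · exact IsPolyFun.coord _

/-- The strip over a short interval `(0, ε)` is decomposed by finitely many locally Lipschitz
semialgebraic graphs such that `P` only depends on the position relative to the graphs. -/
theorem SemiAlg.cells {P : ℝ → ℝ → Prop} (h : SemiAlg fun x : Fin 2 → ℝ => P (x 0) (x 1)) :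
    ∃ ε > 0, ∃ (N : ℕ) (ξ : Fin N → ℝ → ℝ),
      (∀ r ∈ Ioo 0 ε, StrictMono fun i => ξ i r) ∧
      (∀ i, ∀ r₀ ∈ Ioo 0 ε, ∃ K, 0 ≤ K ∧ ∃ δ > 0, ∀ r r', |r - r₀| < δ → |r' - r₀| < δ →
        |ξ i r - ξ i r'| ≤ K * |r - r'|) ∧
      (∀ r ∈ Ioo 0 ε, ∀ r' ∈ Ioo 0 ε, ∀ y y', (∀ i, (y < ξ i r ↔ y' < ξ i r') ∧
        (ξ i r < y ↔ ξ i r' < y')) → P r y → P r' y') ∧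
      ∀ i, SemiAlg fun x : Fin 2 → ℝ => 0 < x 0 ∧ x 0 < ε ∧ x 1 = ξ i (x 0) := by
  classical
  obtain ⟨F₀, hF₀⟩ := h.swap_fin
  set F₁ := F₀.image (MvPolynomial.optionEquivLeft ℝ (Fin 1)) with hF₁
  set F : Finset (MvPolynomial (Fin 1) ℝ)[X] := F₁.biUnion fun p =>
    (Finset.range (p.natDegree + 1)).image fun k => derivative^[k] p with hF
  have hFd : ∀ p ∈ F, p.derivative ∈ F ∨ p.derivative = 0 := by
    intro p hp
    simp only [hF, Finset.mem_biUnion, Finset.mem_image, Finset.mem_range] at hp ⊢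
    obtain ⟨q, hq, k, hk, rfl⟩ := hp
    rw [← Function.iterate_succ_apply' derivative]
    by_cases hk' : k + 1 < q.natDegree + 1
    · exact Or.inl ⟨q, hq, k + 1, hk', rfl⟩
    · exact Or.inr (iterate_derivative_eq_zero (by omega))
  have hF₁F : F₁ ⊆ F := fun p hp => by
    simp only [hF, Finset.mem_biUnion, Finset.mem_image, Finset.mem_range]
    exact ⟨p, hp, 0, by omega, rfl⟩
  obtain ⟨D, hD⟩ := signDetermined F
  have hdich : ∀ c : MvPolynomial (Fin 1) ℝ, ∃ s, ∀ᶠ r in 𝓝[>] (0 : ℝ),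
      SignType.sign (MvPolynomial.eval (fun _ => r) c) = s := fun c => by
    by_contra hcon
    push Not at hcon
    have : ∀ s : SignType, ∀ᶠ r in 𝓝[>] (0 : ℝ),
        ¬ SignType.sign (MvPolynomial.eval (fun _ : Fin 1 => r) c) = s := fun s => by
      have hs : SemiAlg fun x : Fin 1 → ℝ =>
          SignType.sign (MvPolynomial.eval (fun _ : Fin 1 => x 0) c) = s :=
        SemiAlg.of_sign ⟨c, fun x => by congr; funext i; rw [Subsingleton.elim i 0]⟩ (· = s)
      rcases SemiAlg.dichotomy (P := fun r => SignType.sign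
        (MvPolynomial.eval (fun _ : Fin 1 => r) c) = s) hs with h | h
      · exact absurd h (Filter.not_eventually.2 (hcon s))
      · exact h
    have h3 := ((this 0).and ((this 1).and (this (-1)))).exists
    obtain ⟨r, h0, h1, h2⟩ := h3
    rcases h : SignType.sign (MvPolynomial.eval (fun _ : Fin 1 => r) c) with _ | _ | _
    · exact h0 h
    · exact h2 h
    · exact h1 h
  choose sg hsg using hdich
  have hall : ∀ᶠ r in 𝓝[>] (0 : ℝ), ∀ c ∈ D,
      SignType.sign (MvPolynomial.eval (fun _ => r) c) = sg c :=
    (Filter.eventually_all_finset D).2 fun p _ => hsg p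
  obtain ⟨ε, hε, hεD⟩ := mem_nhdsGT_iff_exists_Ioo_subset.1 hall
  have hε : 0 < ε := hε
  have hφ : ∀ r ∈ Ioo 0 ε, ∀ r' ∈ Ioo 0 ε, ∃ φ : ℝ ≃o ℝ, ∀ p ∈ F, ∀ y,
      SignType.sign (evalTwo p r y) = SignType.sign (evalTwo p r' (φ y)) := fun r hr r' hr' =>
    hD _ _ fun c hc => by rw [hεD hr c hc, hεD hr' c hc]
  choose φ hφ using hφ
  set Z : ℝ → Finset ℝ := fun r => F.biUnion fun p =>
    (p.map (MvPolynomial.eval fun _ => r)).roots.toFinset with hZ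
  have memZ : ∀ r y, y ∈ Z r ↔ ∃ p ∈ F, evalTwo p r y = 0 ∧ ∃ y', evalTwo p r y' ≠ 0 := by
    intro r y
    simp only [hZ, Finset.mem_biUnion, Multiset.mem_toFinset, mem_roots', IsRoot, evalTwo]
    refine exists_congr fun p => and_congr_right fun _ => ?_
    rw [and_comm]
    refine and_congr_right fun _ => ?_
    constructor
    · intro h; by_contra hcon; push Not at hcon
      exact h (Polynomial.funext fun y => by simp [hcon y])
    · rintro ⟨y', hy'⟩ h; exact hy' (by rw [h]; simp)
  have sgz : ∀ {a b : ℝ}, SignType.sign a = SignType.sign b → (a = 0 ↔ b = 0) := fun h => by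
    rw [← sign_eq_zero_iff, h, sign_eq_zero_iff]
  have mapZ : ∀ r (hr : r ∈ Ioo 0 ε) r' (hr' : r' ∈ Ioo 0 ε) y,
      y ∈ Z r ↔ φ r hr r' hr' y ∈ Z r' := by
    intro r hr r' hr' y
    rw [memZ, memZ]
    refine exists_congr fun p => and_congr_right fun hp => ?_
    have := hφ r hr r' hr' p hp
    refine and_congr (sgz (this y)) ?_
    refine (exists_congr fun y => not_congr (sgz (this y))).trans ?_
    exact ((φ r hr r' hr').surjective.exists (p := fun y => evalTwo p r' y ≠ 0)).symm
  set rs := ε / 2 with hrs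
  have hrs : rs ∈ Ioo 0 ε := ⟨by positivity, by rw [hrs]; linarith⟩
  set N := (Z rs).card with hN
  have imZ : ∀ r (hr : r ∈ Ioo 0 ε) r' (hr' : r' ∈ Ioo 0 ε), (Z r).image (φ r hr r' hr') = Z r' :=
      by
    intro r hr r' hr'
    ext y
    rw [Finset.mem_image]
    constructor
    · rintro ⟨x, hx, rfl⟩; exact (mapZ r hr r' hr' x).1 hx
    · intro hy
      exact ⟨(φ r hr r' hr').symm y, (mapZ r hr r' hr' _).2 (by simpa using hy), by simp⟩
  have cardZ : ∀ r ∈ Ioo 0 ε, (Z r).card = N := fun r hr => by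
    rw [← imZ rs hrs r hr, Finset.card_image_of_injective _ (φ rs hrs r hr).injective]
  set ξ : Fin N → ℝ → ℝ := fun i r => if hr : r ∈ Ioo 0 ε then
    (Z r).orderEmbOfFin (cardZ r hr) i else 0 with hξ
  have ξeq : ∀ r (hr : r ∈ Ioo 0 ε) i, ξ i r = (Z r).orderEmbOfFin (cardZ r hr) i :=
    fun r hr i => by simp only [hξ]; rw [dif_pos hr]
  have ξmono : ∀ r ∈ Ioo 0 ε, StrictMono fun i => ξ i r := fun r hr i j hij => by
    simp only [ξeq r hr]; exact (Finset.orderEmbOfFin _ _).strictMono hij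
  have ξmem : ∀ r ∈ Ioo 0 ε, ∀ i, ξ i r ∈ Z r := fun r hr i => by
    rw [ξeq r hr]; exact Finset.orderEmbOfFin_mem _ _ _
  have ξuniq : ∀ r ∈ Ioo 0 ε, ∀ f : Fin N → ℝ, (∀ i, f i ∈ Z r) → StrictMono f → ∀ i, f i = ξ i r :=
    fun r hr f h1 h2 i => by
      rw [ξeq r hr, Finset.orderEmbOfFin_unique (cardZ r hr) h1 h2]
  have ξsurj : ∀ r ∈ Ioo 0 ε, ∀ y ∈ Z r, ∃ i, y = ξ i r := fun r hr y hy => by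
    have := Finset.range_orderEmbOfFin (Z r) (cardZ r hr)
    have hy' : y ∈ Set.range ((Z r).orderEmbOfFin (cardZ r hr)) := by rw [this]; exact hy
    obtain ⟨i, hi⟩ := hy'
    exact ⟨i, by rw [ξeq r hr, hi]⟩
  have φξ : ∀ r (hr : r ∈ Ioo 0 ε) r' (hr' : r' ∈ Ioo 0 ε) i, φ r hr r' hr' (ξ i r) = ξ i r' :=
    fun r hr r' hr' i => ξuniq r' hr' (fun i => φ r hr r' hr' (ξ i r))
      (fun i => (mapZ r hr r' hr' _).1 (ξmem r hr i))
      (fun i j hij => (φ r hr r' hr').strictMono (ξmono r hr hij)) i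
  have simple : ∀ i, ∃ q : (MvPolynomial (Fin 1) ℝ)[X], q ∈ F ∧ ∀ r ∈ Ioo 0 ε,
      evalTwo q r (ξ i r) = 0 ∧ evalTwo q.derivative r (ξ i r) ≠ 0 := by
    intro i
    have : ∃ q : (MvPolynomial (Fin 1) ℝ)[X], q ∈ F ∧ evalTwo q rs (ξ i rs) = 0 ∧
        evalTwo q.derivative rs (ξ i rs) ≠ 0 := by
      obtain ⟨p, hp, hp0, y', hy'⟩ := (memZ _ _).1 (ξmem rs hrs i)
      by_contra hcon
      push Not at hcon
      have hall : ∀ k, evalTwo (derivative^[k] p) rs (ξ i rs) = 0 ∧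
          (derivative^[k] p ∈ F ∨ derivative^[k] p = 0) := by
        intro k
        induction k with
        | zero => exact ⟨hp0, Or.inl hp⟩
        | succ k ih =>
          rw [Function.iterate_succ_apply']
          rcases ih.2 with h | h
          · exact ⟨hcon _ h ih.1, hFd _ h⟩
          · rw [h]; simp [evalTwo]
      have hne : p.map (MvPolynomial.eval fun _ => rs) ≠ 0 := fun h => hy' (by simp [evalTwo, h])
      have hall' : ∀ k, (derivative^[k] (p.map (MvPolynomial.eval fun _ : Fin 1 => rs))).IsRoot
          (ξ i rs) := fun k => by
        rw [iterate_derivative_map]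
        exact (hall k).1
      have := (lt_rootMultiplicity_iff_isRoot_iterate_derivative hne
        (n := rootMultiplicity (ξ i rs) (p.map (MvPolynomial.eval fun _ => rs)))).2
        fun k _ => hall' k
      exact lt_irrefl _ this
    obtain ⟨q, hq, hq0, hq1⟩ := this
    refine ⟨q, hq, fun r hr => ?_⟩
    have h1 := hφ rs hrs r hr q hq (ξ i rs)
    rw [φξ] at h1
    refine ⟨(sgz h1).1 hq0, fun h => hq1 ?_⟩
    rcases hFd q hq with h' | h'
    · have h2 := hφ rs hrs r hr _ h' (ξ i rs)
      rw [φξ] at h2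
      exact (sgz h2).2 h
    · rw [h']; simp [evalTwo]
  choose q hqF hq using simple
  have cont : ∀ r₀ ∈ Ioo 0 ε, ∀ i, Tendsto (ξ i) (𝓝 r₀) (𝓝 (ξ i r₀)) := by
    intro r₀ hr₀
    have main : ∀ η > 0, (∀ i j, i < j → ξ i r₀ + 2 * η < ξ j r₀) →
        ∀ᶠ r in 𝓝 r₀, ∀ i, |ξ i r - ξ i r₀| ≤ η := by
      intro η hη hsep
      have hroot : ∀ i, ∀ᶠ r in 𝓝 r₀, ∃ y ∈ Icc (ξ i r₀ - η) (ξ i r₀ + η), evalTwo (q i) r y = 0 ∧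
          ∃ y', evalTwo (q i) r y' ≠ 0 := by
        intro i
        obtain ⟨h0, h1⟩ := hq i r₀ hr₀
        have hder := hasDerivAt_evalTwo (q i) r₀ (ξ i r₀)
        have : ∃ a ∈ Icc (ξ i r₀ - η) (ξ i r₀ + η), ∃ b ∈ Icc (ξ i r₀ - η) (ξ i r₀ + η),
            evalTwo (q i) r₀ a < 0 ∧ 0 < evalTwo (q i) r₀ b := by
          by_contra hcon
          push Not at hcon
          have hI : Icc (ξ i r₀ - η) (ξ i r₀ + η) ∈ 𝓝 (ξ i r₀) :=
            Icc_mem_nhds (by linarith) (by linarith)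
          by_cases hneg : ∃ a ∈ Icc (ξ i r₀ - η) (ξ i r₀ + η), evalTwo (q i) r₀ a < 0
          · obtain ⟨a, ha, ha'⟩ := hneg
            have hmax : IsLocalMax (fun y => evalTwo (q i) r₀ y) (ξ i r₀) := by
              filter_upwards [hI] with b hb
              rw [h0]; exact hcon a ha b hb ha'
            exact h1 (hmax.hasDerivAt_eq_zero hder)
          · push Not at hneg
            have hmin : IsLocalMin (fun y => evalTwo (q i) r₀ y) (ξ i r₀) := by
              filter_upwards [hI] with b hb
              rw [h0]; exact hneg b hb
            exact h1 (hmin.hasDerivAt_eq_zero hder)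
        obtain ⟨a, ha, b, hb, ha', hb'⟩ := this
        have hc : ∀ y, Continuous fun r => evalTwo (q i) r y := fun y =>
          (contDiff_evalTwo (q i)).continuous.comp (by fun_prop : Continuous fun r : ℝ => (r, y))
        filter_upwards [(hc a).continuousAt.eventually_lt continuousAt_const ha',
          continuousAt_const.eventually_lt (hc b).continuousAt hb'] with r h2 h3
        have hiv := intermediate_value_uIcc (a := a) (b := b) (f := fun y => evalTwo (q i) r y)
          ((contDiff_evalTwo (q i)).continuous.comp
            (by fun_prop : Continuous fun y : ℝ => (r, y))).continuousOn
        obtain ⟨y, hy, hy0⟩ := hiv (show (0 : ℝ) ∈ _ by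
          rw [mem_uIcc]; left; exact ⟨h2.le, h3.le⟩)
        exact ⟨y, uIcc_subset_Icc ha hb hy, hy0, a, h2.ne⟩
      filter_upwards [eventually_all.2 hroot, Ioo_mem_nhds hr₀.1 hr₀.2] with r hr hr' i
      choose f hf hf0 hf1 using hr
      have : ∀ i, f i = ξ i r := ξuniq r hr' f
        (fun i => (memZ _ _).2 ⟨q i, hqF i, hf0 i, hf1 i⟩)
        (fun i j hij => by linarith [(hf i).2, (hf j).1, hsep i j hij])
      rw [← this i, abs_le]
      constructor <;> linarith [(hf i).1, (hf i).2]
    have hgap : ∃ η > 0, ∀ i j, i < j → ξ i r₀ + 2 * η < ξ j r₀ := by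
      have : ∀ᶠ η in 𝓝[>] (0 : ℝ), ∀ i j, i < j → ξ i r₀ + 2 * η < ξ j r₀ := by
        refine eventually_all.2 fun i => eventually_all.2 fun j => ?_
        by_cases hij : i < j
        · have h1 := ξmono r₀ hr₀ hij
          have : Tendsto (fun η : ℝ => ξ i r₀ + 2 * η) (𝓝 0) (𝓝 (ξ i r₀ + 2 * 0)) :=
            Continuous.tendsto (by fun_prop) _
          filter_upwards [nhdsWithin_le_nhds (this.eventually_lt_const (by simpa using h1))]
            with η hη _ using hη
        · exact Eventually.of_forall fun _ h => absurd h hij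
      obtain ⟨η, h1, h2⟩ := (this.and self_mem_nhdsWithin).exists
      exact ⟨η, h2, h1⟩
    obtain ⟨η₀, hη₀, hsep⟩ := hgap
    intro i
    rw [Metric.tendsto_nhds]
    intro e he
    filter_upwards [main (min η₀ (e / 2)) (by positivity) fun i j hij => by
      linarith [hsep i j hij, min_le_left η₀ (e / 2)]] with r hr
    rw [Real.dist_eq]
    linarith [hr i, min_le_right η₀ (e / 2)]
  refine ⟨ε, hε, N, ξ, ξmono, fun i r₀ hr₀ => ?_, fun r hr r' hr' y y' hyy hP => ?_, fun i => ?_⟩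
  · have hsd := (contDiff_evalTwo (q i)).contDiffAt.hasStrictFDerivAt (x := (r₀, ξ i r₀)) (by simp)
    have h01 : (fderiv ℝ (fun z : ℝ × ℝ => evalTwo (q i) z.1 z.2) (r₀, ξ i r₀)) (0, 1) =
        evalTwo (q i).derivative r₀ (ξ i r₀) := by
      have h1 := hsd.hasFDerivAt.comp_hasDerivAt (ξ i r₀)
        ((hasDerivAt_const (ξ i r₀) r₀).prodMk (hasDerivAt_id (ξ i r₀)))
      exact h1.unique (hasDerivAt_evalTwo (q i) r₀ (ξ i r₀))
    obtain ⟨K, hK, hKe⟩ := lipschitz_of_strictFDeriv hsd (by rw [h01]; exact (hq i r₀ hr₀).2)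
    have ht : Tendsto (fun r => (r, ξ i r)) (𝓝 r₀) (𝓝 (r₀, ξ i r₀)) :=
      tendsto_id.prodMk_nhds (cont r₀ hr₀ i)
    have h2 := (ht.prodMap ht).eventually hKe
    rw [← nhds_prod_eq] at h2
    obtain ⟨δ, hδ, hball⟩ := Metric.eventually_nhds_iff.1
      (h2.and (prod_mem_nhds (Ioo_mem_nhds hr₀.1 hr₀.2) (Ioo_mem_nhds hr₀.1 hr₀.2)))
    refine ⟨K, hK, δ, hδ, fun r r' h3 h4 => ?_⟩
    have := @hball (r, r') (by
      rw [Prod.dist_eq, max_lt_iff]; exact ⟨by simpa [Real.dist_eq] using h3,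
          by simpa [Real.dist_eq] using h4⟩)
    exact this.1 (by
      simp only [Prod.map]
      rw [(hq i r this.2.1).1, (hq i r' this.2.2).1])
  · have hcmp : ∀ p ∈ F, SignType.sign (evalTwo p r y) = SignType.sign (evalTwo p r' y') := by
      intro p hp
      rw [hφ r hr r' hr' p hp y]
      by_cases hy : φ r hr r' hr' y ∈ Z r'
      · obtain ⟨i, hi⟩ := ξsurj r' hr' _ hy
        rw [← φξ r hr r' hr', (φ r hr r' hr').injective.eq_iff] at hi
        have h1 := (hyy i).1.not.1 (by rw [hi]; exact lt_irrefl _)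
        have h2 := (hyy i).2.not.1 (by rw [hi]; exact lt_irrefl _)
        rw [hi, φξ, le_antisymm (not_lt.1 h2) (not_lt.1 h1)]
      · by_cases hpz : ∃ w, evalTwo p r' w ≠ 0
        · refine sign_const_of_sameSide (Z := Z r') (fun w hw => (memZ _ _).2 ⟨p, hp, hw, hpz⟩)
            fun z hz => ?_
          obtain ⟨i, rfl⟩ := ξsurj r' hr' z hz
          have h3 : φ r hr r' hr' y ≠ ξ i r' := fun h => hy (h ▸ hz)
          rw [← φξ r hr r' hr', (φ r hr r' hr').lt_iff_lt, (φ r hr r' hr').lt_iff_lt,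
            φξ, ← (hyy i).1, ← (hyy i).2]
          rw [← φξ r hr r' hr', (φ r hr r' hr').injective.ne_iff] at h3
          rcases lt_or_gt_of_ne h3 with h | h
          · exact Or.inr ⟨h, h⟩
          · exact Or.inl ⟨h, h⟩
        · push Not at hpz; rw [hpz, hpz]
    refine hF₀ (fun j => j.elim y fun _ => r) (fun j => j.elim y' fun _ => r') (fun p hp => ?_) hP
    have := hcmp _ (hF₁F (Finset.mem_image_of_mem _ hp))
    rw [← SemiAlg.eval_optionEquivLeft, ← SemiAlg.eval_optionEquivLeft]
    exact this
  · have hev : ∀ (p : (MvPolynomial (Fin 1) ℝ)[X]) {κ : Type} (a b : (κ → ℝ) → ℝ), IsPolyFun a →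
        IsPolyFun b → IsPolyFun fun x => evalTwo p (a x) (b x) := by
      intro p κ a b ha hb
      have h1 : IsPolyFun fun z : Option (Fin 1) → ℝ => evalTwo p (z (some 0)) (z none) := by
        refine ⟨(MvPolynomial.optionEquivLeft ℝ (Fin 1)).symm p, fun z => ?_⟩
        have := SemiAlg.eval_optionEquivLeft z ((MvPolynomial.optionEquivLeft ℝ (Fin 1)).symm p)
        rw [AlgEquiv.apply_symm_apply] at this
        refine this.symm.trans ?_
        change _ = (p.map (MvPolynomial.eval fun _ => z (some 0))).eval (z none)
        congr 3
        funext j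
        rw [Subsingleton.elim j 0]
      exact h1.comp (g := fun o : Option (Fin 1) => o.elim b fun _ => a) fun k => by
        rcases k with _ | k
        · exact hb
        · exact ha
    have hZ' : ∀ {κ : Type} (a b : (κ → ℝ) → ℝ), IsPolyFun a → IsPolyFun b →
        SemiAlg fun x => b x ∈ Z (a x) := by
      intro κ a b ha hb
      simp only [memZ]
      have h2 : SemiAlg fun x => ∃ p : F, evalTwo p.1 (a x) (b x) = 0 ∧
          ∃ y', evalTwo p.1 (a x) y' ≠ 0 := by
        refine SemiAlg.finOr fun p => ?_
        refine (SemiAlg.eq (hev _ _ _ ha hb) (.const 0)).and (SemiAlg.ex ?_)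
        refine (SemiAlg.eq (hev _ _ _ ?_ (.coord none)) (.const 0)).not
        exact ha.comp fun k => .coord (some k)
      refine h2.congr fun x => ?_
      rw [Subtype.exists]
      simp only [exists_prop]
    have hgr : ∀ k (hk : k < N), SemiAlg fun x : Fin 2 → ℝ =>
        0 < x 0 ∧ x 0 < ε ∧ x 1 = ξ ⟨k, hk⟩ (x 0) := by
      intro k
      induction k with
      | zero =>
        intro hk
        have : SemiAlg fun x : Fin 2 → ℝ => 0 < x 0 ∧ x 0 < ε ∧ x 1 ∈ Z (x 0) ∧
            ∀ y, y ∈ Z (x 0) → ¬ y < x 1 := by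
          refine (SemiAlg.lt (.const 0) (.coord 0)).and ((SemiAlg.lt (.coord 0) (.const ε)).and
            ((hZ' _ _ (.coord 0) (.coord 1)).and (SemiAlg.all ?_)))
          exact (hZ' _ _ (.coord (some 0)) (.coord none)).imp
            (SemiAlg.lt (.coord none) (.coord (some 1))).not
        refine this.congr fun x => and_congr_right fun h0 => and_congr_right fun h1 => ?_
        have hr : x 0 ∈ Ioo 0 ε := ⟨h0, h1⟩
        symm
        constructor
        · rintro ⟨h2, h3⟩
          obtain ⟨j, hj⟩ := ξsurj _ hr _ h2
          have h4 := h3 _ (ξmem _ hr ⟨0, hk⟩)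
          rw [hj] at h4 ⊢
          exact le_antisymm (not_lt.1 h4) ((ξmono _ hr).monotone (Fin.mk_le_of_le_val (by simp)))
        · intro h2
          rw [h2]
          refine ⟨ξmem _ hr _, fun y hy => ?_⟩
          obtain ⟨j, rfl⟩ := ξsurj _ hr _ hy
          exact not_lt.2 ((ξmono _ hr).monotone (Fin.mk_le_of_le_val (by simp)))
      | succ k ih =>
        intro hk
        have hk' : k < N := by omega
        have : SemiAlg fun x : Fin 2 → ℝ => ∃ y, ((0 < x 0 ∧ x 0 < ε ∧ y = ξ ⟨k, hk'⟩ (x 0)) ∧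
            y < x 1 ∧ x 1 ∈ Z (x 0)) ∧ ∀ y', y' ∈ Z (x 0) → y < y' → ¬ y' < x 1 := by
          refine SemiAlg.ex ((((ih hk').comp (g := ![fun z : Option (Fin 2) → ℝ => z (some 0),
            fun z => z none]) ?_).and ?_).and (SemiAlg.all ?_))
          · intro j; fin_cases j
            · exact .coord _
            · exact .coord _
          · exact (SemiAlg.lt (.coord _) (.coord _)).and (hZ' _ _ (.coord _) (.coord _))
          · exact (hZ' _ _ (.coord (some (some 0))) (.coord none)).imp
              ((SemiAlg.lt (.coord (some none)) (.coord none)).imp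
              (SemiAlg.lt (.coord none) (.coord (some (some 1)))).not)
        refine this.congr fun x => ?_
        symm
        constructor
        · rintro ⟨y, ⟨⟨h0, h1, rfl⟩, h3, h4⟩, h5⟩
          have hr : x 0 ∈ Ioo 0 ε := ⟨h0, h1⟩
          refine ⟨h0, h1, ?_⟩
          obtain ⟨j, hj⟩ := ξsurj _ hr _ h4
          rw [hj, (ξmono _ hr).lt_iff_lt] at h3
          have h6 := h5 _ (ξmem _ hr ⟨k + 1, hk⟩) ((ξmono _ hr) (Fin.mk_lt_mk.2 (by omega)))
          rw [hj] at h6 ⊢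
          refine le_antisymm (not_lt.1 h6) ((ξmono _ hr).monotone ?_)
          rw [Fin.lt_def] at h3
          rw [Fin.le_def]
          exact h3
        · rintro ⟨h0, h1, h2⟩
          have hr : x 0 ∈ Ioo 0 ε := ⟨h0, h1⟩
          rw [h2]
          refine ⟨_, ⟨⟨h0, h1, rfl⟩, (ξmono _ hr) (Fin.mk_lt_mk.2 (by omega)), ξmem _ hr _⟩,
            fun y' hy' h7 h8 => ?_⟩
          obtain ⟨j, rfl⟩ := ξsurj _ hr _ hy'
          rw [(ξmono _ hr).lt_iff_lt, Fin.lt_def] at h7 h8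
          simp at h7 h8
          omega
    exact hgr i.1 i.2
end Cells

section SAFun

theorem SemiAlg.exFin {κ : Type} [Finite κ] : ∀ {ι : Type} {P : (ι → ℝ) → (κ → ℝ) → Prop},
    (SemiAlg fun z : ι ⊕ κ → ℝ => P (fun i => z (Sum.inl i)) (fun k => z (Sum.inr k))) →
    SemiAlg fun x => ∃ y, P x y := by
  refine Finite.induction_empty_option
    (P := fun κ : Type => ∀ {ι : Type} {P : (ι → ℝ) → (κ → ℝ) → Prop},
    (SemiAlg fun z : ι ⊕ κ → ℝ => P (fun i => z (Sum.inl i)) (fun k => z (Sum.inr k))) →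
    SemiAlg fun x => ∃ y, P x y) ?_ ?_ ?_ κ
  · intro α β e ih ι P h
    have h1 := ih (P := fun x (y : α → ℝ) => P x fun k => y (e.symm k))
      (h.comp (g := fun k => Sum.elim (fun i (z : ι ⊕ α → ℝ) => z (Sum.inl i))
        (fun k z => z (Sum.inr (e.symm k))) k)
        fun k => by rcases k with i | k <;> exact .coord _)
    refine h1.congr fun x => ⟨fun ⟨y, hy⟩ => ⟨fun a => y (e a), by simpa using hy⟩,
      fun ⟨y, hy⟩ => ⟨_, hy⟩⟩
  · intro ι P h
    refine (h.comp (g := fun k => Sum.elim (fun (i : ι) (z : ι → ℝ) => z i) (fun k : PEmpty =>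
        k.elim) k)
      fun k => ?_).congr fun x => ⟨fun ⟨y, hy⟩ => ?_, fun hy => ⟨_, hy⟩⟩
    · rcases k with i | k
      · exact .coord _
      · exact k.elim
    · convert hy
      · rfl
      · rename_i k; exact k.elim
  · intro α _ ih ι P h
    have h1 := SemiAlg.ex (P := fun x y => ∃ y' : α → ℝ, P x fun k => k.elim y y') <|
      ih (P := fun (z : Option ι → ℝ) (y' : α → ℝ) => P (fun i => z (some i))
        fun k => k.elim (z none) y') <|
      (h.comp (g := fun k => Sum.elim (fun i (z : Option ι ⊕ α → ℝ) => z (Sum.inl (some i)))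
        (fun k => Option.elim k (fun z => z (Sum.inl none)) fun k z => z (Sum.inr k)) k) fun k => by
          rcases k with i | _ | k <;> exact .coord _).congr fun z => by
        refine iff_of_eq (congrArg _ (funext fun k => ?_))
        rcases k with _ | k <;> rfl
    · refine h1.congr fun x => ⟨fun ⟨y, hy⟩ => ⟨y none, fun k => y (some k), ?_⟩,
        fun ⟨y, y', hy⟩ => ⟨_, hy⟩⟩
      convert hy using 2 with k
      rcases k with _ | k <;> rfl

variable {ι κ : Type}

/-- Functions with semialgebraic graph. -/
def IsSAFun (f : (ι → ℝ) → ℝ) : Prop :=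
  SemiAlg fun z : Option ι → ℝ => z none = f fun i => z (some i)

theorem IsPolyFun.isSAFun {f : (ι → ℝ) → ℝ} (hf : IsPolyFun f) : IsSAFun f :=
  SemiAlg.eq (.coord _) (hf.comp fun _ => .coord _)

theorem SemiAlg.compSA [Finite κ] {P : (κ → ℝ) → Prop} (hP : SemiAlg P) {g : κ → (ι → ℝ) → ℝ}
    (hg : ∀ k, IsSAFun (g k)) : SemiAlg fun x => P fun k => g k x := by
  have : SemiAlg fun x : ι → ℝ => ∃ y : κ → ℝ, (∀ k, y k = g k x) ∧ P y := by
    refine SemiAlg.exFin (SemiAlg.and (SemiAlg.finAnd fun k => ?_) (hP.comp fun _ => .coord _))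
    exact (hg k).comp (g := fun o => Option.elim o (fun z : ι ⊕ κ → ℝ => z (Sum.inr k))
      fun i z => z (Sum.inl i)) fun o => by rcases o with _ | i <;> exact .coord _
  refine this.congr fun x => ⟨fun h => ⟨_, fun _ => rfl, h⟩, fun ⟨y, hy, h⟩ => ?_⟩
  rwa [← funext hy]

namespace IsSAFun

theorem of_graph {f : (ι → ℝ) → ℝ} {G : (ι → ℝ) → ℝ → Prop}
    (h : SemiAlg fun z : Option ι → ℝ => G (fun i => z (some i)) (z none))
    (hG : ∀ x y, y = f x ↔ G x y) : IsSAFun f := h.congr fun _ => hG _ _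

theorem coord (i : ι) : IsSAFun fun x : ι → ℝ => x i := (IsPolyFun.coord i).isSAFun

theorem const (c : ℝ) : IsSAFun fun _ : ι → ℝ => c := (IsPolyFun.const c).isSAFun

theorem comp [Finite κ] {f : (κ → ℝ) → ℝ} (hf : IsSAFun f) {g : κ → (ι → ℝ) → ℝ}
    (hg : ∀ k, IsSAFun (g k)) : IsSAFun fun x => f fun k => g k x :=
  SemiAlg.compSA hf (g := fun o z => Option.elim o (z none) fun k => g k fun i => z (some i))
    fun o => by
      rcases o with _ | k
      · exact coord _
      · exact SemiAlg.comp (hg k) (g := fun o z => Option.elim o (z none) fun i => z (some (some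
            i)))
          fun o => by rcases o with _ | i <;> exact .coord _

theorem comp₂ {F : ℝ → ℝ → ℝ} (hF : IsSAFun fun x : Fin 2 → ℝ => F (x 0) (x 1))
    {f g : (ι → ℝ) → ℝ} (hf : IsSAFun f) (hg : IsSAFun g) : IsSAFun fun x => F (f x) (g x) :=
  hF.comp (g := ![f, g]) fun k => by fin_cases k; exacts [hf, hg]

theorem comp₁ {F : ℝ → ℝ} (hF : IsSAFun fun x : Fin 1 → ℝ => F (x 0))
    {f : (ι → ℝ) → ℝ} (hf : IsSAFun f) : IsSAFun fun x => F (f x) :=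
  hF.comp (g := fun _ => f) fun _ => hf

variable {f g : (ι → ℝ) → ℝ}

theorem add (hf : IsSAFun f) (hg : IsSAFun g) : IsSAFun fun x => f x + g x :=
  comp₂ (F := fun a b => a + b) ((IsPolyFun.coord 0).add (.coord 1)).isSAFun hf hg

theorem sub (hf : IsSAFun f) (hg : IsSAFun g) : IsSAFun fun x => f x - g x :=
  comp₂ (F := fun a b => a - b) ((IsPolyFun.coord 0).sub (.coord 1)).isSAFun hf hg

theorem mul (hf : IsSAFun f) (hg : IsSAFun g) : IsSAFun fun x => f x * g x :=
  comp₂ (F := fun a b => a * b) ((IsPolyFun.coord 0).mul (.coord 1)).isSAFun hf hg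

theorem pow (hf : IsSAFun f) (n : ℕ) : IsSAFun fun x => f x ^ n :=
  comp₁ (F := fun a => a ^ n) ((IsPolyFun.coord 0).pow n).isSAFun hf

theorem div (hf : IsSAFun f) (hg : IsSAFun g) : IsSAFun fun x => f x / g x := by
  refine comp₂ (F := fun a b => a / b) ?_ hf hg
  refine of_graph (G := fun x y => (x 1 = 0 ∧ y = 0) ∨ (¬ x 1 = 0 ∧ y * x 1 = x 0)) ?_ fun x y => ?_
  · exact ((SemiAlg.eq (.coord _) (.const 0)).and (SemiAlg.eq (.coord _) (.const 0))).or
      ((SemiAlg.eq (.coord _) (.const 0)).not.and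
        (SemiAlg.eq (IsPolyFun.mul (.coord _) (.coord _)) (.coord _)))
  · by_cases h : x 1 = 0
    · simp [h]
    · simp [h, eq_div_iff h]

theorem sqrt (hf : IsSAFun f) : IsSAFun fun x => √(f x) := by
  refine comp₁ (F := fun a => √a) ?_ hf
  refine of_graph (G := fun x y => (x 0 ≤ 0 ∧ y = 0) ∨ (0 < x 0 ∧ 0 < y ∧ y * y = x 0)) ?_
    fun x y => ?_
  · exact ((SemiAlg.le (.coord _) (.const 0)).and (SemiAlg.eq (.coord _) (.const 0))).or
      ((SemiAlg.lt (.const 0) (.coord _)).and ((SemiAlg.lt (.const 0) (.coord _)).and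
        (SemiAlg.eq (IsPolyFun.mul (.coord _) (.coord _)) (.coord _))))
  · rcases le_or_gt (x 0) 0 with h | h
    · simp [Real.sqrt_eq_zero_of_nonpos h, h, not_lt.2 h]
    · simp only [h, not_le.2 h, false_and, false_or, true_and]
      constructor
      · rintro rfl; exact ⟨Real.sqrt_pos.2 h, Real.mul_self_sqrt h.le⟩
      · rintro ⟨h1, h2⟩; rw [← h2, Real.sqrt_mul_self h1.le]

theorem ite {P : (ι → ℝ) → Prop} [DecidablePred P] (hP : SemiAlg P) (hf : IsSAFun f)
    (hg : IsSAFun g) : IsSAFun fun x => if P x then f x else g x := by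
  refine of_graph (G := fun x y => (P x ∧ y = f x) ∨ (¬ P x ∧ y = g x)) ?_ fun x y => ?_
  · exact ((hP.comp fun _ => .coord _).and hf).or ((hP.comp fun _ => .coord _).not.and hg)
  · by_cases h : P x <;> simp [h]

theorem lt (hf : IsSAFun f) (hg : IsSAFun g) : SemiAlg fun x => f x < g x :=
  SemiAlg.compSA (P := fun x : Fin 2 → ℝ => x 0 < x 1) (SemiAlg.lt (.coord 0) (.coord 1))
    (g := ![f, g]) fun k => by fin_cases k; exacts [hf, hg]

theorem le (hf : IsSAFun f) (hg : IsSAFun g) : SemiAlg fun x => f x ≤ g x :=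
  (lt hg hf).not.congr fun x => by rw [not_lt]

theorem eq (hf : IsSAFun f) (hg : IsSAFun g) : SemiAlg fun x => f x = g x :=
  ((le hf hg).and (le hg hf)).congr fun _ => le_antisymm_iff

theorem max (hf : IsSAFun f) (hg : IsSAFun g) : IsSAFun fun x => Max.max (f x) (g x) := by
  classical
  have := ite (le hf hg) hg hf
  simpa only [max_def] using this

theorem min (hf : IsSAFun f) (hg : IsSAFun g) : IsSAFun fun x => Min.min (f x) (g x) := by
  classical
  have := ite (le hf hg) hf hg
  simpa only [min_def] using this

theorem norm_toLp {n : ℕ} {f : Fin n → (ι → ℝ) → ℝ} (hf : ∀ i, IsSAFun (f i)) :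
    IsSAFun fun x => ‖(WithLp.toLp 2 fun i => f i x : EuclideanSpace ℝ (Fin n))‖ := by
  have : IsPolyFun fun y : Fin n → ℝ => ∑ i, y i ^ 2 := ⟨∑ i, MvPolynomial.X i ^ 2, by simp⟩
  have h2 := (this.isSAFun.comp hf).sqrt
  simpa only [EuclideanSpace.norm_eq, Real.norm_eq_abs, sq_abs] using h2

end IsSAFun
end SAFun

section Chart
open Filter Topology

/-- Euclidean four-space. -/
abbrev E4 := EuclideanSpace ℝ (Fin 4)

/-- Spherical stereographic coordinate of the direction of `x`. -/
def chartW (x : E4) : Fin 3 → ℝ := fun i => x i.succ / (‖x‖ + x 0)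

/-- The squared length. -/
def sqLen (w : Fin 3 → ℝ) : ℝ := ∑ i, w i ^ 2

/-- The point of norm `r` with stereographic coordinate `w`. -/
def chartPt (r : ℝ) (w : Fin 3 → ℝ) : E4 :=
  WithLp.toLp 2 (Fin.cons (r * (1 - sqLen w) / (1 + sqLen w)) fun i => 2 * r * w i / (1 + sqLen w))

theorem sqLen_nonneg (w : Fin 3 → ℝ) : 0 ≤ sqLen w := Finset.sum_nonneg fun _ _ => sq_nonneg _

theorem chartPt_zero_coord (r : ℝ) (w : Fin 3 → ℝ) :
    chartPt r w 0 = r * (1 - sqLen w) / (1 + sqLen w) := rfl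

theorem chartPt_succ (r : ℝ) (w : Fin 3 → ℝ) (i : Fin 3) :
    chartPt r w i.succ = 2 * r * w i / (1 + sqLen w) := rfl

theorem sq_norm_eq (x : E4) : ‖x‖ ^ 2 = x 0 ^ 2 + ∑ i : Fin 3, x i.succ ^ 2 := by
  rw [EuclideanSpace.norm_sq_eq, Fin.sum_univ_succ]
  simp

theorem norm_chartPt {r : ℝ} (hr : 0 ≤ r) (w : Fin 3 → ℝ) : ‖chartPt r w‖ = r := by
  rw [← sq_eq_sq₀ (norm_nonneg _) hr, sq_norm_eq, chartPt_zero_coord]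
  simp only [chartPt_succ]
  have h := sqLen_nonneg w
  have : ∑ i, (2 * r * w i / (1 + sqLen w)) ^ 2 = 4 * r ^ 2 * sqLen w / (1 + sqLen w) ^ 2 := by
    conv_rhs => rw [sqLen, Finset.mul_sum, Finset.sum_div]
    refine Finset.sum_congr rfl fun i _ => ?_
    rw [← sqLen, div_pow, mul_pow, mul_pow]; ring
  rw [this]
  field_simp
  ring

theorem chartPt_norm_add {r : ℝ} (hr : 0 ≤ r) (w : Fin 3 → ℝ) :
    ‖chartPt r w‖ + chartPt r w 0 = 2 * r / (1 + sqLen w) := by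
  rw [norm_chartPt hr, chartPt_zero_coord]
  have h := sqLen_nonneg w
  field_simp
  ring

theorem norm_add_nonneg (x : E4) : 0 ≤ ‖x‖ + x 0 := by
  have := sq_norm_eq x
  have h2 : 0 ≤ ∑ i : Fin 3, x i.succ ^ 2 := Finset.sum_nonneg fun _ _ => sq_nonneg _
  have : |x 0| ≤ ‖x‖ := abs_le_of_sq_le_sq (by rw [this]; linarith) (norm_nonneg x)
  linarith [neg_abs_le (x 0)]

theorem sqLen_chartW {x : E4} (hx : 0 < ‖x‖ + x 0) :
    1 + sqLen (chartW x) = 2 * ‖x‖ / (‖x‖ + x 0) := by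
  have h1 : sqLen (chartW x) = (‖x‖ ^ 2 - x 0 ^ 2) / (‖x‖ + x 0) ^ 2 := by
    rw [sq_norm_eq, add_sub_cancel_left, Finset.sum_div, sqLen]
    exact Finset.sum_congr rfl fun i _ => by rw [chartW, div_pow]
  rw [h1]
  field_simp
  ring

theorem norm_pos_of_add_pos {x : E4} (hx : 0 < ‖x‖ + x 0) : 0 < ‖x‖ := by
  rcases (norm_nonneg x).eq_or_lt with h | h
  · rw [eq_comm, norm_eq_zero] at h
    simp [h] at hx
  · exact h

theorem chartPt_chartW {x : E4} (hx : 0 < ‖x‖ + x 0) : chartPt ‖x‖ (chartW x) = x := by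
  have h1 := sqLen_chartW hx
  have h0 := norm_pos_of_add_pos hx
  have h2 : sqLen (chartW x) = 2 * ‖x‖ / (‖x‖ + x 0) - 1 := by linarith
  ext i
  refine Fin.cases ?_ (fun i => ?_) i
  · rw [chartPt_zero_coord, h1, h2]
    field_simp
    ring
  · rw [chartPt_succ, h1, chartW]
    field_simp

theorem chartW_chartPt {r : ℝ} (hr : 0 < r) (w : Fin 3 → ℝ) : chartW (chartPt r w) = w := by
  funext i
  rw [chartW, chartPt_norm_add hr.le, chartPt_succ]
  have h := sqLen_nonneg w
  field_simp

theorem continuous_sqLen : Continuous sqLen := by unfold sqLen; fun_prop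

theorem continuous_chartPt : Continuous fun p : ℝ × (Fin 3 → ℝ) => chartPt p.1 p.2 := by
  refine (PiLp.continuous_toLp 2 _).comp (continuous_pi fun i => ?_)
  have h : ∀ p : ℝ × (Fin 3 → ℝ), 1 + sqLen p.2 ≠ 0 := fun p => by
    have := sqLen_nonneg p.2; positivity
  have hc : Continuous fun p : ℝ × (Fin 3 → ℝ) => sqLen p.2 := continuous_sqLen.comp continuous_snd
  refine Fin.cases ?_ (fun i => ?_) i
  · exact (continuous_fst.mul (continuous_const.sub hc)).div (continuous_const.add hc) h
  · have h2 : Continuous fun p : ℝ × (Fin 3 → ℝ) => 2 * p.1 * p.2 i := by fun_prop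
    exact h2.div (continuous_const.add hc) h

/-- The self-map of `ℝ⁴` acting by `A` in the norm-preserving stereographic chart. -/
def chartMap (A : ℝ → (Fin 3 → ℝ) → Fin 3 → ℝ) (x : E4) : E4 :=
  open Classical in if 0 < ‖x‖ + x 0 then chartPt ‖x‖ (A ‖x‖ (chartW x)) else x

theorem norm_chartMap (A : ℝ → (Fin 3 → ℝ) → Fin 3 → ℝ) (x : E4) : ‖chartMap A x‖ = ‖x‖ := by
  unfold chartMap
  split_ifs
  · exact norm_chartPt (norm_nonneg x) _
  · rfl

theorem chartMap_comp {A B : ℝ → (Fin 3 → ℝ) → Fin 3 → ℝ} {ε : ℝ}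
    (h : ∀ r ∈ Ioo 0 ε, ∀ w, B r (A r w) = w) {x : E4} (hx : ‖x‖ < ε) :
    chartMap B (chartMap A x) = x := by
  by_cases h1 : 0 < ‖x‖ + x 0
  · have h0 := norm_pos_of_add_pos h1
    have e : chartMap A x = chartPt ‖x‖ (A ‖x‖ (chartW x)) := if_pos h1
    have h2 : 0 < ‖chartMap A x‖ + chartMap A x 0 := by
      rw [e, chartPt_norm_add h0.le]
      have := sqLen_nonneg (A ‖x‖ (chartW x))
      positivity
    rw [chartMap, if_pos h2, norm_chartMap, e, chartW_chartPt h0, h _ ⟨h0, hx⟩, chartPt_chartW h1]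
  · have e : chartMap A x = x := if_neg h1
    rw [e, e.symm.trans e] at *
    exact if_neg h1

theorem continuousOn_chartMap {A B : ℝ → (Fin 3 → ℝ) → Fin 3 → ℝ} {ε : ℝ}
    (hA : ContinuousOn (fun p : ℝ × (Fin 3 → ℝ) => A p.1 p.2) (Ioo 0 ε ×ˢ univ))
    (hB : ContinuousOn (fun p : ℝ × (Fin 3 → ℝ) => B p.1 p.2) (Ioo 0 ε ×ˢ univ))
    (h : ∀ r ∈ Ioo 0 ε, ∀ w, B r (A r w) = w) :
    ContinuousOn (chartMap A) (ball 0 ε) := by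
  intro x hx
  refine ContinuousAt.continuousWithinAt ?_
  rw [mem_ball_zero_iff] at hx
  have hcn : ContinuousAt (fun x : E4 => ‖x‖ + x 0) x := by fun_prop
  by_cases h1 : 0 < ‖x‖ + x 0
  · have h0 := norm_pos_of_add_pos h1
    have he : chartMap A =ᶠ[𝓝 x] fun x => chartPt ‖x‖ (A ‖x‖ (chartW x)) := by
      filter_upwards [hcn.eventually_const_lt h1] with y hy using if_pos hy
    refine ContinuousAt.congr ?_ he.symm
    have hw : ContinuousAt chartW x := continuousAt_pi.2 fun i =>
      ContinuousAt.div (by fun_prop) hcn h1.ne'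
    have hA' : ContinuousAt (fun p : ℝ × (Fin 3 → ℝ) => A p.1 p.2) (‖x‖, chartW x) :=
      hA.continuousAt (prod_mem_nhds (Ioo_mem_nhds h0 hx) univ_mem)
    have := ContinuousAt.comp (x := x) (f := fun x : E4 => (‖x‖, chartW x)) hA'
      (continuous_norm.continuousAt.prodMk hw)
    exact continuous_chartPt.continuousAt.comp (continuous_norm.continuousAt.prodMk this)
  by_cases hx0 : x = 0
  · subst hx0
    have : chartMap A 0 = 0 := if_neg (by simp)
    rw [ContinuousAt, this, tendsto_zero_iff_norm_tendsto_zero]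
    simp only [norm_chartMap]
    exact tendsto_norm_zero
  have hr0 : 0 < ‖x‖ := norm_pos_iff.2 hx0
  have hneg : ‖x‖ + x 0 = 0 := le_antisymm (not_lt.1 h1) (norm_add_nonneg x)
  have hxx : chartMap A x = x := if_neg h1
  have key : Tendsto (fun z => ‖z‖ + chartMap A z 0) (𝓝 x) (𝓝 0) := by
    rw [Metric.tendsto_nhds]
    intro e he
    obtain ⟨ε₁, hε₁, hε₁'⟩ := exists_between hx
    obtain ⟨ε₀, hε₀, hε₀'⟩ := exists_between hr0
    set R := 2 * ε₁ / e with hR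
    have hcpt : IsCompact (Icc ε₀ ε₁ ×ˢ closedBall (0 : Fin 3 → ℝ) (R + 1)) :=
      isCompact_Icc.prod (isCompact_closedBall _ _)
    have himg := hcpt.image_of_continuousOn ((continuous_sqLen.comp_continuousOn hB).mono (by
      rintro ⟨r, w⟩ ⟨hr, -⟩
      exact ⟨⟨hε₀.trans_le hr.1, hr.2.trans_lt hε₁'⟩, mem_univ _⟩))
    obtain ⟨R', hR'⟩ := himg.bddAbove
    have hev : ∀ᶠ z : E4 in 𝓝 x, (‖z‖ + z 0) * (1 + max R' 0) < 2 * ‖z‖ := by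
      have hc : ContinuousAt (fun z : E4 => (‖z‖ + z 0) * (1 + max R' 0)) x := by fun_prop
      exact hc.eventually_lt (by fun_prop) (by rw [hneg]; linarith)
    filter_upwards [hev, hcn.eventually_lt_const (show ‖x‖ + x 0 < e by rw [hneg]; exact he),
      continuous_norm.continuousAt.eventually_lt_const hε₁,
      continuous_norm.continuousAt.eventually_const_lt hε₀'] with z h2 h3 h4 h5
    rw [dist_zero_right, Real.norm_of_nonneg (by
      have := norm_add_nonneg (chartMap A z); rwa [norm_chartMap] at this)]
    by_cases hz : 0 < ‖z‖ + z 0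
    · have e1 : chartMap A z = chartPt ‖z‖ (A ‖z‖ (chartW z)) := if_pos hz
      have h6 := chartPt_norm_add (norm_nonneg z) (A ‖z‖ (chartW z))
      rw [norm_chartPt (norm_nonneg z)] at h6
      rw [e1, h6]
      have h7 : R < sqLen (A ‖z‖ (chartW z)) := by
        by_contra hcon
        push Not at hcon
        have hRpos : 0 < R := by have := hε₀.trans (h5.trans h4); positivity
        have h8 : A ‖z‖ (chartW z) ∈ closedBall (0 : Fin 3 → ℝ) (R + 1) := by
          rw [mem_closedBall_zero_iff, pi_norm_le_iff_of_nonneg (by positivity)]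
          intro i
          have h9 : (A ‖z‖ (chartW z) i) ^ 2 ≤ R := le_trans
            (Finset.single_le_sum (f := fun i => (A ‖z‖ (chartW z) i) ^ 2)
              (fun _ _ => sq_nonneg _) (Finset.mem_univ i)) hcon
          exact abs_le_of_sq_le_sq (by nlinarith) (by positivity)
        have h9 := hR' (mem_image_of_mem _ (show (‖z‖, A ‖z‖ (chartW z)) ∈ Icc ε₀ ε₁ ×ˢ _ from
          ⟨⟨h5.le, h4.le⟩, h8⟩))
        simp only [Function.comp] at h9
        rw [h _ ⟨hε₀.trans h5, h4.trans hε₁'⟩] at h9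
        have h10 := sqLen_chartW hz
        have h11 : 2 * ‖z‖ / (‖z‖ + z 0) ≤ 1 + max R' 0 := by
          rw [← h10]; linarith [le_max_left R' 0]
        rw [div_le_iff₀ hz] at h11
        linarith
      have h8 := sqLen_nonneg (A ‖z‖ (chartW z))
      rw [div_lt_iff₀ (by positivity)]
      rw [hR, div_lt_iff₀ he] at h7
      nlinarith
    · rw [chartMap, if_neg hz]; exact h3
  rw [ContinuousAt, hxx, tendsto_iff_norm_sub_tendsto_zero]
  have hsq : Tendsto (fun z => ‖chartMap A z - x‖ ^ 2) (𝓝 x) (𝓝 0) := by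
    have hx3 : ∀ i : Fin 3, x i.succ = 0 := by
      have h2 := sq_norm_eq x
      have h3 : ∑ i : Fin 3, x i.succ ^ 2 = 0 := by nlinarith
      intro i
      exact pow_eq_zero_iff (two_ne_zero) |>.1
        ((Finset.sum_eq_zero_iff_of_nonneg fun _ _ => sq_nonneg _).1 h3 i (Finset.mem_univ i))
    have e : ∀ z, ‖chartMap A z - x‖ ^ 2 = (‖z‖ - ‖x‖) ^ 2 + 2 * ‖x‖ * (‖z‖ + chartMap A z 0) := by
      intro z
      have h2 := sq_norm_eq (chartMap A z)
      rw [norm_chartMap] at h2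
      rw [sq_norm_eq]
      simp only [PiLp.sub_apply, hx3, sub_zero]
      have h3 : x 0 = -‖x‖ := by linarith
      rw [h3]
      linarith
    simp only [e]
    have h2 : Tendsto (fun z : E4 => (‖z‖ - ‖x‖) ^ 2) (𝓝 x) (𝓝 ((‖x‖ - ‖x‖) ^ 2)) :=
      Continuous.tendsto (by fun_prop) x
    simpa using h2.add (key.const_mul (2 * ‖x‖))
  have := hsq.sqrt
  simpa using this

/-- Fibrewise homeomorphisms in the chart induce ambient topological equivalences. -/
theorem ambientTopEquiv_chart {A B : ℝ → (Fin 3 → ℝ) → Fin 3 → ℝ} {ε : ℝ} (hε : 0 < ε)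
    (hA : ContinuousOn (fun p : ℝ × (Fin 3 → ℝ) => A p.1 p.2) (Ioo 0 ε ×ˢ univ))
    (hB : ContinuousOn (fun p : ℝ × (Fin 3 → ℝ) => B p.1 p.2) (Ioo 0 ε ×ˢ univ))
    (hBA : ∀ r ∈ Ioo 0 ε, ∀ w, B r (A r w) = w) (hAB : ∀ r ∈ Ioo 0 ε, ∀ w, A r (B r w) = w)
    {S : Set E4} (h0 : 0 ∈ S) (hS : ∀ x ∈ S, 0 < ‖x‖ → ‖x‖ < ε → 0 < ‖x‖ + x 0) :
    AmbientTopEquiv {z : E4 | z = 0 ∨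
      ∃ x ∈ S, 0 < ‖x‖ ∧ ‖x‖ < ε ∧ z = chartPt ‖x‖ (A ‖x‖ (chartW x))} S := by
  have hz : chartMap B 0 = 0 := if_neg (by simp)
  have hm : ∀ A, MapsTo (chartMap A) (ball 0 ε) (ball 0 ε) := fun A x hx => by
    rw [mem_ball_zero_iff] at hx ⊢; rwa [norm_chartMap]
  refine ⟨ball 0 ε, ball 0 ε, isOpen_ball, isOpen_ball, mem_ball_self hε, mem_ball_self hε,
    chartMap B, chartMap A, continuousOn_chartMap hB hA hAB, continuousOn_chartMap hA hB hBA,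
    hm B, hm A, fun x hx => chartMap_comp hAB (mem_ball_zero_iff.1 hx),
    fun x hx => chartMap_comp hBA (mem_ball_zero_iff.1 hx), hz, ?_⟩
  ext y
  constructor
  · rintro ⟨z, ⟨rfl | ⟨x, hx, h1, h2, rfl⟩, hzb⟩, rfl⟩
    · rw [hz]; exact ⟨h0, hzb⟩
    · have : chartPt ‖x‖ (A ‖x‖ (chartW x)) = chartMap A x := (if_pos (hS x hx h1 h2)).symm
      rw [this, chartMap_comp hBA h2]
      exact ⟨hx, mem_ball_zero_iff.2 h2⟩
  · rintro ⟨hy, hyb⟩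
    rw [mem_ball_zero_iff] at hyb
    refine ⟨chartMap A y, ⟨?_, hm A (mem_ball_zero_iff.2 hyb)⟩, chartMap_comp hBA hyb⟩
    rcases (norm_nonneg y).eq_or_lt with h | h
    · left
      rw [← norm_eq_zero, norm_chartMap, ← h]
    · exact Or.inr ⟨y, hy, h, hyb, if_pos (hS y hy h hyb)⟩
end Chart

section Horn
open Filter Topology

theorem IsSemialgebraic.exists_vanishing {n : ℕ} {S : Set (EuclideanSpace ℝ (Fin n))}
    (hS : IsSemialgebraic S) {ε : ℝ} (hdim : dimH (S ∩ ball 0 ε) ≠ n) :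
    ∃ P : MvPolynomial (Fin n) ℝ, P ≠ 0 ∧ ∀ x ∈ S ∩ ball 0 ε, MvPolynomial.eval (fun j => x j) P =
        0 := by
  classical
  obtain ⟨N, P, M, Q, rfl⟩ := hS
  refine ⟨∏ i, if P i = 0 then 1 else P i, ?_, ?_⟩
  · refine Finset.prod_ne_zero_iff.2 fun i _ => ?_
    split_ifs with h
    · exact one_ne_zero
    · exact h
  · rintro x ⟨hx, hxb⟩
    obtain ⟨i, h0, hQ⟩ := mem_iUnion.1 hx
    rw [map_prod]
    refine Finset.prod_eq_zero (Finset.mem_univ i) ?_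
    split_ifs with h
    · exfalso
      refine hdim ?_
      have hopen : IsOpen ({y : EuclideanSpace ℝ (Fin n) |
          ∀ j, 0 < MvPolynomial.eval (fun k => y k) (Q i j)} ∩ ball 0 ε) := by
        refine IsOpen.inter ?_ isOpen_ball
        have : {y : EuclideanSpace ℝ (Fin n) | ∀ j, 0 < MvPolynomial.eval (fun k => y k) (Q i j)} =
            ⋂ j, {y | 0 < MvPolynomial.eval (fun k => y k) (Q i j)} := by ext; simp
        rw [this]
        refine isOpen_iInter_of_finite fun j => isOpen_lt continuous_const ?_
        exact (MvPolynomial.continuous_eval (Q i j)).comp (PiLp.continuous_ofLp 2 _)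
      have h1 : ((⋃ i : Fin N, {x : EuclideanSpace ℝ (Fin n) |
        MvPolynomial.eval (fun j => x j) (P i) = 0 ∧
        ∀ j : Fin (M i), 0 < MvPolynomial.eval (fun j => x j) (Q i j)}) ∩ ball 0 ε) ∈ 𝓝 x := by
        refine mem_of_superset (hopen.mem_nhds ⟨hQ, hxb⟩) fun y hy => ⟨mem_iUnion.2 ⟨i, ?_,
            hy.1⟩, hy.2⟩
        rw [h, map_zero]
      rw [Real.dimH_of_mem_nhds h1]
      simp
    · exact h0

theorem exists_ne_zero_near {n : ℕ} {P : MvPolynomial (Fin n) ℝ} {d : Fin n → ℝ}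
    (hP : MvPolynomial.eval d P ≠ 0) {δ : ℝ} (hδ : 0 < δ) :
    ∃ t ∈ Ioo 0 δ, MvPolynomial.eval (fun i => t * d i) P ≠ 0 := by
  set q : Polynomial ℝ := MvPolynomial.aeval (fun i => Polynomial.C (d i) * Polynomial.X) P with hq
  have hev : ∀ t, q.eval t = MvPolynomial.eval (fun i => t * d i) P := fun t => by
    rw [hq]
    clear hP hq q
    induction P using MvPolynomial.induction_on with
    | C a => simp
    | add p q hp hq => rw [map_add, map_add, Polynomial.eval_add, hp, hq]
    | mul_X p i hp =>
      rw [map_mul, map_mul, Polynomial.eval_mul, hp]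
      simp only [MvPolynomial.aeval_X, MvPolynomial.eval_X, Polynomial.eval_mul,
        Polynomial.eval_C, Polynomial.eval_X]
      ring
  have hq0 : q ≠ 0 := fun h => hP (by simpa [h] using (hev 1).symm)
  by_contra hcon
  push Not at hcon
  refine (Ioo_infinite hδ) ((q.roots.toFinset.finite_toSet).subset fun t ht => ?_)
  simp [hq0, hev, hcon t ht]

theorem exists_isometry_avoiding {S : Set E4} (hS : IsSemialgebraic S) {ε : ℝ} (hε : 0 < ε)
    (hdim : dimH (S ∩ ball 0 ε) ≠ 4) :
    ∃ L : E4 ≃ₗᵢ[ℝ] E4, ∀ δ > 0, ∃ r ∈ Ioo 0 δ,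
      EuclideanSpace.single 0 (-r) ∉ closure (L '' S) := by
  obtain ⟨P, hP, hPS⟩ := hS.exists_vanishing (ε := ε) (by simpa using hdim)
  obtain ⟨d, hd⟩ : ∃ d, MvPolynomial.eval d (P * MvPolynomial.X 0) ≠ 0 := by
    by_contra hcon
    push Not at hcon
    exact (mul_ne_zero hP (MvPolynomial.X_ne_zero 0))
      (MvPolynomial.funext fun x => by simpa using hcon x)
  rw [map_mul, MvPolynomial.eval_X] at hd
  set D : E4 := WithLp.toLp 2 d with hD
  have hD0 : D ≠ 0 := fun h => by
    have : D 0 = 0 := by rw [h]; rfl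
    exact hd (by rw [show d 0 = 0 from this, mul_zero])
  have hDn : 0 < ‖D‖ := norm_pos_iff.2 hD0
  set E : E4 := EuclideanSpace.single 0 (-‖D‖) with hE
  have hn : ‖D‖ = ‖E‖ := by rw [hE]; simp
  refine ⟨(ℝ ∙ (D - E))ᗮ.reflection, fun δ hδ => ?_⟩
  have hLD : (ℝ ∙ (D - E))ᗮ.reflection D = E := Submodule.reflection_sub hn
  obtain ⟨t, ht, htP⟩ := exists_ne_zero_near (left_ne_zero_of_mul hd)
    (show 0 < min δ ε / ‖D‖ by positivity)
  rw [mem_Ioo, lt_div_iff₀ hDn, lt_min_iff] at ht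
  refine ⟨t * ‖D‖, ⟨by nlinarith, ht.2.1⟩, fun hcl => htP ?_⟩
  have h1 : EuclideanSpace.single 0 (-(t * ‖D‖)) = (ℝ ∙ (D - E))ᗮ.reflection (t • D) := by
    rw [map_smul, hLD, hE]
    ext i
    by_cases hi : i = 0 <;> simp [hi]
  have h2 := (ℝ ∙ (D - E))ᗮ.reflection.toHomeomorph.image_closure S
  rw [LinearIsometryEquiv.coe_toHomeomorph] at h2
  rw [h1, ← h2] at hcl
  obtain ⟨y, hy, hy'⟩ := hcl
  rw [(LinearIsometryEquiv.injective _ hy')] at hy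
  have h3 : t • D ∈ ball (0 : E4) ε := by
    rw [mem_ball_zero_iff, norm_smul, Real.norm_of_nonneg ht.1.le]
    exact ht.2.2
  have h4 := closure_minimal (t := {x : E4 | MvPolynomial.eval (fun j => x j) P = 0})
    (fun x hx => hPS x ⟨hx.2, hx.1⟩)
    (isClosed_eq ((MvPolynomial.continuous_eval P).comp (PiLp.continuous_ofLp 2 _))
      continuous_const) (isOpen_ball.inter_closure ⟨h3, hy⟩)
  simpa [hD] using h4

theorem IsPolyFun.linear {ι : Type*} [Finite ι] (f : (ι → ℝ) →ₗ[ℝ] ℝ) : IsPolyFun f := by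
  classical
  have := Fintype.ofFinite ι
  refine ⟨∑ j, MvPolynomial.C (f (Pi.single j 1)) * MvPolynomial.X j, fun x => ?_⟩
  rw [LinearMap.pi_apply_eq_sum_univ f x, map_sum]
  refine Finset.sum_congr rfl fun i _ => ?_
  have : (fun j => if i = j then (1 : ℝ) else 0) = Pi.single i 1 := by
    funext j
    simp [Pi.single_apply, eq_comm]
  rw [this, map_mul, MvPolynomial.eval_C, MvPolynomial.eval_X, smul_eq_mul, mul_comm]

theorem IsSemialgebraic.image_isometry {n : ℕ} {S : Set (EuclideanSpace ℝ (Fin n))}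
    (hS : IsSemialgebraic S) (L : EuclideanSpace ℝ (Fin n) ≃ₗᵢ[ℝ] EuclideanSpace ℝ (Fin n)) :
    IsSemialgebraic (L '' S) := by
  rw [isSemialgebraic_iff] at hS ⊢
  refine (hS.comp (g := fun i x => L.symm (WithLp.toLp 2 x) i) fun i =>
    IsPolyFun.linear ⟨⟨fun x => L.symm (WithLp.toLp 2 x) i, fun x y => ?_⟩, fun c x => ?_⟩).congr
    fun x => ?_
  · simp
  · simp
  · constructor
    · rintro ⟨y, hy, hyx⟩
      rw [← hyx]; simpa using hy
    · intro h
      exact ⟨_, h, L.apply_symm_apply _⟩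

theorem AmbientTopEquiv.of_image_isometry {n : ℕ} {Y S : Set (EuclideanSpace ℝ (Fin n))}
    (L : EuclideanSpace ℝ (Fin n) ≃ₗᵢ[ℝ] EuclideanSpace ℝ (Fin n))
    (h : AmbientTopEquiv Y (L '' S)) : AmbientTopEquiv Y S := by
  obtain ⟨U, V, hU, hV, hU0, hV0, h, g, hh, hg, hUV, hVU, hgh, hhg, h0, himg⟩ := h
  refine ⟨U, L ⁻¹' V, hU, hV.preimage L.continuous, hU0, by simpa using hV0, L.symm ∘ h, g ∘ L,
    L.symm.continuous.comp_continuousOn hh, hg.comp L.continuous.continuousOn fun x hx => hx,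
    fun x hx => by simpa using hUV hx, fun x hx => hVU hx, fun x hx => by simpa using hgh x hx,
    fun y hy => by simp [hhg (L y) hy], by simp [h0], ?_⟩
  rw [image_comp, himg]
  ext y
  constructor
  · rintro ⟨_, ⟨⟨x, hx, rfl⟩, hV⟩, rfl⟩
    rw [L.symm_apply_apply]
    exact ⟨hx, hV⟩
  · rintro ⟨hy, hV⟩
    exact ⟨L y, ⟨mem_image_of_mem _ hy, hV⟩, by simp⟩

/-- If `S` avoids points of the negative first axis, then it avoids a horn around that axis. -/
theorem exists_horn {S : Set E4} (hS : IsSemialgebraic S)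
    (h : ∀ δ > 0, ∃ r ∈ Ioo 0 δ, EuclideanSpace.single 0 (-r) ∉ closure S) :
    ∃ m : ℕ, ∃ ε > 0, ∀ x ∈ S, 0 < ‖x‖ → ‖x‖ < ε →
      0 < ‖x‖ + x 0 ∧ ∀ i, |chartW x i| * ‖x‖ ^ m ≤ 1 := by
  have hQ : SemiAlg fun z : Fin 2 → ℝ => ∃ x : Fin 4 → ℝ, WithLp.toLp 2 x ∈ S ∧
      ‖(WithLp.toLp 2 x : E4)‖ = z 0 ∧ z 0 + x 0 ≤ z 1 := by
    refine SemiAlg.exFin ?_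
    refine ((isSemialgebraic_iff.1 hS).comp fun _ => .coord _).and (SemiAlg.and ?_ ?_)
    · exact IsSAFun.eq (IsSAFun.norm_toLp fun _ => .coord _) (.coord _)
    · exact SemiAlg.le (IsPolyFun.add (.coord _) (.coord _)) (.coord _)
  obtain ⟨m, hm | hm⟩ := SemiAlg.dichotomy₂ (P := fun r l => ∃ x : Fin 4 → ℝ, WithLp.toLp 2 x ∈ S ∧
      ‖(WithLp.toLp 2 x : E4)‖ = r ∧ r + x 0 ≤ l) hQ
  · exfalso
    obtain ⟨δ, hδ, hδm⟩ := mem_nhdsGT_iff_exists_Ioo_subset.1 hm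
    obtain ⟨r, hr, hcl⟩ := h δ hδ
    refine hcl (Metric.mem_closure_iff.2 fun e he => ?_)
    have hr0 : 0 < r := hr.1
    obtain ⟨x, hxS, hxr, hx⟩ := hδm hr (min (r ^ m) (e ^ 2 / (2 * r)) / 2) (by positivity) (by
      have := min_le_left (r ^ m) (e ^ 2 / (2 * r))
      have : 0 < r ^ m := by positivity
      linarith)
    refine ⟨_, hxS, ?_⟩
    have hl : min (r ^ m) (e ^ 2 / (2 * r)) / 2 < e ^ 2 / (2 * r) := by
      have := min_le_right (r ^ m) (e ^ 2 / (2 * r))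
      have : 0 < e ^ 2 / (2 * r) := by positivity
      linarith
    rw [dist_comm, dist_eq_norm]
    refine lt_of_pow_lt_pow_left₀ 2 he.le ?_
    have h1 := sq_norm_eq (WithLp.toLp 2 x)
    rw [hxr] at h1
    have h3 := hx.trans_lt hl
    rw [lt_div_iff₀ (by positivity)] at h3
    rw [sq_norm_eq]
    simp at h1 ⊢
    nlinarith
  · obtain ⟨δ, hδ, hδm⟩ := mem_nhdsGT_iff_exists_Ioo_subset.1 hm
    refine ⟨m, min δ (1 / 2), by have : (0 : ℝ) < δ := hδ; positivity, fun x hx h0 h1 => ?_⟩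
    rw [lt_min_iff] at h1
    have hrm : 0 < ‖x‖ ^ m := by positivity
    have h2 := hδm ⟨h0, h1.1⟩ (‖x‖ ^ m / 2) (by positivity) (by linarith)
    have h3 : ‖x‖ ^ m / 2 < ‖x‖ + x 0 := by
      by_contra hcon
      exact h2 ⟨_, hx, rfl, not_lt.1 hcon⟩
    have h4 : 0 < ‖x‖ + x 0 := by linarith
    refine ⟨h4, fun i => ?_⟩
    have h5 : |x i.succ| ≤ ‖x‖ := PiLp.norm_apply_le x i.succ
    rw [chartW, abs_div, abs_of_pos h4, div_mul_eq_mul_div, div_le_one h4]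
    nlinarith

end Horn

section Gap
open Filter Topology

/-- A planar semialgebraic set with bounded fibres either has, near `r = 0⁺`,
its fibres contained in finitely many locally Lipschitz graphs, or contains a band between two
semialgebraic graphs. -/
theorem SemiAlg.graphs_or_band {P : ℝ → ℝ → Prop} (h : SemiAlg fun x : Fin 2 → ℝ => P (x 0) (x 1))
    {ε₁ : ℝ} (hε₁ : 0 < ε₁) (hbd : ∀ r ∈ Ioo 0 ε₁, ∃ M, ∀ y, P r y → |y| ≤ M) :
    (∃ ε > 0, ∃ N, ∃ ξ : Fin N → ℝ → ℝ,
      (∀ i, ∀ r₀ ∈ Ioo 0 ε, ∃ K : NNReal, ∃ t ∈ 𝓝 r₀, LipschitzOnWith K (ξ i) t) ∧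
      ∀ r ∈ Ioo 0 ε, ∀ y, P r y → ∃ i, y = ξ i r) ∨
    ∃ ε > 0, ∃ α β : ℝ → ℝ, ContinuousOn α (Ioo 0 ε) ∧ ContinuousOn β (Ioo 0 ε) ∧
      (IsSAFun fun x : Fin 1 → ℝ => α (x 0)) ∧ (IsSAFun fun x : Fin 1 → ℝ => β (x 0)) ∧
      (∀ r ∈ Ioo 0 ε, α r < β r) ∧ ∀ r ∈ Ioo 0 ε, ∀ y ∈ Ioo (α r) (β r), P r y := by
  classical
  obtain ⟨ε₂, hε₂, N, ξ, hmono, hlip, hcell, hSA⟩ := h.cells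
  have hlip' : ∀ i, ∀ r₀ ∈ Ioo 0 ε₂, ∃ K : NNReal, ∃ t ∈ 𝓝 r₀, LipschitzOnWith K (ξ i) t := by
    intro i r₀ hr₀
    obtain ⟨K, hK, δ, hδ, hKδ⟩ := hlip i r₀ hr₀
    refine ⟨⟨K, hK⟩, ball r₀ δ, ball_mem_nhds _ hδ, LipschitzOnWith.of_dist_le_mul fun r hr r' hr'
        => ?_⟩
    exact hKδ r r' hr hr'
  have hcont : ∀ i, ContinuousOn (ξ i) (Ioo 0 ε₂) := fun i r hr => by
    obtain ⟨K, t, ht, hKt⟩ := hlip' i r hr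
    exact (hKt.continuousOn.continuousAt ht).continuousWithinAt
  set ε := min ε₁ ε₂ with hε
  have hεpos : 0 < ε := by positivity
  have hsub : Ioo 0 ε ⊆ Ioo 0 ε₂ := Ioo_subset_Ioo_right (min_le_right _ _)
  by_cases hall : ∀ r ∈ Ioo 0 ε, ∀ y, P r y → ∃ i, y = ξ i r
  · exact .inl ⟨ε, hεpos, N, ξ, fun i r hr => hlip' i r (hsub hr), hall⟩
  right
  push Not at hall
  obtain ⟨r, hr, y, hy, hne⟩ := hall
  obtain ⟨M, hM⟩ := hbd r ⟨hr.1, hr.2.trans_le (min_le_left _ _)⟩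
  have hr2 := hsub hr
  have habove : ∃ i, y < ξ i r := by
    by_contra hcon
    push Not at hcon
    have hcon' : ∀ i, ξ i r < y := fun i => (hcon i).lt_of_ne (hne i).symm
    have := hM _ (hcell r hr2 r hr2 y (max y (M + 1)) (fun i =>
      ⟨⟨fun h => absurd h (hcon i).not_gt, fun h => absurd ((hcon' i).trans_le (le_max_left _ _))
          h.not_gt⟩,
        ⟨fun h => h.trans_le (le_max_left _ _), fun _ => hcon' i⟩⟩) hy)
    have h2 := le_abs_self (max y (M + 1))
    have h3 := le_max_right y (M + 1)
    linarith
  have hbelow : ∃ i, ξ i r < y := by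
    by_contra hcon
    push Not at hcon
    have hcon' : ∀ i, y < ξ i r := fun i => (hcon i).lt_of_ne (hne i)
    have := hM _ (hcell r hr2 r hr2 y (min y (-M - 1)) (fun i =>
      ⟨⟨fun h => (min_le_left _ _).trans_lt h, fun _ => hcon' i⟩,
        ⟨fun h => absurd h (hcon i).not_gt, fun h => absurd ((min_le_left _ _).trans_lt (hcon' i))
            h.not_gt⟩⟩) hy)
    have h2 := neg_abs_le (min y (-M - 1))
    have h3 := min_le_right y (-M - 1)
    linarith
  obtain ⟨i, hi, himin⟩ := (Finset.univ.filter fun i => y < ξ i r).exists_min_image (fun i => i)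
    (by obtain ⟨i, hi⟩ := habove; exact ⟨i, by simpa using hi⟩)
  obtain ⟨j, hj, hjmax⟩ := (Finset.univ.filter fun i => ξ i r < y).exists_max_image (fun i => i)
    (by obtain ⟨i, hi⟩ := hbelow; exact ⟨i, by simpa using hi⟩)
  simp only [Finset.mem_filter, Finset.mem_univ, true_and] at hi himin hj hjmax
  have hji : j < i := (hmono r hr2).lt_iff_lt.1 (hj.trans hi)
  have hSA' : ∀ l, IsSAFun fun x : Fin 1 → ℝ => if x 0 ∈ Ioo 0 ε₂ then ξ l (x 0) else 0 := fun l =>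
      by
    refine IsSAFun.of_graph (G := fun x y => (0 < x 0 ∧ x 0 < ε₂ ∧ y = ξ l (x 0)) ∨
      (¬ (0 < x 0 ∧ x 0 < ε₂) ∧ y = 0)) ?_ fun x y => ?_
    · refine SemiAlg.or ?_ (SemiAlg.and (SemiAlg.not (SemiAlg.and ?_ ?_)) ?_)
      · exact (hSA l).comp (g := ![fun z => z (some 0), fun z => z none]) fun k => by
          fin_cases k <;> exact .coord _
      · exact .lt (.const _) (.coord _)
      · exact .lt (.coord _) (.const _)
      · exact .eq (.coord _) (.const _)
    · by_cases hx : 0 < x 0 ∧ x 0 < ε₂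
      · simp [hx.1, hx.2]
      · have : x 0 ∉ Ioo 0 ε₂ := hx
        rw [if_neg this]
        tauto
  refine ⟨ε₂, hε₂, fun r => if r ∈ Ioo 0 ε₂ then ξ j r else 0,
    fun r => if r ∈ Ioo 0 ε₂ then ξ i r else 0, ?_, ?_, hSA' j, hSA' i, ?_, ?_⟩
  · exact (hcont j).congr fun r hr => if_pos hr
  · exact (hcont i).congr fun r hr => if_pos hr
  · intro r' hr'
    simp only [if_pos hr']
    exact hmono r' hr' hji
  · intro r' hr' y' hy'
    simp only [if_pos hr'] at hy'
    refine hcell r hr2 r' hr' y y' (fun l => ?_) hy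
    rcases lt_or_gt_of_ne (hne l) with hl | hl
    · have h1 : ξ i r' ≤ ξ l r' := (hmono r' hr').monotone (himin l hl)
      exact ⟨⟨fun _ => hy'.2.trans_le h1, fun _ => hl⟩,
        ⟨fun h => absurd hl h.not_gt, fun h => absurd (hy'.2.trans_le h1) h.not_gt⟩⟩
    · have h1 : ξ l r' ≤ ξ j r' := (hmono r' hr').monotone (hjmax l hl)
      exact ⟨⟨fun h => absurd hl h.not_gt, fun h => absurd (h1.trans_lt hy'.1) h.not_gt⟩,
        ⟨fun _ => h1.trans_lt hy'.1, fun _ => hl⟩⟩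

theorem contDiff_chartPt : ContDiff ℝ 1 fun p : ℝ × (Fin 3 → ℝ) => chartPt p.1 p.2 := by
  have hs : ContDiff ℝ 1 fun p : ℝ × (Fin 3 → ℝ) => sqLen p.2 := by unfold sqLen; fun_prop
  have hne : ∀ p : ℝ × (Fin 3 → ℝ), 1 + sqLen p.2 ≠ 0 := fun p => by
    have := sqLen_nonneg p.2; positivity
  rw [contDiff_euclidean]
  intro i
  refine Fin.cases ?_ (fun i => ?_) i
  · simp only [chartPt_zero_coord]
    exact ContDiff.div (by fun_prop) (by fun_prop) hne
  · simp only [chartPt_succ]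
    exact ContDiff.div (by fun_prop) (by fun_prop) hne

/-- A surface germ has a band of values of some stereographic coordinate. -/
theorem exists_band {S : Set E4} (hS : IsSemialgebraic S) {m : ℕ} {ε₀ : ℝ} (hε₀ : 0 < ε₀)
    (hhorn : ∀ x ∈ S, 0 < ‖x‖ → ‖x‖ < ε₀ → 0 < ‖x‖ + x 0 ∧ ∀ i, |chartW x i| * ‖x‖ ^ m ≤ 1)
    (hdim : ∀ ε, 0 < ε → ε ≤ ε₀ → 1 < dimH (S ∩ ball 0 ε)) :
    ∃ k : Fin 3, ∃ ε > 0, ∃ α β : ℝ → ℝ, ContinuousOn α (Ioo 0 ε) ∧ ContinuousOn β (Ioo 0 ε) ∧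
      (IsSAFun fun x : Fin 1 → ℝ => α (x 0)) ∧ (IsSAFun fun x : Fin 1 → ℝ => β (x 0)) ∧
      (∀ r ∈ Ioo 0 ε, α r < β r) ∧
      ∀ r ∈ Ioo 0 ε, ∀ y ∈ Ioo (α r) (β r), ∃ x ∈ S, ‖x‖ = r ∧ chartW x k = y := by
  have hSA : ∀ k : Fin 3, SemiAlg fun z : Fin 2 → ℝ => ∃ x ∈ S, ‖x‖ = z 0 ∧ chartW x k = z 1 := fun
      k => by
    have : SemiAlg fun z : Fin 2 → ℝ => ∃ x : Fin 4 → ℝ, WithLp.toLp 2 x ∈ S ∧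
        ‖(WithLp.toLp 2 x : E4)‖ = z 0 ∧ chartW (WithLp.toLp 2 x) k = z 1 := by
      refine SemiAlg.exFin ?_
      refine ((isSemialgebraic_iff.1 hS).comp fun _ => .coord _).and (SemiAlg.and ?_ ?_)
      · exact IsSAFun.eq (IsSAFun.norm_toLp fun _ => .coord _) (.coord _)
      · exact IsSAFun.eq (IsSAFun.div (.coord _)
          (IsSAFun.add (IsSAFun.norm_toLp fun _ => .coord _) (.coord _))) (.coord _)
    refine this.congr fun z => ?_
    constructor
    · rintro ⟨x, h1, h2, h3⟩
      exact ⟨WithLp.ofLp x, h1, h2, h3⟩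
    · rintro ⟨x, h⟩
      exact ⟨_, h⟩
  have hdich := fun k => SemiAlg.graphs_or_band (P := fun r y => ∃ x ∈ S, ‖x‖ = r ∧ chartW x k = y)
    (hSA k) hε₀ (fun r hr => ⟨1 / r ^ m, fun y ⟨x, hx, hxr, hxy⟩ => by
      have := hr.1
      rw [le_div_iff₀ (by positivity), ← hxy, ← hxr]
      exact (hhorn x hx (hxr ▸ hr.1) (hxr ▸ hr.2)).2 k⟩)
  by_contra hcon
  have hgr := fun k => (hdich k).resolve_right fun h => hcon ⟨k, h⟩
  clear hcon hdich hSA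
  choose e he N ξ hξ hgraph using hgr
  set ε := min ε₀ (Finset.univ.inf' ⟨0, Finset.mem_univ 0⟩ e) with hε
  have hεe : ∀ k, ε ≤ e k := fun k => (min_le_right _ _).trans (Finset.inf'_le _ (Finset.mem_univ
      k))
  have hε0 : 0 < ε := lt_min hε₀ ((Finset.lt_inf'_iff _).2 fun k _ => he k)
  refine (hdim ε hε0 (min_le_left _ _)).not_ge ?_
  have hsub : S ∩ ball 0 ε ⊆ {0} ∪ ⋃ c : (k : Fin 3) → Fin (N k),
      (fun r : ℝ => chartPt r fun k => ξ k (c k) r) '' Ioo 0 ε := by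
    rintro x ⟨hx, hxε⟩
    rw [mem_ball_zero_iff] at hxε
    rcases (norm_nonneg x).eq_or_lt with h0 | h0
    · left
      rw [eq_comm, norm_eq_zero] at h0
      exact h0
    · right
      have hc := fun k => hgraph k ‖x‖ ⟨h0, hxε.trans_le (hεe k)⟩ _ ⟨x, hx, rfl, rfl⟩
      choose c hc using hc
      refine mem_iUnion.2 ⟨c, ‖x‖, ⟨h0, hxε⟩, ?_⟩
      have := chartPt_chartW (hhorn x hx h0 (hxε.trans_le (min_le_left _ _))).1
      simp only [← hc]
      exact this
  refine (dimH_mono hsub).trans ?_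
  rw [dimH_union, dimH_singleton, dimH_iUnion]
  refine max_le zero_le_one (iSup_le fun c => ?_)
  refine (dimH_image_le_of_locally_lipschitzOn fun r hr => ?_).trans
    ((dimH_mono (subset_univ _)).trans Real.dimH_univ.le)
  have h1 : ∀ k, ∃ K : NNReal, ∃ t ∈ 𝓝 r, LipschitzOnWith K (ξ k (c k)) t := fun k =>
    hξ k (c k) r ⟨hr.1, hr.2.trans_le (hεe k)⟩
  choose K t ht hK using h1
  have h2 : LipschitzOnWith (Finset.univ.sup K) (fun r k => ξ k (c k) r) (⋂ k, t k) := by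
    refine LipschitzOnWith.of_dist_le_mul fun a ha b hb => ?_
    rw [dist_pi_le_iff (by positivity)]
    intro k
    refine ((hK k).dist_le_mul a (mem_iInter.1 ha k) b (mem_iInter.1 hb k)).trans ?_
    gcongr
    exact_mod_cast Finset.le_sup (Finset.mem_univ k)
  have ht' : (⋂ k, t k) ∈ 𝓝 r := (Filter.iInter_mem.2 ht)
  obtain ⟨K', u, hu, hK'⟩ := (contDiff_chartPt.contDiffAt (x := (r, fun k => ξ k (c k)
      r))).exists_lipschitzOnWith
  have h3 : LipschitzOnWith (max 1 (Finset.univ.sup K)) (fun r => (r, fun k => ξ k (c k) r))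
      (⋂ k, t k) := LipschitzOnWith.prodMk (LipschitzWith.id.lipschitzOnWith (s := ⋂ k, t k)) h2
  refine ⟨K' * max 1 (Finset.univ.sup K),
    (⋂ k, t k) ∩ (fun r => (r, fun k => ξ k (c k) r)) ⁻¹' u, mem_nhdsWithin_of_mem_nhds ?_, ?_⟩
  · exact inter_mem ht' ((h3.continuousOn.continuousAt ht').preimage_mem_nhds hu)
  · exact LipschitzOnWith.comp (g := fun p : ℝ × (Fin 3 → ℝ) => chartPt p.1 p.2)
      (f := fun r => (r, fun k => ξ k (c k) r)) hK' (h3.mono inter_subset_left) fun x hx => hx.2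
end Gap

section Band
open Filter Topology

/-- Piecewise affine increasing map sending `[α, β]` onto `[-1, 1]`, with slope `c` outside. -/
def bandMap (α β c σ : ℝ) : ℝ :=
  -1 + 2 * (max α (min σ β) - α) / (β - α) + c * (σ - max α (min σ β))

/-- The inverse of `bandMap`. -/
def bandInv (α β c y : ℝ) : ℝ :=
  α + (max (-1) (min y 1) + 1) * (β - α) / 2 + (y - max (-1) (min y 1)) / c

variable {α β c : ℝ}

theorem bandMap_of_le (h : α < β) {σ : ℝ} (hσ : σ ≤ α) : bandMap α β c σ = -1 + c * (σ - α) := by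
  rw [bandMap, min_eq_left (hσ.trans h.le), max_eq_left hσ]
  simp

theorem bandMap_of_mem {σ : ℝ} (h1 : α ≤ σ) (h2 : σ ≤ β) :
    bandMap α β c σ = -1 + 2 * (σ - α) / (β - α) := by
  rw [bandMap, min_eq_left h2, max_eq_right h1]
  simp

theorem bandMap_of_ge (h : α < β) {σ : ℝ} (hσ : β ≤ σ) : bandMap α β c σ = 1 + c * (σ - β) := by
  have : β - α ≠ 0 := by linarith
  rw [bandMap, min_eq_right hσ, max_eq_right h.le]
  field_simp
  ring

theorem bandInv_bandMap (h : α < β) (hc : 0 < c) (σ : ℝ) : bandInv α β c (bandMap α β c σ) = σ := by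
  have hne : β - α ≠ 0 := by linarith
  have hpos : 0 < β - α := by linarith
  rcases le_total σ α with h1 | h1
  · rw [bandMap_of_le h h1, bandInv]
    have : -1 + c * (σ - α) ≤ -1 := by nlinarith
    rw [min_eq_left (by linarith), max_eq_left this]
    field_simp
    ring
  rcases le_total σ β with h2 | h2
  · rw [bandMap_of_mem h1 h2, bandInv]
    have h3 : 0 ≤ 2 * (σ - α) / (β - α) := div_nonneg (by linarith) hpos.le
    have h4 : 2 * (σ - α) / (β - α) ≤ 2 := by rw [div_le_iff₀ hpos]; linarith
    rw [min_eq_left (by linarith), max_eq_right (by linarith)]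
    field_simp
    ring
  · rw [bandMap_of_ge h h2, bandInv]
    have : 1 ≤ 1 + c * (σ - β) := by nlinarith
    rw [min_eq_right this, max_eq_right (by norm_num)]
    field_simp
    ring

theorem bandMap_bandInv (h : α < β) (hc : 0 < c) (y : ℝ) : bandMap α β c (bandInv α β c y) = y := by
  have hne : β - α ≠ 0 := by linarith
  have hpos : 0 < β - α := by linarith
  rcases le_total y (-1) with h1 | h1
  · have : bandInv α β c y = α + (y + 1) / c := by
      rw [bandInv, min_eq_left (by linarith), max_eq_left h1]; ring
    have h3 : (y + 1) / c ≤ 0 := div_nonpos_of_nonpos_of_nonneg (by linarith) hc.le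
    rw [this, bandMap_of_le h (by linarith)]
    field_simp
    ring
  rcases le_total y 1 with h2 | h2
  · have : bandInv α β c y = α + (y + 1) * (β - α) / 2 := by
      rw [bandInv, min_eq_left h2, max_eq_right h1]; simp
    rw [this, bandMap_of_mem (by nlinarith) (by nlinarith)]
    field_simp
    ring
  · have : bandInv α β c y = β + (y - 1) / c := by
      rw [bandInv, min_eq_right h2, max_eq_right (by norm_num)]; ring
    have h3 : 0 ≤ (y - 1) / c := div_nonneg (by linarith) hc.le
    rw [this, bandMap_of_ge h (by linarith)]
    field_simp
    ring

theorem abs_bandMap_le (h : α < β) (hc : 0 < c) {d : ℝ} (hd : ∀ y ∈ Ioo α β, |y| ≤ d) {σ : ℝ}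
    (hσ : |σ| ≤ d) : |bandMap α β c σ| ≤ 1 + 2 * c * d := by
  have hpos : 0 < β - α := by linarith
  have hmid := abs_le.1 (hd ((α + β) / 2) ⟨by linarith, by linarith⟩)
  have hd0 : 0 ≤ c * d := mul_nonneg hc.le ((abs_nonneg _).trans hσ)
  rw [abs_le] at hσ
  rw [abs_le]
  rcases le_total σ α with h1 | h1
  · rw [bandMap_of_le h h1]
    have : c * (α - σ) ≤ c * (d + d) := mul_le_mul_of_nonneg_left (by linarith) hc.le
    have : 0 ≤ c * (α - σ) := mul_nonneg hc.le (by linarith)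
    constructor <;> linarith
  rcases le_total σ β with h2 | h2
  · rw [bandMap_of_mem h1 h2]
    have h3 : 0 ≤ 2 * (σ - α) / (β - α) := div_nonneg (by linarith) hpos.le
    have h4 : 2 * (σ - α) / (β - α) ≤ 2 := by rw [div_le_iff₀ hpos]; linarith
    constructor <;> linarith
  · rw [bandMap_of_ge h h2]
    have : c * (σ - β) ≤ c * (d + d) := mul_le_mul_of_nonneg_left (by linarith) hc.le
    have : 0 ≤ c * (σ - β) := mul_nonneg hc.le (by linarith)
    constructor <;> linarith

/-- The family of homeomorphisms of the chart moving a band into standard position. -/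
def bandA (k : Fin 3) (M : ℕ) (α β : ℝ → ℝ) (r : ℝ) (w : Fin 3 → ℝ) : Fin 3 → ℝ :=
  ![r / 2 * bandMap (α r) (β r) (r ^ M) (w (Equiv.swap 0 k 0)), r ^ M * w (Equiv.swap 0 k 1),
    r ^ M * w (Equiv.swap 0 k 2)]

/-- The inverse family of `bandA`. -/
def bandB (k : Fin 3) (M : ℕ) (α β : ℝ → ℝ) (r : ℝ) (u : Fin 3 → ℝ) : Fin 3 → ℝ :=
  fun i => ![bandInv (α r) (β r) (r ^ M) (2 * u 0 / r), u 1 / r ^ M, u 2 / r ^ M] (Equiv.swap 0 k i)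

theorem bandB_bandA {k : Fin 3} {M : ℕ} {α β : ℝ → ℝ} {r : ℝ} (hr : 0 < r) (h : α r < β r)
    (w : Fin 3 → ℝ) : bandB k M α β r (bandA k M α β r w) = w := by
  have hrM : 0 < r ^ M := by positivity
  have h1 : 2 * (r / 2 * bandMap (α r) (β r) (r ^ M) (w k)) / r =
    bandMap (α r) (β r) (r ^ M) (w k) := by field_simp
  funext i
  rw [bandB]
  obtain ⟨j, hj⟩ : ∃ j, j = Equiv.swap 0 k i := ⟨_, rfl⟩
  have hi : i = Equiv.swap 0 k j := by rw [hj, Equiv.swap_apply_self]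
  rw [hi, Equiv.swap_apply_self]
  fin_cases j
  · simp [bandA, h1, bandInv_bandMap h hrM]
  · simp [bandA, hrM.ne']
  · simp [bandA, hrM.ne']

theorem bandA_bandB {k : Fin 3} {M : ℕ} {α β : ℝ → ℝ} {r : ℝ} (hr : 0 < r) (h : α r < β r)
    (w : Fin 3 → ℝ) : bandA k M α β r (bandB k M α β r w) = w := by
  have hrM : 0 < r ^ M := by positivity
  have h1 : r / 2 * (2 * w 0 / r) = w 0 := by field_simp
  funext i
  rw [bandA]
  simp only [bandB, Equiv.swap_apply_self]
  fin_cases i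
  · simp [bandMap_bandInv h hrM, h1]
  · simp [mul_div_cancel₀ _ hrM.ne']
  · simp [mul_div_cancel₀ _ hrM.ne']

theorem continuousOn_bandA {k : Fin 3} {M : ℕ} {α β : ℝ → ℝ} {ε : ℝ} (hα : ContinuousOn α (Ioo 0 ε))
    (hβ : ContinuousOn β (Ioo 0 ε)) (h : ∀ r ∈ Ioo 0 ε, α r < β r) :
    ContinuousOn (fun p : ℝ × (Fin 3 → ℝ) => bandA k M α β p.1 p.2) (Ioo 0 ε ×ˢ univ) := by
  have hα' : ContinuousOn (fun p : ℝ × (Fin 3 → ℝ) => α p.1) (Ioo 0 ε ×ˢ univ) :=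
    hα.comp continuousOn_fst fun p hp => hp.1
  have hβ' : ContinuousOn (fun p : ℝ × (Fin 3 → ℝ) => β p.1) (Ioo 0 ε ×ˢ univ) :=
    hβ.comp continuousOn_fst fun p hp => hp.1
  have hw : ∀ i, ContinuousOn (fun p : ℝ × (Fin 3 → ℝ) => p.2 i) (Ioo 0 ε ×ˢ univ) := fun i =>
    Continuous.continuousOn (by fun_prop)
  have hr : ContinuousOn (fun p : ℝ × (Fin 3 → ℝ) => p.1) (Ioo 0 ε ×ˢ univ) := continuousOn_fst
  have hne : ∀ p ∈ Ioo 0 ε ×ˢ (univ : Set (Fin 3 → ℝ)), β p.1 - α p.1 ≠ 0 := fun p hp => by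
    have := h p.1 hp.1; linarith
  rw [continuousOn_pi]
  intro i
  fin_cases i
  · have hcl := ContinuousOn.sup hα' ((hw (Equiv.swap 0 k 0)).inf hβ')
    exact (hr.div_const 2).mul ((continuousOn_const.add ((continuousOn_const.mul (hcl.sub hα')).div
      (hβ'.sub hα') hne)).add ((hr.pow M).mul ((hw _).sub hcl)))
  · exact (hr.pow M).mul (hw _)
  · exact (hr.pow M).mul (hw _)

theorem continuousOn_bandB {k : Fin 3} {M : ℕ} {α β : ℝ → ℝ} {ε : ℝ} (hα : ContinuousOn α (Ioo 0 ε))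
    (hβ : ContinuousOn β (Ioo 0 ε)) :
    ContinuousOn (fun p : ℝ × (Fin 3 → ℝ) => bandB k M α β p.1 p.2) (Ioo 0 ε ×ˢ univ) := by
  have hα' : ContinuousOn (fun p : ℝ × (Fin 3 → ℝ) => α p.1) (Ioo 0 ε ×ˢ univ) :=
    hα.comp continuousOn_fst fun p hp => hp.1
  have hβ' : ContinuousOn (fun p : ℝ × (Fin 3 → ℝ) => β p.1) (Ioo 0 ε ×ˢ univ) :=
    hβ.comp continuousOn_fst fun p hp => hp.1
  have hw : ∀ i, ContinuousOn (fun p : ℝ × (Fin 3 → ℝ) => p.2 i) (Ioo 0 ε ×ˢ univ) := fun i =>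
    Continuous.continuousOn (by fun_prop)
  have hr : ContinuousOn (fun p : ℝ × (Fin 3 → ℝ) => p.1) (Ioo 0 ε ×ˢ univ) := continuousOn_fst
  have hne : ∀ p ∈ Ioo 0 ε ×ˢ (univ : Set (Fin 3 → ℝ)), p.1 ≠ 0 := fun p hp => hp.1.1.ne'
  have hneM : ∀ p ∈ Ioo 0 ε ×ˢ (univ : Set (Fin 3 → ℝ)), p.1 ^ M ≠ 0 := fun p hp =>
    pow_ne_zero _ (hne p hp)
  have key : ∀ j : Fin 3, ContinuousOn (fun p : ℝ × (Fin 3 → ℝ) =>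
      ![bandInv (α p.1) (β p.1) (p.1 ^ M) (2 * p.2 0 / p.1), p.2 1 / p.1 ^ M, p.2 2 / p.1 ^ M] j)
      (Ioo 0 ε ×ˢ univ) := by
    intro j
    fin_cases j
    · have hy := (continuousOn_const (c := (2 : ℝ))).mul (hw 0) |>.div hr hne
      have hcl := ContinuousOn.sup (continuousOn_const (c := (-1 : ℝ)))
        (hy.inf (continuousOn_const (c := (1 : ℝ))))
      exact (hα'.add (((hcl.add continuousOn_const).mul (hβ'.sub hα')).div_const 2)).add
        ((hy.sub hcl).div (hr.pow M) hneM)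
    · exact (hw 1).div (hr.pow M) hneM
    · exact (hw 2).div (hr.pow M) hneM
  rw [continuousOn_pi]
  exact fun i => key _

theorem isSAFun_bandA {ι : Type} {k : Fin 3} {M : ℕ} {α β : ℝ → ℝ}
    (hα : IsSAFun fun x : Fin 1 → ℝ => α (x 0)) (hβ : IsSAFun fun x : Fin 1 → ℝ => β (x 0))
    {r : (ι → ℝ) → ℝ} {w : (ι → ℝ) → Fin 3 → ℝ} (hr : IsSAFun r) (hw : ∀ i, IsSAFun fun x => w x i)
    (j : Fin 3) : IsSAFun fun x => bandA k M α β (r x) (w x) j := by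
  have hα' := IsSAFun.comp₁ hα hr
  have hβ' := IsSAFun.comp₁ hβ hr
  fin_cases j
  · have hcl := IsSAFun.max hα' (IsSAFun.min (hw (Equiv.swap 0 k 0)) hβ')
    exact (hr.div (.const 2)).mul (((IsSAFun.const (-1)).add (((IsSAFun.const 2).mul
      (hcl.sub hα')).div (hβ'.sub hα'))).add ((hr.pow M).mul ((hw _).sub hcl)))
  · exact (hr.pow M).mul (hw _)
  · exact (hr.pow M).mul (hw _)

theorem isSAFun_chartPt {ι : Type} {r : (ι → ℝ) → ℝ} {w : (ι → ℝ) → Fin 3 → ℝ} (hr : IsSAFun r)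
    (hw : ∀ i, IsSAFun fun x => w x i) (j : Fin 4) : IsSAFun fun x => chartPt (r x) (w x) j := by
  have hs : IsSAFun fun x => sqLen (w x) := by
    simp only [sqLen, Fin.sum_univ_three]
    exact (((hw 0).pow 2).add ((hw 1).pow 2)).add ((hw 2).pow 2)
  refine Fin.cases ?_ (fun i => ?_) j
  · exact (hr.mul ((IsSAFun.const 1).sub hs)).div ((IsSAFun.const 1).add hs)
  · exact (((IsSAFun.const 2).mul hr).mul (hw i)).div ((IsSAFun.const 1).add hs)

/-- The image of a semialgebraic set under the chart homeomorphism given by `bandA`. -/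
theorem isSemialgebraic_band {S : Set E4} (hS : IsSemialgebraic S) {k : Fin 3} {M : ℕ} {α β : ℝ → ℝ}
    (hα : IsSAFun fun x : Fin 1 → ℝ => α (x 0)) (hβ : IsSAFun fun x : Fin 1 → ℝ => β (x 0)) (ε : ℝ)
        :
    IsSemialgebraic {z : E4 | z = 0 ∨ ∃ x ∈ S, 0 < ‖x‖ ∧ ‖x‖ < ε ∧
      z = chartPt ‖x‖ (bandA k M α β ‖x‖ (chartW x))} := by
  rw [isSemialgebraic_iff]
  have h1 : SemiAlg fun z : Fin 4 → ℝ => ∃ x : Fin 4 → ℝ, WithLp.toLp 2 x ∈ S ∧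
      0 < ‖(WithLp.toLp 2 x : E4)‖ ∧ ‖(WithLp.toLp 2 x : E4)‖ < ε ∧ ∀ i, z i =
        chartPt ‖(WithLp.toLp 2 x : E4)‖
          (bandA k M α β ‖(WithLp.toLp 2 x : E4)‖ (chartW (WithLp.toLp 2 x))) i := by
    refine SemiAlg.exFin ?_
    have hn : IsSAFun fun z : Fin 4 ⊕ Fin 4 → ℝ =>
        ‖(WithLp.toLp 2 (fun k => z (Sum.inr k)) : E4)‖ := IsSAFun.norm_toLp fun _ => .coord _
    refine ((isSemialgebraic_iff.1 hS).comp fun _ => .coord _).and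
      ((IsSAFun.lt (.const 0) hn).and ((IsSAFun.lt hn (.const ε)).and (SemiAlg.finAnd fun i => ?_)))
    refine IsSAFun.eq (.coord _) (isSAFun_chartPt hn (fun j => isSAFun_bandA hα hβ hn (fun l => ?_)
        j) i)
    exact (IsSAFun.coord _).div (hn.add (.coord _))
  have h2 : SemiAlg fun z : Fin 4 → ℝ => ∀ i, z i = 0 :=
    SemiAlg.finAnd fun i => SemiAlg.eq (.coord _) (.const _)
  refine (h2.or h1).congr fun z => or_congr ?_ ?_
  · constructor
    · intro h i
      exact congrArg (fun y : E4 => y i) h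
    · intro h
      ext i
      exact h i
  · constructor
    · rintro ⟨x, hx, h3, h4, h5⟩
      exact ⟨WithLp.ofLp x, hx, h3, h4, fun i => congrArg (fun y : E4 => y i) h5⟩
    · rintro ⟨x, hx, h3, h4, h5⟩
      exact ⟨_, hx, h3, h4, by ext i; exact h5 i⟩

end Band

section Finger
open Filter Topology

theorem chartPt_estimates {r : ℝ} (hr : 0 < r) (hr' : r ≤ 1 / 8) {u : Fin 3 → ℝ} {ψ : ℝ}
    (h0 : u 0 = r / 2 * ψ) (hψ : |ψ| ≤ 1 + r ^ 6) (h1 : |u 1| ≤ r ^ 7) (h2 : |u 2| ≤ r ^ 7) :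
    0 < chartPt r u 0 ∧ chartPt r u 0 ≤ r ∧ |chartPt r u 1| ≤ chartPt r u 0 ^ 2 + 48 * chartPt r u
        0 ^ 3 ∧
    |chartPt r u 2| ≤ chartPt r u 0 ^ 5 ∧ |chartPt r u 3| ≤ chartPt r u 0 ^ 5 ∧
    |chartPt r u 0 - r| ≤ r ^ 3 ∧ |chartPt r u 1 - r ^ 2 * ψ| ≤ 2 * r ^ 4 := by
  have hr6 : r ^ 6 ≤ 1 / 8 := by
    calc r ^ 6 ≤ (1 / 8) ^ 6 := by gcongr
      _ ≤ 1 / 8 := by norm_num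
  set q := sqLen u with hq
  have hq0 : 0 ≤ q := sqLen_nonneg u
  have hqr : q ≤ r ^ 2 / 2 := by
    have e0 : u 0 ^ 2 = r ^ 2 / 4 * ψ ^ 2 := by rw [h0]; ring
    have e1 : ψ ^ 2 ≤ (9 / 8) ^ 2 := by
      rw [← sq_abs]; gcongr; linarith
    have e2 : u 1 ^ 2 ≤ (r ^ 7) ^ 2 := by rw [← sq_abs]; gcongr
    have e3 : u 2 ^ 2 ≤ (r ^ 7) ^ 2 := by rw [← sq_abs]; gcongr
    have e4 : (r ^ 7) ^ 2 ≤ r ^ 2 * (1 / 8) ^ 12 := by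
      calc (r ^ 7) ^ 2 = r ^ 2 * r ^ 12 := by ring
        _ ≤ _ := by gcongr
    rw [hq, sqLen, Fin.sum_univ_three, e0]
    nlinarith [sq_nonneg r]
  have hr2 : r ^ 2 ≤ 1 / 64 := by
    calc r ^ 2 ≤ (1 / 8) ^ 2 := by gcongr
      _ = _ := by norm_num
  have c0 : chartPt r u 0 = r * (1 - q) / (1 + q) := rfl
  have c1 : chartPt r u 1 = 2 * r * u 0 / (1 + q) := rfl
  have c2 : chartPt r u 2 = 2 * r * u 1 / (1 + q) := rfl
  have c3 : chartPt r u 3 = 2 * r * u 2 / (1 + q) := rfl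
  have hq1 : 0 < 1 + q := by linarith
  rw [c1, c2, c3, c0]
  set t := r * (1 - q) / (1 + q) with ht
  have ht1 : t ≤ r := by
    rw [ht, div_le_iff₀ hq1]; nlinarith
  have ht2 : r * (1 - r ^ 2) ≤ t := by
    rw [ht, le_div_iff₀ hq1]
    have : (1 - r ^ 2) * (1 + q) ≤ 1 - q := by nlinarith
    nlinarith
  have ht3 : r / 2 ≤ t := by nlinarith
  have ht0 : 0 < t := by linarith
  have hs : |2 * r * u 0 / (1 + q)| ≤ r ^ 2 * (1 + r ^ 6) := by
    rw [h0, abs_div, abs_of_pos hq1, div_le_iff₀ hq1]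
    have : |2 * r * (r / 2 * ψ)| = r ^ 2 * |ψ| := by
      rw [show 2 * r * (r / 2 * ψ) = r ^ 2 * ψ by ring, abs_mul, abs_of_pos (by positivity)]
    rw [this]
    have h3 : r ^ 2 * |ψ| ≤ r ^ 2 * (1 + r ^ 6) := by gcongr
    have h4 : 0 ≤ r ^ 2 * (1 + r ^ 6) * q := by positivity
    linarith
  have hv : ∀ a, |a| ≤ r ^ 7 → |2 * r * a / (1 + q)| ≤ t ^ 5 := by
    intro a ha
    have h5 : (r / 2) ^ 5 ≤ t ^ 5 := by gcongr
    refine le_trans ?_ h5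
    rw [abs_div, abs_of_pos hq1, div_le_iff₀ hq1, abs_mul, abs_of_pos (by positivity)]
    have h6 : 2 * r * |a| ≤ 2 * r * r ^ 7 := by gcongr
    have h7 : 2 * r * r ^ 7 ≤ (r / 2) ^ 5 := by
      have : r ^ 3 ≤ (1 / 8) ^ 3 := by gcongr
      have h8 : 0 < r ^ 5 := by positivity
      calc 2 * r * r ^ 7 = 2 * r ^ 5 * r ^ 3 := by ring
        _ ≤ 2 * r ^ 5 * (1 / 8) ^ 3 := by gcongr
        _ ≤ (r / 2) ^ 5 := by ring_nf; nlinarith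
    have h9 : 0 ≤ (r / 2) ^ 5 * q := by positivity
    linarith
  refine ⟨ht0, ht1, ?_, hv _ h1, hv _ h2, ?_, ?_⟩
  · refine hs.trans ?_
    have e1 : (r * (1 - r ^ 2)) ^ 2 ≤ t ^ 2 := by
      have : 0 ≤ r * (1 - r ^ 2) := mul_nonneg hr.le (by linarith)
      gcongr
    have e2 : r ^ 3 ≤ 8 * t ^ 3 := by
      calc r ^ 3 = 8 * (r / 2) ^ 3 := by ring
        _ ≤ _ := by gcongr
    have e3 : r ^ 2 * (1 + r ^ 6) ≤ (r * (1 - r ^ 2)) ^ 2 + 6 * r ^ 3 := by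
      have : r ^ 2 * (1 + r ^ 6) - (r * (1 - r ^ 2)) ^ 2 = r ^ 3 * (r ^ 5 + 2 * r - r ^ 3) := by
          ring
      have h6 : r ^ 5 + 2 * r - r ^ 3 ≤ 6 := by
        have : r ^ 5 ≤ (1 / 8) ^ 5 := by gcongr
        have : 0 ≤ r ^ 3 := by positivity
        norm_num at *
        linarith
      nlinarith [show 0 < r ^ 3 by positivity]
    linarith
  · rw [abs_sub_comm, abs_of_nonneg (by linarith)]
    nlinarith
  · rw [h0]
    have : 2 * r * (r / 2 * ψ) / (1 + q) - r ^ 2 * ψ = -(r ^ 2 * ψ * q / (1 + q)) := by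
      field_simp; ring
    rw [this, abs_neg, abs_div, abs_of_pos hq1, abs_mul, abs_mul, abs_of_nonneg hq0,
      abs_of_pos (by positivity : 0 < r ^ 2), div_le_iff₀ hq1]
    have : r ^ 2 * |ψ| * q ≤ r ^ 2 * 2 * (r ^ 2 / 2) := by
      gcongr; linarith
    have : 0 ≤ 2 * r ^ 4 * q := by positivity
    nlinarith [show 0 ≤ r ^ 4 by positivity]

/-- Every surface germ is ambient topologically equivalent to a semialgebraic germ which is squeezed
into a thin finger around the planar horn `|s| ≤ t ^ 2` and whose projection is coarsely dense
there. -/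
theorem exists_finger {S : Set E4} (hS : IsSemialgebraic S) (h0 : 0 ∈ S)
    (hdim : ∃ ε₀ > 0, ∀ ε, 0 < ε → ε ≤ ε₀ → dimH (S ∩ ball 0 ε) = 2) :
    ∃ Y : Set E4, IsSemialgebraic Y ∧ 0 ∈ Y ∧ AmbientTopEquiv Y S ∧ ∃ ε > 0,
      (∀ z ∈ Y, z ≠ 0 → 0 < z 0 ∧ |z 1| ≤ z 0 ^ 2 + 48 * z 0 ^ 3 ∧ |z 2| ≤ z 0 ^ 5 ∧ |z 3| ≤ z 0 ^
          5) ∧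
      ∀ t s : ℝ, 0 < t → t < ε → |s| ≤ t ^ 2 →
        ∃ z ∈ Y, z ≠ 0 ∧ |z 0 - t| ≤ 48 * t ^ 3 ∧ |z 1 - s| ≤ 48 * t ^ 3 := by
  obtain ⟨ε₀, hε₀, hdim⟩ := hdim
  obtain ⟨L, hL⟩ := exists_isometry_avoiding hS hε₀ (by rw [hdim ε₀ hε₀ le_rfl]; norm_num)
  have hS' := hS.image_isometry L
  obtain ⟨m, ε₁, hε₁, hhorn⟩ := exists_horn hS' hL
  have hdim' : ∀ ε, 0 < ε → ε ≤ min ε₀ ε₁ → 1 < dimH (L '' S ∩ ball 0 ε) := by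
    intro ε hε hle
    have h1 : L '' S ∩ ball 0 ε = L '' (S ∩ ball 0 ε) := by
      rw [image_inter L.injective, LinearIsometryEquiv.image_ball, map_zero]
    rw [h1, L.isometry.dimH_image, hdim ε hε (hle.trans (min_le_left _ _))]
    norm_num
  obtain ⟨k, ε₂, hε₂, α, β, hα, hβ, hαS, hβS, hαβ, hband⟩ := exists_band hS' (lt_min hε₀ hε₁)
    (fun x hx hx0 hx1 => hhorn x hx hx0 (hx1.trans_le (min_le_right _ _))) hdim'
  set ε := min (min ε₁ ε₂) (1 / 8) with hε
  have hεpos : 0 < ε := by positivity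
  have hε1 : ε ≤ ε₁ := (min_le_left _ _).trans (min_le_left _ _)
  have hε2 : ε ≤ ε₂ := (min_le_left _ _).trans (min_le_right _ _)
  have hε8 : ε ≤ 1 / 8 := min_le_right _ _
  have hsub : Ioo 0 ε ⊆ Ioo 0 ε₂ := Ioo_subset_Ioo_right hε2
  have hpt : ∀ x ∈ L '' S, 0 < ‖x‖ → ‖x‖ < ε →
      (∀ i, |chartW x i| ≤ 1 / ‖x‖ ^ m) ∧
      |bandMap (α ‖x‖) (β ‖x‖) (‖x‖ ^ (m + 7)) (chartW x k)| ≤ 1 + ‖x‖ ^ 6 ∧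
      ∀ i, |‖x‖ ^ (m + 7) * chartW x i| ≤ ‖x‖ ^ 7 := by
    intro x hx hx0 hx1
    have hw : ∀ y ∈ L '' S, ‖y‖ = ‖x‖ → ∀ i, |chartW y i| ≤ 1 / ‖x‖ ^ m := fun y hy hyx i => by
      rw [le_div_iff₀ (by positivity), ← hyx]
      exact (hhorn y hy (hyx ▸ hx0) (hyx ▸ hx1.trans_le hε1)).2 i
    refine ⟨hw x hx rfl, ?_, fun i => ?_⟩
    · refine (abs_bandMap_le (hαβ _ ⟨hx0, hx1.trans_le hε2⟩) (by positivity) (fun y hy => ?_)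
        (hw x hx rfl k)).trans ?_
      · obtain ⟨x', hx', hn, rfl⟩ := hband _ ⟨hx0, hx1.trans_le hε2⟩ y hy
        exact hw x' hx' hn k
      · have : 2 * ‖x‖ ^ (m + 7) * (1 / ‖x‖ ^ m) = 2 * ‖x‖ * ‖x‖ ^ 6 := by
          field_simp; ring
        rw [this]
        have : 0 ≤ ‖x‖ ^ 6 := by positivity
        nlinarith
    · rw [abs_mul, abs_of_pos (by positivity)]
      calc ‖x‖ ^ (m + 7) * |chartW x i| ≤ ‖x‖ ^ (m + 7) * (1 / ‖x‖ ^ m) := by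
            gcongr; exact hw x hx rfl i
        _ = ‖x‖ ^ 7 := by field_simp; ring
  have hest : ∀ x ∈ L '' S, 0 < ‖x‖ → ‖x‖ < ε → _ := fun x hx hx0 hx1 =>
    chartPt_estimates hx0 (hx1.le.trans hε8) (u := bandA k (m + 7) α β ‖x‖ (chartW x))
      (ψ := bandMap (α ‖x‖) (β ‖x‖) (‖x‖ ^ (m + 7)) (chartW x k)) (by simp [bandA])
      (hpt x hx hx0 hx1).2.1 ((hpt x hx hx0 hx1).2.2 _) ((hpt x hx hx0 hx1).2.2 _)
  refine ⟨_, isSemialgebraic_band hS' (k := k) (M := m + 7) hαS hβS ε, .inl rfl,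
    .of_image_isometry L ?_, ε, hεpos, ?_, ?_⟩
  · exact ambientTopEquiv_chart hεpos
      (continuousOn_bandA (hα.mono hsub) (hβ.mono hsub) fun r hr => hαβ r (hsub hr))
      (continuousOn_bandB (hα.mono hsub) (hβ.mono hsub))
      (fun r hr w => bandB_bandA hr.1 (hαβ r (hsub hr)) w)
      (fun r hr w => bandA_bandB hr.1 (hαβ r (hsub hr)) w) ⟨0, h0, map_zero L⟩
      fun x hx hx0 hx1 => (hhorn x hx hx0 (hx1.trans_le hε1)).1
  · rintro z (rfl | ⟨x, hx, hx0, hx1, rfl⟩) hz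
    · exact absurd rfl hz
    · obtain ⟨h1, -, h2, h3, h4, -⟩ := hest x hx hx0 hx1
      exact ⟨h1, h2, h3, h4⟩
  · intro t s ht htε hs
    have ht8 : t ≤ 1 / 8 := htε.le.trans hε8
    have hαβt := hαβ t (hsub ⟨ht, htε⟩)
    set y := (1 - t) * s / t ^ 2 with hy
    have hy1 : |y| < 1 := by
      rw [hy, abs_div, abs_mul, abs_of_pos (by positivity : 0 < t ^ 2),
          abs_of_pos (by linarith : 0 < 1 - t),
        div_lt_one (by positivity)]
      nlinarith [show 0 < t ^ 2 by positivity]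
    rw [abs_lt] at hy1
    obtain ⟨x, hx, hxt, hxk⟩ := hband t (hsub ⟨ht, htε⟩) (α t + (y + 1) * (β t - α t) / 2)
      ⟨by nlinarith, by nlinarith⟩
    obtain ⟨h1, h2, h3, h4, h5, h6, h7⟩ := hest x hx (by rwa [hxt]) (by rwa [hxt])
    refine ⟨_, .inr ⟨x, hx, by rwa [hxt], by rwa [hxt], rfl⟩, ?_, ?_, ?_⟩
    · intro h
      rw [h] at h1
      exact lt_irrefl _ h1
    · rw [hxt] at h6 ⊢
      refine h6.trans ?_
      have : 0 < t ^ 3 := by positivity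
      linarith
    · rw [hxt] at h7 ⊢
      have hψ : bandMap (α t) (β t) (t ^ (m + 7)) (chartW x k) = y := by
        rw [hxk, bandMap_of_mem (by nlinarith) (by nlinarith)]
        have : β t - α t ≠ 0 := by linarith
        field_simp
        ring
      rw [hψ] at h7
      have h8 : |t ^ 2 * y - s| ≤ t ^ 3 := by
        have : t ^ 2 * y - s = -(t * s) := by rw [hy]; field_simp; ring
        rw [this, abs_neg, abs_mul, abs_of_pos ht]
        nlinarith
      have h9 : 2 * t ^ 4 ≤ t ^ 3 := by
        have : 0 < t ^ 3 := by positivity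
        nlinarith
      have h10 := abs_sub_le (chartPt t (bandA k (m + 7) α β t (chartW x)) 1) (t ^ 2 * y) s
      have : 0 < t ^ 3 := by positivity
      linarith
end Finger

section Knot
open Filter Topology Polynomial

/-- The common denominator of the parametrization of the long knot. -/
def knotQ : ℝ[X] := 13 * X ^ 4 - 2 * X ^ 2 + 1

theorem knotQ_eval (σ : ℝ) : knotQ.eval σ = 13 * σ ^ 4 - 2 * σ ^ 2 + 1 := by simp [knotQ]

theorem le_knotQ (σ : ℝ) : 1 / 2 * (1 + σ ^ 4) ≤ knotQ.eval σ := by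
  rw [knotQ_eval]; nlinarith [sq_nonneg (σ ^ 2 - 1 / 12)]

theorem knotQ_pos (σ : ℝ) : 0 < knotQ.eval σ := lt_of_lt_of_le (by positivity) (le_knotQ σ)

theorem natDegree_knotQ : knotQ.natDegree ≤ 4 := by unfold knotQ; compute_degree

theorem exists_abs_eval_le (p : ℝ[X]) {m : ℕ} (h : p.natDegree ≤ 4 * m) :
    ∃ C, 0 ≤ C ∧ ∀ σ, |p.eval σ| ≤ C * knotQ.eval σ ^ m := by
  refine ⟨(∑ i ∈ Finset.range (p.natDegree + 1), |p.coeff i|) * 2 ^ m, by positivity, fun σ => ?_⟩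
  have h1 : ∀ j ≤ 4 * m, |σ| ^ j ≤ (1 + σ ^ 4) ^ m := fun j hj => by
    rcases le_total |σ| 1 with h | h
    · refine (pow_le_one₀ (abs_nonneg _) h).trans (one_le_pow₀ ?_)
      have : 0 ≤ σ ^ 4 := by positivity
      linarith
    · refine (pow_le_pow_right₀ h hj).trans ?_
      rw [pow_mul, show |σ| ^ 4 = σ ^ 4 by rw [← abs_pow, abs_of_nonneg (by positivity)]]
      gcongr
      linarith
  have h2 : (1 + σ ^ 4) ^ m ≤ 2 ^ m * knotQ.eval σ ^ m := by
    rw [← mul_pow]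
    gcongr
    linarith [le_knotQ σ]
  rw [eval_eq_sum_range, mul_assoc, Finset.sum_mul]
  refine (Finset.abs_sum_le_sum_abs _ _).trans (Finset.sum_le_sum fun i hi => ?_)
  rw [abs_mul, abs_pow]
  gcongr
  exact (h1 i (by rw [Finset.mem_range] at hi; omega)).trans h2

/-- The rational function `p / knotQ ^ m`. -/
def knotRatio (p : ℝ[X]) (m : ℕ) (σ : ℝ) : ℝ := p.eval σ / knotQ.eval σ ^ m

/-- The numerator of the derivative of `p / knotQ ^ m`. -/
def knotD (p : ℝ[X]) (m : ℕ) : ℝ[X] := derivative p * knotQ - m * p * derivative knotQ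

theorem hasDerivAt_knotRatio (p : ℝ[X]) (m : ℕ) (σ : ℝ) :
    HasDerivAt (knotRatio p m) (knotRatio (knotD p m) (m + 1) σ) σ := by
  have hq := (knotQ_pos σ).ne'
  have h1 := (p.hasDerivAt σ).div ((knotQ.hasDerivAt σ).pow m) (pow_ne_zero m hq)
  refine h1.congr_deriv ?_
  rw [knotRatio, knotD]
  simp only [eval_sub, eval_mul, eval_natCast]
  cases m with
  | zero => simp [hq]
  | succ m =>
    simp only [Nat.add_sub_cancel, Pi.pow_apply]
    field_simp
    ring

theorem natDegree_knotD {p : ℝ[X]} {m : ℕ} (h : p.natDegree ≤ 4 * m) :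
    (knotD p m).natDegree ≤ 4 * (m + 1) - 1 := by
  have hq' : (derivative knotQ).natDegree ≤ 3 := (natDegree_derivative_le _).trans (by
    have := natDegree_knotQ; omega)
  refine (natDegree_sub_le _ _).trans (max_le ?_ ?_)
  · by_cases h0 : p.natDegree = 0
    · rw [natDegree_eq_zero.1 h0 |>.choose_spec.symm]
      simp
    · refine natDegree_mul_le.trans ?_
      have := natDegree_derivative_le p
      have := natDegree_knotQ
      omega
  · refine natDegree_mul_le.trans ?_
    have h1 : ((m : ℝ[X]) * p).natDegree ≤ p.natDegree := by
      refine natDegree_mul_le.trans ?_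
      simp
    omega

/-- A symbol of order zero: bounded, with derivative of size `O(1 / (1 + |σ|))`. -/
theorem exists_knotRatio_bound {p : ℝ[X]} {m : ℕ} (h : p.natDegree ≤ 4 * m) :
    ∃ C, 0 ≤ C ∧ ∀ σ, |knotRatio p m σ| ≤ C ∧ |knotRatio (knotD p m) (m + 1) σ| ≤ C ∧
      |σ * knotRatio (knotD p m) (m + 1) σ| ≤ C := by
  obtain ⟨C₁, h₁, hC₁⟩ := exists_abs_eval_le p h
  have hd := natDegree_knotD h
  obtain ⟨C₂, h₂, hC₂⟩ := exists_abs_eval_le (knotD p m) (m := m + 1) (by omega)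
  obtain ⟨C₃, h₃, hC₃⟩ := exists_abs_eval_le (X * knotD p m) (m := m + 1) (by
    refine natDegree_mul_le.trans ?_
    have : (X : ℝ[X]).natDegree = 1 := natDegree_X
    omega)
  refine ⟨C₁ + C₂ + C₃, by positivity, fun σ => ⟨?_, ?_, ?_⟩⟩
  · rw [knotRatio, abs_div, abs_of_pos (pow_pos (knotQ_pos σ) m), div_le_iff₀ (pow_pos (knotQ_pos
        σ) m)]
    refine (hC₁ σ).trans ?_
    have := pow_pos (knotQ_pos σ) m
    gcongr; linarith
  · have := pow_pos (knotQ_pos σ) (m + 1)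
    rw [knotRatio, abs_div, abs_of_pos this, div_le_iff₀ this]
    refine (hC₂ σ).trans ?_
    gcongr; linarith
  · have := pow_pos (knotQ_pos σ) (m + 1)
    rw [knotRatio, ← mul_div_assoc, abs_div, abs_of_pos this, div_le_iff₀ this]
    have h5 := hC₃ σ
    rw [eval_mul, eval_X] at h5
    refine h5.trans ?_
    gcongr; linarith

/-- Numerators of the bounded parts of the knot. -/
def knotN (i : Fin 3) : ℝ[X] :=
  ![-28 * X ^ 3 + 4 * X, 5 * X ^ 4 - 10 * X ^ 2 + 1, 40 * X ^ 3 - 24 * X] i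

theorem natDegree_knotN (i : Fin 3) : (knotN i).natDegree ≤ 4 * 1 := by
  fin_cases i
  · change (-28 * X ^ 3 + 4 * X : ℝ[X]).natDegree ≤ 4
    compute_degree!
  · change (5 * X ^ 4 - 10 * X ^ 2 + 1 : ℝ[X]).natDegree ≤ 4
    compute_degree
  · change (40 * X ^ 3 - 24 * X : ℝ[X]).natDegree ≤ 4
    compute_degree!

/-- The bounded part of the long knot. -/
def knotk (i : Fin 3) : ℝ → ℝ := knotRatio (knotN i) 1

/-- The derivative of `knotk`. -/
def knotk' (i : Fin 3) : ℝ → ℝ := knotRatio (knotD (knotN i) 1) 2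

/-- The second derivative of `knotk`. -/
def knotk'' (i : Fin 3) : ℝ → ℝ := knotRatio (knotD (knotD (knotN i) 1) 2) 3

theorem hasDerivAt_knotk (i : Fin 3) (σ : ℝ) : HasDerivAt (knotk i) (knotk' i σ) σ :=
  hasDerivAt_knotRatio _ _ _

theorem hasDerivAt_knotk' (i : Fin 3) (σ : ℝ) : HasDerivAt (knotk' i) (knotk'' i σ) σ :=
  hasDerivAt_knotRatio _ _ _

theorem exists_knotk_bound : ∃ C, 0 < C ∧ ∀ i σ, |knotk i σ| ≤ C ∧ |knotk' i σ| ≤ C ∧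
    |σ * knotk' i σ| ≤ C ∧ |knotk'' i σ| ≤ C ∧ |σ * knotk'' i σ| ≤ C := by
  choose C hC h using fun i => exists_knotRatio_bound (natDegree_knotN i)
  choose C' hC' h' using fun i => exists_knotRatio_bound (p := knotD (knotN i) 1) (m := 2)
    ((natDegree_knotD (natDegree_knotN i)).trans (by norm_num))
  have hle : ∀ i, C i ≤ ∑ i, (C i + C' i) + 1 ∧ C' i ≤ ∑ i, (C i + C' i) + 1 := fun i => by
    have := Finset.single_le_sum (f := fun i => C i + C' i)
      (fun i _ => add_nonneg (hC i) (hC' i)) (Finset.mem_univ i)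
    have h1 := hC i
    have h2 := hC' i
    constructor <;> linarith
  refine ⟨∑ i, (C i + C' i) + 1, ?_, fun i σ => ⟨?_, ?_, ?_, ?_, ?_⟩⟩
  · have : 0 ≤ ∑ i, (C i + C' i) := Finset.sum_nonneg fun i _ => add_nonneg (hC i) (hC' i)
    linarith
  · exact (h i σ).1.trans (hle i).1
  · exact (h i σ).2.1.trans (hle i).1
  · exact (h i σ).2.2.trans (hle i).1
  · exact (h' i σ).2.1.trans (hle i).2
  · exact (h' i σ).2.2.trans (hle i).2

theorem knotk_zero (σ : ℝ) : knotk 0 σ = (-28 * σ ^ 3 + 4 * σ) / (13 * σ ^ 4 - 2 * σ ^ 2 + 1) := by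
  simp [knotk, knotRatio, knotN, knotQ_eval]

theorem knotk_one (σ : ℝ) :
    knotk 1 σ = (5 * σ ^ 4 - 10 * σ ^ 2 + 1) / (13 * σ ^ 4 - 2 * σ ^ 2 + 1) := by
  simp [knotk, knotRatio, knotN, knotQ_eval]

theorem knotk_two (σ : ℝ) : knotk 2 σ = (40 * σ ^ 3 - 24 * σ) / (13 * σ ^ 4 - 2 * σ ^ 2 + 1) := by
  simp [knotk, knotRatio, knotN, knotQ_eval]

/-- The projection of the knot to the plane of the first and last coordinates is immersed. -/
theorem exists_knot_immersed : ∃ c, 0 < c ∧ ∀ σ, c ≤ (1 + knotk' 0 σ) ^ 2 + knotk' 2 σ ^ 2 := by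
  obtain ⟨C₁, h₁, hC₁⟩ := exists_abs_eval_le (m := 2) (C (-7955 / 689) + C (25544 / 689) * X ^ 2 +
    C (21482 / 53) * X ^ 4 - 416 * X ^ 6 + 169 * X ^ 8) (by compute_degree)
  obtain ⟨C₂, h₂, hC₂⟩ := exists_abs_eval_le (m := 2) (C (-1686 / 689) + C (27010 / 689) * X ^ 2 +
    C (1150 / 53) * X ^ 4 - C (8762 / 53) * X ^ 6) (by compute_degree!)
  refine ⟨1 / (2 * (C₁ + C₂ + 1) ^ 2), by positivity, fun σ => ?_⟩
  have hq := knotQ_pos σ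
  have e1 : (1 + knotk' 0 σ) * knotQ.eval σ ^ 2 =
      5 - 80 * σ ^ 2 - 70 * σ ^ 4 + 312 * σ ^ 6 + 169 * σ ^ 8 := by
    rw [knotk', knotRatio]
    field_simp
    simp [knotD, knotN, knotQ]
    ring
  have e3 : knotk' 2 σ * knotQ.eval σ ^ 2 = -24 + 72 * σ ^ 2 + 856 * σ ^ 4 - 520 * σ ^ 6 := by
    rw [knotk', knotRatio]
    field_simp
    simp [knotD, knotN, knotQ]
    ring
  have g1 := hC₁ σ
  have g2 := hC₂ σ
  simp only [eval_add, eval_sub, eval_mul, eval_pow, eval_X, eval_C, eval_ofNat] at g1 g2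
  set U := -7955 / 689 + 25544 / 689 * σ ^ 2 + 21482 / 53 * σ ^ 4 - 416 * σ ^ 6 + 169 * σ ^ 8
  set V := -1686 / 689 + 27010 / 689 * σ ^ 2 + 1150 / 53 * σ ^ 4 - 8762 / 53 * σ ^ 6
  have key : U * ((1 + knotk' 0 σ) * knotQ.eval σ ^ 2) + V * (knotk' 2 σ * knotQ.eval σ ^ 2) =
      knotQ.eval σ ^ 2 * knotQ.eval σ ^ 2 := by
    rw [e1, e3, knotQ_eval]
    ring
  set a := 1 + knotk' 0 σ
  set b := knotk' 2 σ
  have key2 : U * a + V * b = knotQ.eval σ ^ 2 := by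
    have : knotQ.eval σ ^ 2 ≠ 0 := by positivity
    apply mul_right_cancel₀ this
    linarith
  set Q := knotQ.eval σ ^ 2
  have hQ : 0 < Q := by positivity
  have h5 : Q ≤ (C₁ + C₂ + 1) * Q * (|a| + |b|) := by
    calc Q ≤ |U * a| + |V * b| := by
          rw [← key2]; exact (le_abs_self _).trans (abs_add_le _ _)
      _ = |U| * |a| + |V| * |b| := by rw [abs_mul, abs_mul]
      _ ≤ C₁ * Q * |a| + C₂ * Q * |b| := by gcongr
      _ ≤ (C₁ + C₂ + 1) * Q * |a| + (C₁ + C₂ + 1) * Q * |b| := by gcongr <;> linarith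
      _ = _ := by ring
  have h6 : 1 ≤ (C₁ + C₂ + 1) * (|a| + |b|) := by
    have : 1 * Q ≤ (C₁ + C₂ + 1) * (|a| + |b|) * Q := by linarith
    exact le_of_mul_le_mul_right this hQ
  rw [div_le_iff₀ (by positivity)]
  have h7 : (|a| + |b|) ^ 2 ≤ 2 * (a ^ 2 + b ^ 2) := by
    rw [← sq_abs a, ← sq_abs b]
    nlinarith [sq_nonneg (|a| - |b|)]
  have h8 : (1 : ℝ) ≤ ((C₁ + C₂ + 1) * (|a| + |b|)) ^ 2 := one_le_pow₀ h6
  rw [mul_pow] at h8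
  nlinarith [sq_nonneg (C₁ + C₂ + 1)]

/-- The long knot. -/
def knot (σ : ℝ) : Fin 3 → ℝ := ![σ + knotk 0 σ, knotk 1 σ, knotk 2 σ]

/-- The chord-arc property of the long knot. -/
theorem exists_knot_chord : ∃ c, 0 < c ∧ ∀ σ σ', c * |σ - σ'| ≤ ‖knot σ - knot σ'‖ := by
  refine ⟨1 / 100, by norm_num, fun s s' => ?_⟩
  have hq := knotQ_pos s
  have hq' := knotQ_pos s'
  rw [knotQ_eval] at hq hq'
  set x := knot s 0 - knot s' 0 with hx
  set y := knot s 1 - knot s' 1 with hy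
  set z := knot s 2 - knot s' 2 with hz
  have hx' : |x| ≤ ‖knot s - knot s'‖ := norm_le_pi_norm (knot s - knot s') 0
  have hy' : |y| ≤ ‖knot s - knot s'‖ := norm_le_pi_norm (knot s - knot s') 1
  have hz' : |z| ≤ ‖knot s - knot s'‖ := norm_le_pi_norm (knot s - knot s') 2
  set n := ‖knot s - knot s'‖
  have hn : 0 ≤ n := norm_nonneg _
  set c := (s ^ 2 - 1) * (s' ^ 2 - 1) + 4 * s * s'
  set D := (s ^ 2 + 1) * (s' ^ 2 + 1)
  have key : ((5 * x + z / 2) / 13) ^ 2 + y ^ 2 + ((5 / 2 * z - x) / 13) ^ 2 =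
      (s - s') ^ 2 * 2 * (4 * c ^ 2 + 6 * c * D + 3 * D ^ 2) /
        ((13 * s ^ 4 - 2 * s ^ 2 + 1) * (13 * s' ^ 4 - 2 * s' ^ 2 + 1)) := by
    have e1 : x = s + (-28 * s ^ 3 + 4 * s) / (13 * s ^ 4 - 2 * s ^ 2 + 1) -
        (s' + (-28 * s' ^ 3 + 4 * s') / (13 * s' ^ 4 - 2 * s' ^ 2 + 1)) := by
      rw [← knotk_zero, ← knotk_zero]; rfl
    have e2 : y = (5 * s ^ 4 - 10 * s ^ 2 + 1) / (13 * s ^ 4 - 2 * s ^ 2 + 1) -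
        (5 * s' ^ 4 - 10 * s' ^ 2 + 1) / (13 * s' ^ 4 - 2 * s' ^ 2 + 1) := by
      rw [← knotk_one, ← knotk_one]; rfl
    have e3 : z = (40 * s ^ 3 - 24 * s) / (13 * s ^ 4 - 2 * s ^ 2 + 1) -
        (40 * s' ^ 3 - 24 * s') / (13 * s' ^ 4 - 2 * s' ^ 2 + 1) := by
      rw [← knotk_two, ← knotk_two]; rfl
    have gen : ∀ q q' : ℝ, q ≠ 0 → q' ≠ 0 → ∀ a a' : ℝ,
        (a / q - a' / q') ^ 2 = (a * q' - a' * q) ^ 2 / (q * q') ^ 2 := by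
      intro q q' h h' a a'
      rw [← div_pow]
      congr 1
      field_simp
    have f1 : (5 * x + z / 2) / 13 = (5 * s ^ 5 - 10 * s ^ 3 + s) / (13 * s ^ 4 - 2 * s ^ 2 + 1) -
        (5 * s' ^ 5 - 10 * s' ^ 3 + s') / (13 * s' ^ 4 - 2 * s' ^ 2 + 1) := by
      rw [e1, e3, add_div' _ _ _ hq.ne', add_div' _ _ _ hq'.ne']
      ring
    have f3 : (5 / 2 * z - x) / 13 =
        (-s ^ 5 + 10 * s ^ 3 - 5 * s) / (13 * s ^ 4 - 2 * s ^ 2 + 1) -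
        (-s' ^ 5 + 10 * s' ^ 3 - 5 * s') / (13 * s' ^ 4 - 2 * s' ^ 2 + 1) := by
      rw [e1, e3, add_div' _ _ _ hq.ne', add_div' _ _ _ hq'.ne']
      ring
    rw [f1, f3, e2, gen _ _ hq.ne' hq'.ne', gen _ _ hq.ne' hq'.ne', gen _ _ hq.ne' hq'.ne',
      ← add_div, ← add_div, div_eq_div_iff (pow_pos (mul_pos hq hq') 2).ne' (mul_pos hq hq').ne']
    simp only [c, D]
    ring
  have hD : 0 < D := by positivity
  have h1 : 3 / 4 * D ^ 2 ≤ 4 * c ^ 2 + 6 * c * D + 3 * D ^ 2 := by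
    nlinarith [sq_nonneg (2 * c + 3 / 2 * D)]
  have h2 : (13 * s ^ 4 - 2 * s ^ 2 + 1) * (13 * s' ^ 4 - 2 * s' ^ 2 + 1) ≤ 169 * D ^ 2 := by
    calc _ ≤ 13 * (s ^ 2 + 1) ^ 2 * (13 * (s' ^ 2 + 1) ^ 2) := by
          gcongr <;> nlinarith [sq_nonneg s, sq_nonneg s']
      _ = _ := by ring
  have h3 : (s - s') ^ 2 * (3 / 338) ≤ (s - s') ^ 2 * 2 * (4 * c ^ 2 + 6 * c * D + 3 * D ^ 2) /
        ((13 * s ^ 4 - 2 * s ^ 2 + 1) * (13 * s' ^ 4 - 2 * s' ^ 2 + 1)) := by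
    rw [le_div_iff₀ (by positivity)]
    have h4 := sq_nonneg (s - s')
    calc (s - s') ^ 2 * (3 / 338) * ((13 * s ^ 4 - 2 * s ^ 2 + 1) * (13 * s' ^ 4 - 2 * s' ^ 2 + 1))
        ≤ (s - s') ^ 2 * (3 / 338) * (169 * D ^ 2) := by gcongr
      _ = (s - s') ^ 2 * 2 * (3 / 4 * D ^ 2) := by ring
      _ ≤ _ := by gcongr
  rw [← key] at h3
  have b1 : ((5 * x + z / 2) / 13) ^ 2 ≤ n ^ 2 := by
    rw [abs_le] at hx' hz'
    exact sq_le_sq' (by linarith) (by linarith)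
  have b2 : y ^ 2 ≤ n ^ 2 := by
    rw [abs_le] at hy'
    exact sq_le_sq' (by linarith) (by linarith)
  have b3 : ((5 / 2 * z - x) / 13) ^ 2 ≤ n ^ 2 := by
    rw [abs_le] at hx' hz'
    exact sq_le_sq' (by linarith) (by linarith)
  refine abs_le_of_sq_le_sq' (a := 1 / 100 * |s - s'|) ?_ hn |>.2
  rw [mul_pow, sq_abs]
  nlinarith [sq_nonneg (s - s')]
end Knot

section Tub
open Filter Topology

theorem knotk_sub_le {C : ℝ} (hC : ∀ i σ, |knotk' i σ| ≤ C) (i : Fin 3) (a b : ℝ) :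
    |knotk i a - knotk i b| ≤ C * |a - b| :=
  Convex.norm_image_sub_le_of_norm_hasDerivWithin_le (s := univ)
    (fun x _ => (hasDerivAt_knotk i x).hasDerivWithinAt) (fun x _ => hC i x) convex_univ
    (mem_univ _) (mem_univ _)

theorem knotk'_sub_le {C : ℝ} (hC : ∀ i σ, |knotk'' i σ| ≤ C) (i : Fin 3) (a b : ℝ) :
    |knotk' i a - knotk' i b| ≤ C * |a - b| :=
  Convex.norm_image_sub_le_of_norm_hasDerivWithin_le (s := univ)
    (fun x _ => (hasDerivAt_knotk' i x).hasDerivWithinAt) (fun x _ => hC i x) convex_univ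
    (mem_univ _) (mem_univ _)

theorem knotk_taylor {C : ℝ} (hC : ∀ i σ, |knotk'' i σ| ≤ C) (i : Fin 3) {σ a b η : ℝ}
    (ha : |a - σ| ≤ η) (hb : |b - σ| ≤ η) :
    |knotk i a - knotk i b - knotk' i σ * (a - b)| ≤ C * η * |a - b| := by
  have h := Convex.norm_image_sub_le_of_norm_hasDerivWithin_le (s := Icc (σ - η) (σ + η))
    (f := fun x => knotk i x - knotk' i σ * x) (f' := fun x => knotk' i x - knotk' i σ)
    (C := C * η) (x := b) (y := a)
    (fun x _ => ((hasDerivAt_knotk i x).sub (by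
      simpa using (hasDerivAt_id x).const_mul (knotk' i σ))).hasDerivWithinAt)
    (fun x hx => (knotk'_sub_le hC i x σ).trans (by
      have : 0 ≤ C := (abs_nonneg _).trans (hC i σ)
      gcongr
      rw [abs_le]; constructor <;> linarith [hx.1, hx.2])) (convex_Icc _ _)
    (by rw [abs_le] at hb; constructor <;> linarith [hb.1, hb.2])
    (by rw [abs_le] at ha; constructor <;> linarith [ha.1, ha.2])
  rw [Real.norm_eq_abs, Real.norm_eq_abs] at h
  convert h using 2
  ring

/-- The parametrization of a tubular neighborhood of the long knot. -/
def tub (y : Fin 3 → ℝ) : Fin 3 → ℝ :=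
  ![y 0 + knotk 0 (y 0) - y 2 * knotk' 2 (y 0), y 1 + knotk 1 (y 0),
    knotk 2 (y 0) + y 2 * (1 + knotk' 0 (y 0))]

theorem tub_axis (σ : ℝ) : tub ![σ, 0, 0] = knot σ := by simp [tub, knot]

theorem pi3_norm_le {y : Fin 3 → ℝ} {r : ℝ} (h0 : |y 0| ≤ r) (h1 : |y 1| ≤ r) (h2 : |y 2| ≤ r) :
    ‖y‖ ≤ r := by
  rw [pi_norm_le_iff_of_nonneg ((abs_nonneg _).trans h0)]
  intro i
  fin_cases i <;> assumption

/-- The linear approximation of `tub` along the knot. -/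
def tubLin (σ : ℝ) : (Fin 3 → ℝ) ≃L[ℝ] (Fin 3 → ℝ) :=
  LinearEquiv.toContinuousLinearEquiv
  { toFun := fun u => ![u 0 * (1 + knotk' 0 σ) - u 2 * knotk' 2 σ, u 1 + u 0 * knotk' 1 σ,
      u 0 * knotk' 2 σ + u 2 * (1 + knotk' 0 σ)]
    invFun := fun w =>
      ![((1 + knotk' 0 σ) * w 0 + knotk' 2 σ * w 2) / ((1 + knotk' 0 σ) ^ 2 + knotk' 2 σ ^ 2),
        w 1 - ((1 + knotk' 0 σ) * w 0 + knotk' 2 σ * w 2) /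
          ((1 + knotk' 0 σ) ^ 2 + knotk' 2 σ ^ 2) * knotk' 1 σ,
        ((1 + knotk' 0 σ) * w 2 - knotk' 2 σ * w 0) / ((1 + knotk' 0 σ) ^ 2 + knotk' 2 σ ^ 2)]
    map_add' := fun u u' => by ext i; fin_cases i <;> simp <;> ring
    map_smul' := fun r u => by ext i; fin_cases i <;> simp <;> ring
    left_inv := fun u => by
      obtain ⟨c, hc, h⟩ := exists_knot_immersed
      have hne := (hc.trans_le (h σ)).ne'
      ext i; fin_cases i <;> simp <;> field_simp <;> ring
    right_inv := fun u => by
      obtain ⟨c, hc, h⟩ := exists_knot_immersed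
      have hne := (hc.trans_le (h σ)).ne'
      ext i; fin_cases i <;> simp <;> field_simp <;> ring }

theorem tubLin_apply (σ : ℝ) (u : Fin 3 → ℝ) : tubLin σ u =
    ![u 0 * (1 + knotk' 0 σ) - u 2 * knotk' 2 σ, u 1 + u 0 * knotk' 1 σ,
      u 0 * knotk' 2 σ + u 2 * (1 + knotk' 0 σ)] := rfl

theorem tubLin_symm_apply (σ : ℝ) (w : Fin 3 → ℝ) : (tubLin σ).symm w =
    ![((1 + knotk' 0 σ) * w 0 + knotk' 2 σ * w 2) / ((1 + knotk' 0 σ) ^ 2 + knotk' 2 σ ^ 2),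
        w 1 - ((1 + knotk' 0 σ) * w 0 + knotk' 2 σ * w 2) /
          ((1 + knotk' 0 σ) ^ 2 + knotk' 2 σ ^ 2) * knotk' 1 σ,
        ((1 + knotk' 0 σ) * w 2 - knotk' 2 σ * w 0) /
          ((1 + knotk' 0 σ) ^ 2 + knotk' 2 σ ^ 2)] := rfl

theorem exists_tubLin_symm_le :
    ∃ B, 0 < B ∧ ∀ σ w, ‖(tubLin σ).symm w‖ ≤ B * ‖w‖ := by
  obtain ⟨c, hc, h⟩ := exists_knot_immersed
  obtain ⟨C, hC, hk⟩ := exists_knotk_bound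
  refine ⟨1 + (1 + 2 * C) / c * (1 + C), by positivity, fun σ w => ?_⟩
  have w0 : |w 0| ≤ ‖w‖ := norm_le_pi_norm w 0
  have w1 : |w 1| ≤ ‖w‖ := norm_le_pi_norm w 1
  have w2 : |w 2| ≤ ‖w‖ := norm_le_pi_norm w 2
  have k0 := (hk 0 σ).2.1
  have k1 := (hk 1 σ).2.1
  have k2 := (hk 2 σ).2.1
  have k0' : |1 + knotk' 0 σ| ≤ 1 + C := (abs_add_le _ _).trans (by simpa using k0)
  have hn := norm_nonneg w
  have e1 : |((1 + knotk' 0 σ) * w 0 + knotk' 2 σ * w 2) /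
      ((1 + knotk' 0 σ) ^ 2 + knotk' 2 σ ^ 2)| ≤ (1 + 2 * C) / c * ‖w‖ := by
    rw [abs_div, abs_of_pos (hc.trans_le (h σ)), div_mul_eq_mul_div]
    refine div_le_div₀ (by positivity) ?_ hc (h σ)
    refine (abs_add_le _ _).trans ?_
    rw [abs_mul, abs_mul]
    calc _ ≤ (1 + C) * ‖w‖ + C * ‖w‖ := by gcongr
      _ = _ := by ring
  have e2 : |((1 + knotk' 0 σ) * w 2 - knotk' 2 σ * w 0) /
      ((1 + knotk' 0 σ) ^ 2 + knotk' 2 σ ^ 2)| ≤ (1 + 2 * C) / c * ‖w‖ := by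
    rw [abs_div, abs_of_pos (hc.trans_le (h σ)), div_mul_eq_mul_div]
    refine div_le_div₀ (by positivity) ?_ hc (h σ)
    refine (abs_sub _ _).trans ?_
    rw [abs_mul, abs_mul]
    calc _ ≤ (1 + C) * ‖w‖ + C * ‖w‖ := by gcongr
      _ = _ := by ring
  have hm : (1 + 2 * C) / c * ‖w‖ ≤ (1 + (1 + 2 * C) / c * (1 + C)) * ‖w‖ := by
    have : 0 ≤ (1 + 2 * C) / c * C := by positivity
    gcongr
    linarith
  rw [tubLin_symm_apply]
  refine pi3_norm_le ?_ ?_ ?_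
  · simpa using e1.trans hm
  · simp only [Matrix.cons_val_one, Matrix.cons_val_zero]
    refine (abs_sub _ _).trans ?_
    rw [abs_mul]
    calc _ ≤ ‖w‖ + (1 + 2 * C) / c * ‖w‖ * C := by gcongr
      _ ≤ _ := by
        have : 0 ≤ (1 + 2 * C) / c * ‖w‖ := by positivity
        linarith
  · simpa using e2.trans hm

theorem exists_tub_sub_tubLin_le : ∃ C, 0 < C ∧ ∀ σ η y y', |y 0 - σ| ≤ η → |y' 0 - σ| ≤ η →
    |y 2| ≤ η → |y' 2| ≤ η → ‖tub y - tub y' - tubLin σ (y - y')‖ ≤ C * η * ‖y - y'‖ := by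
  obtain ⟨C, hC, hk⟩ := exists_knotk_bound
  have hC2 : ∀ i σ, |knotk'' i σ| ≤ C := fun i σ => (hk i σ).2.2.2.1
  refine ⟨3 * C, by positivity, fun σ η y y' h0 h0' h2 h2' => ?_⟩
  have hη : 0 ≤ η := (abs_nonneg _).trans h0
  have w0 : |y 0 - y' 0| ≤ ‖y - y'‖ := norm_le_pi_norm (y - y') 0
  have w2 : |y 2 - y' 2| ≤ ‖y - y'‖ := norm_le_pi_norm (y - y') 2
  have hn := norm_nonneg (y - y')
  have ht : ∀ i, |knotk i (y 0) - knotk i (y' 0) - knotk' i σ * (y 0 - y' 0)| ≤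
      C * η * ‖y - y'‖ := fun i => (knotk_taylor hC2 i h0 h0').trans (by gcongr)
  have hv : ∀ i, |(y 2 - y' 2) * (knotk' i (y 0) - knotk' i σ) +
      y' 2 * (knotk' i (y 0) - knotk' i (y' 0))| ≤ 2 * C * η * ‖y - y'‖ := fun i => by
    refine (abs_add_le _ _).trans ?_
    rw [abs_mul, abs_mul]
    calc _ ≤ ‖y - y'‖ * (C * η) + η * (C * ‖y - y'‖) := by
          gcongr
          · exact (knotk'_sub_le hC2 i _ _).trans (by gcongr)
          · exact (knotk'_sub_le hC2 i _ _).trans (by gcongr)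
      _ = _ := by ring
  have h00 : 0 ≤ C * η * ‖y - y'‖ := by positivity
  rw [tubLin_apply]
  refine pi3_norm_le ?_ ?_ ?_
  · have e : (tub y - tub y' - ![(y - y') 0 * (1 + knotk' 0 σ) - (y - y') 2 * knotk' 2 σ,
      (y - y') 1 + (y - y') 0 * knotk' 1 σ, (y - y') 0 * knotk' 2 σ +
      (y - y') 2 * (1 + knotk' 0 σ)]) 0 =
      (knotk 0 (y 0) - knotk 0 (y' 0) - knotk' 0 σ * (y 0 - y' 0)) -
      ((y 2 - y' 2) * (knotk' 2 (y 0) - knotk' 2 σ) +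
      y' 2 * (knotk' 2 (y 0) - knotk' 2 (y' 0))) := by
      simp [tub]; ring
    rw [e]
    refine (abs_sub _ _).trans ?_
    linarith [ht 0, hv 2]
  · have e : (tub y - tub y' - ![(y - y') 0 * (1 + knotk' 0 σ) - (y - y') 2 * knotk' 2 σ,
      (y - y') 1 + (y - y') 0 * knotk' 1 σ, (y - y') 0 * knotk' 2 σ +
      (y - y') 2 * (1 + knotk' 0 σ)]) 1 =
      (knotk 1 (y 0) - knotk 1 (y' 0) - knotk' 1 σ * (y 0 - y' 0)) := by
      simp [tub]; ring
    rw [e]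
    linarith [ht 1]
  · have e : (tub y - tub y' - ![(y - y') 0 * (1 + knotk' 0 σ) - (y - y') 2 * knotk' 2 σ,
      (y - y') 1 + (y - y') 0 * knotk' 1 σ, (y - y') 0 * knotk' 2 σ +
      (y - y') 2 * (1 + knotk' 0 σ)]) 2 =
      (knotk 2 (y 0) - knotk 2 (y' 0) - knotk' 2 σ * (y 0 - y' 0)) +
      ((y 2 - y' 2) * (knotk' 0 (y 0) - knotk' 0 σ) +
      y' 2 * (knotk' 0 (y 0) - knotk' 0 (y' 0))) := by
      simp [tub]; ring
    rw [e]
    refine (abs_add_le _ _).trans ?_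
    linarith [ht 2, hv 0]

theorem exists_tub_sub_knot_le : ∃ C, 0 < C ∧
    ∀ y δ, |y 1| ≤ δ → |y 2| ≤ δ → ‖tub y - knot (y 0)‖ ≤ C * δ := by
  obtain ⟨C, hC, hk⟩ := exists_knotk_bound
  refine ⟨1 + C, by positivity, fun y δ h1 h2 => ?_⟩
  have hδ : 0 ≤ δ := (abs_nonneg _).trans h1
  have hCδ : 0 ≤ C * δ := by positivity
  have k0 := (hk 0 (y 0)).2.1
  have k2 := (hk 2 (y 0)).2.1
  refine pi3_norm_le ?_ ?_ ?_
  · have : (tub y - knot (y 0)) 0 = -(y 2 * knotk' 2 (y 0)) := by simp [tub, knot]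
    rw [this, abs_neg, abs_mul]
    calc _ ≤ δ * C := by gcongr
      _ ≤ _ := by linarith
  · have : (tub y - knot (y 0)) 1 = y 1 := by simp [tub, knot]
    rw [this]
    linarith
  · have : (tub y - knot (y 0)) 2 = y 2 * (1 + knotk' 0 (y 0)) := by simp [tub, knot]
    rw [this, abs_mul]
    calc _ ≤ δ * (1 + C) := by
          gcongr
          exact (abs_add_le _ _).trans (by simpa using k0)
      _ = _ := by ring

/-- `tub` is uniformly bi-Lipschitz and open on a tube around the axis. -/
theorem exists_tub_bilip : ∃ δ c L, 0 < δ ∧ δ ≤ 1 ∧ 0 < c ∧ 0 < L ∧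
    (∀ y y', |y 1| ≤ δ → |y 2| ≤ δ → |y' 1| ≤ δ → |y' 2| ≤ δ →
      c * ‖y - y'‖ ≤ ‖tub y - tub y'‖ ∧ ‖tub y - tub y'‖ ≤ L * ‖y - y'‖) ∧
    ∀ y, |y 1| < δ → |y 2| < δ → map tub (𝓝 y) = 𝓝 (tub y) := by
  obtain ⟨B, hB, hinv⟩ := exists_tubLin_symm_le
  obtain ⟨C, hC, happ⟩ := exists_tub_sub_tubLin_le
  obtain ⟨C', hC', hkn⟩ := exists_tub_sub_knot_le
  obtain ⟨c₀, hc₀, hch⟩ := exists_knot_chord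
  obtain ⟨Ck, hCk, hk⟩ := exists_knotk_bound
  set η := 1 / (2 * B * C) with hη
  have hη0 : 0 < η := by positivity
  have hCη : C * η = 1 / (2 * B) := by rw [hη]; field_simp
  set δ := min (min 1 (η / 2)) (c₀ * η / (4 * C')) with hδ
  have hδ0 : 0 < δ := by positivity
  have hδ1 : δ ≤ 1 := (min_le_left _ _).trans (min_le_left _ _)
  have hδη : 2 * δ ≤ η := by
    have : δ ≤ η / 2 := (min_le_left _ _).trans (min_le_right _ _)
    linarith
  have hδc : 2 * (C' * δ) ≤ c₀ * η / 2 := by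
    have : δ ≤ c₀ * η / (4 * C') := min_le_right _ _
    rw [le_div_iff₀ (by positivity)] at this
    linarith
  have hlow : ∀ σ u, ‖u‖ / B ≤ ‖tubLin σ u‖ := fun σ u => by
    rw [div_le_iff₀ hB, mul_comm]
    simpa using hinv σ (tubLin σ u)
  refine ⟨δ, min (1 / (2 * B)) (c₀ / 2), 1 + 3 * Ck + 1, hδ0, hδ1, by positivity,
    by positivity, fun y y' h1 h2 h1' h2' => ⟨?_, ?_⟩, fun y h1 h2 => ?_⟩
  · have hn := norm_nonneg (y - y')
    rcases le_total |y 0 - y' 0| η with h | h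
    · have e1 := happ (y' 0) η y y' h (by simpa using hη0.le) (by linarith) (by linarith)
      have e2 := hlow (y' 0) (y - y')
      have e3 : ‖tubLin (y' 0) (y - y')‖ ≤ ‖tub y - tub y'‖ +
          ‖tub y - tub y' - tubLin (y' 0) (y - y')‖ := by
        rw [norm_sub_rev (tub y - tub y')]
        exact (norm_le_norm_add_norm_sub' _ _).trans (by rw [norm_sub_rev])
      rw [hCη] at e1
      calc _ ≤ 1 / (2 * B) * ‖y - y'‖ := by gcongr; exact min_le_left _ _
        _ = ‖y - y'‖ / B - 1 / (2 * B) * ‖y - y'‖ := by field_simp; ring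
        _ ≤ _ := by linarith
    · have e1 := hkn y δ h1 h2
      have e2 := hkn y' δ h1' h2'
      have e3 := hch (y 0) (y' 0)
      have e4 : ‖knot (y 0) - knot (y' 0)‖ ≤ ‖tub y - knot (y 0)‖ + ‖tub y' - knot (y' 0)‖ +
          ‖tub y - tub y'‖ := by
        have : knot (y 0) - knot (y' 0) =
          -(tub y - knot (y 0)) + (tub y' - knot (y' 0)) + (tub y - tub y') := by abel
        rw [this]
        refine (norm_add_le _ _).trans ?_
        gcongr
        refine (norm_add_le _ _).trans ?_
        rw [norm_neg]
      have e5 : ‖y - y'‖ ≤ |y 0 - y' 0| := by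
        refine pi3_norm_le le_rfl ?_ ?_
        · exact (abs_sub _ _).trans (by linarith)
        · exact (abs_sub _ _).trans (by linarith)
      calc _ ≤ c₀ / 2 * |y 0 - y' 0| := by gcongr; exact min_le_right _ _
        _ ≤ _ := by nlinarith
  · have hn := norm_nonneg (y - y')
    have w0 : |y 0 - y' 0| ≤ ‖y - y'‖ := norm_le_pi_norm (y - y') 0
    have w1 : |y 1 - y' 1| ≤ ‖y - y'‖ := norm_le_pi_norm (y - y') 1
    have w2 : |y 2 - y' 2| ≤ ‖y - y'‖ := norm_le_pi_norm (y - y') 2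
    have hkl : ∀ i, |knotk i (y 0) - knotk i (y' 0)| ≤ Ck * ‖y - y'‖ := fun i =>
      (knotk_sub_le (fun i σ => (hk i σ).2.1) i _ _).trans (by gcongr)
    have hv : ∀ i, |y 2 * knotk' i (y 0) - y' 2 * knotk' i (y' 0)| ≤ 2 * Ck * ‖y - y'‖ :=
      fun i => by
      have : y 2 * knotk' i (y 0) - y' 2 * knotk' i (y' 0) =
        (y 2 - y' 2) * knotk' i (y 0) + y' 2 * (knotk' i (y 0) - knotk' i (y' 0)) := by ring
      rw [this]
      refine (abs_add_le _ _).trans ?_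
      rw [abs_mul, abs_mul]
      calc _ ≤ ‖y - y'‖ * Ck + 1 * (Ck * ‖y - y'‖) := by
            gcongr
            · exact (hk i _).2.1
            · linarith
            · exact (knotk'_sub_le (fun i σ => (hk i σ).2.2.2.1) i _ _).trans (by gcongr)
        _ = _ := by ring
    refine pi3_norm_le ?_ ?_ ?_
    · have : (tub y - tub y') 0 = (y 0 - y' 0) + (knotk 0 (y 0) - knotk 0 (y' 0)) -
          (y 2 * knotk' 2 (y 0) - y' 2 * knotk' 2 (y' 0)) := by simp [tub]; ring
      rw [this]
      refine (abs_sub _ _).trans ?_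
      have := abs_add_le (y 0 - y' 0) (knotk 0 (y 0) - knotk 0 (y' 0))
      linarith [hkl 0, hv 2]
    · have : (tub y - tub y') 1 = (y 1 - y' 1) + (knotk 1 (y 0) - knotk 1 (y' 0)) := by
        simp [tub]; ring
      rw [this]
      refine (abs_add_le _ _).trans ?_
      have : 0 ≤ Ck * ‖y - y'‖ := by positivity
      linarith [hkl 1]
    · have : (tub y - tub y') 2 = (y 2 - y' 2) + (knotk 2 (y 0) - knotk 2 (y' 0)) +
          (y 2 * knotk' 0 (y 0) - y' 2 * knotk' 0 (y' 0)) := by simp [tub]; ring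
      rw [this]
      refine (abs_add_le _ _).trans ?_
      have := abs_add_le (y 2 - y' 2) (knotk 2 (y 0) - knotk 2 (y' 0))
      linarith [hkl 2, hv 0]
  · set s : Set (Fin 3 → ℝ) := {z | |z 0 - y 0| < η ∧ |z 2| < η} with hs
    have hso : s ∈ 𝓝 y := by
      have h1o : IsOpen {z : Fin 3 → ℝ | |z 0 - y 0| < η} :=
        isOpen_lt (by fun_prop) continuous_const
      have h2o : IsOpen {z : Fin 3 → ℝ | |z 2| < η} :=
        isOpen_lt (by fun_prop) continuous_const
      refine (h1o.inter h2o).mem_nhds ⟨?_, ?_⟩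
      · show |y 0 - y 0| < η
        simpa using hη0
      · show |y 2| < η
        linarith
    have hA : ApproximatesLinearOn tub (tubLin (y 0) : (Fin 3 → ℝ) →L[ℝ] (Fin 3 → ℝ)) s
        ⟨1 / (2 * B), by positivity⟩ := fun z hz z' hz' => by
      have := happ (y 0) η z z' hz.1.le hz'.1.le hz.2.le hz'.2.le
      rw [hCη] at this
      exact this
    refine hA.map_nhds_eq ⟨(tubLin (y 0)).symm, ⟨B, hB.le⟩, hinv (y 0),
      (tubLin (y 0)).apply_symm_apply⟩ hso (Or.inr ?_)
    change (1 / (2 * B) : ℝ) < B⁻¹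
    rw [one_div]
    exact inv_strictAnti₀ hB (by linarith)
end Tub

section Scaled
open Filter Topology

/-- The map `tub` rescaled by the factor `r`. -/
def stub (r : ℝ) (y : Fin 3 → ℝ) : Fin 3 → ℝ := r • tub (r⁻¹ • y)

theorem stub_eq {r : ℝ} (hr : r ≠ 0) (y : Fin 3 → ℝ) : stub r y =
    ![y 0 + r * knotk 0 (y 0 / r) - y 2 * knotk' 2 (y 0 / r), y 1 + r * knotk 1 (y 0 / r),
      r * knotk 2 (y 0 / r) + y 2 * (1 + knotk' 0 (y 0 / r))] := by
  ext i
  fin_cases i <;> simp [stub, tub, inv_mul_eq_div] <;> field_simp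

theorem exists_stub_sub_le : ∃ C, 0 < C ∧
    ∀ r y, 0 < r → |y 2| ≤ r → ‖stub r y - y‖ ≤ C * r := by
  obtain ⟨C, hC, hk⟩ := exists_knotk_bound
  refine ⟨2 * C, by positivity, fun r y hr h => ?_⟩
  have hk0 : ∀ i, |r * knotk i (y 0 / r)| ≤ C * r := fun i => by
    rw [abs_mul, abs_of_pos hr, mul_comm]
    gcongr
    exact (hk i _).1
  have hk1 : ∀ i, |y 2 * knotk' i (y 0 / r)| ≤ C * r := fun i => by
    rw [abs_mul, mul_comm]
    gcongr
    exact (hk i _).2.1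
  rw [stub_eq hr.ne']
  have hCr : 0 ≤ C * r := by positivity
  refine pi3_norm_le ?_ ?_ ?_
  · have e := abs_sub (r * knotk 0 (y 0 / r)) (y 2 * knotk' 2 (y 0 / r))
    calc |_| = |r * knotk 0 (y 0 / r) - y 2 * knotk' 2 (y 0 / r)| := by simp; ring_nf
      _ ≤ _ := by linarith [hk0 0, hk1 2]
  · calc |_| = |r * knotk 1 (y 0 / r)| := by simp
      _ ≤ _ := by linarith [hk0 1]
  · have e := abs_add_le (r * knotk 2 (y 0 / r)) (y 2 * knotk' 0 (y 0 / r))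
    calc |_| = |r * knotk 2 (y 0 / r) + y 2 * knotk' 0 (y 0 / r)| := by simp; ring_nf
      _ ≤ _ := by linarith [hk0 2, hk1 0]

theorem hasDerivAt_mul_knotk (i : Fin 3) (s : ℝ) {r : ℝ} (hr : r ≠ 0) :
    HasDerivAt (fun r => r * knotk i (s / r)) (knotk i (s / r) - s / r * knotk' i (s / r)) r := by
  have h1 : HasDerivAt (fun r : ℝ => s / r) (-s / r ^ 2) r := by
    refine ((hasDerivAt_const r s).div (hasDerivAt_id r) hr).congr_deriv ?_
    simp
  refine ((hasDerivAt_id r).mul ((hasDerivAt_knotk i (s / r)).comp r h1)).congr_deriv ?_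
  simp
  field_simp
  ring

theorem hasDerivAt_knotk'_div (i : Fin 3) (s : ℝ) {r : ℝ} (hr : r ≠ 0) :
    HasDerivAt (fun r => knotk' i (s / r)) (-(s / r * knotk'' i (s / r)) / r) r := by
  have h1 : HasDerivAt (fun r : ℝ => s / r) (-s / r ^ 2) r := by
    refine ((hasDerivAt_const r s).div (hasDerivAt_id r) hr).congr_deriv ?_
    simp
  refine ((hasDerivAt_knotk' i (s / r)).comp r h1).congr_deriv ?_
  field_simp

theorem exists_stub_sub_stub_le : ∃ C, 0 < C ∧
    ∀ r r' y, 0 < r' → r' ≤ r → |y 2| ≤ r' → ‖stub r y - stub r' y‖ ≤ C * (r - r') := by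
  obtain ⟨C, hC, hk⟩ := exists_knotk_bound
  refine ⟨3 * C, by positivity, fun r r' y hr' hr h => ?_⟩
  have hr0 : 0 < r := hr'.trans_le hr
  have hrr : 0 ≤ r - r' := sub_nonneg.2 hr
  have hk0 : ∀ i, |r * knotk i (y 0 / r) - r' * knotk i (y 0 / r')| ≤ 2 * C * (r - r') :=
    fun i => by
    have := Convex.norm_image_sub_le_of_norm_hasDerivWithin_le (s := Icc r' r) (C := 2 * C)
      (fun x hx => (hasDerivAt_mul_knotk i (y 0) (hr'.trans_le hx.1).ne').hasDerivWithinAt)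
      (fun x _ => (abs_sub _ _).trans (by
        linarith [(hk i (y 0 / x)).1, (hk i (y 0 / x)).2.2.1])) (convex_Icc _ _)
      (left_mem_Icc.2 hr) (right_mem_Icc.2 hr)
    rw [Real.norm_eq_abs, Real.norm_eq_abs, abs_of_nonneg hrr] at this
    exact this
  have hk1 : ∀ i, |y 2 * knotk' i (y 0 / r) - y 2 * knotk' i (y 0 / r')| ≤ C * (r - r') :=
    fun i => by
    have := Convex.norm_image_sub_le_of_norm_hasDerivWithin_le (s := Icc r' r) (C := C)
      (fun x hx => ((hasDerivAt_knotk'_div i (y 0)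
        (hr'.trans_le hx.1).ne').const_mul (y 2)).hasDerivWithinAt)
      (fun x hx => by
        have hx0 := hr'.trans_le hx.1
        rw [Real.norm_eq_abs, abs_mul, abs_div, abs_neg, abs_of_pos hx0, ← mul_div_assoc,
          div_le_iff₀ hx0, mul_comm]
        gcongr
        · exact (hk i (y 0 / x)).2.2.2.2
        · exact h.trans hx.1) (convex_Icc _ _)
      (left_mem_Icc.2 hr) (right_mem_Icc.2 hr)
    rw [Real.norm_eq_abs, Real.norm_eq_abs, abs_of_nonneg hrr] at this
    exact this
  rw [stub_eq hr0.ne', stub_eq hr'.ne']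
  have hCr : 0 ≤ C * (r - r') := by positivity
  refine pi3_norm_le ?_ ?_ ?_
  · have e := abs_sub (r * knotk 0 (y 0 / r) - r' * knotk 0 (y 0 / r'))
      (y 2 * knotk' 2 (y 0 / r) - y 2 * knotk' 2 (y 0 / r'))
    calc |_| = |(r * knotk 0 (y 0 / r) - r' * knotk 0 (y 0 / r')) -
          (y 2 * knotk' 2 (y 0 / r) - y 2 * knotk' 2 (y 0 / r'))| := by simp; ring_nf
      _ ≤ _ := by linarith [hk0 0, hk1 2]
  · calc |_| = |r * knotk 1 (y 0 / r) - r' * knotk 1 (y 0 / r')| := by simp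
      _ ≤ _ := by linarith [hk0 1]
  · have e := abs_add_le (r * knotk 2 (y 0 / r) - r' * knotk 2 (y 0 / r'))
      (y 2 * knotk' 0 (y 0 / r) - y 2 * knotk' 0 (y 0 / r'))
    calc |_| = |(r * knotk 2 (y 0 / r) - r' * knotk 2 (y 0 / r')) +
          (y 2 * knotk' 0 (y 0 / r) - y 2 * knotk' 0 (y 0 / r'))| := by simp; ring_nf
      _ ≤ _ := by linarith [hk0 2, hk1 0]

/-- Far out along the negative axis `stub r` is close to the identity. -/
theorem exists_stub_near_id {κ : ℝ} (hκ : 0 < κ) : ∃ M, 0 < M ∧ ∀ r y y', 0 < r →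
    y 0 ≤ -(M * r) → y' 0 ≤ -(M * r) → |y 2| ≤ r → |y' 2| ≤ r →
    ‖(stub r y - y) - (stub r y' - y')‖ ≤ κ * ‖y - y'‖ := by
  obtain ⟨C, hC, hk⟩ := exists_knotk_bound
  refine ⟨3 * C / κ, by positivity, fun r y y' hr h h' h2 h2' => ?_⟩
  set M := 3 * C / κ with hM
  have hM0 : 0 < M := by positivity
  have hCM : C / M = κ / 3 := by rw [hM]; field_simp
  have hn := norm_nonneg (y - y')
  have w0 : |y 0 - y' 0| ≤ ‖y - y'‖ := norm_le_pi_norm (y - y') 0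
  have w2 : |y 2 - y' 2| ≤ ‖y - y'‖ := norm_le_pi_norm (y - y') 2
  have hs : y 0 / r ∈ Iic (-M) := by rw [mem_Iic, div_le_iff₀ hr]; linarith
  have hs' : y' 0 / r ∈ Iic (-M) := by rw [mem_Iic, div_le_iff₀ hr]; linarith
  have far : ∀ {f : ℝ → ℝ} (x : ℝ), x ∈ Iic (-M) → |x * f x| ≤ C → |f x| ≤ κ / 3 := by
    intro f x hx hf
    rw [← hCM, le_div_iff₀ hM0]
    refine le_trans ?_ hf
    rw [abs_mul, mul_comm]
    gcongr
    rw [abs_of_neg (by linarith [mem_Iic.1 hx])]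
    linarith [mem_Iic.1 hx]
  have hd : |y 0 / r - y' 0 / r| = |y 0 - y' 0| / r := by
    rw [← sub_div, abs_div, abs_of_pos hr]
  have hk0 : ∀ i, |r * knotk i (y 0 / r) - r * knotk i (y' 0 / r)| ≤ κ / 3 * ‖y - y'‖ :=
    fun i => by
    have := Convex.norm_image_sub_le_of_norm_hasDerivWithin_le (s := Iic (-M)) (C := κ / 3)
      (fun x _ => (hasDerivAt_knotk i x).hasDerivWithinAt)
      (fun x hx => far x hx (hk i x).2.2.1) (convex_Iic _) hs' hs
    rw [Real.norm_eq_abs, Real.norm_eq_abs, hd] at this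
    rw [← mul_sub, abs_mul, abs_of_pos hr]
    calc _ ≤ r * (κ / 3 * (|y 0 - y' 0| / r)) := by gcongr
      _ = κ / 3 * |y 0 - y' 0| := by field_simp
      _ ≤ _ := by gcongr
  have hk1 : ∀ i, |y 2 * knotk' i (y 0 / r) - y' 2 * knotk' i (y' 0 / r)| ≤
      2 * (κ / 3) * ‖y - y'‖ := fun i => by
    have := Convex.norm_image_sub_le_of_norm_hasDerivWithin_le (s := Iic (-M)) (C := κ / 3)
      (fun x _ => (hasDerivAt_knotk' i x).hasDerivWithinAt)
      (fun x hx => far x hx (hk i x).2.2.2.2) (convex_Iic _) hs' hs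
    rw [Real.norm_eq_abs, Real.norm_eq_abs, hd] at this
    have e : y 2 * knotk' i (y 0 / r) - y' 2 * knotk' i (y' 0 / r) =
      (y 2 - y' 2) * knotk' i (y 0 / r) +
        y' 2 * (knotk' i (y 0 / r) - knotk' i (y' 0 / r)) := by ring
    rw [e]
    refine (abs_add_le _ _).trans ?_
    rw [abs_mul, abs_mul]
    calc _ ≤ ‖y - y'‖ * (κ / 3) + r * (κ / 3 * (|y 0 - y' 0| / r)) := by
          gcongr
          exact far _ hs (hk i _).2.2.1
      _ = ‖y - y'‖ * (κ / 3) + κ / 3 * |y 0 - y' 0| := by field_simp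
      _ ≤ ‖y - y'‖ * (κ / 3) + κ / 3 * ‖y - y'‖ := by gcongr
      _ = _ := by ring
  rw [stub_eq hr.ne', stub_eq hr.ne']
  have hCr : 0 ≤ κ * ‖y - y'‖ := by positivity
  refine pi3_norm_le ?_ ?_ ?_
  · have e := abs_sub (r * knotk 0 (y 0 / r) - r * knotk 0 (y' 0 / r))
      (y 2 * knotk' 2 (y 0 / r) - y' 2 * knotk' 2 (y' 0 / r))
    calc |_| = |(r * knotk 0 (y 0 / r) - r * knotk 0 (y' 0 / r)) -
          (y 2 * knotk' 2 (y 0 / r) - y' 2 * knotk' 2 (y' 0 / r))| := by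
            simp [Matrix.vecHead]; ring_nf
      _ ≤ _ := by linarith [hk0 0, hk1 2]
  · calc |_| = |r * knotk 1 (y 0 / r) - r * knotk 1 (y' 0 / r)| := by
          simp [Matrix.vecHead, Matrix.vecTail]
      _ ≤ _ := by linarith [hk0 1]
  · have e := abs_add_le (r * knotk 2 (y 0 / r) - r * knotk 2 (y' 0 / r))
      (y 2 * knotk' 0 (y 0 / r) - y' 2 * knotk' 0 (y' 0 / r))
    calc |_| = |(r * knotk 2 (y 0 / r) - r * knotk 2 (y' 0 / r)) +
          (y 2 * knotk' 0 (y 0 / r) - y' 2 * knotk' 0 (y' 0 / r))| := by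
          have e1 : Matrix.vecHead (Matrix.vecTail (Matrix.vecTail y)) = y 2 := rfl
          have e2 : Matrix.vecHead (Matrix.vecTail (Matrix.vecTail y')) = y' 2 := rfl
          simp [e1, e2]; ring_nf
      _ ≤ _ := by linarith [hk0 2, hk1 0]

/-- Scales that are `o(t ^ 2)` and larger than `t ^ 3`. -/
structure IsRad (ρ : ℝ → ℝ) : Prop where
  cont : Continuous ρ
  zero : ρ 0 = 0
  pos : ∀ t, 0 < t → 0 < ρ t
  mono : Monotone ρ
  sq : ∀ κ > 0, ∀ᶠ t in 𝓝[>] (0 : ℝ), ρ t ≤ κ * t ^ 2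
  cube : ∀ κ > 0, ∀ᶠ t in 𝓝[>] (0 : ℝ), t ^ 3 ≤ κ * ρ t
  lip : ∀ κ > 0, ∃ ε > 0, ∀ t u, 0 ≤ t → t ≤ ε → 0 ≤ u → u ≤ ε → |ρ t - ρ u| ≤ κ * |t - u|

/-- The scale of the `n`-th model. -/
def rad (n : ℕ) (t : ℝ) : ℝ := (max t 0) ^ (2 + 1 / ((n : ℝ) + 2))

theorem tendsto_rpow_nhdsGT_zero {a : ℝ} (ha : 0 < a) :
    Tendsto (fun t : ℝ => t ^ a) (𝓝[>] 0) (𝓝 0) := by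
  have := (Real.continuousAt_rpow_const 0 a (Or.inr ha.le)).tendsto
  rw [Real.zero_rpow ha.ne'] at this
  exact this.mono_left nhdsWithin_le_nhds

theorem isRad_rad (n : ℕ) : IsRad (rad n) := by
  set a : ℝ := 1 / ((n : ℝ) + 2) with ha
  have ha0 : 0 < a := by positivity
  have ha1 : a < 1 := by
    rw [ha, div_lt_one (by positivity)]
    have : (0 : ℝ) ≤ n := Nat.cast_nonneg n
    linarith
  have hrad : ∀ t, rad n t = (max t 0) ^ (2 + a) := fun t => rfl
  have hpos : ∀ t, 0 < t → rad n t = t ^ 2 * t ^ a := fun t ht => by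
    rw [hrad, max_eq_left ht.le, Real.rpow_add ht]
    norm_num
  refine ⟨?_, ?_, fun t ht => ?_, fun t t' h => ?_, fun κ hκ => ?_, fun κ hκ => ?_,
    fun κ hκ => ?_⟩
  · exact (continuous_id.max continuous_const).rpow_const fun x => Or.inr (by positivity)
  · rw [hrad, max_self, Real.zero_rpow (by positivity)]
  · rw [hpos t ht]; positivity
  · exact Real.rpow_le_rpow (le_max_right _ _) (max_le_max_right _ h) (by positivity)
  · filter_upwards [(tendsto_rpow_nhdsGT_zero ha0).eventually (ge_mem_nhds hκ),
      self_mem_nhdsWithin] with t h1 h2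
    rw [hpos t h2, mul_comm]
    gcongr
  · filter_upwards [(tendsto_rpow_nhdsGT_zero (sub_pos.2 ha1)).eventually (ge_mem_nhds hκ),
      self_mem_nhdsWithin] with t h1 h2
    have h2' : 0 < t := h2
    have : t ^ 3 = t ^ (1 - a) * (t ^ 2 * t ^ a) := by
      have : t = t ^ (1 - a) * t ^ a := by
        rw [← Real.rpow_add h2']; simp
      calc t ^ 3 = t ^ 2 * t := by ring
        _ = t ^ 2 * (t ^ (1 - a) * t ^ a) := by rw [← this]
        _ = _ := by ring
    rw [this, hpos t h2]
    gcongr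
  · refine ⟨min 1 (κ / 3), by positivity, fun t t' h0 h1 h0' h1' => ?_⟩
    have key := Convex.norm_image_sub_le_of_norm_hasDerivWithin_le
      (s := Icc 0 (min 1 (κ / 3))) (f := fun x : ℝ => x ^ (2 + a)) (C := κ) (x := t') (y := t)
      (fun x _ => (Real.hasDerivAt_rpow_const (x := x) (p := 2 + a)
        (Or.inr (by linarith))).hasDerivWithinAt)
      (fun x hx => by
        have h3 : x ^ (2 + a - 1) ≤ x := by
          rcases eq_or_lt_of_le hx.1 with h | h
          · rw [← h, Real.zero_rpow (by linarith)]
          · calc x ^ (2 + a - 1) ≤ x ^ (1 : ℝ) :=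
                  Real.rpow_le_rpow_of_exponent_ge h (hx.2.trans (min_le_left _ _)) (by linarith)
              _ = x := Real.rpow_one x
        have h4 := Real.rpow_nonneg hx.1 (2 + a - 1)
        rw [Real.norm_eq_abs, abs_of_nonneg (by positivity)]
        have h5 := hx.2.trans (min_le_right _ _)
        calc (2 + a) * x ^ (2 + a - 1) ≤ 3 * x := by gcongr; linarith
          _ ≤ κ := by linarith) (convex_Icc _ _) ⟨h0', h1'⟩ ⟨h0, h1⟩
    rw [hrad, hrad, max_eq_left h0, max_eq_left h0']
    exact key
end Scaled

section Emb
open Filter Topology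

/-- The embedding of a tube around the plane `{y 1 = y 2 = 0}` that knots it at the scale `ρ`. -/
def emb (ρ : ℝ → ℝ) (p : ℝ × (Fin 3 → ℝ)) : ℝ × (Fin 3 → ℝ) := (p.1, stub (ρ p.1) p.2)

theorem emb_zero {ρ : ℝ → ℝ} (hρ : IsRad ρ) : emb ρ 0 = 0 := by
  ext i
  · rfl
  · simp [emb, stub, hρ.zero]

theorem prod_norm_le {p : ℝ × (Fin 3 → ℝ)} {r : ℝ} (h1 : |p.1| ≤ r) (h2 : ‖p.2‖ ≤ r) : ‖p‖ ≤ r :=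
  max_le h1 h2

theorem IsRad.small {ρ : ℝ → ℝ} (hρ : IsRad ρ) {κ : ℝ} (hκ : 0 < κ) :
    ∃ ε, 0 < ε ∧ ε ≤ 1 ∧ (∀ t, 0 < t → t ≤ ε → ρ t ≤ κ * t ^ 2 ∧ t ^ 3 ≤ κ * ρ t) ∧
      ∀ t t', 0 ≤ t → t ≤ ε → 0 ≤ t' → t' ≤ ε → |ρ t - ρ t'| ≤ κ * |t - t'| := by
  obtain ⟨ε₁, h₁, H₁⟩ := hρ.lip κ hκ
  obtain ⟨ε₂, h₂, H₂⟩ := mem_nhdsGT_iff_exists_Ioc_subset.1 ((hρ.sq κ hκ).and (hρ.cube κ hκ))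
  exact ⟨min 1 (min ε₁ ε₂), by have : 0 < ε₂ := h₂; positivity, min_le_left _ _, fun t h0 h =>
    H₂ ⟨h0, h.trans ((min_le_right _ _).trans (min_le_right _ _))⟩, fun t t' h0 h h0' h' =>
    H₁ t t' h0 (h.trans ((min_le_right _ _).trans (min_le_left _ _))) h0'
      (h'.trans ((min_le_right _ _).trans (min_le_left _ _)))⟩

/-- The tube on which `emb ρ` is bi-Lipschitz. -/
def tubeSet (ρ : ℝ → ℝ) (ε δ : ℝ) : Set (ℝ × (Fin 3 → ℝ)) :=
  {p | 0 < p.1 ∧ p.1 ≤ ε ∧ |p.2 1| ≤ δ * ρ p.1 ∧ |p.2 2| ≤ δ * ρ p.1}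

theorem exists_emb_bilip : ∃ δ c L, 0 < δ ∧ δ ≤ 1 ∧ 0 < c ∧ 0 < L ∧
    ∀ ρ, IsRad ρ → ∃ ε > 0, (∀ p ∈ insert 0 (tubeSet ρ ε δ), ∀ q ∈ insert 0 (tubeSet ρ ε δ),
      c * ‖p - q‖ ≤ ‖emb ρ p - emb ρ q‖ ∧ ‖emb ρ p - emb ρ q‖ ≤ L * ‖p - q‖) := by
  obtain ⟨δ, c, L, hδ, hδ1, hc, hL, hbi, -⟩ := exists_tub_bilip
  obtain ⟨C₁, hC₁, hid⟩ := exists_stub_sub_le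
  obtain ⟨C₂, hC₂, hr⟩ := exists_stub_sub_stub_le
  refine ⟨δ, min (c / (1 + C₂)) (1 / (1 + C₁)), 1 + L + C₂ + C₁, hδ, hδ1, by positivity,
    by positivity, fun ρ hρ => ?_⟩
  obtain ⟨ε, hε, hε1, hsq, hlip⟩ := hρ.small one_pos
  refine ⟨ε, hε, ?_⟩
  have zero : ∀ p ∈ tubeSet ρ ε δ, min (c / (1 + C₂)) (1 / (1 + C₁)) * ‖p‖ ≤ ‖emb ρ p‖ ∧
      ‖emb ρ p‖ ≤ (1 + L + C₂ + C₁) * ‖p‖ := by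
    rintro ⟨t, y⟩ ⟨ht, htε, h1, h2⟩
    dsimp only at ht htε h1 h2
    have hρt := hρ.pos t ht
    have h2' : |y 2| ≤ ρ t := h2.trans (by nlinarith)
    have e := hid (ρ t) y hρt h2'
    have hρt' : ρ t ≤ t := ((hsq t ht htε).1).trans (by nlinarith)
    have a1 : t ≤ ‖((t, y) : ℝ × (Fin 3 → ℝ))‖ := (le_abs_self t).trans (le_max_left _ _)
    have a2 : ‖y‖ ≤ ‖((t, y) : ℝ × (Fin 3 → ℝ))‖ := le_max_right _ _
    have b1 : t ≤ ‖emb ρ (t, y)‖ := (le_abs_self t).trans (le_max_left _ _)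
    have b2 : ‖stub (ρ t) y‖ ≤ ‖emb ρ (t, y)‖ := le_max_right _ _
    have hn := norm_nonneg ((t, y) : ℝ × (Fin 3 → ℝ))
    have hn' := norm_nonneg (emb ρ (t, y))
    have e3 : C₁ * ρ t ≤ C₁ * t := by gcongr
    have e4 : C₁ * t ≤ C₁ * ‖emb ρ (t, y)‖ := by gcongr
    have e5 : C₁ * t ≤ C₁ * ‖((t, y) : ℝ × (Fin 3 → ℝ))‖ := by gcongr
    constructor
    · calc _ ≤ 1 / (1 + C₁) * ‖((t, y) : ℝ × (Fin 3 → ℝ))‖ := by gcongr; exact min_le_right _ _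
        _ ≤ 1 / (1 + C₁) * ((1 + C₁) * ‖emb ρ (t, y)‖) := by
          gcongr
          refine prod_norm_le ?_ ?_
          · rw [abs_of_pos ht]; nlinarith
          · have := norm_le_norm_add_norm_sub' y (stub (ρ t) y)
            rw [norm_sub_rev] at this
            dsimp only
            linarith
        _ = _ := by field_simp
    · refine prod_norm_le ?_ ?_
      · change |t| ≤ _
        rw [abs_of_pos ht]
        have : 0 ≤ (L + C₂ + C₁) * ‖((t, y) : ℝ × (Fin 3 → ℝ))‖ := by positivity
        linarith
      · change ‖stub (ρ t) y‖ ≤ _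
        have := norm_le_norm_add_norm_sub' (stub (ρ t) y) y
        have h8 : 0 ≤ (L + C₂) * ‖((t, y) : ℝ × (Fin 3 → ℝ))‖ := by positivity
        linarith
  have main : ∀ p ∈ tubeSet ρ ε δ, ∀ q ∈ tubeSet ρ ε δ, q.1 ≤ p.1 →
      min (c / (1 + C₂)) (1 / (1 + C₁)) * ‖p - q‖ ≤ ‖emb ρ p - emb ρ q‖ ∧
      ‖emb ρ p - emb ρ q‖ ≤ (1 + L + C₂ + C₁) * ‖p - q‖ := by
    rintro ⟨t, y⟩ ⟨ht, htε, h1, h2⟩ ⟨t', y'⟩ ⟨ht', htε', h1', h2'⟩ htt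
    dsimp only at ht htε h1 h2 ht' htε' h1' h2' htt
    have hρt := hρ.pos t ht
    have hρt' := hρ.pos t' ht'
    have hρρ := hρ.mono htt
    have hdρ : δ * ρ t' ≤ δ * ρ t := by gcongr
    have e1 := hr (ρ t) (ρ t') y' hρt' hρρ (h2'.trans (by nlinarith))
    have e2 := hlip t t' ht.le htε ht'.le htε'
    rw [one_mul, abs_of_nonneg (sub_nonneg.2 hρρ)] at e2
    have e3 : c * ‖y - y'‖ ≤ ‖stub (ρ t) y - stub (ρ t) y'‖ ∧
        ‖stub (ρ t) y - stub (ρ t) y'‖ ≤ L * ‖y - y'‖ := by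
      have hs : ∀ z : Fin 3 → ℝ, ∀ i, |z i| ≤ δ * ρ t → |((ρ t)⁻¹ • z) i| ≤ δ := fun z i h => by
        rw [Pi.smul_apply, smul_eq_mul, abs_mul, abs_inv, abs_of_pos hρt, inv_mul_le_iff₀ hρt]
        linarith
      have := hbi ((ρ t)⁻¹ • y) ((ρ t)⁻¹ • y') (hs y 1 h1) (hs y 2 h2)
        (hs y' 1 (h1'.trans hdρ)) (hs y' 2 (h2'.trans hdρ))
      rw [stub, stub, ← smul_sub, norm_smul, Real.norm_eq_abs, abs_of_pos hρt]
      rw [← smul_sub, norm_smul, norm_inv, Real.norm_eq_abs, abs_of_pos hρt] at this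
      constructor
      · calc _ = ρ t * (c * ((ρ t)⁻¹ * ‖y - y'‖)) := by field_simp
          _ ≤ _ := by gcongr; exact this.1
      · calc _ ≤ ρ t * (L * ((ρ t)⁻¹ * ‖y - y'‖)) := by gcongr; exact this.2
          _ = _ := by field_simp
    set A := stub (ρ t) y - stub (ρ t) y' with hA
    set D := stub (ρ t) y' - stub (ρ t') y' with hD
    have hAD : A + D = stub (ρ t) y - stub (ρ t') y' := by rw [hA, hD]; abel
    have a1 : |t - t'| ≤ ‖((t, y) - (t', y') : ℝ × (Fin 3 → ℝ))‖ := le_max_left _ _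
    have a2 : ‖y - y'‖ ≤ ‖((t, y) - (t', y') : ℝ × (Fin 3 → ℝ))‖ := le_max_right _ _
    have b1 : |t - t'| ≤ ‖emb ρ (t, y) - emb ρ (t', y')‖ := le_max_left _ _
    have b2 : ‖A + D‖ ≤ ‖emb ρ (t, y) - emb ρ (t', y')‖ := by rw [hAD]; exact le_max_right _ _
    have hDle : ‖D‖ ≤ C₂ * |t - t'| := e1.trans (by gcongr)
    have hn := norm_nonneg ((t, y) - (t', y') : ℝ × (Fin 3 → ℝ))
    have hn' := norm_nonneg (emb ρ (t, y) - emb ρ (t', y'))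
    have e4 : C₂ * |t - t'| ≤ C₂ * ‖emb ρ (t, y) - emb ρ (t', y')‖ := by gcongr
    have e5 : C₂ * |t - t'| ≤ C₂ * ‖((t, y) - (t', y') : ℝ × (Fin 3 → ℝ))‖ := by gcongr
    have e6 : L * ‖y - y'‖ ≤ L * ‖((t, y) - (t', y') : ℝ × (Fin 3 → ℝ))‖ := by gcongr
    constructor
    · rcases le_total |t - t'| ‖y - y'‖ with h | h
      · calc _ ≤ c / (1 + C₂) * ‖y - y'‖ := by
              gcongr
              · exact min_le_left _ _
              · exact prod_norm_le h le_rfl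
          _ = 1 / (1 + C₂) * (c * ‖y - y'‖) := by ring
          _ ≤ 1 / (1 + C₂) * ((1 + C₂) * ‖emb ρ (t, y) - emb ρ (t', y')‖) := by
            refine mul_le_mul_of_nonneg_left ?_ (by positivity)
            have := norm_le_add_norm_add A D
            linarith [e3.1]
          _ = _ := by field_simp
      · calc _ ≤ 1 / (1 + C₁) * |t - t'| := by
              gcongr
              · exact min_le_right _ _
              · exact prod_norm_le le_rfl h
          _ ≤ 1 * |t - t'| := by
            gcongr
            rw [div_le_one (by positivity)]
            linarith
          _ ≤ _ := by linarith
    · have h9 : 0 ≤ (L + C₂ + C₁) * ‖((t, y) - (t', y') : ℝ × (Fin 3 → ℝ))‖ := by positivity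
      have h10 : 0 ≤ (1 + C₁) * ‖((t, y) - (t', y') : ℝ × (Fin 3 → ℝ))‖ := by positivity
      refine prod_norm_le ?_ ?_
      · change |t - t'| ≤ _
        linarith
      · change ‖stub (ρ t) y - stub (ρ t') y'‖ ≤ _
        rw [← hAD]
        refine (norm_add_le _ _).trans ?_
        linarith [e3.2]
  rintro p (rfl | hp) q (rfl | hq)
  · simp
  · rw [zero_sub, emb_zero hρ, zero_sub, norm_neg, norm_neg]
    exact zero q hq
  · rw [sub_zero, emb_zero hρ, sub_zero]
    exact zero p hp
  · rcases le_total q.1 p.1 with h | h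
    · exact main p hp q hq h
    · rw [norm_sub_rev, norm_sub_rev (emb ρ p)]
      exact main q hq p hp h

theorem exists_map_emb_nhds : ∃ δ, 0 < δ ∧ ∀ ρ, IsRad ρ → ∀ p, 0 < p.1 →
    |p.2 1| < δ * ρ p.1 → |p.2 2| < δ * ρ p.1 → map (emb ρ) (𝓝 p) = 𝓝 (emb ρ p) := by
  obtain ⟨δ, c, L, hδ, -, -, -, -, hop⟩ := exists_tub_bilip
  refine ⟨δ, hδ, fun ρ hρ p hp h1 h2 => ?_⟩
  have hρp := hρ.pos _ hp
  set r : ℝ → ℝ := fun t => max (ρ t) (ρ p.1 / 2) with hr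
  have hr0 : ∀ t, 0 < r t := fun t => lt_max_of_lt_right (by positivity)
  have hrc : Continuous r := hρ.cont.max continuous_const
  let Θ : (ℝ × (Fin 3 → ℝ)) ≃ₜ (ℝ × (Fin 3 → ℝ)) :=
    { toFun := fun q => (q.1, (r q.1)⁻¹ • q.2)
      invFun := fun q => (q.1, r q.1 • q.2)
      left_inv := fun q => by simp [smul_smul, (hr0 q.1).ne']
      right_inv := fun q => by simp [smul_smul, (hr0 q.1).ne']
      continuous_toFun := by
        have : Continuous fun q : ℝ × (Fin 3 → ℝ) => (r q.1)⁻¹ :=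
          (hrc.comp continuous_fst).inv₀ fun q => (hr0 q.1).ne'
        exact continuous_fst.prodMk (this.smul continuous_snd)
      continuous_invFun :=
        continuous_fst.prodMk ((hrc.comp continuous_fst).smul continuous_snd) }
  have hev : emb ρ =ᶠ[𝓝 p] Θ.symm ∘ Prod.map id tub ∘ Θ := by
    have : ∀ᶠ q in 𝓝 p, ρ p.1 / 2 < ρ q.1 :=
      (hρ.cont.comp continuous_fst).continuousAt.eventually (lt_mem_nhds (by
        show ρ p.1 / 2 < ρ p.1
        linarith))
    filter_upwards [this] with q hq
    have hrq : r q.1 = ρ q.1 := max_eq_left hq.le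
    show (q.1, stub (ρ q.1) q.2) = (q.1, r q.1 • tub ((r q.1)⁻¹ • q.2))
    rw [hrq, stub]
  rw [Filter.map_congr hev, hev.eq_of_nhds, ← Filter.map_map, ← Filter.map_map, Θ.map_nhds_eq,
    nhds_prod_eq, ← Filter.prod_map_map_eq', Filter.map_id, hop, ← nhds_prod_eq]
  · exact Θ.symm.map_nhds_eq _
  · show |(r p.1)⁻¹ * p.2 1| < δ
    rw [abs_mul, abs_inv, abs_of_pos (hr0 _), inv_mul_lt_iff₀ (hr0 _), hr]
    simp only [max_eq_left (by linarith : ρ p.1 / 2 ≤ ρ p.1)]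
    linarith
  · show |(r p.1)⁻¹ * p.2 2| < δ
    rw [abs_mul, abs_inv, abs_of_pos (hr0 _), inv_mul_lt_iff₀ (hr0 _), hr]
    simp only [max_eq_left (by linarith : ρ p.1 / 2 ≤ ρ p.1)]
    linarith

/-- The region beside the horn in which `emb ρ` is close to the identity. -/
def sideSet (ε : ℝ) : Set (ℝ × (Fin 3 → ℝ)) :=
  {p | 0 < p.1 ∧ p.1 ≤ ε ∧ -(9 * p.1 ^ 2) ≤ p.2 0 ∧ p.2 0 ≤ -(4 * p.1 ^ 2) ∧ |p.2 2| ≤ 3 * p.1 ^ 5}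

theorem exists_emb_near_id {ρ : ℝ → ℝ} (hρ : IsRad ρ) {κ : ℝ} (hκ : 0 < κ) : ∃ ε > 0,
    ∀ p ∈ insert 0 (sideSet ε), ∀ q ∈ insert 0 (sideSet ε),
      ‖(emb ρ p - p) - (emb ρ q - q)‖ ≤ κ * ‖p - q‖ := by
  obtain ⟨C₁, hC₁, hid⟩ := exists_stub_sub_le
  obtain ⟨C₂, hC₂, hr⟩ := exists_stub_sub_stub_le
  obtain ⟨M, hM, hnear⟩ := exists_stub_near_id (half_pos hκ)
  obtain ⟨ε₀, hε₀, hε₁, hsq, hlip⟩ := hρ.small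
    (κ := min (min (1 / 3) (1 / M)) (min (κ / (8 * C₁)) (κ / (2 * (C₂ + 1))))) (by positivity)
  set κ' := min (min (1 / 3) (1 / M)) (min (κ / (8 * C₁)) (κ / (2 * (C₂ + 1)))) with hκ'
  have k1 : κ' ≤ 1 / 3 := (min_le_left _ _).trans (min_le_left _ _)
  have k2 : κ' * M ≤ 1 := by
    rw [← le_div_iff₀ hM]; exact (min_le_left _ _).trans (min_le_right _ _)
  have k3 : κ' * (8 * C₁) ≤ κ := by
    rw [← le_div_iff₀ (by positivity)]; exact (min_le_right _ _).trans (min_le_left _ _)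
  have k4 : κ' * (2 * (C₂ + 1)) ≤ κ := by
    rw [← le_div_iff₀ (by positivity)]; exact (min_le_right _ _).trans (min_le_right _ _)
  have hκ0 : 0 < κ' := by positivity
  have hv : ∀ p ∈ sideSet ε₀, |p.2 2| ≤ ρ p.1 := by
    rintro ⟨t, y⟩ ⟨ht, htε, -, -, h2⟩
    dsimp only at ht htε h2 ⊢
    have h3 := (hsq t ht htε).2
    have hρt := hρ.pos t ht
    have ht2 : t ^ 2 ≤ 1 := pow_le_one₀ ht.le (htε.trans hε₁)
    have h4 : κ' * ρ t ≤ 1 / 3 * ρ t := by gcongr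
    have h5 : t ^ 5 ≤ t ^ 3 := pow_le_pow_of_le_one ht.le (htε.trans hε₁) (by norm_num)
    linarith
  have hbd : ∀ p ∈ sideSet ε₀, ‖stub (ρ p.1) p.2 - p.2‖ ≤ κ / 8 * p.1 := by
    intro p hp
    refine (hid _ _ (hρ.pos _ hp.1) (hv p hp)).trans ?_
    have h1 := (hsq p.1 hp.1 hp.2.1).1
    have h2 : p.1 ^ 2 ≤ p.1 := by nlinarith [hp.1, hp.2.1]
    calc C₁ * ρ p.1 ≤ C₁ * (κ' * p.1) := by
          gcongr
          exact h1.trans (by gcongr)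
      _ = κ' * (8 * C₁) / 8 * p.1 := by ring
      _ ≤ _ := by have := hp.1; gcongr
  have hfst : ∀ p q : ℝ × (Fin 3 → ℝ), ‖(emb ρ p - p) - (emb ρ q - q)‖ =
      ‖(stub (ρ p.1) p.2 - p.2) - (stub (ρ q.1) q.2 - q.2)‖ := fun p q => by
    rw [Prod.norm_def]
    have : ((emb ρ p - p) - (emb ρ q - q)).1 = 0 := by simp [emb]
    rw [this, norm_zero]
    exact max_eq_right (norm_nonneg _)
  have zero : ∀ p ∈ sideSet ε₀, ‖emb ρ p - p‖ ≤ κ * ‖p‖ := by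
    intro p hp
    have h1 := hfst p 0
    have h2 : emb ρ 0 - 0 = 0 := by rw [emb_zero hρ]; simp
    have h3 : stub (ρ (0 : ℝ × (Fin 3 → ℝ)).1) (0 : ℝ × (Fin 3 → ℝ)).2 -
      (0 : ℝ × (Fin 3 → ℝ)).2 = 0 := congrArg Prod.snd h2
    rw [h2, h3, sub_zero, sub_zero] at h1
    rw [h1]
    have h4 : p.1 ≤ ‖p‖ := (le_abs_self _).trans (le_max_left _ _)
    have := hp.1
    calc _ ≤ κ / 8 * p.1 := hbd p hp
      _ ≤ κ * p.1 := by gcongr; linarith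
      _ ≤ _ := by gcongr
  have main : ∀ p ∈ sideSet ε₀, ∀ q ∈ sideSet ε₀, q.1 ≤ p.1 →
      ‖(emb ρ p - p) - (emb ρ q - q)‖ ≤ κ * ‖p - q‖ := by
    intro p hp q hq hqp
    rw [hfst]
    have a1 : |p.1 - q.1| ≤ ‖p - q‖ := le_max_left _ _
    have a2 : ‖p.2 - q.2‖ ≤ ‖p - q‖ := le_max_right _ _
    have hn := norm_nonneg (p - q)
    have hp0 := hp.1
    have hq0 := hq.1
    rw [abs_of_nonneg (sub_nonneg.2 hqp)] at a1
    rcases le_total p.1 (2 * q.1) with h | h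
    · have hρρ := hρ.mono hqp
      have e1 := hr (ρ p.1) (ρ q.1) q.2 (hρ.pos _ hq0) hρρ (hv q hq)
      have e2 := hlip p.1 q.1 hp0.le hp.2.1 hq0.le hq.2.1
      rw [abs_of_nonneg (sub_nonneg.2 hρρ), abs_of_nonneg (sub_nonneg.2 hqp)] at e2
      have hMρ : M * ρ p.1 ≤ p.1 ^ 2 := by
        calc M * ρ p.1 ≤ M * (κ' * p.1 ^ 2) := by gcongr; exact (hsq _ hp0 hp.2.1).1
          _ = κ' * M * p.1 ^ 2 := by ring
          _ ≤ _ := mul_le_of_le_one_left (by positivity) k2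
      have hpq : p.1 ^ 2 ≤ (2 * q.1) ^ 2 := by gcongr
      have e3 := hnear (ρ p.1) p.2 q.2 (hρ.pos _ hp0) (by nlinarith [hp.2.2.2.1])
        (by nlinarith [hq.2.2.2.1]) (hv p hp) ((hv q hq).trans hρρ)
      have e4 : (stub (ρ p.1) p.2 - p.2) - (stub (ρ q.1) q.2 - q.2) =
        ((stub (ρ p.1) p.2 - p.2) - (stub (ρ p.1) q.2 - q.2)) +
          (stub (ρ p.1) q.2 - stub (ρ q.1) q.2) := by abel
      rw [e4]
      refine (norm_add_le _ _).trans ?_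
      calc _ ≤ κ / 2 * ‖p.2 - q.2‖ + C₂ * (κ' * (p.1 - q.1)) := by
            gcongr; exact e1.trans (by gcongr)
        _ ≤ κ / 2 * ‖p - q‖ + C₂ * (κ' * ‖p - q‖) := by gcongr
        _ ≤ κ / 2 * ‖p - q‖ + (C₂ + 1) * (κ' * ‖p - q‖) := by gcongr; linarith
        _ = κ / 2 * ‖p - q‖ + (κ' * (2 * (C₂ + 1))) / 2 * ‖p - q‖ := by ring
        _ ≤ κ / 2 * ‖p - q‖ + κ / 2 * ‖p - q‖ := by gcongr
        _ = _ := by ring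
    · calc _ ≤ κ / 8 * p.1 + κ / 8 * q.1 :=
            (norm_sub_le _ _).trans (add_le_add (hbd p hp) (hbd q hq))
        _ ≤ κ * (p.1 - q.1) := by nlinarith
        _ ≤ _ := by gcongr
  refine ⟨ε₀, hε₀, ?_⟩
  rintro p (rfl | hp) q (rfl | hq)
  · simp
  · rw [emb_zero hρ, sub_zero, zero_sub, norm_neg, zero_sub, norm_neg]
    exact zero q hq
  · rw [emb_zero hρ, sub_zero, sub_zero, sub_zero]
    exact zero p hp
  · rcases le_total q.1 p.1 with h | h
    · exact main p hp q hq h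
    · rw [norm_sub_rev, norm_sub_rev p]
      exact main q hq p hp h
end Emb

section Unknot
open Filter Topology

/-- Conjugate a homeomorphism supported in a compact set by an embedding of that set. -/
theorem exists_conj_homeomorph {X : Type*} [TopologicalSpace X] [T2Space X] {K : Set X}
    (hK : IsCompact K) {E : X → X} (hE : ContinuousOn E K) (hinj : InjOn E K)
    (hint : ∀ x ∈ interior K, E x ∈ interior (E '' K)) (c : X ≃ₜ X) (hc : ∀ x ∉ K, c x = x) :
    ∃ C : X ≃ₜ X, ∀ x ∈ K, C (E x) = E (c x) := by
  classical
  rcases isEmpty_or_nonempty X with hX | hX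
  · exact ⟨c, fun x => (hX.false x).elim⟩
  have hKc : IsClosed (E '' K) := (hK.image_of_continuousOn hE).isClosed
  have hG : ContinuousOn (Function.invFunOn E K) (E '' K) := by
    have : CompactSpace K := isCompact_iff_compactSpace.1 hK
    rw [continuousOn_iff_continuous_domRestrict]
    have hcl : Topology.IsClosedEmbedding (K.domRestrict E) :=
      (continuousOn_iff_continuous_domRestrict.1 hE).isClosedEmbedding
        (injOn_iff_injective.1 hinj)
    rw [continuous_def]
    intro s hs
    rw [← isClosed_compl_iff]
    have h1 : IsClosed (E '' (K ∩ sᶜ)) :=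
      ((hK.inter_right hs.isClosed_compl).image_of_continuousOn
        (hE.mono inter_subset_left)).isClosed
    convert h1.preimage (continuous_subtype_val (p := fun x => x ∈ E '' K)) using 1
    ext ⟨z, x, hx, rfl⟩
    have : Function.invFunOn E K (E x) = x := hinj.leftInvOn_invFunOn hx
    simp only [mem_compl_iff, mem_preimage, domRestrict_apply, this, mem_image]
    constructor
    · exact fun h => ⟨x, ⟨hx, h⟩, rfl⟩
    · rintro ⟨x', ⟨hx', h⟩, h'⟩
      rwa [← hinj hx' hx h']
  have key : ∀ c : X ≃ₜ X, (∀ x ∉ K, c x = x) → MapsTo c K K ∧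
      Continuous ((E '' K).piecewise (fun z => E (c (Function.invFunOn E K z))) id) := by
    intro c hc
    have hmaps : MapsTo c K K := fun x hx => by
      by_contra h
      have h1 := hc _ h
      have h2 := c.injective h1
      rw [h2] at h
      exact h hx
    refine ⟨hmaps, continuous_piecewise ?_ ?_ continuousOn_id⟩
    · intro z hz
      obtain ⟨x, hx, rfl⟩ := hKc.frontier_subset hz
      rw [hinj.leftInvOn_invFunOn hx]
      have hxi : x ∉ interior K := fun h => hz.2 (hint x h)
      have hx2 : x ∈ closure Kᶜ := by rwa [closure_compl]
      have : closure Kᶜ ⊆ {x | c x = x} :=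
        closure_minimal (fun x hx => hc x hx) (isClosed_eq c.continuous continuous_id)
      have := this hx2
      rw [mem_ofPred_eq] at this
      rw [this]
      rfl
    · rw [hKc.closure_eq]
      refine hE.comp (c.continuous.comp_continuousOn hG) ?_
      rintro z ⟨x, hx, rfl⟩
      change c (Function.invFunOn E K (E x)) ∈ K
      rw [hinj.leftInvOn_invFunOn hx]
      exact hmaps hx
  have hc' : ∀ x ∉ K, c.symm x = x := fun x hx => by rw [c.symm_apply_eq, hc x hx]
  have val : ∀ c : X ≃ₜ X, ∀ x ∈ K,
      (E '' K).piecewise (fun z => E (c (Function.invFunOn E K z))) id (E x) = E (c x) :=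
    fun c x hx => by
      rw [piecewise_eq_of_mem _ _ _ (mem_image_of_mem E hx), hinj.leftInvOn_invFunOn hx]
  have inv : ∀ c c' : X ≃ₜ X, (∀ x ∉ K, c x = x) → (∀ x, c' (c x) = x) → ∀ z,
      (E '' K).piecewise (fun z => E (c' (Function.invFunOn E K z))) id
      ((E '' K).piecewise (fun z => E (c (Function.invFunOn E K z))) id z) = z := by
    intro c c' hc hcc z
    by_cases hz : z ∈ E '' K
    · obtain ⟨x, hx, rfl⟩ := hz
      rw [val c x hx, val c' _ ((key c hc).1 hx), hcc]
    · rw [piecewise_eq_of_notMem _ _ _ hz, id, piecewise_eq_of_notMem _ _ _ hz, id]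
  exact ⟨{
    toFun := (E '' K).piecewise (fun z => E (c (Function.invFunOn E K z))) id
    invFun := (E '' K).piecewise (fun z => E (c.symm (Function.invFunOn E K z))) id
    left_inv := inv c c.symm hc c.symm_apply_apply
    right_inv := inv c.symm c hc' c.apply_symm_apply
    continuous_toFun := (key c hc).2
    continuous_invFun := (key c.symm hc').2 }, val c⟩

/-- A piecewise linear homeomorphism of the line supported in `[-8 * a, 8 * a]`. -/
def pl (a s : ℝ) : ℝ := max (min s ((s - 72 * a) / 10)) (min (4 * s - 24 * a) s)

/-- The inverse of `pl`. -/
def plInv (a s : ℝ) : ℝ := min (max s (10 * s + 72 * a)) (max ((s + 24 * a) / 4) s)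

theorem plInv_pl {a : ℝ} (ha : 0 ≤ a) (s : ℝ) : plInv a (pl a s) = s := by
  unfold plInv pl
  rcases le_total s ((s - 72 * a) / 10) with h1 | h1 <;>
  rcases le_total (4 * s - 24 * a) s with h2 | h2 <;>
  simp only [h1, h2, min_eq_left, min_eq_right] <;>
  simp only [max_def, min_def] <;> split_ifs <;> linarith

theorem pl_plInv {a : ℝ} (ha : 0 ≤ a) (s : ℝ) : pl a (plInv a s) = s := by
  unfold plInv pl
  rcases le_total s (10 * s + 72 * a) with h1 | h1 <;>
  rcases le_total ((s + 24 * a) / 4) s with h2 | h2 <;>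
  simp only [h1, h2, max_eq_left, max_eq_right] <;>
  simp only [max_def, min_def] <;> split_ifs <;> linarith

theorem pl_eq_self {a s : ℝ} (ha : 0 ≤ a) (h : 8 * a ≤ |s|) : pl a s = s := by
  unfold pl
  rcases abs_cases s with ⟨h1, h2⟩ | ⟨h1, h2⟩ <;> rw [h1] at h <;>
  simp only [max_def, min_def] <;> split_ifs <;> linarith

theorem pl_mem {a s : ℝ} (ha : 0 ≤ a) (h : |s| ≤ 2 * a) :
    -(9 * a) ≤ pl a s ∧ pl a s ≤ -(4 * a) := by
  rw [abs_le] at h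
  unfold pl
  simp only [max_def, min_def]
  split_ifs <;> constructor <;> linarith

/-- The distance of `t` to the boundary of `[0, ε]`. -/
def fade (ε t : ℝ) : ℝ := max 0 (min t (ε - t))

/-- The amplitude of the compression. -/
def ampl (ε : ℝ) (p : ℝ × (Fin 3 → ℝ)) : ℝ :=
  max 0 (min (fade ε p.1 ^ 2)
    (3 * fade ε p.1 ^ 2 - max |p.2 1| |p.2 2| / fade ε p.1 ^ 3))

theorem continuous_fade (ε : ℝ) : Continuous (fade ε) := by unfold fade; fun_prop

theorem ampl_nonneg (ε : ℝ) (p) : 0 ≤ ampl ε p := le_max_left _ _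

theorem ampl_le (ε : ℝ) (p) : ampl ε p ≤ fade ε p.1 ^ 2 :=
  max_le (by positivity) (min_le_left _ _)

theorem continuous_ampl (ε : ℝ) : Continuous (ampl ε) := by
  have hf : Continuous fun p : ℝ × (Fin 3 → ℝ) => fade ε p.1 :=
    (continuous_fade ε).comp continuous_fst
  rw [continuous_iff_continuousAt]
  intro p
  by_cases h : fade ε p.1 = 0
  · have h0 : ampl ε p = 0 := le_antisymm ((ampl_le ε p).trans (by simp [h])) (ampl_nonneg ε p)
    rw [ContinuousAt, h0]
    refine tendsto_of_tendsto_of_tendsto_of_le_of_le tendsto_const_nhds ?_ (ampl_nonneg ε)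
      (ampl_le ε)
    have : Tendsto (fun q : ℝ × (Fin 3 → ℝ) => fade ε q.1 ^ 2) (𝓝 p) (𝓝 (fade ε p.1 ^ 2)) :=
      (hf.pow 2).tendsto p
    simpa [h] using this
  · have h1 : ContinuousAt (fun p : ℝ × (Fin 3 → ℝ) => max |p.2 1| |p.2 2| / fade ε p.1 ^ 3) p :=
      ContinuousAt.div (by fun_prop) (hf.pow 3).continuousAt (pow_ne_zero 3 h)
    have h2 : ContinuousAt (fun p : ℝ × (Fin 3 → ℝ) => fade ε p.1 ^ 2) p :=
      (hf.pow 2).continuousAt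
    exact continuousAt_const.max (h2.min ((continuousAt_const.mul h2).sub h1))

/-- Slide the finger sideways. -/
def slide (ε : ℝ) : (ℝ × (Fin 3 → ℝ)) ≃ₜ (ℝ × (Fin 3 → ℝ)) where
  toFun p := (p.1, ![pl (ampl ε p) (p.2 0), p.2 1, p.2 2])
  invFun p := (p.1, ![plInv (ampl ε p) (p.2 0), p.2 1, p.2 2])
  left_inv p := by
    have : ampl ε (p.1, ![pl (ampl ε p) (p.2 0), p.2 1, p.2 2]) = ampl ε p := by simp [ampl]
    ext i
    · rfl
    · fin_cases i <;> simp [this, plInv_pl (ampl_nonneg ε p)]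
  right_inv p := by
    have : ampl ε (p.1, ![plInv (ampl ε p) (p.2 0), p.2 1, p.2 2]) = ampl ε p := by simp [ampl]
    ext i
    · rfl
    · fin_cases i <;> simp [this, pl_plInv (ampl_nonneg ε p)]
  continuous_toFun := by
    have := continuous_ampl ε
    refine continuous_fst.prodMk (continuous_pi fun i => ?_)
    fin_cases i
    · change Continuous fun p : ℝ × (Fin 3 → ℝ) => pl (ampl ε p) (p.2 0)
      unfold pl; fun_prop
    · change Continuous fun p : ℝ × (Fin 3 → ℝ) => p.2 1
      fun_prop
    · change Continuous fun p : ℝ × (Fin 3 → ℝ) => p.2 2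
      fun_prop
  continuous_invFun := by
    have := continuous_ampl ε
    refine continuous_fst.prodMk (continuous_pi fun i => ?_)
    fin_cases i
    · change Continuous fun p : ℝ × (Fin 3 → ℝ) => plInv (ampl ε p) (p.2 0)
      unfold plInv; fun_prop
    · change Continuous fun p : ℝ × (Fin 3 → ℝ) => p.2 1
      fun_prop
    · change Continuous fun p : ℝ × (Fin 3 → ℝ) => p.2 2
      fun_prop

theorem slide_apply (ε : ℝ) (p) : slide ε p = (p.1, ![pl (ampl ε p) (p.2 0), p.2 1, p.2 2]) := rfl

/-- The support of `slide`. -/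
def slideSet (ε : ℝ) : Set (ℝ × (Fin 3 → ℝ)) :=
  {p | 0 ≤ p.1 ∧ p.1 ≤ ε ∧ |p.2 0| ≤ 8 * fade ε p.1 ^ 2 ∧ |p.2 1| ≤ 3 * fade ε p.1 ^ 5 ∧
    |p.2 2| ≤ 3 * fade ε p.1 ^ 5}

theorem fade_nonneg (ε t : ℝ) : 0 ≤ fade ε t := le_max_left _ _

theorem fade_le {ε t : ℝ} (ht : 0 ≤ t) : fade ε t ≤ t := max_le ht (min_le_left _ _)

theorem isCompact_slideSet {ε : ℝ} : IsCompact (slideSet ε) := by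
  have hf : Continuous fun p : ℝ × (Fin 3 → ℝ) => fade ε p.1 :=
    (continuous_fade ε).comp continuous_fst
  refine Metric.isCompact_of_isClosed_isBounded ?_ ?_
  · refine IsClosed.and ?_ (IsClosed.and ?_ (IsClosed.and ?_ (IsClosed.and ?_ ?_)))
    all_goals exact isClosed_le (by fun_prop) (by fun_prop)
  · rw [isBounded_iff_forall_norm_le]
    refine ⟨ε + 8 * ε ^ 2 + 3 * ε ^ 5, ?_⟩
    rintro ⟨t, y⟩ ⟨h1, h2, h3, h4, h5⟩
    dsimp only at h1 h2 h3 h4 h5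
    have h6 := (fade_le (ε := ε) h1).trans h2
    have h7 := fade_nonneg ε t
    have e2 : fade ε t ^ 2 ≤ ε ^ 2 := by gcongr
    have e5 : fade ε t ^ 5 ≤ ε ^ 5 := by gcongr
    have hε : 0 ≤ ε := h1.trans h2
    have p2 : 0 ≤ ε ^ 2 := by positivity
    have p5 : 0 ≤ ε ^ 5 := by positivity
    refine prod_norm_le ?_ (pi3_norm_le ?_ ?_ ?_) <;> dsimp only
    · rw [abs_of_nonneg h1]; linarith
    all_goals linarith

theorem slide_eq_self {ε : ℝ} {p} (hp : p ∉ slideSet ε) : slide ε p = p := by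
  have key : 8 * ampl ε p ≤ |p.2 0| := by
    by_contra hlt
    push Not at hlt
    have ha : 0 < ampl ε p := by linarith [abs_nonneg (p.2 0)]
    have hf2 := ha.trans_le (ampl_le ε p)
    have hf : 0 < fade ε p.1 := (fade_nonneg _ _).lt_of_ne fun h => by simp [← h] at hf2
    have h1 : 0 < min p.1 (ε - p.1) := by
      rcases lt_max_iff.1 hf with h | h
      · exact (lt_irrefl _ h).elim
      · exact h
    rw [lt_min_iff] at h1
    have h2 : 0 < 3 * fade ε p.1 ^ 2 - max |p.2 1| |p.2 2| / fade ε p.1 ^ 3 := by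
      rcases lt_max_iff.1 ha with h | h
      · exact (lt_irrefl _ h).elim
      · exact (lt_min_iff.1 h).2
    rw [sub_pos, div_lt_iff₀ (by positivity)] at h2
    have h3 : max |p.2 1| |p.2 2| ≤ 3 * fade ε p.1 ^ 5 := by linarith
    exact hp ⟨h1.1.le, by linarith [h1.2], by linarith [ampl_le ε p], (le_max_left _ _).trans h3,
      (le_max_right _ _).trans h3⟩
  rw [slide_apply, pl_eq_self (ampl_nonneg ε p) key]
  ext i
  · rfl
  · fin_cases i <;> rfl

/-- On a thin horn, `emb ρ` is induced by a homeomorphism of the ambient space. -/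
theorem exists_homeomorph_eq_emb {ρ : ℝ → ℝ} (hρ : IsRad ρ) : ∃ ε > 0,
    ∃ h : (ℝ × (Fin 3 → ℝ)) ≃ₜ (ℝ × (Fin 3 → ℝ)), h 0 = 0 ∧
      ∀ p : ℝ × (Fin 3 → ℝ), 0 < p.1 → p.1 ≤ ε → |p.2 0| ≤ 2 * p.1 ^ 2 →
        |p.2 1| ≤ p.1 ^ 5 → |p.2 2| ≤ p.1 ^ 5 → h p = emb ρ p := by
  obtain ⟨δ₁, c, L, hδ₁, -, hc, hL, hbi⟩ := exists_emb_bilip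
  obtain ⟨ε₁, hε₁, hbi⟩ := hbi ρ hρ
  obtain ⟨δ₂, hδ₂, hop⟩ := exists_map_emb_nhds
  replace hop := hop ρ hρ
  obtain ⟨ε₂, hε₂, hε₂1, hsq, -⟩ := hρ.small (κ := min δ₁ δ₂ / 4) (by positivity)
  have hl : (0 : ℝ) < lipschitzExtensionConstant (ℝ × (Fin 3 → ℝ)) :=
    lipschitzExtensionConstant_pos _
  obtain ⟨ε₃, hε₃, hnear⟩ := exists_emb_near_id hρ
    (κ := 1 / (2 * lipschitzExtensionConstant (ℝ × (Fin 3 → ℝ)))) (by positivity)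
  set κ : ℝ := 1 / (2 * lipschitzExtensionConstant (ℝ × (Fin 3 → ℝ))) with hκ
  have hκ0 : 0 < κ := by positivity
  obtain ⟨J, hJ⟩ : ∃ J : (ℝ × (Fin 3 → ℝ)) ≃ₜ (ℝ × (Fin 3 → ℝ)),
      EqOn (emb ρ) J (insert 0 (sideSet ε₃)) := by
    have hA : ApproximatesLinearOn (emb ρ)
        (ContinuousLinearEquiv.refl ℝ (ℝ × (Fin 3 → ℝ)) :
          (ℝ × (Fin 3 → ℝ)) →L[ℝ] (ℝ × (Fin 3 → ℝ))) (insert 0 (sideSet ε₃)) κ.toNNReal := by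
      intro p hp q hq
      rw [Real.coe_toNNReal _ hκ0.le]
      have := hnear p hp q hq
      refine le_trans (le_of_eq ?_) this
      congr 1
      simp only [ContinuousLinearEquiv.coe_refl, ContinuousLinearMap.coe_id', id_eq]
      abel
    refine hA.exists_homeomorph_extension (Or.inr ?_)
    have h1 : ‖(((ContinuousLinearEquiv.refl ℝ (ℝ × (Fin 3 → ℝ))).symm :
        (ℝ × (Fin 3 → ℝ)) →L[ℝ] (ℝ × (Fin 3 → ℝ))))‖₊ = 1 := by
      rw [ContinuousLinearEquiv.refl_symm, ContinuousLinearEquiv.coe_refl]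
      exact ContinuousLinearMap.nnnorm_id
    rw [h1, inv_one, ← NNReal.coe_lt_coe, NNReal.coe_mul, Real.coe_toNNReal _ hκ0.le, hκ,
        NNReal.coe_one]
    rw [mul_one_div, div_lt_one (by positivity)]
    linarith
  set ε := min ε₁ (min ε₂ ε₃) with hε
  have hε0 : 0 < ε := by positivity
  have hεε₁ : ε ≤ ε₁ := min_le_left _ _
  have hεε₂ : ε ≤ ε₂ := (min_le_right _ _).trans (min_le_left _ _)
  have hεε₃ : ε ≤ ε₃ := (min_le_right _ _).trans (min_le_right _ _)
  have hsl : ∀ p ∈ slideSet ε, 0 < p.1 → ∀ i : Fin 3, |p.2 i| ≤ 3 * fade ε p.1 ^ 5 →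
      |p.2 i| ≤ δ₁ * ρ p.1 ∧ |p.2 i| < δ₂ * ρ p.1 := by
    intro p hp h0 i hi
    have hpε := hp.2.1
    have h1 := (hsq p.1 h0 (by linarith)).2
    have h2 : fade ε p.1 ^ 5 ≤ p.1 ^ 5 := by
      have := fade_nonneg ε p.1
      gcongr
      exact fade_le h0.le
    have h3 : p.1 ^ 5 ≤ p.1 ^ 3 := pow_le_pow_of_le_one h0.le (by linarith) (by norm_num)
    have hρp := hρ.pos _ h0
    have h4 : min δ₁ δ₂ / 4 * ρ p.1 ≤ δ₁ / 4 * ρ p.1 := by gcongr; exact min_le_left _ _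
    have h5 : min δ₁ δ₂ / 4 * ρ p.1 ≤ δ₂ / 4 * ρ p.1 := by gcongr; exact min_le_right _ _
    have h6 : 0 < δ₁ * ρ p.1 := by positivity
    have h7 : 0 < δ₂ * ρ p.1 := by positivity
    constructor <;> linarith
  have hfade0 : fade ε 0 = 0 := by simp [fade]
  have hsub : slideSet ε ⊆ insert 0 (tubeSet ρ ε₁ δ₁) := by
    intro p hp
    rcases hp.1.eq_or_lt with h | h
    · left
      obtain ⟨t, y⟩ := p
      obtain ⟨-, -, h1, h2, h3⟩ := hp
      dsimp only at h h1 h2 h3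
      subst h
      rw [hfade0] at h1 h2 h3
      norm_num at h1 h2 h3
      ext i
      · rfl
      · fin_cases i <;> assumption
    · right
      exact ⟨h, hp.2.1.trans hεε₁, (hsl p hp h 1 hp.2.2.2.1).1, (hsl p hp h 2 hp.2.2.2.2).1⟩
  have hLip : LipschitzOnWith ⟨L, hL.le⟩ (emb ρ) (slideSet ε) :=
    LipschitzOnWith.of_dist_le_mul fun p hp q hq => by
      rw [dist_eq_norm, dist_eq_norm]
      exact (hbi p (hsub hp) q (hsub hq)).2
  have hinj : InjOn (emb ρ) (slideSet ε) := fun p hp q hq h => by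
    have := (hbi p (hsub hp) q (hsub hq)).1
    rw [h, sub_self, norm_zero] at this
    have h2 : ‖p - q‖ = 0 := le_antisymm (by
      by_contra hh
      push Not at hh
      have : 0 < c * ‖p - q‖ := by positivity
      linarith) (norm_nonneg _)
    exact sub_eq_zero.1 (norm_eq_zero.1 h2)
  obtain ⟨C, hC⟩ := exists_conj_homeomorph isCompact_slideSet hLip.continuousOn hinj (by
    intro p hp
    have hpK := interior_subset hp
    have h0 : 0 < p.1 := by
      have h1 : p.1 ∈ interior (Ici (0 : ℝ)) := by
        refine interior_maximal ?_ (isOpenMap_fst _ isOpen_interior) (mem_image_of_mem Prod.fst hp)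
        rintro _ ⟨q, hq, rfl⟩
        exact (interior_subset hq).1
      rwa [interior_Ici] at h1
    rw [mem_interior_iff_mem_nhds, ← hop p h0 (hsl p hpK h0 1 hpK.2.2.2.1).2
      (hsl p hpK h0 2 hpK.2.2.2.2).2, Filter.mem_map]
    exact mem_of_superset (mem_interior_iff_mem_nhds.1 hp) (subset_preimage_image _ _))
    (slide ε) (fun p hp => slide_eq_self hp)
  have h0K : (0 : ℝ × (Fin 3 → ℝ)) ∈ slideSet ε := by
    simp [slideSet, hfade0, hε0.le]
  have hs0 : slide ε 0 = 0 := by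
    have : ampl ε 0 = 0 := le_antisymm ((ampl_le ε 0).trans (by simp [hfade0])) (ampl_nonneg _ _)
    rw [slide_apply, this]
    ext i
    · rfl
    · fin_cases i <;> simp [pl]
  have main : ∀ p ∈ slideSet ε, slide ε p ∈ insert 0 (sideSet ε₃) →
      C.symm (J (slide ε p)) = emb ρ p := by
    intro p hp h
    rw [← hJ h, ← hC p hp, C.symm_apply_apply]
  refine ⟨ε / 2, by positivity, (slide ε).trans (J.trans C.symm), ?_, ?_⟩
  · have := main 0 h0K (by rw [hs0]; exact mem_insert _ _)
    rwa [emb_zero hρ] at this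
  · rintro ⟨t, y⟩ h0 h1 h2 h3 h4
    dsimp only at h0 h1 h2 h3 h4
    have hft : fade ε t = t := by
      rw [fade, min_eq_left (by linarith), max_eq_right h0.le]
    have ht5 : 0 ≤ t ^ 5 := by positivity
    have hampl : ampl ε (t, y) = t ^ 2 := by
      rw [ampl]
      simp only [hft]
      have : max |y 1| |y 2| / t ^ 3 ≤ t ^ 2 := by
        rw [div_le_iff₀ (by positivity)]
        exact (max_le h3 h4).trans (le_of_eq (by ring))
      have ht2 := sq_nonneg t
      rw [min_eq_left (by linarith), max_eq_right ht2]
    refine main (t, y) ⟨h0.le, by dsimp only; linarith, ?_, ?_, ?_⟩ (mem_insert_of_mem _ ?_)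
    · simp only [hft]
      nlinarith
    · simp only [hft]; linarith
    · simp only [hft]; linarith
    · rw [slide_apply, hampl]
      have := pl_mem (sq_nonneg t) h2
      refine ⟨h0, ?_, this.1, this.2, ?_⟩
      · dsimp only; linarith
      · simpa using by linarith
end Unknot

section Germs
open Filter Topology

/-- The splitting `ℝ⁴ = ℝ × ℝ³`. -/
def split4 : E4 ≃L[ℝ] ℝ × (Fin 3 → ℝ) :=
  LinearEquiv.toContinuousLinearEquiv
  { toFun := fun z => (z 0, fun i => z i.succ)
    invFun := fun p => WithLp.toLp 2 (Fin.cons p.1 p.2)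
    map_add' := fun _ _ => rfl
    map_smul' := fun _ _ => rfl
    left_inv := fun z => by
      ext i
      refine Fin.cases ?_ (fun i => ?_) i <;> simp
    right_inv := fun p => by ext i <;> simp }

theorem split4_fst (z : E4) : (split4 z).1 = z 0 := rfl

/-- A thin finger around the region `|y₀| ≤ t²` of the half plane `t > 0`. -/
structure IsFinger (F : Set (ℝ × (Fin 3 → ℝ))) : Prop where
  zero : 0 ∈ F
  thin : ∃ ε > 0, ∀ p ∈ F, p.1 ≤ ε → p ≠ 0 → 0 < p.1 ∧ |p.2 0| ≤ p.1 ^ 2 + 48 * p.1 ^ 3 ∧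
    |p.2 1| ≤ p.1 ^ 5 ∧ |p.2 2| ≤ p.1 ^ 5
  pos : ∀ p ∈ F, p ≠ 0 → 0 < p.1
  dense : ∃ ε > 0, ∀ t s, 0 < t → t < ε → |s| ≤ t ^ 2 →
    ∃ p ∈ F, p ≠ 0 ∧ |p.1 - t| ≤ 48 * t ^ 3 ∧ |p.2 0 - s| ≤ 48 * t ^ 3

theorem IsFinger.subset_tubeSet {F : Set (ℝ × (Fin 3 → ℝ))} (hF : IsFinger F) {ρ : ℝ → ℝ}
    (hρ : IsRad ρ) {δ : ℝ} (hδ : 0 < δ) : ∃ ε₀ > 0, ∀ ε ≤ ε₀, ∀ p ∈ F, p.1 ≤ ε →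
      p ∈ insert 0 (tubeSet ρ ε δ) ∧ |p.2 2| ≤ ρ p.1 := by
  obtain ⟨ε₁, h₁, thin⟩ := hF.thin
  obtain ⟨ε₂, h₂, h₂1, hsq, -⟩ := hρ.small (κ := min δ 1) (by positivity)
  refine ⟨min ε₁ ε₂, by positivity, fun ε hε p hp hpε => ?_⟩
  by_cases h0 : p = 0
  · exact ⟨Or.inl h0, by simp [h0, hρ.zero]⟩
  have hpε' := hpε.trans hε
  obtain ⟨ht, -, hp1, hp2⟩ := thin p hp (hpε'.trans (min_le_left _ _)) h0
  have ht2 := hpε'.trans (min_le_right _ _)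
  have h3 := (hsq _ ht ht2).2
  have h4 : p.1 ^ 5 ≤ p.1 ^ 3 := pow_le_pow_of_le_one ht.le (ht2.trans h₂1) (by norm_num)
  have h5 : min δ 1 * ρ p.1 ≤ δ * ρ p.1 := by
    have := hρ.pos _ ht
    gcongr
    exact min_le_left _ _
  have h6 : min δ 1 * ρ p.1 ≤ 1 * ρ p.1 := by
    have := hρ.pos _ ht
    gcongr
    exact min_le_right _ _
  exact ⟨Or.inr ⟨ht, hpε, by linarith, by linarith⟩, by linarith⟩

/-- The germ obtained from a finger by embedding it along a knot of size `ρ`. -/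
def model (ρ : ℝ → ℝ) (F : Set (ℝ × (Fin 3 → ℝ))) : Set E4 := split4.symm '' (emb ρ '' F)

theorem zero_mem_model {ρ : ℝ → ℝ} (hρ : IsRad ρ) {F : Set (ℝ × (Fin 3 → ℝ))} (hF : IsFinger F) :
    0 ∈ model ρ F := ⟨0, ⟨0, hF.zero, emb_zero hρ⟩, map_zero _⟩

theorem AmbientTopEquiv.trans {n : ℕ} {X Y Z : Set (EuclideanSpace ℝ (Fin n))}
    (h₁ : AmbientTopEquiv X Y) (h₂ : AmbientTopEquiv Y Z) : AmbientTopEquiv X Z := by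
  obtain ⟨U, V, hU, hV, h0U, h0V, h, g, hc, gc, hm, gm, hgh, hhg, h0, him⟩ := h₁
  obtain ⟨U', V', hU', hV', h0U', h0V', h', g', hc', gc', hm', gm', hgh', hhg', h0', him'⟩ := h₂
  refine ⟨U ∩ h ⁻¹' U', V' ∩ g' ⁻¹' V, hc.isOpen_inter_preimage hU hU',
    gc'.isOpen_inter_preimage hV' hV, ⟨h0U, by simpa [h0] using h0U'⟩,
    ⟨h0V', ?_⟩, h' ∘ h, g ∘ g', ?_, ?_, ?_, ?_, ?_, ?_, by simp [h0, h0'], ?_⟩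
  · have := hgh' 0 h0U'
    rw [h0'] at this
    rwa [mem_preimage, this]
  · exact hc'.comp (hc.mono inter_subset_left) fun x hx => hx.2
  · exact gc.comp (gc'.mono inter_subset_left) fun x hx => hx.2
  · exact fun x hx => ⟨hm' hx.2, by rw [mem_preimage, Function.comp, hgh' _ hx.2]; exact hm hx.1⟩
  · exact fun x hx => ⟨gm hx.2, by rw [mem_preimage, Function.comp, hhg _ hx.2]; exact gm' hx.1⟩
  · exact fun x hx => by rw [Function.comp, Function.comp, hgh' _ hx.2, hgh _ hx.1]
  · exact fun x hx => by rw [Function.comp, Function.comp, hhg _ hx.2, hhg' _ hx.1]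
  · apply Subset.antisymm
    · rintro _ ⟨x, ⟨hx, hxU, hxU'⟩, rfl⟩
      have h1 : h x ∈ Y ∩ V := him ▸ ⟨x, ⟨hx, hxU⟩, rfl⟩
      have h2 : h' (h x) ∈ Z ∩ V' := him' ▸ ⟨h x, ⟨h1.1, hxU'⟩, rfl⟩
      exact ⟨h2.1, h2.2, by rw [mem_preimage, Function.comp, hgh' _ hxU']; exact h1.2⟩
    · rintro z ⟨hz, hzV, hzV'⟩
      obtain ⟨y, ⟨hy, hyU⟩, rfl⟩ : z ∈ h' '' (Y ∩ U') := him' ▸ ⟨hz, hzV⟩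
      rw [mem_preimage, hgh' _ hyU] at hzV'
      obtain ⟨x, ⟨hx, hxU⟩, rfl⟩ : y ∈ h '' (X ∩ U) := him ▸ ⟨hy, hzV'⟩
      exact ⟨x, ⟨hx, hxU, hyU⟩, rfl⟩

theorem AmbientTopEquiv.symm {n : ℕ} {X Y : Set (EuclideanSpace ℝ (Fin n))}
    (h₁ : AmbientTopEquiv X Y) : AmbientTopEquiv Y X := by
  obtain ⟨U, V, hU, hV, h0U, h0V, h, g, hc, gc, hm, gm, hgh, hhg, h0, him⟩ := h₁
  refine ⟨V, U, hV, hU, h0V, h0U, g, h, gc, hc, gm, hm, hhg, hgh, by simpa [h0] using hgh 0 h0U, ?_⟩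
  rw [← him, image_image]
  apply Subset.antisymm
  · rintro _ ⟨x, hx, rfl⟩
    change g (h x) ∈ X ∩ U
    rwa [hgh x hx.2]
  · exact fun x hx => ⟨x, hx, hgh x hx.2⟩

theorem AmbientTopEquiv.refl {n : ℕ} (X : Set (EuclideanSpace ℝ (Fin n))) : AmbientTopEquiv X X :=
  ⟨univ, univ, isOpen_univ, isOpen_univ, mem_univ _, mem_univ _, id, id, continuousOn_id,
    continuousOn_id, mapsTo_univ _ _, mapsTo_univ _ _, fun _ _ => rfl, fun _ _ => rfl, rfl,
    image_id _⟩

theorem ambientTopEquiv_model {ρ : ℝ → ℝ} (hρ : IsRad ρ) {F : Set (ℝ × (Fin 3 → ℝ))}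
    (hF : IsFinger F) : AmbientTopEquiv (split4.symm '' F) (model ρ F) := by
  obtain ⟨ε₁, hε₁, h, h0, hh⟩ := exists_homeomorph_eq_emb hρ
  obtain ⟨ε₂, hε₂, thin⟩ := hF.thin
  set ε := min ε₁ (min ε₂ (1 / 48)) with hε
  have hε0 : 0 < ε := by positivity
  have hεε₁ : ε ≤ ε₁ := min_le_left _ _
  have hεε₂ : ε ≤ ε₂ := (min_le_right _ _).trans (min_le_left _ _)
  have hεε₃ : ε ≤ 1 / 48 := (min_le_right _ _).trans (min_le_right _ _)
  have key : ∀ p ∈ F, p.1 < ε → h p = emb ρ p := by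
    intro p hp hpε
    by_cases hp0 : p = 0
    · rw [hp0, h0, emb_zero hρ]
    obtain ⟨ht, h1, h2, h3⟩ := thin p hp (hpε.le.trans hεε₂) hp0
    refine hh p ht (hpε.le.trans hεε₁) ?_ h2 h3
    have : p.1 ^ 3 ≤ 1 / 48 * p.1 ^ 2 := by
      rw [pow_succ, mul_comm]
      gcongr
      linarith
    linarith
  have hO : IsOpen {p : ℝ × (Fin 3 → ℝ) | p.1 < ε} := isOpen_lt continuous_fst continuous_const
  let H : E4 ≃ₜ E4 := (split4.toHomeomorph.trans h).trans split4.symm.toHomeomorph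
  have hH : ∀ z, H z = split4.symm (h (split4 z)) := fun _ => rfl
  have hHs : ∀ z, split4 (H z) = h (split4 z) := fun z => by rw [hH, split4.apply_symm_apply]
  have hH0 : H 0 = 0 := by rw [hH, map_zero, h0, map_zero]
  let O : Set E4 := {z | (split4 z).1 < ε}
  have hOo : IsOpen O := hO.preimage split4.continuous
  have h0O : (0 : E4) ∈ O := by
    change (split4 0).1 < ε
    rw [map_zero]
    exact hε0
  refine ⟨O ∩ H ⁻¹' O, H '' (O ∩ H ⁻¹' O), hOo.inter (hOo.preimage H.continuous),
    H.isOpenMap _ (hOo.inter (hOo.preimage H.continuous)), ⟨h0O, by rwa [mem_preimage, hH0]⟩,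
    ⟨0, ⟨h0O, by rwa [mem_preimage, hH0]⟩, hH0⟩, H, H.symm, H.continuous.continuousOn,
    H.symm.continuous.continuousOn, mapsTo_image _ _, ?_, fun _ _ => H.symm_apply_apply _,
    fun _ _ => H.apply_symm_apply _, hH0, ?_⟩
  · rintro _ ⟨x, hx, rfl⟩
    rwa [H.symm_apply_apply]
  · apply Subset.antisymm
    · rintro _ ⟨_, ⟨⟨p, hp, rfl⟩, hpO⟩, rfl⟩
      refine ⟨⟨_, ⟨p, hp, rfl⟩, ?_⟩, mem_image_of_mem _ hpO⟩
      rw [hH, split4.apply_symm_apply, key p hp]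
      have : (split4 (split4.symm p)).1 < ε := hpO.1
      rwa [split4.apply_symm_apply] at this
    · rintro _ ⟨⟨_, ⟨p, hp, rfl⟩, rfl⟩, z, hz, hze⟩
      have h1 : p.1 < ε := by
        have := hz.2
        rw [mem_preimage, hze] at this
        change (split4 (split4.symm (emb ρ p))).1 < ε at this
        rwa [split4.apply_symm_apply] at this
      have h2 : z = split4.symm p := by
        apply H.injective
        rw [hze, hH, split4.apply_symm_apply, key p hp h1]
      exact ⟨z, ⟨⟨p, hp, h2.symm⟩, hz⟩, hze⟩

theorem outerLipGermEquiv_model {ρ ρ' : ℝ → ℝ} (hρ : IsRad ρ) (hρ' : IsRad ρ')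
    {F : Set (ℝ × (Fin 3 → ℝ))} (hF : IsFinger F) :
    OuterLipGermEquiv (model ρ F) (model ρ' F) := by
  obtain ⟨δ, c, L, hδ, -, hc, hL, hbi⟩ := exists_emb_bilip
  obtain ⟨ε₁, hε₁, hb⟩ := hbi ρ hρ
  obtain ⟨ε₂, hε₂, hb'⟩ := hbi ρ' hρ'
  obtain ⟨ε₃, hε₃, ht⟩ := hF.subset_tubeSet hρ hδ
  obtain ⟨ε₄, hε₄, ht'⟩ := hF.subset_tubeSet hρ' hδ
  set ε := min (min ε₁ ε₂) (min ε₃ ε₄) with hε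
  have hε0 : 0 < ε := by positivity
  have e1 : ε ≤ ε₁ := (min_le_left _ _).trans (min_le_left _ _)
  have e2 : ε ≤ ε₂ := (min_le_left _ _).trans (min_le_right _ _)
  have e3 : ε ≤ ε₃ := (min_le_right _ _).trans (min_le_left _ _)
  have e4 : ε ≤ ε₄ := (min_le_right _ _).trans (min_le_right _ _)
  have mono : ∀ (ρ : ℝ → ℝ) (ε' : ℝ), ε ≤ ε' → insert 0 (tubeSet ρ ε δ) ⊆
      insert 0 (tubeSet ρ ε' δ) := fun ρ ε' h =>
    insert_subset_insert fun p hp => ⟨hp.1, hp.2.1.trans h, hp.2.2⟩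
  set G : Set (ℝ × (Fin 3 → ℝ)) := F ∩ {p | p.1 ≤ ε} with hG
  have b : ∀ p ∈ G, ∀ q ∈ G, c * ‖p - q‖ ≤ ‖emb ρ p - emb ρ q‖ ∧
      ‖emb ρ p - emb ρ q‖ ≤ L * ‖p - q‖ := fun p hp q hq =>
    hb p (mono _ _ e1 (ht ε e3 p hp.1 hp.2).1) q (mono _ _ e1 (ht ε e3 q hq.1 hq.2).1)
  have b' : ∀ p ∈ G, ∀ q ∈ G, c * ‖p - q‖ ≤ ‖emb ρ' p - emb ρ' q‖ ∧
      ‖emb ρ' p - emb ρ' q‖ ≤ L * ‖p - q‖ := fun p hp q hq =>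
    hb' p (mono _ _ e2 (ht' ε e4 p hp.1 hp.2).1) q (mono _ _ e2 (ht' ε e4 q hq.1 hq.2).1)
  have h0G : 0 ∈ G := ⟨hF.zero, hε0.le⟩
  have hinj : InjOn (emb ρ) G := fun p hp q hq h => by
    have := (b p hp q hq).1
    rw [h, sub_self, norm_zero] at this
    have h2 : ‖p - q‖ ≤ 0 := nonpos_of_mul_nonpos_right this hc
    exact sub_eq_zero.1 (norm_le_zero_iff.1 h2)
  have hbb : ∀ p ∈ G, ∀ q ∈ G, ‖emb ρ p - emb ρ q‖ ≤ L / c * ‖emb ρ' p - emb ρ' q‖ ∧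
      ‖emb ρ' p - emb ρ' q‖ ≤ L / c * ‖emb ρ p - emb ρ q‖ := by
    intro p hp q hq
    rw [div_mul_eq_mul_div, div_mul_eq_mul_div, le_div_iff₀ hc, le_div_iff₀ hc]
    obtain ⟨h1, h2⟩ := b p hp q hq
    obtain ⟨h3, h4⟩ := b' p hp q hq
    constructor <;> nlinarith
  obtain ⟨M, hM, hΦ, hΨ⟩ : ∃ M, 0 < M ∧ (∀ z, ‖split4 z‖ ≤ M * ‖z‖) ∧
      ∀ p, ‖split4.symm p‖ ≤ M * ‖p‖ := by
    refine ⟨max 1 (max ‖(split4 : E4 →L[ℝ] ℝ × (Fin 3 → ℝ))‖ ‖(split4.symm : (ℝ × (Fin 3 → ℝ))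
        →L[ℝ] E4)‖),
      by positivity, fun z => ?_, fun p => ?_⟩
    · refine ((split4 : E4 →L[ℝ] ℝ × (Fin 3 → ℝ)).le_opNorm z).trans ?_
      gcongr
      exact (le_max_left _ _).trans (le_max_right _ _)
    · refine ((split4.symm : (ℝ × (Fin 3 → ℝ)) →L[ℝ] E4).le_opNorm p).trans ?_
      gcongr
      exact (le_max_right _ _).trans (le_max_right _ _)
  set lam := max 1 (M * (L / c * M)) with hlam
  have hlam1 : 1 ≤ lam := le_max_left _ _
  have hlam0 : 0 < lam := by positivity
  have tr : ∀ p q p' q' : ℝ × (Fin 3 → ℝ), ‖p - q‖ ≤ L / c * ‖p' - q'‖ →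
      ‖split4.symm p - split4.symm q‖ ≤ lam * ‖split4.symm p' - split4.symm q'‖ := by
    intro p q p' q' h
    rw [← map_sub, ← map_sub]
    calc ‖split4.symm (p - q)‖ ≤ M * (L / c * (M * ‖split4.symm (p' - q')‖)) := by
          refine (hΨ _).trans ?_
          gcongr
          refine h.trans ?_
          gcongr
          simpa using hΦ (split4.symm (p' - q'))
      _ = M * (L / c * M) * ‖split4.symm (p' - q')‖ := by ring
      _ ≤ _ := by gcongr; exact le_max_right _ _
  have fst_lt : ∀ (ρ : ℝ → ℝ) (p : ℝ × (Fin 3 → ℝ)) (r : ℝ), ‖split4.symm (emb ρ p)‖ < r →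
      p.1 < r := by
    intro ρ p r h
    have h1 := EuclideanSpace.norm_eq (split4.symm (emb ρ p))
    have h2 := PiLp.norm_apply_le (split4.symm (emb ρ p)) 0
    rw [← split4_fst, split4.apply_symm_apply] at h2
    exact (le_abs_self _).trans_lt (h2.trans_lt h)
  set f : E4 → E4 := fun z =>
    split4.symm (emb ρ' (Function.invFunOn (emb ρ) G (split4 z))) with hf
  have hfv : ∀ p ∈ G, f (split4.symm (emb ρ p)) = split4.symm (emb ρ' p) := fun p hp => by
    rw [hf]
    dsimp only
    rw [split4.apply_symm_apply, hinj.leftInvOn_invFunOn hp]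
  have hrep : ∀ x ∈ model ρ F ∩ ball 0 ε, ∃ p ∈ G, split4.symm (emb ρ p) = x := by
    rintro _ ⟨⟨_, ⟨p, hp, rfl⟩, rfl⟩, hb⟩
    exact ⟨p, ⟨hp, (fst_lt ρ p ε (mem_ball_zero_iff.1 hb)).le⟩, rfl⟩
  refine ⟨ε, hε0, ε / lam, by positivity, lam, hlam1, f, ?_, ?_, ?_, ?_⟩
  · have := hfv 0 h0G
    rwa [emb_zero hρ, emb_zero hρ', map_zero] at this
  · intro x hx
    obtain ⟨p, hp, rfl⟩ := hrep x hx
    rw [hfv p hp]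
    exact ⟨_, ⟨p, hp.1, rfl⟩, rfl⟩
  · intro x hx y hy
    obtain ⟨p, hp, rfl⟩ := hrep x hx
    obtain ⟨q, hq, rfl⟩ := hrep y hy
    rw [hfv p hp, hfv q hq, inv_mul_le_iff₀ hlam0]
    exact ⟨tr _ _ _ _ (hbb p hp q hq).1, tr _ _ _ _ (hbb p hp q hq).2⟩
  · rintro _ ⟨⟨_, ⟨p, hp, rfl⟩, rfl⟩, hpb⟩
    rw [mem_ball_zero_iff] at hpb
    have hpG : p ∈ G := by
      refine ⟨hp, (fst_lt ρ' p ε (hpb.trans_le ?_)).le⟩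
      exact div_le_self hε0.le hlam1
    refine ⟨split4.symm (emb ρ p), ⟨⟨_, ⟨p, hp, rfl⟩, rfl⟩, ?_⟩, hfv p hpG⟩
    have := tr _ _ _ _ (hbb p hpG 0 h0G).1
    rw [emb_zero hρ, emb_zero hρ', map_zero, sub_zero, sub_zero] at this
    rw [mem_ball_zero_iff]
    rw [lt_div_iff₀ hlam0] at hpb
    linarith

theorem tangentConeAt_model_subset {ρ ρ' : ℝ → ℝ} (hρ : IsRad ρ) (hρ' : IsRad ρ')
    {F : Set (ℝ × (Fin 3 → ℝ))} (hF : IsFinger F) :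
    tangentConeAt ℝ (model ρ F) 0 ⊆ tangentConeAt ℝ (model ρ' F) 0 := by
  intro v hv
  obtain ⟨α, l, hl, c, d, hd, hdX, hcd⟩ := exists_fun_of_mem_tangentConeAt hv
  simp only [zero_add] at hdX
  obtain ⟨C, hC, hstub⟩ := exists_stub_sub_le
  obtain ⟨ε₁, h₁, ht⟩ := hF.subset_tubeSet hρ one_pos
  obtain ⟨ε₂, h₂, ht'⟩ := hF.subset_tubeSet hρ' one_pos
  obtain ⟨ε₃, h₃, -, hs, -⟩ := hρ.small one_pos
  obtain ⟨ε₄, h₄, -, hs', -⟩ := hρ'.small one_pos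
  have hex : ∀ n, ∃ p ∈ F, d n ∈ model ρ F → d n = split4.symm (emb ρ p) := by
    intro n
    by_cases h : d n ∈ model ρ F
    · obtain ⟨_, ⟨p, hp, rfl⟩, h⟩ := h
      exact ⟨p, hp, fun _ => h.symm⟩
    · exact ⟨0, hF.zero, fun h' => (h h').elim⟩
  choose p hpF hp using hex
  have hD : Tendsto (fun n => split4 (d n)) l (𝓝 0) := by
    simpa [Function.comp_def] using (split4.continuous.tendsto 0).comp hd
  have hcD : Tendsto (fun n => split4 (c n • d n)) l (𝓝 (split4 v)) :=
    (split4.continuous.tendsto v).comp hcd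
  have hpe : ∀ᶠ n in l, split4 (d n) = emb ρ (p n) := by
    filter_upwards [hdX] with n hn
    rw [hp n hn, split4.apply_symm_apply]
  have hp1 : Tendsto (fun n => (p n).1) l (𝓝 0) := by
    refine ((continuous_fst.tendsto _).comp hD).congr' ?_
    filter_upwards [hpe] with n hn
    simp [hn, emb]
  have hcp : Tendsto (fun n => c n * (p n).1) l (𝓝 (split4 v).1) := by
    refine ((continuous_fst.tendsto _).comp hcD).congr' ?_
    filter_upwards [hpe] with n hn
    simp [hn, emb]
  have hest : ∀ᶠ n in l, ‖emb ρ' (p n) - emb ρ (p n)‖ ≤ 2 * C * (p n).1 ^ 2 := by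
    filter_upwards [hp1.eventually_le_const h₁, hp1.eventually_le_const h₂,
      hp1.eventually_le_const h₃, hp1.eventually_le_const h₄] with n e1 e2 e3 e4
    by_cases h0 : p n = 0
    · rw [h0, emb_zero hρ, emb_zero hρ', sub_self, norm_zero]
      simp
    have hpos := hF.pos _ (hpF n) h0
    have a1 := hstub _ (p n).2 (hρ.pos _ hpos) (ht _ le_rfl _ (hpF n) e1).2
    have a2 := hstub _ (p n).2 (hρ'.pos _ hpos) (ht' _ le_rfl _ (hpF n) e2).2
    have a3 := (hs _ hpos e3).1
    have a4 := (hs' _ hpos e4).1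
    have a5 : 0 ≤ 2 * C * (p n).1 ^ 2 := by positivity
    refine prod_norm_le (by simpa [emb] using a5) ?_
    change ‖stub (ρ' (p n).1) (p n).2 - stub (ρ (p n).1) (p n).2‖ ≤ _
    rw [← sub_sub_sub_cancel_right _ _ (p n).2]
    refine (norm_sub_le _ _).trans ?_
    nlinarith
  have hdiff : Tendsto (fun n => emb ρ' (p n) - emb ρ (p n)) l (𝓝 0) := by
    refine squeeze_zero_norm' hest ?_
    simpa using ((hp1.pow 2).const_mul (2 * C))
  have hcdiff : Tendsto (fun n => c n • (emb ρ' (p n) - emb ρ (p n))) l (𝓝 0) := by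
    refine squeeze_zero_norm' (a := fun n => 2 * C * (|c n * (p n).1| * |(p n).1|)) ?_ ?_
    · filter_upwards [hest] with n hn
      rw [norm_smul, abs_mul, Real.norm_eq_abs]
      have : |c n| * ‖emb ρ' (p n) - emb ρ (p n)‖ ≤ |c n| * (2 * C * (p n).1 ^ 2) := by gcongr
      rw [← sq_abs] at this
      linarith
    · have := ((hcp.abs.mul hp1.abs).const_mul (2 * C))
      simpa using this
  refine mem_tangentConeAt_of_seq l c (fun n => split4.symm (emb ρ' (p n))) ?_ ?_ ?_
  · have : Tendsto (fun n => emb ρ' (p n)) l (𝓝 0) := by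
      have h := hdiff.add hD
      rw [add_zero] at h
      refine h.congr' ?_
      filter_upwards [hpe] with n hn
      rw [hn, sub_add_cancel]
    simpa [Function.comp_def] using (split4.symm.continuous.tendsto 0).comp this
  · exact Eventually.of_forall fun n => by
      rw [zero_add]
      exact ⟨_, ⟨p n, hpF n, rfl⟩, rfl⟩
  · have : Tendsto (fun n => c n • emb ρ' (p n)) l (𝓝 (split4 v)) := by
      have h := hcdiff.add hcD
      rw [zero_add] at h
      refine h.congr' ?_
      filter_upwards [hpe] with n hn
      rw [map_smul, hn, ← smul_add, sub_add_cancel]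
    simpa [Function.comp_def] using (split4.symm.continuous.tendsto _).comp this

end Germs

section Germs

theorem Polynomial.isPolyFun (p : Polynomial ℝ) :
    IsPolyFun fun x : Fin 1 → ℝ => p.eval (x 0) :=
  ⟨Polynomial.aeval (MvPolynomial.X 0) p, fun x => by
    rw [← MvPolynomial.coe_aeval_eq_eval, Polynomial.aeval_def, Polynomial.hom_eval₂]
    have : (MvPolynomial.eval x).comp MvPolynomial.C = RingHom.id ℝ := by ext; simp
    simp [Polynomial.eval₂_eq_eval_map, this]⟩

theorem isSAFun_knotRatio (p : Polynomial ℝ) (m : ℕ) :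
    IsSAFun fun x : Fin 1 → ℝ => knotRatio p m (x 0) :=
  p.isPolyFun.isSAFun.div (knotQ.isPolyFun.isSAFun.pow m)

theorem isSAFun_rad (n : ℕ) : IsSAFun fun x : Fin 1 → ℝ => rad n (x 0) := by
  refine IsSAFun.of_graph
    (G := fun x y => 0 ≤ y ∧ y ^ (n + 2) = (max (x 0) 0) ^ (2 * (n + 2) + 1)) ?_ fun x y => ?_
  · exact (IsSAFun.le (.const 0) (.coord none)).and (IsSAFun.eq ((IsSAFun.coord none).pow _)
      (((IsSAFun.coord (some 0)).max (.const 0)).pow _))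
  · have hm : 0 ≤ max (x 0) 0 := le_max_right _ _
    have hr : (rad n (x 0)) ^ (n + 2) = (max (x 0) 0) ^ (2 * (n + 2) + 1) := by
      rw [rad, ← Real.rpow_natCast, ← Real.rpow_natCast, ← Real.rpow_mul hm]
      congr 1
      push_cast
      have : (n : ℝ) + 2 ≠ 0 := by positivity
      field_simp
    have h0 : 0 ≤ rad n (x 0) := Real.rpow_nonneg hm _
    constructor
    · rintro rfl
      exact ⟨h0, hr⟩
    · rintro ⟨hy, h⟩
      exact (pow_left_inj₀ hy h0 (by omega)).1 (h.trans hr.symm)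

theorem isSAFun_emb (n : ℕ) {ι : Type} {y : Fin 4 → (ι → ℝ) → ℝ}
    (hy : ∀ k, IsSAFun (y k)) (i : Fin 3) :
    IsSAFun fun x => (emb (rad n) (y 0 x, fun k => y k.succ x)).2 i := by
  have hr : IsSAFun fun x => rad n (y 0 x) := .comp₁ (F := rad n) (isSAFun_rad n) (hy 0)
  have hs : ∀ k : Fin 3, IsSAFun fun x => (rad n (y 0 x))⁻¹ * y k.succ x := fun k => by
    have := ((IsSAFun.const 1).div hr).mul (hy k.succ)
    simpa only [one_div] using this
  have hk : ∀ j : Fin 3, IsSAFun fun x => knotk j ((rad n (y 0 x))⁻¹ * y 1 x) := fun j =>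
    .comp₁ (F := knotk j) (isSAFun_knotRatio _ _) (hs 0)
  have hk' : ∀ j : Fin 3, IsSAFun fun x => knotk' j ((rad n (y 0 x))⁻¹ * y 1 x) := fun j =>
    .comp₁ (F := knotk' j) (isSAFun_knotRatio _ _) (hs 0)
  fin_cases i
  · exact hr.mul (((hs 0).add (hk 0)).sub ((hs 2).mul (hk' 2)))
  · exact hr.mul ((hs 1).add (hk 1))
  · exact hr.mul ((hk 2).add ((hs 2).mul ((IsSAFun.const 1).add (hk' 0))))

theorem isSemialgebraic_model (n : ℕ) {Y : Set E4} (hY : IsSemialgebraic Y) :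
    IsSemialgebraic (model (rad n) (split4 '' Y)) := by
  rw [isSemialgebraic_iff] at hY ⊢
  have h : SemiAlg fun x : Fin 4 → ℝ => ∃ y : Fin 4 → ℝ, WithLp.toLp 2 y ∈ Y ∧ x 0 = y 0 ∧
      ∀ i : Fin 3, x i.succ = (emb (rad n) (y 0, fun k => y k.succ)).2 i := by
    refine SemiAlg.exFin ((hY.comp fun _ => .coord _).and (.and (SemiAlg.eq (.coord _) (.coord _))
      (SemiAlg.finAnd fun i => IsSAFun.eq (.coord _) ?_)))
    exact isSAFun_emb n (y := fun k z => z (Sum.inr k)) (fun k => .coord _) i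
  refine h.congr fun x => ?_
  constructor
  · rintro ⟨_, ⟨_, ⟨y, hy, rfl⟩, rfl⟩, h⟩
    have h' : emb (rad n) (split4 y) = split4 (WithLp.toLp 2 x) := by
      rw [← h, split4.apply_symm_apply]
    exact ⟨y.ofLp, hy, (congrArg Prod.fst h').symm, fun i => (congrFun (congrArg Prod.snd h')
        i).symm⟩
  · rintro ⟨y, hy, h0, h1⟩
    refine ⟨_, ⟨_, ⟨_, hy, rfl⟩, rfl⟩, ?_⟩
    rw [← split4.symm_apply_apply (WithLp.toLp 2 x)]
    congr 1
    exact Prod.ext h0.symm (funext fun i => (h1 i).symm)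

theorem exists_isFinger {S : Set E4} (hS : IsSemialgebraic S) (h0 : 0 ∈ S)
    (hdim : ∃ ε₀ > (0 : ℝ), ∀ ε : ℝ, 0 < ε → ε ≤ ε₀ → dimH (S ∩ Metric.ball 0 ε) = 2) :
    ∃ Y : Set E4, IsSemialgebraic Y ∧ AmbientTopEquiv Y S ∧ IsFinger (split4 '' Y) := by
  obtain ⟨Y, hY, h0Y, hYS, ε, hε, hthin, hdense⟩ := exists_finger hS h0 hdim
  refine ⟨Y, hY, hYS, ⟨0, h0Y, map_zero _⟩, ⟨1, one_pos, ?_⟩, ?_, ε, hε, ?_⟩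
  · rintro _ ⟨z, hz, rfl⟩ - h
    exact hthin z hz fun h' => h (by rw [h', map_zero])
  · rintro _ ⟨z, hz, rfl⟩ h
    exact (hthin z hz fun h' => h (by rw [h', map_zero])).1
  · intro t s ht htε hs
    obtain ⟨z, hz, hz0, h1, h2⟩ := hdense t s ht htε hs
    exact ⟨_, ⟨z, hz, rfl⟩, by simpa using hz0, h1, h2⟩

end Germs

section Root
open Filter Topology

/-- The coefficients `(a, b)` of the cubic polynomial `X³ - 3 a X + 2 b` with roots `x`, `y`
and `-x - y`. -/
def cubicCoeff (p : ℂ × ℂ) : ℂ × ℂ :=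
  ((p.1 ^ 2 + p.1 * p.2 + p.2 ^ 2) / 3, p.1 * p.2 * (p.1 + p.2) / 2)

/-- The complement of the cusp: coefficients of the cubics with three distinct roots. -/
def cuspCompl : Set (ℂ × ℂ) := {q | q.1 ^ 3 ≠ q.2 ^ 2}

theorem cubicCoeff_disc (p : ℂ × ℂ) : 108 * ((cubicCoeff p).1 ^ 3 - (cubicCoeff p).2 ^ 2) =
    ((p.1 - p.2) * (2 * p.1 + p.2) * (p.1 + 2 * p.2)) ^ 2 := by
  simp only [cubicCoeff]; ring

theorem mem_cuspCompl_cubicCoeff {p : ℂ × ℂ} : cubicCoeff p ∈ cuspCompl ↔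
    (p.1 - p.2) * (2 * p.1 + p.2) * (p.1 + 2 * p.2) ≠ 0 := by
  have := cubicCoeff_disc p
  rw [cuspCompl, mem_ofPred_eq, ← sub_ne_zero]
  constructor
  · intro h h0
    rw [h0] at this
    exact h (by simpa using this)
  · intro h h0
    rw [h0, mul_zero] at this
    exact h (pow_eq_zero_iff two_ne_zero |>.1 this.symm)

theorem cubicCoeff_root (p : ℂ × ℂ) :
    p.1 ^ 3 = 3 * (cubicCoeff p).1 * p.1 - 2 * (cubicCoeff p).2 := by
  simp only [cubicCoeff]; ring

theorem cubicCoeff_swap (x y : ℂ) : cubicCoeff (y, x) = cubicCoeff (x, y) := by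
  simp only [cubicCoeff, Prod.mk.injEq]; constructor <;> ring

theorem cubicCoeff_swap' (x y : ℂ) : cubicCoeff (x, -x - y) = cubicCoeff (x, y) := by
  simp only [cubicCoeff, Prod.mk.injEq]; constructor <;> ring

theorem cubicCoeff_smul (k : ℝ) (x y : ℂ) : cubicCoeff (k * x, k * y) =
    (k ^ 2 * (cubicCoeff (x, y)).1, k ^ 3 * (cubicCoeff (x, y)).2) := by
  simp only [cubicCoeff, Prod.mk.injEq]; constructor <;> ring

theorem continuous_cubicCoeff : Continuous cubicCoeff := by unfold cubicCoeff; fun_prop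

theorem norm_fst_le_of_cubicCoeff {p : ℂ × ℂ} {M : ℝ} (h : ‖cubicCoeff p‖ ≤ M) :
    ‖p.1‖ ≤ 1 + 5 * M := by
  have h1 := (norm_fst_le _).trans h
  have h2 := (norm_snd_le _).trans h
  have hM : 0 ≤ M := (norm_nonneg _).trans h
  by_contra! hx
  have h3 : ‖p.1‖ ^ 3 ≤ 3 * M * ‖p.1‖ + 2 * M := by
    rw [← norm_pow, cubicCoeff_root]
    refine (norm_sub_le _ _).trans ?_
    simp only [norm_mul, Complex.norm_ofNat]
    gcongr
  have h4 : ‖p.1‖ ^ 3 ≤ (5 * M) * ‖p.1‖ := by nlinarith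
  have h5 : ‖p.1‖ ^ 2 ≤ 5 * M := by
    have : 0 < ‖p.1‖ := by linarith
    nlinarith
  nlinarith

theorem isProperMap_cubicCoeff : IsProperMap cubicCoeff := by
  refine isProperMap_iff_isCompact_preimage.2 ⟨continuous_cubicCoeff, fun K hK => ?_⟩
  obtain ⟨M, hM⟩ := hK.isBounded.exists_norm_le
  refine (isCompact_closedBall (0 : ℂ × ℂ) (1 + 5 * M)).of_isClosed_subset
    (hK.isClosed.preimage continuous_cubicCoeff) fun p hp => ?_
  have h := hM _ hp
  rw [mem_closedBall_zero_iff, Prod.norm_def]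
  refine max_le (norm_fst_le_of_cubicCoeff h) ?_
  rw [← cubicCoeff_swap] at h
  exact norm_fst_le_of_cubicCoeff h

/-- The derivative of `cubicCoeff`. -/
def cubicCoeffD (p : ℂ × ℂ) : ℂ × ℂ →L[ℂ] ℂ × ℂ :=
  ContinuousLinearMap.prod
    (((2 * p.1 + p.2) / 3) • ContinuousLinearMap.fst ℂ ℂ ℂ +
      ((p.1 + 2 * p.2) / 3) • ContinuousLinearMap.snd ℂ ℂ ℂ)
    (((2 * p.1 * p.2 + p.2 ^ 2) / 2) • ContinuousLinearMap.fst ℂ ℂ ℂ +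
      ((p.1 ^ 2 + 2 * p.1 * p.2) / 2) • ContinuousLinearMap.snd ℂ ℂ ℂ)

theorem hasStrictFDerivAt_cubicCoeff (p : ℂ × ℂ) :
    HasStrictFDerivAt cubicCoeff (cubicCoeffD p) p := by
  have h1 := hasStrictFDerivAt_fst (𝕜 := ℂ) (p := p)
  have h2 := hasStrictFDerivAt_snd (𝕜 := ℂ) (p := p)
  unfold cubicCoeff cubicCoeffD
  simp only [div_eq_mul_inv]
  refine HasStrictFDerivAt.prodMk ?_ ?_
  · refine ((((h1.pow 2).add (h1.mul h2)).add (h2.pow 2)).mul_const (3 : ℂ)⁻¹).congr_fderiv ?_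
    ext <;> simp <;> ring
  · refine (((h1.mul h2).mul (h1.add h2)).mul_const (2 : ℂ)⁻¹).congr_fderiv ?_
    ext <;> simp <;> ring

theorem injective_cubicCoeffD {p : ℂ × ℂ}
    (h : (p.1 - p.2) * (2 * p.1 + p.2) * (p.1 + 2 * p.2) ≠ 0) :
    Function.Injective (cubicCoeffD p) := by
  rw [injective_iff_map_eq_zero]
  rintro ⟨u, v⟩ huv
  obtain ⟨h1, h2⟩ : (2 * p.1 + p.2) / 3 * u + (p.1 + 2 * p.2) / 3 * v = 0 ∧
    (2 * p.1 * p.2 + p.2 ^ 2) / 2 * u + (p.1 ^ 2 + 2 * p.1 * p.2) / 2 * v = 0 := by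
    simpa [cubicCoeffD] using huv
  have hu : (p.1 - p.2) * (2 * p.1 + p.2) * (p.1 + 2 * p.2) * u = 0 := by
    linear_combination 3 * (p.1 ^ 2 + 2 * p.1 * p.2) * h1 - 2 * (p.1 + 2 * p.2) * h2
  have hv : (p.1 - p.2) * (2 * p.1 + p.2) * (p.1 + 2 * p.2) * v = 0 := by
    linear_combination 2 * (2 * p.1 + p.2) * h2 - 3 * (2 * p.1 * p.2 + p.2 ^ 2) * h1
  rw [Prod.mk_eq_zero]
  exact ⟨(mul_eq_zero.1 hu).resolve_left h, (mul_eq_zero.1 hv).resolve_left h⟩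

theorem isCoveringMapOn_cubicCoeff : IsCoveringMapOn cubicCoeff cuspCompl := by
  have key : ∀ p : ℂ × ℂ, cubicCoeff p ∈ cuspCompl →
      ∃ φ : OpenPartialHomeomorph (ℂ × ℂ) (ℂ × ℂ), p ∈ φ.source ∧ φ = cubicCoeff := fun p hp => by
    let e := (LinearEquiv.ofInjectiveEndo (cubicCoeffD p).toLinearMap
      (injective_cubicCoeffD (mem_cuspCompl_cubicCoeff.1 hp))).toContinuousLinearEquiv
    have he : HasStrictFDerivAt cubicCoeff (e : ℂ × ℂ →L[ℂ] ℂ × ℂ) p :=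
      (hasStrictFDerivAt_cubicCoeff p).congr_fderiv (by ext <;> simp [e])
    exact ⟨he.toOpenPartialHomeomorph _, he.mem_toOpenPartialHomeomorph_source, by simp⟩
  intro q hq
  have h : ∀ p ∈ cubicCoeff ⁻¹' {q},
      ∃ φ : OpenPartialHomeomorph (ℂ × ℂ) (ℂ × ℂ), p ∈ φ.source ∧ φ = cubicCoeff :=
    fun p hp => key p (by rw [show cubicCoeff p = q from hp]; exact hq)
  exact isProperMap_cubicCoeff.isClosedMap.isEvenlyCovered_of_openPartialHomeomorph
    ((isProperMap_cubicCoeff.isCompact_preimage isCompact_singleton).finite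
      (.of_openPartialHomeomorph _ subset_rfl h)) h

end Root

section Obstruction
open Filter Topology unitInterval

variable {Ω : Type*} [TopologicalSpace Ω] [SimplyConnectedSpace Ω] [LocallyPathConnectedSpace Ω]

theorem cubicCoeff_lift_unique {A : Type*} [TopologicalSpace A] [PreconnectedSpace A]
    {r r' : C(A, ℂ × ℂ)} (h : ∀ x, cubicCoeff (r x) ∈ cuspCompl)
    (hr : ∀ x, cubicCoeff (r x) = cubicCoeff (r' x)) {x₀ : A} (h0 : r x₀ = r' x₀) : r = r' := by
  have := isCoveringMapOn_cubicCoeff.isCoveringMap_restrictPreimage.eq_of_comp_eq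
    (g₁ := fun x => ⟨r x, h x⟩) (g₂ := fun x => ⟨r' x, by simpa [← hr] using h x⟩)
    (by fun_prop) (by fun_prop) (funext fun x => Subtype.ext (hr x)) x₀ (Subtype.ext h0)
  ext1 x
  exact congrArg Subtype.val (congrFun this x)

theorem exists_cubicCoeff_lift {G : Ω → ℂ × ℂ} (hG : Continuous G) (hc : ∀ x, G x ∈ cuspCompl)
    {x₀ : Ω} {p : ℂ × ℂ} (hp : cubicCoeff p = G x₀) :
    ∃ r : C(Ω, ℂ × ℂ), r x₀ = p ∧ ∀ x, cubicCoeff (r x) = G x := by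
  obtain ⟨r, ⟨h0, hr⟩, -⟩ := isCoveringMapOn_cubicCoeff.existsUnique_continuousMap_lifts
    (⟨G, hG⟩ : C(Ω, ℂ × ℂ)) (a₀ := x₀) hp hc
  exact ⟨r, h0, fun x => congrFun hr x⟩

omit [SimplyConnectedSpace Ω] [LocallyPathConnectedSpace Ω] in
theorem cubicCoeff_path_unique {G : Ω → ℂ × ℂ} (hc : ∀ x, G x ∈ cuspCompl) {r : C(Ω, ℂ × ℂ)}
    (hr : ∀ x, cubicCoeff (r x) = G x) {γ : C(I, Ω)} {s : C(I, ℂ × ℂ)}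
    (hs : ∀ φ, cubicCoeff (s φ) = G (γ φ)) (h0 : r (γ 0) = s 0) : r (γ 1) = s 1 := by
  have : r.comp γ = s := cubicCoeff_lift_unique (x₀ := (0 : I))
    (fun φ => by simpa [hr] using hc (γ φ)) (fun φ => by simp [hr, hs]) h0
  exact DFunLike.congr_fun this 1

/-- Over a simply connected space there is no loop with nontrivial root monodromy. -/
theorem eq_of_cubicCoeff_loop {G : Ω → ℂ × ℂ} (hG : Continuous G) (hc : ∀ x, G x ∈ cuspCompl)
    {γ : C(I, Ω)} (hγ : γ 1 = γ 0) {s : C(I, ℂ × ℂ)}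
    (hs : ∀ φ, cubicCoeff (s φ) = G (γ φ)) : s 1 = s 0 := by
  obtain ⟨r, h0, hr⟩ := exists_cubicCoeff_lift hG hc (hs 0)
  rw [← cubicCoeff_path_unique hc hr hs h0, hγ, h0]

/-- Two deck transformations that commute cannot realize two adjacent transpositions of the
roots. -/
theorem false_of_commute_deck {G : Ω → ℂ × ℂ} (hG : Continuous G) (hc : ∀ x, G x ∈ cuspCompl)
    {T T' : C(Ω, Ω)} (hT : ∀ x, G (T x) = G x) (hT' : ∀ x, G (T' x) = G x) {γ γ' : C(I, Ω)}
    (hγ : γ 1 = T (γ 0)) (hγ' : γ' 1 = T' (γ' 0)) (hγγ' : γ' 0 = γ 0)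
    (hTT' : T (T' (γ 0)) = T' (T (γ 0)))
    {s s' : C(I, ℂ × ℂ)} (hs : ∀ φ, cubicCoeff (s φ) = G (γ φ))
    (hs' : ∀ φ, cubicCoeff (s' φ) = G (γ' φ)) (hss' : s' 0 = s 0)
    (h1 : s 1 = ((s 0).2, (s 0).1)) (h1' : s' 1 = ((s 0).1, -(s 0).1 - (s 0).2)) : False := by
  obtain ⟨r, h0, hr⟩ := exists_cubicCoeff_lift hG hc (hs 0)
  have e1 := cubicCoeff_path_unique hc hr hs h0
  have e2 := cubicCoeff_path_unique hc hr hs' (by rw [hss', hγγ', h0])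
  rw [hγ, h1] at e1
  rw [hγ', h1', hγγ'] at e2
  have k1 : r.comp T = (⟨fun p => (p.2, p.1), by fun_prop⟩ : C(ℂ × ℂ, ℂ × ℂ)).comp r :=
    cubicCoeff_lift_unique (x₀ := γ 0) (fun x => by simpa [hr, hT] using hc x)
      (fun x => by simp [hr, hT, cubicCoeff_swap]) (by simp [e1, h0])
  have k2 : r.comp T' = (⟨fun p => (p.1, -p.1 - p.2), by fun_prop⟩ : C(ℂ × ℂ, ℂ × ℂ)).comp r :=
    cubicCoeff_lift_unique (x₀ := γ 0) (fun x => by simpa [hr, hT'] using hc x)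
      (fun x => by simp [hr, hT', cubicCoeff_swap']) (by simp [e2, h0])
  have k3 := DFunLike.congr_fun k1 (T' (γ 0))
  have k4 := DFunLike.congr_fun k2 (T (γ 0))
  simp only [ContinuousMap.comp_apply, ContinuousMap.coe_mk, e1, e2] at k3 k4
  rw [hTT', k4, Prod.mk.injEq] at k3
  have hne := mem_cuspCompl_cubicCoeff.1 (show cubicCoeff (s 0) ∈ cuspCompl by
    rw [hs]; exact hc _)
  refine hne ?_
  linear_combination ((s 0).1 - (s 0).2) * (2 * (s 0).1 + (s 0).2) * k3.1

end Obstruction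

section Loop
open Filter Topology

/-- First complex coordinate of (a multiple of) the inverse stereographic projection of `y`,
after the linear normalization of the long knot. -/
def knotZ (y : Fin 3 → ℝ) : ℂ :=
  ⟨((5 * y 0 + y 2 / 2) / 13) ^ 2 + y 1 ^ 2 + ((-y 0 + 5 / 2 * y 2) / 13) ^ 2 - 1,
    2 * ((5 * y 0 + y 2 / 2) / 13)⟩

/-- Second complex coordinate of (a multiple of) the inverse stereographic projection. -/
def knotW (y : Fin 3 → ℝ) : ℂ := ⟨2 * y 1, 2 * ((-y 0 + 5 / 2 * y 2) / 13)⟩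

/-- A map from `ℝ³` to pairs of coefficients of cubics for which the knot is the preimage of the
cusp. -/
def knotCoeff (y : Fin 3 → ℝ) : ℂ × ℂ :=
  ((knotZ y + knotW y) * ‖knotZ y + knotW y‖, (knotZ y - knotW y) * ‖knotZ y - knotW y‖ ^ 2)

theorem continuous_knotZ : Continuous knotZ := by
  have : knotZ = fun y => Complex.equivRealProdCLM.symm
      (((5 * y 0 + y 2 / 2) / 13) ^ 2 + y 1 ^ 2 + ((-y 0 + 5 / 2 * y 2) / 13) ^ 2 - 1,
    2 * ((5 * y 0 + y 2 / 2) / 13)) := by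
    funext y; apply Complex.ext <;> simp [knotZ]
  rw [this]; fun_prop

theorem continuous_knotW : Continuous knotW := by
  have : knotW = fun y => Complex.equivRealProdCLM.symm
      (2 * y 1, 2 * ((-y 0 + 5 / 2 * y 2) / 13)) := by
    funext y; apply Complex.ext <;> simp [knotW]
  rw [this]; fun_prop

theorem continuous_knotCoeff : Continuous knotCoeff := by
  have := continuous_knotZ
  have := continuous_knotW
  unfold knotCoeff
  fun_prop

theorem norm_knotZ_add_sq (y : Fin 3 → ℝ) :
    ‖knotZ y + knotW y‖ ^ 2 + ‖knotZ y - knotW y‖ ^ 2 = 2 * ((knotZ y).re + 2) ^ 2 := by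
  simp only [← Complex.normSq_eq_norm_sq, Complex.normSq_apply, knotZ, knotW, Complex.add_re,
    Complex.add_im, Complex.sub_re, Complex.sub_im]
  ring

theorem add_I_pow_five (σ : ℝ) : ((σ : ℂ) + Complex.I) ^ 5 =
    ⟨σ ^ 5 - 10 * σ ^ 3 + 5 * σ, 5 * σ ^ 4 - 10 * σ ^ 2 + 1⟩ := by
  rw [show (⟨σ ^ 5 - 10 * σ ^ 3 + 5 * σ, 5 * σ ^ 4 - 10 * σ ^ 2 + 1⟩ : ℂ) =
    ((σ ^ 5 - 10 * σ ^ 3 + 5 * σ : ℝ) : ℂ) + ((5 * σ ^ 4 - 10 * σ ^ 2 + 1 : ℝ) : ℂ) * Complex.I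
    from (Complex.mk_eq_add_mul_I _ _)]
  push_cast
  have hI := Complex.I_sq
  linear_combination (5 * (σ : ℂ) ^ 1 * (Complex.I ^ 2 - 1) + Complex.I ^ 3 - Complex.I
    + 10 * (σ : ℂ) ^ 2 * Complex.I + 10 * σ ^ 3) * hI

theorem knot_eq_iff (y : Fin 3 → ℝ) (σ : ℝ) : y = knot σ ↔
    knotZ y = 2 * σ * (σ + Complex.I) ^ 5 / (knotQ.eval σ : ℝ) ∧
    knotW y = -(2 * Complex.I * (σ + Complex.I) ^ 5 / (knotQ.eval σ : ℝ)) := by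
  have hq := (knotQ_pos σ).ne'
  have h5 := add_I_pow_five σ
  have hzi : (2 * σ * ((σ : ℂ) + Complex.I) ^ 5 / (knotQ.eval σ : ℝ)).im =
      2 * σ * (5 * σ ^ 4 - 10 * σ ^ 2 + 1) / knotQ.eval σ := by
    rw [h5, Complex.div_ofReal_im]; simp
  have hzr : (2 * σ * ((σ : ℂ) + Complex.I) ^ 5 / (knotQ.eval σ : ℝ)).re =
      2 * σ * (σ ^ 5 - 10 * σ ^ 3 + 5 * σ) / knotQ.eval σ := by
    rw [h5, Complex.div_ofReal_re]; simp
  have hwr : (-(2 * Complex.I * ((σ : ℂ) + Complex.I) ^ 5 / (knotQ.eval σ : ℝ))).re =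
      2 * (5 * σ ^ 4 - 10 * σ ^ 2 + 1) / knotQ.eval σ := by
    rw [h5, Complex.neg_re, Complex.div_ofReal_re]; simp; ring
  have hwi : (-(2 * Complex.I * ((σ : ℂ) + Complex.I) ^ 5 / (knotQ.eval σ : ℝ))).im =
      -(2 * (σ ^ 5 - 10 * σ ^ 3 + 5 * σ) / knotQ.eval σ) := by
    rw [h5, Complex.neg_im, Complex.div_ofReal_im]; simp
  rw [Complex.ext_iff, Complex.ext_iff, hzi, hzr, hwr, hwi]
  simp only [knotZ, knotW]
  rw [knotQ_eval] at *
  have hq2 : σ ^ 2 * (13 * σ ^ 2 - 2) + 1 ≠ 0 := by convert hq using 1; ring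
  constructor
  · rintro rfl
    simp only [knot, knotk_zero, knotk_one, knotk_two, Matrix.cons_val]
    clear hzi hzr hwr hwi hq2
    generalize hQ : 13 * σ ^ 4 - 2 * σ ^ 2 + 1 = q at *
    refine ⟨⟨?_, ?_⟩, ?_, ?_⟩ <;> field_simp <;> rw [← hQ] <;> ring
  · rintro ⟨⟨-, h1⟩, h2, h3⟩
    funext i
    fin_cases i
    · simp only [knot, knotk_zero, Matrix.cons_val, Fin.zero_eta]
      trans 5 / 4 * (2 * σ * (5 * σ ^ 4 - 10 * σ ^ 2 + 1) / (13 * σ ^ 4 - 2 * σ ^ 2 + 1)) +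
        1 / 4 * (2 * (σ ^ 5 - 10 * σ ^ 3 + 5 * σ) / (13 * σ ^ 4 - 2 * σ ^ 2 + 1))
      · linear_combination 5 / 4 * h1 - 1 / 4 * h3
      · generalize hQ : 13 * σ ^ 4 - 2 * σ ^ 2 + 1 = q at *
        field_simp
        rw [← hQ]
        ring
    · simp only [knot, knotk_one, Matrix.cons_val, Fin.mk_one]
      linear_combination 1 / 2 * h2
    · simp only [knot, knotk_two, Matrix.cons_val, Fin.reduceFinMk]
      linear_combination 1 / 2 * h1 + 5 / 2 * h3

theorem knotCoeff_knot (σ : ℝ) : knotCoeff (knot σ) ∉ cuspCompl := by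
  obtain ⟨hz, hw⟩ := (knot_eq_iff _ σ).1 rfl
  have hq := knotQ_pos σ
  generalize knotQ.eval σ = q at *
  have hqc : (q : ℂ) ≠ 0 := Complex.ofReal_ne_zero.2 hq.ne'
  obtain ⟨u, hu⟩ : ∃ u : ℂ, u = σ + Complex.I := ⟨_, rfl⟩
  have hv : starRingEnd ℂ u = σ - Complex.I := by rw [hu]; simp [sub_eq_add_neg]
  have hmul : starRingEnd ℂ u * u = (‖u‖ : ℂ) ^ 2 := by rw [mul_comm, Complex.mul_conj']
  have hA : knotZ (knot σ) + knotW (knot σ) = 2 * starRingEnd ℂ u * u ^ 5 / q := by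
    rw [hz, hw, hv, ← hu]; ring
  have hB : knotZ (knot σ) - knotW (knot σ) = 2 * u ^ 6 / q := by
    rw [hz, hw, ← hu]
    linear_combination -(2 * u ^ 5 / q) * hu
  have nA : ‖knotZ (knot σ) + knotW (knot σ)‖ = 2 * ‖u‖ ^ 6 / q := by
    rw [hA]; simp [abs_of_pos hq]; ring
  have nB : ‖knotZ (knot σ) - knotW (knot σ)‖ = 2 * ‖u‖ ^ 6 / q := by
    rw [hB]; simp [abs_of_pos hq]
  simp only [cuspCompl, mem_ofPred_eq, not_not, knotCoeff, nA, nB]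
  rw [hA, hB]
  push_cast
  have h6 : (‖u‖ : ℂ) ^ 6 = (starRingEnd ℂ u * u) ^ 3 := by rw [hmul]; ring
  rw [h6]
  field_simp

theorem mem_range_knot_of_knotCoeff {y : Fin 3 → ℝ} (h : knotCoeff y ∉ cuspCompl) :
    y ∈ range knot := by
  simp only [cuspCompl, mem_ofPred_eq, not_not, knotCoeff] at h
  have hn := norm_knotZ_add_sq y
  have hre : 1 ≤ (knotZ y).re + 2 := by
    simp only [knotZ]
    nlinarith [sq_nonneg ((5 * y 0 + y 2 / 2) / 13), sq_nonneg (y 1),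
      sq_nonneg ((-y 0 + 5 / 2 * y 2) / 13)]
  obtain ⟨A, hA⟩ : ∃ A, A = knotZ y + knotW y := ⟨_, rfl⟩
  obtain ⟨B, hB⟩ : ∃ B, B = knotZ y - knotW y := ⟨_, rfl⟩
  obtain ⟨ρ, hρ⟩ : ∃ ρ, ρ = (knotZ y).re + 2 := ⟨_, rfl⟩
  rw [← hA, ← hB] at h hn
  rw [← hρ] at hn hre
  have hAB : ‖A‖ = ‖B‖ := by
    have h6 : ‖A‖ ^ 6 = ‖B‖ ^ 6 := by
      have := congrArg norm h
      simp only [norm_pow, norm_mul, Complex.norm_real, norm_norm] at this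
      linear_combination this
    exact (pow_left_inj₀ (norm_nonneg _) (norm_nonneg _) (by norm_num)).1 h6
  have hAρ : ‖A‖ = ρ := by
    rw [← hAB] at hn
    exact (pow_left_inj₀ (norm_nonneg _) (by linarith) two_ne_zero).1 (by linarith)
  have hBρ : ‖B‖ = ρ := hAB ▸ hAρ
  have hρc : (ρ : ℂ) ≠ 0 := Complex.ofReal_ne_zero.2 (by linarith)
  have hA0 : A ≠ 0 := by rw [← norm_pos_iff]; linarith
  rw [hAρ, hBρ] at h
  have h3 : A ^ 3 = ρ * B ^ 2 := mul_right_cancel₀ (pow_ne_zero 3 hρc) (by linear_combination h)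
  obtain ⟨u, hu⟩ : ∃ u, u = B / A := ⟨_, rfl⟩
  have hu2 : A = ρ * u ^ 2 := by rw [hu]; field_simp; linear_combination h3
  have hu3 : B = ρ * u ^ 3 := by
    have : B = A * u := by rw [hu]; field_simp
    rw [this, hu2]; ring
  have hu1 : u.re ^ 2 + u.im ^ 2 = 1 := by
    have : ‖u‖ = 1 := by rw [hu, norm_div, hAρ, hBρ, div_self (by linarith)]
    have := congrArg (· ^ 2) this
    simp only [← Complex.normSq_eq_norm_sq, Complex.normSq_apply] at this
    linarith
  have hZ : knotZ y = ρ * u ^ 2 * (1 + u) / 2 := by linear_combination (hu2 + hu3 - hA - hB) / 2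
  have hW : knotW y = ρ * u ^ 2 * (1 - u) / 2 := by linear_combination (hu2 - hu3 - hA + hB) / 2
  have hne : 1 - u.re ≠ 0 := by
    intro h0
    have h1 : u = 1 := by
      apply Complex.ext <;> simp
      · linarith
      · have : u.re = 1 := by linarith
        rw [this] at hu1
        exact pow_eq_zero_iff two_ne_zero |>.1 (by linarith)
    rw [h1] at hZ
    have := congrArg Complex.re hZ
    simp at this
    linarith
  obtain ⟨s, hs⟩ : ∃ s, s = u.im / (1 - u.re) := ⟨_, rfl⟩
  have hsu : u * (s - Complex.I) = s + Complex.I := by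
    have hs' : s * (1 - u.re) = u.im := by rw [hs, div_mul_cancel₀ _ hne]
    apply Complex.ext
    · simp
      linear_combination -hs'
    · simp
      refine mul_right_cancel₀ hne ?_
      linear_combination u.im * hs' + hu1
  have hm : ((s : ℂ) - Complex.I) * (s + Complex.I) = (s ^ 2 + 1 : ℝ) := by
    push_cast
    linear_combination -Complex.I_sq
  have hs1 : ((s ^ 2 + 1 : ℝ) : ℂ) ≠ 0 := Complex.ofReal_ne_zero.2 (by positivity)
  have hsm : (s : ℂ) - Complex.I ≠ 0 := fun h0 => hs1 (by rw [← hm, h0, zero_mul])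
  have hsp : (s : ℂ) + Complex.I ≠ 0 := fun h0 => hs1 (by rw [← hm, h0, mul_zero])
  have hu' : u = (s + Complex.I) / (s - Complex.I) := by rw [eq_div_iff hsm, hsu]
  have hZ' : knotZ y = ρ * s * (s + Complex.I) ^ 5 / ((s ^ 2 + 1 : ℝ) : ℂ) ^ 3 := by
    rw [hZ, hu', ← hm]; field_simp; ring
  have hW' : knotW y = -(ρ * Complex.I * (s + Complex.I) ^ 5 / ((s ^ 2 + 1 : ℝ) : ℂ) ^ 3) := by
    rw [hW, hu', ← hm]; field_simp; ring
  have hq : ρ * knotQ.eval s = 2 * (s ^ 2 + 1) ^ 3 := by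
    have := congrArg Complex.re hZ'
    rw [add_I_pow_five, ← Complex.ofReal_pow, Complex.div_ofReal_re] at this
    simp at this
    rw [eq_div_iff (by positivity)] at this
    rw [knotQ_eval]
    have h2 : (knotZ y).re = ρ - 2 := by linarith
    rw [h2] at this
    linear_combination this
  refine ⟨s, ((knot_eq_iff y s).2 ?_).symm⟩
  have hqc : ((knotQ.eval s : ℝ) : ℂ) ≠ 0 := Complex.ofReal_ne_zero.2 (knotQ_pos s).ne'
  have hρ' : (ρ : ℂ) = 2 * ((s ^ 2 + 1 : ℝ) : ℂ) ^ 3 / (knotQ.eval s : ℝ) := by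
    rw [eq_div_iff hqc]
    exact_mod_cast hq
  rw [hZ', hW', hρ']
  constructor <;> field_simp

theorem knotCoeff_mem_cuspCompl {y : Fin 3 → ℝ} : knotCoeff y ∈ cuspCompl ↔ y ∉ range knot := by
  refine ⟨?_, fun h => by_contra fun h' => h (mem_range_knot_of_knotCoeff h')⟩
  rintro h ⟨σ, rfl⟩
  exact knotCoeff_knot σ h

end Loop

section KnotPoint
open Filter Topology

/-- The radial rescaling of `z` with `radialRoot e z * ‖radialRoot e z‖ ^ (1 / (1 - e) - 1) = z`. -/
def radialRoot (e : ℝ) (z : ℂ) : ℂ := z * (‖z‖ ^ (-e) : ℝ)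

theorem norm_radialRoot (e : ℝ) {z : ℂ} (hz : z ≠ 0) : ‖radialRoot e z‖ = ‖z‖ ^ (1 - e) := by
  have h := norm_pos_iff.2 hz
  rw [radialRoot, norm_mul, Complex.norm_real, Real.norm_of_nonneg (by positivity), sub_eq_add_neg,
    Real.rpow_add h, Real.rpow_one]

theorem radialRoot_half {z : ℂ} (hz : z ≠ 0) :
    radialRoot (1 / 2) z * ‖radialRoot (1 / 2) z‖ = z := by
  have h := norm_pos_iff.2 hz
  rw [norm_radialRoot _ hz, radialRoot, mul_assoc, ← Complex.ofReal_mul, ← Real.rpow_add h]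
  norm_num

theorem radialRoot_two_thirds {z : ℂ} (hz : z ≠ 0) :
    radialRoot (2 / 3) z * ‖radialRoot (2 / 3) z‖ ^ 2 = z := by
  have h := norm_pos_iff.2 hz
  rw [norm_radialRoot _ hz, radialRoot, mul_assoc, ← Complex.ofReal_pow, ← Complex.ofReal_mul,
    ← Real.rpow_natCast, ← Real.rpow_mul h.le, ← Real.rpow_add h]
  norm_num

theorem continuousAt_radialRoot (e : ℝ) {z : ℂ} (hz : z ≠ 0) : ContinuousAt (radialRoot e) z := by
  refine continuousAt_id.mul (Complex.continuous_ofReal.continuousAt.comp ?_)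
  exact continuous_norm.continuousAt.rpow_const (Or.inl (norm_ne_zero_iff.2 hz))

/-- The first sphere coordinate of `q`. -/
def preZ (q : ℂ × ℂ) : ℂ := (radialRoot (1 / 2) q.1 + radialRoot (2 / 3) q.2) / 2

/-- The second sphere coordinate of `q`. -/
def preW (q : ℂ × ℂ) : ℂ := (radialRoot (1 / 2) q.1 - radialRoot (2 / 3) q.2) / 2

/-- The denominator of the stereographic projection. -/
def preD (q : ℂ × ℂ) : ℝ := √(‖preZ q‖ ^ 2 + ‖preW q‖ ^ 2) - (preZ q).re

/-- A right inverse of `knotCoeff`, up to weighted positive scaling. -/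
def knotPoint (q : ℂ × ℂ) : Fin 3 → ℝ :=
  ![(5 / 2 * (preZ q).im - 1 / 2 * (preW q).im) / preD q, (preW q).re / preD q,
    ((preZ q).im + 5 * (preW q).im) / preD q]

variable {q : ℂ × ℂ} (h1 : q.1 ≠ 0) (h2 : q.2 ≠ 0)

include h1 h2 in
theorem preD_pos (hq : q ∈ cuspCompl) : 0 < preD q := by
  rw [preD, sub_pos]
  by_contra! h
  obtain ⟨h0, h⟩ := Real.sqrt_le_iff.1 h
  rw [← Complex.normSq_eq_norm_sq, ← Complex.normSq_eq_norm_sq, Complex.normSq_apply,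
    Complex.normSq_apply] at h
  have hw : preW q = 0 := by
    apply Complex.ext <;> refine pow_eq_zero_iff two_ne_zero |>.1 ?_ <;>
    nlinarith [sq_nonneg (preZ q).im, sq_nonneg (preW q).re, sq_nonneg (preW q).im]
  have hz : preZ q = ((preZ q).re : ℝ) := by
    apply Complex.ext
    · simp
    · refine pow_eq_zero_iff two_ne_zero |>.1 ?_
      nlinarith [sq_nonneg (preZ q).im, sq_nonneg (preW q).re, sq_nonneg (preW q).im]
  have e1 : radialRoot (1 / 2) q.1 = ((preZ q).re : ℝ) := by
    rw [← hz, ← add_zero (preZ q), ← hw, preZ, preW]; ring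
  have e2 : radialRoot (2 / 3) q.2 = ((preZ q).re : ℝ) := by
    rw [← hz, ← sub_zero (preZ q), ← hw, preZ, preW]; ring
  have k1 := radialRoot_half h1
  have k2 := radialRoot_two_thirds h2
  rw [e1, Complex.norm_real, Real.norm_of_nonneg h0] at k1
  rw [e2, Complex.norm_real, Real.norm_of_nonneg h0] at k2
  exact hq (by rw [← k1, ← k2]; ring)

include h1 h2 in
theorem knotCoeff_knotPoint (hq : q ∈ cuspCompl) :
    knotCoeff (knotPoint q) = ((2 / preD q : ℝ) ^ 2 * q.1, (2 / preD q : ℝ) ^ 3 * q.2) := by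
  have hD := preD_pos h1 h2 hq
  have hZW : ((preZ q).re + preD q) ^ 2 =
      (preZ q).re ^ 2 + (preZ q).im ^ 2 + (preW q).re ^ 2 + (preW q).im ^ 2 := by
    rw [preD, add_sub_cancel, Real.sq_sqrt (by positivity), ← Complex.normSq_eq_norm_sq,
      ← Complex.normSq_eq_norm_sq, Complex.normSq_apply, Complex.normSq_apply]
    ring
  have hz : knotZ (knotPoint q) = (2 / preD q : ℝ) * preZ q := by
    apply Complex.ext
    · rw [Complex.re_ofReal_mul]
      simp only [knotZ, knotPoint, Matrix.cons_val]
      field_simp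
      linear_combination -676 * hZW
    · rw [Complex.im_ofReal_mul]
      simp only [knotZ, knotPoint, Matrix.cons_val]
      field_simp
      ring
  have hw : knotW (knotPoint q) = (2 / preD q : ℝ) * preW q := by
    apply Complex.ext
    · rw [Complex.re_ofReal_mul]
      simp only [knotW, knotPoint, Matrix.cons_val]
      field_simp
    · rw [Complex.im_ofReal_mul]
      simp only [knotW, knotPoint, Matrix.cons_val]
      field_simp
      ring
  have e1 : knotZ (knotPoint q) + knotW (knotPoint q) =
      (2 / preD q : ℝ) * radialRoot (1 / 2) q.1 := by rw [hz, hw, preZ, preW]; ring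
  have e2 : knotZ (knotPoint q) - knotW (knotPoint q) =
      (2 / preD q : ℝ) * radialRoot (2 / 3) q.2 := by rw [hz, hw, preZ, preW]; ring
  rw [knotCoeff, e1, e2, norm_mul, norm_mul, Complex.norm_real,
    Real.norm_of_nonneg (by positivity : (0:ℝ) ≤ 2 / preD q)]
  generalize (2 / preD q : ℝ) = k
  push_cast
  congr 1
  · linear_combination (k : ℂ) ^ 2 * radialRoot_half h1
  · linear_combination (k : ℂ) ^ 3 * radialRoot_two_thirds h2

include h1 h2 in
theorem continuousAt_preD : ContinuousAt preD q ∧ ContinuousAt preZ q ∧ ContinuousAt preW q := by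
  have c1 : ContinuousAt (fun q : ℂ × ℂ => radialRoot (1 / 2) q.1) q :=
    (continuousAt_radialRoot _ h1).comp (f := fun q : ℂ × ℂ => q.1) continuousAt_fst
  have c2 : ContinuousAt (fun q : ℂ × ℂ => radialRoot (2 / 3) q.2) q :=
    (continuousAt_radialRoot _ h2).comp (f := fun q : ℂ × ℂ => q.2) continuousAt_snd
  have cz : ContinuousAt preZ q := (c1.add c2).div_const 2
  have cw : ContinuousAt preW q := (c1.sub c2).div_const 2
  refine ⟨?_, cz, cw⟩
  exact ((cz.norm.pow 2).add (cw.norm.pow 2)).sqrt.sub (Complex.continuous_re.continuousAt.comp cz)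

include h1 h2 in
theorem continuousAt_knotPoint (hq : q ∈ cuspCompl) : ContinuousAt knotPoint q := by
  obtain ⟨cd, cz, cw⟩ := continuousAt_preD h1 h2
  have hD := (preD_pos h1 h2 hq).ne'
  have czi := Complex.continuous_im.continuousAt.comp cz
  have cwi := Complex.continuous_im.continuousAt.comp cw
  have cwr := Complex.continuous_re.continuousAt.comp cw
  refine continuousAt_pi.2 fun i => ?_
  fin_cases i
  · exact ((czi.const_mul _).sub (cwi.const_mul _)).div cd hD
  · exact cwr.div cd hD
  · exact (czi.add (cwi.const_mul _)).div cd hD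

open Complex in
/-- Lifting a path of cubics with nonzero coefficients to a path avoiding the knot. -/
theorem exists_knotPoint_path {p : C(unitInterval, ℂ × ℂ)}
    (hp : ∀ φ, cubicCoeff (p φ) ∈ cuspCompl ∧ (cubicCoeff (p φ)).1 ≠ 0 ∧ (cubicCoeff (p φ)).2 ≠ 0) :
    ∃ (ℓ : C(unitInterval, Fin 3 → ℝ)) (s : C(unitInterval, ℂ × ℂ)),
      (∀ φ, ℓ φ = knotPoint (cubicCoeff (p φ))) ∧
      (∀ φ, s φ = ((2 / preD (cubicCoeff (p φ)) : ℝ) * (p φ).1,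
        (2 / preD (cubicCoeff (p φ)) : ℝ) * (p φ).2)) ∧
      ∀ φ, cubicCoeff (s φ) = knotCoeff (ℓ φ) ∧ knotCoeff (ℓ φ) ∈ cuspCompl := by
  have cp : Continuous fun φ => cubicCoeff (p φ) := continuous_cubicCoeff.comp p.continuous
  have c1 : Continuous fun φ => knotPoint (cubicCoeff (p φ)) :=
    continuous_iff_continuousAt.2 fun φ =>
      (continuousAt_knotPoint (hp φ).2.1 (hp φ).2.2 (hp φ).1).comp (f := fun φ => cubicCoeff (p φ))
        cp.continuousAt
  have c2 : Continuous fun φ => 2 / preD (cubicCoeff (p φ)) := by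
    refine continuous_const.div (continuous_iff_continuousAt.2 fun φ => ?_)
      fun φ => (preD_pos (hp φ).2.1 (hp φ).2.2 (hp φ).1).ne'
    exact (continuousAt_preD (hp φ).2.1 (hp φ).2.2).1.comp (f := fun φ => cubicCoeff (p φ))
        cp.continuousAt
  refine ⟨⟨_, c1⟩, ⟨fun φ => ((2 / preD (cubicCoeff (p φ)) : ℝ) * (p φ).1,
        (2 / preD (cubicCoeff (p φ)) : ℝ) * (p φ).2), by fun_prop⟩,
    fun φ => rfl, fun φ => rfl, fun φ => ?_⟩
  have h := knotCoeff_knotPoint (hp φ).2.1 (hp φ).2.2 (hp φ).1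
  have hs := cubicCoeff_smul (2 / preD (cubicCoeff (p φ))) (p φ).1 (p φ).2
  have hD := preD_pos (hp φ).2.1 (hp φ).2.2 (hp φ).1
  refine ⟨by simpa only [ContinuousMap.coe_mk, h] using hs, ?_⟩
  simp only [ContinuousMap.coe_mk]
  rw [h, ← hs, mem_cuspCompl_cubicCoeff]
  have hk : ((2 / preD (cubicCoeff (p φ)) : ℝ) : ℂ) ≠ 0 := ofReal_ne_zero.2 (by positivity)
  have h3 := mem_cuspCompl_cubicCoeff.1 (hp φ).1
  generalize ((2 / preD (cubicCoeff (p φ)) : ℝ) : ℂ) = k at *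
  convert mul_ne_zero (pow_ne_zero 3 hk) h3 using 1
  ring

theorem ofReal_add_mul_ne_zero {E : ℂ} (hE : ‖E‖ = 1) {c k : ℝ} (h : |c| ≠ |k|) :
    (c : ℂ) + k * E ≠ 0 := by
  intro h0
  have := congrArg norm (eq_neg_of_add_eq_zero_left h0)
  rw [norm_neg, norm_mul, hE, mul_one, Complex.norm_real, Complex.norm_real] at this
  exact h this

/-- Two loops in the knot complement, with the same base point, whose root monodromies are two
adjacent transpositions. -/
theorem exists_knot_loops : ∃ (ℓ ℓ' : C(unitInterval, Fin 3 → ℝ)) (s s' : C(unitInterval, ℂ × ℂ)),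
    (∀ φ, cubicCoeff (s φ) = knotCoeff (ℓ φ) ∧ knotCoeff (ℓ φ) ∈ cuspCompl) ∧
    (∀ φ, cubicCoeff (s' φ) = knotCoeff (ℓ' φ) ∧ knotCoeff (ℓ' φ) ∈ cuspCompl) ∧
    ℓ 1 = ℓ 0 ∧ ℓ' 1 = ℓ' 0 ∧ ℓ' 0 = ℓ 0 ∧ s' 0 = s 0 ∧
    s 1 = ((s 0).2, (s 0).1) ∧ s' 1 = ((s 0).1, -(s 0).1 - (s 0).2) := by
  let E : unitInterval → ℂ := fun φ => Complex.exp ((Real.pi * φ : ℝ) * Complex.I)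
  have hE : ∀ φ, ‖E φ‖ = 1 := fun φ => Complex.norm_exp_ofReal_mul_I _
  have hE2 : ∀ φ, ‖E φ ^ 2‖ = 1 := fun φ => by rw [norm_pow, hE, one_pow]
  have cE : Continuous E := by fun_prop
  have E0 : E 0 = 1 := by simp [E]
  have E1 : E 1 = -1 := by simp [E]
  let p : C(unitInterval, ℂ × ℂ) := ⟨fun φ => (3 / 2 - E φ / 2, 3 / 2 + E φ / 2), by fun_prop⟩
  let p' : C(unitInterval, ℂ × ℂ) := ⟨fun φ => (1, -1 / 2 + 5 / 2 * E φ), by fun_prop⟩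
  have ne : ∀ (c k : ℝ) (φ), |c| ≠ |k| → (c : ℂ) + k * E φ ≠ 0 := fun c k φ h =>
    ofReal_add_mul_ne_zero (hE φ) h
  have ne2 : ∀ (c k : ℝ) (φ), |c| ≠ |k| → (c : ℂ) + k * E φ ^ 2 ≠ 0 := fun c k φ h =>
    ofReal_add_mul_ne_zero (hE2 φ) h
  obtain ⟨ℓ, s, hℓ, hs, h⟩ := exists_knotPoint_path (p := p) fun φ => by
    refine ⟨mem_cuspCompl_cubicCoeff.2 ?_, ?_, ?_⟩
    · convert mul_ne_zero (mul_ne_zero (ne 0 (-1) φ (by norm_num))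
        (ne (9 / 2) (-1 / 2) φ (by norm_num [abs_div]))) (ne (9 / 2) (1 / 2) φ (by norm_num
            [abs_div]))
        using 1
      simp only [p, ContinuousMap.coe_mk]
      push_cast
      ring
    · convert ne2 (9 / 4) (1 / 12) φ (by norm_num [abs_div]) using 1
      simp only [p, ContinuousMap.coe_mk, cubicCoeff]
      push_cast
      ring
    · convert ne2 (27 / 8) (-3 / 8) φ (by norm_num [abs_div]) using 1
      simp only [p, ContinuousMap.coe_mk, cubicCoeff]
      push_cast
      ring
  obtain ⟨ℓ', s', hℓ', hs', h'⟩ := exists_knotPoint_path (p := p') fun φ => by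
    refine ⟨mem_cuspCompl_cubicCoeff.2 ?_, ?_, ?_⟩
    · convert mul_ne_zero (mul_ne_zero (ne (3 / 2) (-5 / 2) φ (by norm_num [abs_div]))
        (ne (3 / 2) (5 / 2) φ (by norm_num [abs_div]))) (ne 0 5 φ (by norm_num)) using 1
      simp only [p', ContinuousMap.coe_mk]
      push_cast
      ring
    · convert ne2 (1 / 4) (25 / 12) φ (by norm_num [abs_div]) using 1
      simp only [p', ContinuousMap.coe_mk, cubicCoeff]
      push_cast
      ring
    · convert ne2 (-1 / 8) (25 / 8) φ (by norm_num [abs_div]) using 1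
      simp only [p', ContinuousMap.coe_mk, cubicCoeff]
      push_cast
      ring
  have p0 : p 0 = (1, 2) := by simp only [p, ContinuousMap.coe_mk, E0]; norm_num
  have p1 : p 1 = (2, 1) := by simp only [p, ContinuousMap.coe_mk, E1]; norm_num
  have p0' : p' 0 = (1, 2) := by simp only [p', ContinuousMap.coe_mk, E0]; norm_num
  have p1' : p' 1 = (1, -3) := by simp only [p', ContinuousMap.coe_mk, E1]; norm_num
  have c1 : cubicCoeff (2, 1) = cubicCoeff (1, 2) := cubicCoeff_swap _ _
  have c2 : cubicCoeff (1, -3) = cubicCoeff (1, 2) := by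
    rw [← cubicCoeff_swap']; norm_num
  refine ⟨ℓ, ℓ', s, s', h, h', ?_, ?_, ?_, ?_, ?_, ?_⟩
  · rw [hℓ, hℓ, p0, p1, c1]
  · rw [hℓ', hℓ', p0', p1', c2]
  · rw [hℓ, hℓ', p0, p0']
  · rw [hs, hs', p0, p0']
  · rw [hs, hs, p0, p1, c1]
  · rw [hs, hs', p0, p1', c2]
    ring_nf

end KnotPoint

section Regions
open Filter Topology

theorem eq_of_starConvex_loop {E : Type*} [NormedAddCommGroup E] [NormedSpace ℝ E] {A : Set E}
    {P : E} (hP : P ∈ A) (hA : IsOpen A) (hst : StarConvex ℝ P A) {G : E → ℂ × ℂ}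
    (hG : ContinuousOn G A) (hc : ∀ w ∈ A, G w ∈ cuspCompl) {γ : C(unitInterval, E)}
    (hγA : ∀ φ, γ φ ∈ A) (hγ : γ 1 = γ 0) {s : C(unitInterval, ℂ × ℂ)}
    (hs : ∀ φ, cubicCoeff (s φ) = G (γ φ)) : s 1 = s 0 := by
  have : ContractibleSpace A := hst.contractibleSpace ⟨P, hP⟩
  have : LocallyPathConnectedSpace A := hA.locallyPathConnectedSpace
  exact eq_of_cubicCoeff_loop (Ω := A) (G := fun x => G x)
    (continuousOn_iff_continuous_domRestrict.1 hG) (fun x => hc x x.2)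
    (γ := ⟨fun φ => ⟨γ φ, hγA φ⟩, by fun_prop⟩) (Subtype.ext hγ) hs

theorem exists_log_lift {c : C(unitInterval, ℂ)} (hc : ∀ φ, c φ ≠ 0) {a : ℂ}
    (ha : Complex.exp a = c 0) :
    ∃ L : C(unitInterval, ℂ), L 0 = a ∧ ∀ φ, Complex.exp (L φ) = c φ := by
  obtain ⟨L, hL, h0⟩ := Complex.isCoveringMap_exp.exists_path_lifts
    ⟨fun φ => ⟨c φ, hc φ⟩, by fun_prop⟩ a (Subtype.ext ha.symm)
  exact ⟨L, h0, fun φ => congrArg Subtype.val (congrFun hL φ)⟩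

/-- The product of a square and a round annulus. -/
def annulusBox (R d r : ℝ) : Set (ℝ × (Fin 3 → ℝ)) :=
  {w | |w.1| < R ∧ |w.2 0| < R ∧ d < ‖(⟨w.2 1, w.2 2⟩ : ℂ)‖ ∧ ‖(⟨w.2 1, w.2 2⟩ : ℂ)‖ < r}

theorem false_of_annulusBox_loops {R d r : ℝ} (hd : 0 < d) {G : ℝ × (Fin 3 → ℝ) → ℂ × ℂ}
    (hG : ContinuousOn G (annulusBox R d r)) (hc : ∀ w ∈ annulusBox R d r, G w ∈ cuspCompl)
    {γ γ' : C(unitInterval, ℝ × (Fin 3 → ℝ))} (hγA : ∀ φ, γ φ ∈ annulusBox R d r)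
    (hγA' : ∀ φ, γ' φ ∈ annulusBox R d r) (hγ : γ 1 = γ 0) (hγ' : γ' 1 = γ' 0)
    (hγγ' : γ' 0 = γ 0) {s s' : C(unitInterval, ℂ × ℂ)} (hs : ∀ φ, cubicCoeff (s φ) = G (γ φ))
    (hs' : ∀ φ, cubicCoeff (s' φ) = G (γ' φ)) (hss' : s' 0 = s 0)
    (h1 : s 1 = ((s 0).2, (s 0).1)) (h1' : s' 1 = ((s 0).1, -(s 0).1 - (s 0).2)) : False := by
  have hr : 0 < r := hd.trans ((hγA 0).2.2.1.trans (hγA 0).2.2.2)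
  let A : Set (ℂ × ℝ × ℝ) :=
    {x | x.1.re ∈ Ioo (Real.log d) (Real.log r) ∧ x.2.1 ∈ Ioo (-R) R ∧ x.2.2 ∈ Ioo (-R) R}
  let e : ℂ × ℝ × ℝ → ℝ × (Fin 3 → ℝ) := fun x =>
    (x.2.1, ![x.2.2, (Complex.exp x.1).re, (Complex.exp x.1).im])
  have he : Continuous e := by
    refine Continuous.prodMk (by fun_prop) (continuous_pi fun i => ?_)
    fin_cases i <;> dsimp <;> fun_prop
  have heA : ∀ x, e x ∈ annulusBox R d r ↔ x ∈ A := by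
    intro x
    have k : (⟨(e x).2 1, (e x).2 2⟩ : ℂ) = Complex.exp x.1 := rfl
    unfold annulusBox
    rw [mem_ofPred_eq, k, Complex.norm_exp, abs_lt, abs_lt, ← Real.log_lt_iff_lt_exp hd,
      ← Real.lt_log_iff_exp_lt hr]
    constructor
    · rintro ⟨a, b, c, d⟩; exact ⟨⟨c, d⟩, a, b⟩
    · rintro ⟨⟨c, d⟩, a, b⟩; exact ⟨a, b, c, d⟩
  have hAo : IsOpen A := by
    have h1 : Continuous fun x : ℂ × ℝ × ℝ => x.1.re := by fun_prop
    exact (isOpen_Ioo.preimage h1).inter ((isOpen_Ioo.preimage (by fun_prop)).inter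
      (isOpen_Ioo.preimage (by fun_prop)))
  have hAc : Convex ℝ A := by
    have l1 : IsLinearMap ℝ fun x : ℂ × ℝ × ℝ => x.1.re := ⟨fun _ _ => by simp, fun _ _ => by simp⟩
    have l2 : IsLinearMap ℝ fun x : ℂ × ℝ × ℝ => x.2.1 := ⟨fun _ _ => rfl, fun _ _ => rfl⟩
    have l3 : IsLinearMap ℝ fun x : ℂ × ℝ × ℝ => x.2.2 := ⟨fun _ _ => rfl, fun _ _ => rfl⟩
    exact ((convex_Ioo _ _).is_linear_preimage l1).inter
      (((convex_Ioo _ _).is_linear_preimage l2).inter ((convex_Ioo _ _).is_linear_preimage l3))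
  have lift : ∀ (γ : C(unitInterval, ℝ × (Fin 3 → ℝ))), (∀ φ, γ φ ∈ annulusBox R d r) → ∀ a : ℂ,
      Complex.exp a = ⟨(γ 0).2 1, (γ 0).2 2⟩ → ∃ L : C(unitInterval, A),
      (L 0).1 = (a, (γ 0).1, (γ 0).2 0) ∧ ∀ φ, e (L φ) = γ φ := by
    intro γ hγ a ha
    let c : C(unitInterval, ℂ) := ⟨fun φ => (γ φ).2 1 + (γ φ).2 2 * Complex.I, by fun_prop⟩
    have hcγ : ∀ φ, c φ = ⟨(γ φ).2 1, (γ φ).2 2⟩ := fun φ => by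
      simp [c, Complex.ext_iff]
    obtain ⟨L, h0, hL⟩ := exists_log_lift (c := c) (a := a)
      (fun φ => by rw [hcγ, ← norm_pos_iff]; exact hd.trans (hγ φ).2.2.1) (by rw [hcγ, ha])
    have key : ∀ φ, e (L φ, (γ φ).1, (γ φ).2 0) = γ φ := fun φ => by
      refine Prod.ext rfl (funext fun i => ?_)
      have := (hL φ).trans (hcγ φ)
      fin_cases i
      · rfl
      · exact congrArg Complex.re this
      · exact congrArg Complex.im this
    exact ⟨⟨fun φ => ⟨(L φ, (γ φ).1, (γ φ).2 0), (heA _).1 (by rw [key]; exact hγ φ)⟩,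
      by fun_prop⟩, by simp [h0], key⟩
  have deck : ∀ z : ℂ, Complex.exp z = 1 → ∃ T : C(A, A), ∀ x : A, (T x).1 = (x.1.1 + z,
      x.1.2) := by
    intro z hz
    have hz' : z.re = 0 := by
      have := Complex.norm_exp z
      rw [hz, norm_one] at this
      exact (Real.exp_eq_one_iff _).1 this.symm
    exact ⟨⟨fun x => ⟨(x.1.1 + z, x.1.2), by
      obtain ⟨x, h⟩ := x
      exact ⟨by simpa [hz'] using h.1, h.2⟩⟩, by fun_prop⟩, fun x => rfl⟩
  have he' : ∀ (z : ℂ) (x : ℂ × ℝ × ℝ), Complex.exp z = 1 → e (x.1 + z, x.2) = e x :=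
    fun z x hz => by simp [e, Complex.exp_add, hz]
  have ends : ∀ x y : ℂ × ℝ × ℝ, e x = e y → ∃ z, Complex.exp z = 1 ∧ x = (y.1 + z, y.2) := by
    intro x y h
    refine ⟨x.1 - y.1, ?_, ?_⟩
    · rw [Complex.exp_sub, div_eq_one_iff_eq (Complex.exp_ne_zero _)]
      have h' := congrArg Prod.snd h
      exact Complex.ext (congrFun h' 1) (congrFun h' 2)
    · refine Prod.ext (by simp) (Prod.ext ?_ ?_)
      · exact congrArg (fun w => w.1) h
      · exact congrArg (fun w => w.2 0) h
  obtain ⟨a, ha⟩ : ∃ a, Complex.exp a = ⟨(γ 0).2 1, (γ 0).2 2⟩ :=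
    ⟨_, Complex.exp_log (by rw [← norm_pos_iff]; exact hd.trans (hγA 0).2.2.1)⟩
  obtain ⟨L, L0, hL⟩ := lift γ hγA a ha
  obtain ⟨L', L0', hL'⟩ := lift γ' hγA' a (by rw [hγγ', ha])
  obtain ⟨z, hz, Lz⟩ := ends (L 1) (L 0) (by rw [hL, hL, hγ])
  obtain ⟨z', hz', Lz'⟩ := ends (L' 1) (L' 0) (by rw [hL', hL', hγ'])
  obtain ⟨T, hT⟩ := deck z hz
  obtain ⟨T', hT'⟩ := deck z' hz'
  have : ContractibleSpace A := hAc.contractibleSpace ⟨_, (L 0).2⟩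
  have : LocallyPathConnectedSpace A := hAo.locallyPathConnectedSpace
  have hGe : Continuous fun x : A => G (e x) :=
    hG.comp_continuous (he.comp continuous_subtype_val) fun x => (heA _).2 x.2
  refine false_of_commute_deck hGe (fun x => hc _ ((heA _).2 x.2)) (T := T) (T' := T')
    (fun x => by rw [hT, he' z _ hz]) (fun x => by rw [hT', he' z' _ hz']) (γ := L) (γ' := L')
    (Subtype.ext (by rw [hT, Lz])) (Subtype.ext (by rw [hT', Lz']))
    (Subtype.ext (by rw [L0, L0', hγγ'])) (Subtype.ext (by simp [hT, hT']; ring))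
    (fun φ => by rw [hs, hL]) (fun φ => by rw [hs', hL']) hss' h1 h1'

end Regions

section ScaledObstruction
open Filter Topology

theorem isClosed_range_knot : IsClosed (range knot) := by
  have h : range knot = {y | (knotCoeff y).1 ^ 3 = (knotCoeff y).2 ^ 2} := by
    ext y
    have := knotCoeff_mem_cuspCompl (y := y)
    rw [← not_iff_not, ← this]
    rfl
  rw [h]
  exact isClosed_eq ((continuous_fst.comp continuous_knotCoeff).pow 3)
    ((continuous_snd.comp continuous_knotCoeff).pow 2)

theorem exists_loop_dist (ℓ : C(unitInterval, Fin 3 → ℝ))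
    (h : ∀ φ, knotCoeff (ℓ φ) ∈ cuspCompl) :
    ∃ d R, 0 < d ∧ 0 < R ∧ ∀ φ, ‖ℓ φ‖ ≤ R ∧ ∀ σ, 2 * d ≤ ‖ℓ φ - knot σ‖ := by
  obtain ⟨φ₀, -, h₀⟩ := isCompact_univ.exists_isMinOn univ_nonempty
    (f := fun φ => infDist (ℓ φ) (range knot)) (by fun_prop)
  obtain ⟨φ₁, -, h₁⟩ := isCompact_univ.exists_isMaxOn univ_nonempty
    (f := fun φ => ‖ℓ φ‖) (by fun_prop)
  have hpos := (isClosed_range_knot.notMem_iff_infDist_pos (range_nonempty _)).1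
    (knotCoeff_mem_cuspCompl.1 (h φ₀))
  refine ⟨infDist (ℓ φ₀) (range knot) / 2, ‖ℓ φ₁‖ + 1, by positivity, by positivity, fun φ =>
    ⟨(h₁ (mem_univ φ)).trans (by simp), fun σ => ?_⟩⟩
  rw [mul_div_cancel₀ _ two_ne_zero, ← dist_eq_norm]
  exact (h₀ (mem_univ φ)).trans (infDist_le_dist_of_mem (mem_range_self σ))

theorem coord_sub_le (p q : ℝ × (Fin 3 → ℝ)) (i : Fin 3) : |p.2 i - q.2 i| ≤ ‖p - q‖ :=
  (norm_le_pi_norm (p - q).2 i).trans (norm_snd_le _)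

theorem coord_le (p : ℝ × (Fin 3 → ℝ)) (i : Fin 3) : |p.2 i| ≤ ‖p‖ :=
  (norm_le_pi_norm p.2 i).trans (norm_snd_le _)

theorem exists_scaled_obstruction {K : ℝ} (hK : 1 ≤ K) : ∃ d₁ > 0, ∀ C₀ ≥ 0, ∃ R η d₂ : ℝ,
    0 < R ∧ 0 < η ∧ 0 < d₂ ∧ ∀ (A B : Set (ℝ × (Fin 3 → ℝ)))
    (H G : ℝ × (Fin 3 → ℝ) → ℝ × (Fin 3 → ℝ)) (e e' : ℝ),
    (∀ x y, ‖x‖ ≤ R → ‖y‖ ≤ R → ‖H x - H y‖ ≤ K * ‖x - y‖) →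
    (∀ x y, ‖x‖ ≤ R → ‖y‖ ≤ R → ‖G x - G y‖ ≤ K * ‖x - y‖) →
    (∀ x, ‖x‖ ≤ R → G (H x) = x) → (∀ x, ‖x‖ ≤ R → H (G x) = x) →
    (∀ x ∈ A, ‖x‖ ≤ R → H x ∈ B) → (∀ x ∈ B, ‖x‖ ≤ R → G x ∈ A) → ‖H 0‖ ≤ C₀ →
    (∀ a ∈ A, ‖a‖ ≤ R → ∃ σ, ‖a.2 - knot σ‖ ≤ d₁) →
    (∀ x σ, ‖x‖ ≤ R → x.2 = knot σ → ∃ a ∈ A, ‖x - a‖ < d₂) →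
    -1 ≤ e → -1 ≤ e' → 2 * R ≤ e + e' →
    (∀ w ∈ B, ‖w‖ ≤ R → |w.2 1| ≤ η ∧ |w.2 2| ≤ η ∧ -e' - η ≤ w.2 0 ∧ w.2 0 ≤ e + η) →
    (∀ τ σ, |τ| ≤ R → |σ| ≤ R → -e' ≤ σ → σ ≤ e → ∃ b ∈ B, ‖b - (τ, ![σ, 0, 0])‖ ≤ η) →
    False := by
  obtain ⟨ℓ, ℓ', s, s', hs, hs', hℓ, hℓ', hℓℓ', hss', h1, h1'⟩ := exists_knot_loops
  obtain ⟨da, Ra, hda, hRa, ha⟩ := exists_loop_dist ℓ fun φ => (hs φ).2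
  obtain ⟨db, Rb, hdb, hRb, hb⟩ := exists_loop_dist ℓ' fun φ => (hs' φ).2
  set d₁ := min da db with hd₁
  have hd₁0 : 0 < d₁ := lt_min hda hdb
  refine ⟨d₁, hd₁0, fun C₀ hC₀ => ?_⟩
  have hK0 : 0 < K := one_pos.trans_le hK
  set R₁ := C₀ + K * max Ra Rb with hR₁
  have hR₁0 : 0 < R₁ := by positivity
  set Rw := 2 * R₁ + 4 with hRw
  set R := K * (Rw + 2 + C₀) + 2 with hR
  set d := min 1 (d₁ / (4 * K)) with hd
  have hd0 : 0 < d := by positivity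
  have hd1 : d ≤ 1 := min_le_left _ _
  have hdd : d ≤ d₁ / K / 4 := (min_le_right _ _).trans (by rw [div_div, mul_comm])
  set κ := d₁ / K / 4 / (2 * R₁ + 3) with hκ
  have hκ0 : 0 < κ := by positivity
  set η := min (d / 4) (κ * d / (2 * (1 + κ))) with hη
  have hη0 : 0 < η := by positivity
  have hηd : η ≤ d / 4 := min_le_left _ _
  have hηκ : (η + η) * (1 + κ) ≤ κ * d := by
    have : η ≤ κ * d / (2 * (1 + κ)) := min_le_right _ _
    rw [le_div_iff₀ (by positivity)] at this
    linarith
  have hRwR : Rw + 2 + C₀ ≤ R - 2 := by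
    have : 1 * (Rw + 2 + C₀) ≤ K * (Rw + 2 + C₀) := by gcongr
    linarith
  refine ⟨R, η, η / K, by positivity, hη0, by positivity, ?_⟩
  intro A B H G e e' hH hG hGH hHG hHA hGB hH0 hA1 hA2 he he' hee hBa hBb
  have nG : ∀ w, ‖w‖ ≤ Rw + 2 → ‖G w‖ ≤ R - 2 := by
    intro w hw
    have k := hG w (H 0) (by linarith) (by linarith)
    rw [hGH 0 (by simpa using by linarith), sub_zero] at k
    have k2 := norm_sub_le w (H 0)
    have : K * ‖w - H 0‖ ≤ K * (Rw + 2 + C₀) := by gcongr; linarith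
    linarith
  have hηK : η / K ≤ η := div_le_self hη0.le hK
  have free : ∀ w, ‖w‖ ≤ Rw → (∀ b ∈ B, ‖b‖ ≤ Rw + 1 → η ≤ ‖w - b‖) →
      knotCoeff (G w).2 ∈ cuspCompl := by
    intro w hw hwB
    rw [knotCoeff_mem_cuspCompl]
    rintro ⟨σ, hσ⟩
    have n1 := nG w (by linarith)
    obtain ⟨a, ha, hwa⟩ := hA2 (G w) σ (by linarith) hσ.symm
    have n2 := norm_sub_norm_le a (G w)
    rw [norm_sub_rev] at n2
    have k := hH (G w) a (by linarith) (by linarith)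
    rw [hHG w (by linarith)] at k
    have k2 : K * ‖G w - a‖ < η := by rwa [lt_div_iff₀' hK0] at hwa
    have n3 := norm_sub_norm_le (H a) w
    rw [norm_sub_rev] at n3
    have := hwB (H a) (hHA a ha (by linarith)) (by linarith)
    linarith
  have hRR : R₁ ≤ R := by linarith
  have hmaxR : max Ra Rb ≤ R := by
    have : 1 * max Ra Rb ≤ K * max Ra Rb := by gcongr
    linarith
  have nl : ∀ y : Fin 3 → ℝ, ‖((0 : ℝ), y)‖ = ‖y‖ := fun y => by simp [Prod.norm_def]
  have loops : ∀ ℓ : C(unitInterval, Fin 3 → ℝ), (∀ φ, ‖ℓ φ‖ ≤ max Ra Rb ∧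
      ∀ σ, 2 * d₁ ≤ ‖ℓ φ - knot σ‖) → ∃ γ : C(unitInterval, ℝ × (Fin 3 → ℝ)),
      (∀ φ, γ φ = H (0, ℓ φ)) ∧ (∀ φ, (G (γ φ)).2 = ℓ φ) ∧ (∀ φ, ‖γ φ‖ ≤ R₁) ∧
      ∀ φ, ∀ b ∈ B, ‖b‖ ≤ Rw + 1 → d₁ / K ≤ ‖γ φ - b‖ := by
    intro ℓ hℓ
    have n0 : ∀ φ, ‖((0 : ℝ), ℓ φ)‖ ≤ R := fun φ => by
      rw [nl]; exact (hℓ φ).1.trans hmaxR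
    have hc : Continuous fun φ => H (0, ℓ φ) := by
      have : ContinuousOn H {x | ‖x‖ ≤ R} := by
        refine LipschitzOnWith.continuousOn (K := K.toNNReal) (LipschitzOnWith.of_dist_le_mul ?_)
        intro x hx y hy
        rw [dist_eq_norm, dist_eq_norm, Real.coe_toNNReal _ hK0.le]
        exact hH x y hx hy
      exact this.comp_continuous (by fun_prop) n0
    have nγ : ∀ φ, ‖H (0, ℓ φ)‖ ≤ R₁ := fun φ => by
      have k := hH (0, ℓ φ) 0 (n0 φ) (by simpa using by linarith)
      rw [sub_zero, nl] at k
      have k2 := norm_sub_norm_le (H (0, ℓ φ)) (H 0)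
      have : K * ‖ℓ φ‖ ≤ K * max Ra Rb := by gcongr; exact (hℓ φ).1
      linarith
    refine ⟨⟨_, hc⟩, fun φ => rfl, fun φ => ?_, nγ, fun φ b hb hbR => ?_⟩
    · exact congrArg Prod.snd (hGH _ (n0 φ))
    · have n1 := nG b (by linarith)
      obtain ⟨σ, hσ⟩ := hA1 (G b) (hGB b hb (by linarith)) (by linarith)
      have k := hG (H (0, ℓ φ)) b ((nγ φ).trans hRR) (by linarith)
      rw [hGH _ (n0 φ)] at k
      have k2 : ‖ℓ φ - (G b).2‖ ≤ ‖((0 : ℝ), ℓ φ) - G b‖ := norm_snd_le (((0 : ℝ), ℓ φ) - G b)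
      have k3 := norm_sub_le_norm_sub_add_norm_sub (ℓ φ) (G b).2 (knot σ)
      have k4 := (hℓ φ).2 σ
      rw [div_le_iff₀' hK0]
      change _ ≤ K * ‖H (0, ℓ φ) - b‖
      linarith
  obtain ⟨γ, γe, Gγ, nγ, sγ⟩ := loops ℓ fun φ => ⟨(ha φ).1.trans (le_max_left _ _), fun σ =>
    le_trans (by gcongr; exact min_le_left _ _) ((ha φ).2 σ)⟩
  obtain ⟨γ', γe', Gγ', nγ', sγ'⟩ := loops ℓ' fun φ => ⟨(hb φ).1.trans (le_max_right _ _), fun σ =>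
    le_trans (by gcongr; exact min_le_right _ _) ((hb φ).2 σ)⟩
  have near_plane : ∀ {φ τ σ b}, b ∈ B → |τ| ≤ R₁ + 1 → |σ| ≤ R₁ + 1 →
      ‖b - (τ, ![σ, 0, 0])‖ ≤ η → d₁ / K ≤ ‖γ φ - b‖ ∧ d₁ / K ≤ ‖γ' φ - b‖ := by
    intro φ τ σ b hb hτ hσ h
    have k : ‖((τ, ![σ, 0, 0]) : ℝ × (Fin 3 → ℝ))‖ ≤ R₁ + 1 :=
      prod_norm_le hτ (pi3_norm_le hσ (by simp; linarith) (by simp; linarith))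
    have k2 := norm_sub_norm_le b (τ, ![σ, 0, 0])
    exact ⟨sγ φ b hb (by linarith), sγ' φ b hb (by linarith)⟩
  have ne : s 1 ≠ s 0 := by
    intro h
    rw [h1] at h
    have k := mem_cuspCompl_cubicCoeff.1 ((hs 0).1 ▸ (hs 0).2)
    have h' := congrArg Prod.fst h
    exact k (by simp only at h'; rw [h']; ring)
  have Gc : ContinuousOn (fun w => knotCoeff (G w).2) {w | ‖w‖ ≤ R} := by
    have : ContinuousOn G {x | ‖x‖ ≤ R} := by
      refine LipschitzOnWith.continuousOn (K := K.toNNReal) (LipschitzOnWith.of_dist_le_mul ?_)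
      intro x hx y hy
      rw [dist_eq_norm, dist_eq_norm, Real.coe_toNNReal _ hK0.le]
      exact hG x y hx hy
    exact continuous_knotCoeff.comp_continuousOn (continuous_snd.comp_continuousOn this)
  have half : ∀ ω : ℝ, (ω = 1 ∨ ω = -1) → ∀ e, -1 ≤ e → e < R₁ + 1 →
      (∀ w ∈ B, ‖w‖ ≤ R → ω * w.2 0 ≤ e + η) →
      (∀ τ σ, |τ| ≤ R → |σ| ≤ Rw → ω * σ ≤ e → ∃ b ∈ B, ‖b - (τ, ![σ, 0, 0])‖ ≤ η) →
      False := by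
    intro ω hω e he heR hBω hBd
    have hω2 : ω * ω = 1 := by rcases hω with rfl | rfl <;> norm_num
    have hω1 : |ω| = 1 := by rcases hω with rfl | rfl <;> norm_num
    have hωx : ∀ x, |ω * x| = |x| := fun x => by rw [abs_mul, hω1, one_mul]
    let Ω : Set (ℝ × (Fin 3 → ℝ)) := {w | ‖w‖ < Rw} ∩
      {w | κ * (e + d - ω * w.2 0) < max |w.2 1| |w.2 2|}
    let P : ℝ × (Fin 3 → ℝ) := (0, ![ω * (e + 2), 0, 0])
    have nP : ‖P‖ < Rw := by
      rw [nl]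
      refine (pi3_norm_le (r := R₁ + 3) ?_ ?_ ?_).trans_lt (by linarith)
      · change |ω * (e + 2)| ≤ _
        rw [hωx, abs_le]
        constructor <;> linarith
      · simp; linarith
      · simp; linarith
    have hP : P ∈ Ω := by
      refine ⟨nP, ?_⟩
      have : e + d - ω * P.2 0 < 0 := by
        change e + d - ω * (ω * (e + 2)) < 0
        rw [← mul_assoc, hω2]
        linarith
      exact (mul_neg_of_pos_of_neg hκ0 this).trans_le (le_max_of_le_left (abs_nonneg _))
    have hΩo : IsOpen Ω := (isOpen_lt continuous_norm continuous_const).inter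
      (isOpen_lt (by fun_prop) (by fun_prop))
    have hΩs : StarConvex ℝ P Ω := by
      refine StarConvex.inter ?_ ?_
      · have := (convex_ball (0 : ℝ × (Fin 3 → ℝ)) Rw).starConvex (x := P) (by simpa using nP)
        simpa [ball, dist_eq_norm] using this
      · intro w hw a b ha hb hab
        have hw' : κ * (e + d - ω * w.2 0) < max |w.2 1| |w.2 2| := hw
        have e0 : (a • P + b • w).2 0 = a * (ω * (e + 2)) + b * w.2 0 := rfl
        have e1 : (a • P + b • w).2 1 = b * w.2 1 := by simp [P]
        have e2 : (a • P + b • w).2 2 = b * w.2 2 := by simp [P]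
        rw [mem_ofPred_eq, e0, e1, e2, abs_mul, abs_mul, abs_of_nonneg hb,
            ← mul_max_of_nonneg _ _ hb]
        have e3 : κ * (e + d - ω * (a * (ω * (e + 2)) + b * w.2 0)) =
            b * (κ * (e + d - ω * w.2 0)) + a * (κ * (d - 2)) := by
          obtain rfl : a = 1 - b := by linarith
          linear_combination -κ * (1 - b) * (e + 2) * hω2
        rw [e3]
        have e4 : κ * (d - 2) < 0 := mul_neg_of_pos_of_neg hκ0 (by linarith)
        rcases hb.eq_or_lt with rfl | hb'
        · obtain rfl : a = 1 := by linarith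
          linarith
        · have := mul_lt_mul_of_pos_left hw' hb'
          have := mul_nonpos_of_nonneg_of_nonpos ha e4.le
          linarith
    refine ne (eq_of_starConvex_loop hP hΩo hΩs (G := fun w => knotCoeff (G w).2)
      (Gc.mono fun w hw => ?_) (fun w hw => free w hw.1.le fun b hb hbR => ?_) (γ := γ)
      (fun φ => ⟨(nγ φ).trans_lt (by linarith), ?_⟩) (by rw [γe, γe, hℓ])
      fun φ => by rw [(hs φ).1, Gγ])
    · have : ‖w‖ < Rw := hw.1
      exact this.le.trans (by linarith)
    · by_contra! hwb
      obtain ⟨b1, b2, -, -⟩ := hBa b hb (by linarith)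
      have b0 := hBω b hb (by linarith)
      have w0 := (coord_sub_le w b 0).trans_lt hwb
      rw [← hωx, abs_lt] at w0
      have w1 := (coord_sub_le w b 1).trans_lt hwb
      have w2 := (coord_sub_le w b 2).trans_lt hwb
      have hm : max |w.2 1| |w.2 2| ≤ η + η := by
        have k1 := abs_sub_abs_le_abs_sub (w.2 1) (b.2 1)
        have k2 := abs_sub_abs_le_abs_sub (w.2 2) (b.2 2)
        exact max_le (by linarith) (by linarith)
      have hw2 : κ * (e + d - ω * w.2 0) < max |w.2 1| |w.2 2| := hw.2
      have : κ * (d - (η + η)) ≤ κ * (e + d - ω * w.2 0) :=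
        mul_le_mul_of_nonneg_left (by linarith) hκ0.le
      linarith
    · by_contra! hφ
      have hφ' : max |(γ φ).2 1| |(γ φ).2 2| ≤ κ * (e + d - ω * (γ φ).2 0) := by
        simpa using hφ
      have g0 := abs_le.1 ((hωx _).le.trans ((coord_le (γ φ) 0).trans (nγ φ)))
      have hup : κ * (e + d - ω * (γ φ).2 0) ≤ d₁ / K / 4 := by
        calc _ ≤ κ * (2 * R₁ + 3) := by gcongr; linarith
          _ = _ := by rw [hκ]; field_simp
      have hnn : 0 ≤ e + d - ω * (γ φ).2 0 := by
        by_contra! hneg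
        have := mul_neg_of_pos_of_neg hκ0 hneg
        have := (abs_nonneg _).trans (le_max_left |(γ φ).2 1| |(γ φ).2 2|)
        linarith
      obtain ⟨σ, hσe, hσR, hσ⟩ : ∃ σ, ω * σ ≤ e ∧ |σ| ≤ R₁ + 1 ∧ |(γ φ).2 0 - σ| ≤ d := by
        rcases le_total (ω * (γ φ).2 0) e with h | h
        · exact ⟨_, h, by linarith [(coord_le (γ φ) 0).trans (nγ φ)], by simpa using hd0.le⟩
        · refine ⟨ω * e, by rw [← mul_assoc, hω2, one_mul], ?_, ?_⟩
          · rw [hωx, abs_le]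
            constructor <;> linarith
          · rw [← hωx, mul_sub, ← mul_assoc, hω2, one_mul, abs_le]
            constructor <;> linarith
      have hτ : |(γ φ).1| ≤ R₁ := (norm_fst_le (γ φ)).trans (nγ φ)
      obtain ⟨b, hb, hbd⟩ := hBd (γ φ).1 σ (by linarith) (by linarith) hσe
      refine absurd ?_ (not_lt.2 (near_plane (φ := φ) hb (by linarith) (by linarith) hbd).1)
      refine (norm_sub_le_norm_sub_add_norm_sub (γ φ) ((γ φ).1, ![σ, 0, 0]) b).trans_lt ?_
      rw [norm_sub_rev _ b]
      have : ‖γ φ - ((γ φ).1, ![σ, 0, 0])‖ ≤ d₁ / K / 4 := by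
        refine prod_norm_le (by simp; positivity) (pi3_norm_le ?_ ?_ ?_)
        · exact hσ.trans hdd
        · simpa using (le_max_left _ _).trans (hφ'.trans hup)
        · simpa using (le_max_right _ _).trans (hφ'.trans hup)
      have : 0 < d₁ / K := by positivity
      linarith
  by_cases c1 : e < R₁ + 1
  · refine half 1 (Or.inl rfl) e he c1 (fun w hw hwR => ?_) fun τ σ hτ hσ h => ?_
    · linarith [hBa w hw hwR]
    · exact hBb τ σ hτ (by linarith) (by linarith [(abs_le.1 hσ).1]) (by linarith)
  by_cases c2 : e' < R₁ + 1
  · refine half (-1) (Or.inr rfl) e' he' c2 (fun w hw hwR => ?_) fun τ σ hτ hσ h => ?_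
    · linarith [hBa w hw hwR]
    · exact hBb τ σ hτ (by linarith) (by linarith) (by linarith [(abs_le.1 hσ).2])
  have ann : ∀ v : Fin 3 → ℝ, max |v 1| |v 2| ≤ ‖(⟨v 1, v 2⟩ : ℂ)‖ ∧
      ‖(⟨v 1, v 2⟩ : ℂ)‖ ≤ 2 * max |v 1| |v 2| := fun v => by
    refine ⟨max_le (Complex.abs_re_le_norm ⟨v 1, v 2⟩) (Complex.abs_im_le_norm ⟨v 1, v 2⟩), ?_⟩
    have := Complex.norm_le_abs_re_add_abs_im ⟨v 1, v 2⟩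
    have := le_max_left |v 1| |v 2|
    have := le_max_right |v 1| |v 2|
    dsimp only at *
    linarith
  have inAnn : ∀ x : ℝ × (Fin 3 → ℝ), ‖x‖ ≤ R₁ → (∀ σ b, b ∈ B → |σ| ≤ R₁ + 1 →
      ‖b - (x.1, ![σ, 0, 0])‖ ≤ η → d₁ / K ≤ ‖x - b‖) →
      x ∈ annulusBox (R₁ + 1) d (2 * R₁ + 1) := by
    intro x hx hxB
    have hτ : |x.1| ≤ R₁ := (norm_fst_le x).trans hx
    have h0 := (coord_le x 0).trans hx
    refine ⟨by linarith, by linarith, ?_, ?_⟩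
    · refine lt_of_lt_of_le ?_ (ann x.2).1
      by_contra! hm
      obtain ⟨b, hb, hbd⟩ := hBb x.1 (x.2 0) (by linarith) (by linarith)
        (by linarith [(abs_le.1 h0).1]) (by linarith [(abs_le.1 h0).2])
      refine absurd (hxB (x.2 0) b hb (by linarith) hbd) (not_le.2 ?_)
      refine (norm_sub_le_norm_sub_add_norm_sub x (x.1, ![x.2 0, 0, 0]) b).trans_lt ?_
      rw [norm_sub_rev _ b]
      have : ‖x - (x.1, ![x.2 0, 0, 0])‖ ≤ d₁ / K / 4 := by
        refine prod_norm_le (by simp; positivity) (pi3_norm_le ?_ ?_ ?_)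
        · simp; positivity
        · simpa using (le_max_left _ _).trans (hm.trans hdd)
        · simpa using (le_max_right _ _).trans (hm.trans hdd)
      have : 0 < d₁ / K := by positivity
      linarith
    · refine (ann x.2).2.trans_lt ?_
      have := max_le ((coord_le x 1).trans hx) ((coord_le x 2).trans hx)
      linarith
  have nBox : ∀ w ∈ annulusBox (R₁ + 1) d (2 * R₁ + 1), ‖w‖ ≤ Rw := by
    rintro w ⟨a1, a2, -, a3⟩
    have := (ann w.2).1
    have := le_max_left |w.2 1| |w.2 2|
    have := le_max_right |w.2 1| |w.2 2|
    exact prod_norm_le (by linarith) (pi3_norm_le (by linarith) (by linarith) (by linarith))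
  refine false_of_annulusBox_loops (R := R₁ + 1) (r := 2 * R₁ + 1) hd0
    (G := fun w => knotCoeff (G w).2) (γ := γ) (γ' := γ') (s := s) (s' := s')
    (Gc.mono fun w hw => ?_) (fun w hw => free w ?_ fun b hb hbR => ?_)
    (fun φ => inAnn _ (nγ φ) fun σ b hb hσ h => (near_plane hb ?_ hσ h).1)
    (fun φ => inAnn _ (nγ' φ) fun σ b hb hσ h => (near_plane hb ?_ hσ h).2)
    (by rw [γe, γe, hℓ]) (by rw [γe', γe', hℓ']) (by rw [γe, γe', hℓℓ'])
    (fun φ => by rw [(hs φ).1, Gγ]) (fun φ => by rw [(hs' φ).1, Gγ']) hss' h1 h1'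
  · exact (nBox w hw).trans (by linarith)
  · exact nBox w hw
  · by_contra! hwb
    obtain ⟨b1, b2, -, -⟩ := hBa b hb (by linarith)
    have w1 := (coord_sub_le w b 1).trans_lt hwb
    have w2 := (coord_sub_le w b 2).trans_lt hwb
    have hm : max |w.2 1| |w.2 2| < η + η := by
      have k1 := abs_sub_abs_le_abs_sub (w.2 1) (b.2 1)
      have k2 := abs_sub_abs_le_abs_sub (w.2 2) (b.2 2)
      exact max_lt (by linarith) (by linarith)
    have := hw.2.2.1
    have := (ann w.2).2
    linarith
  · exact ((norm_fst_le (γ φ)).trans (nγ φ)).trans (by linarith)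
  · exact ((norm_fst_le (γ' φ)).trans (nγ' φ)).trans (by linarith)

end ScaledObstruction

section Asymptotics
open Filter Topology

variable {ρ : ℝ → ℝ} {F : Set (ℝ × (Fin 3 → ℝ))}

/-- On an interval of size comparable to `ρ t₀` around `t₀`, the scale `ρ` is almost constant. -/
theorem IsRad.comparable (hρ : IsRad ρ) {R κ : ℝ} (hR : 0 < R) (hκ : 0 < κ) (hRκ : R * κ ≤ 1 / 2) :
    ∃ δ > 0, ∀ t₀, 0 < t₀ → t₀ < δ → ∀ t, |t - t₀| ≤ R * ρ t₀ →
      t₀ / 2 ≤ t ∧ t ≤ 2 * t₀ ∧ |ρ t - ρ t₀| ≤ κ * (R * ρ t₀) ∧ ρ t₀ ≤ 2 * ρ t ∧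
      ρ t ≤ 2 * ρ t₀ ∧ ρ t ≤ κ * t ^ 2 ∧ t ^ 3 ≤ κ * ρ t ∧ t ≤ κ ∧ t ≤ 1 := by
  obtain ⟨ε, hε, hε1, h1, h2⟩ := hρ.small hκ
  refine ⟨min ε κ / 2, by positivity, fun t₀ h0 hδ t ht => ?_⟩
  have l1 := min_le_left ε κ
  have l2 := min_le_right ε κ
  have hρ0 := hρ.pos t₀ h0
  have a1 : R * ρ t₀ ≤ t₀ / 2 := by
    calc R * ρ t₀ ≤ R * (κ * t₀ ^ 2) := by gcongr; exact (h1 t₀ h0 (by linarith)).1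
      _ = (R * κ) * t₀ ^ 2 := by ring
      _ ≤ 1 / 2 * t₀ ^ 2 := by gcongr
      _ ≤ t₀ / 2 := by nlinarith
  have a2 := abs_le.1 (ht.trans a1)
  have a3 := h2 t t₀ (by linarith) (by linarith) (by linarith) (by linarith)
  have a4 : κ * |t - t₀| ≤ κ * (R * ρ t₀) := by gcongr
  have a5 : κ * (R * ρ t₀) ≤ 1 / 2 * ρ t₀ := by
    calc _ = R * κ * ρ t₀ := by ring
      _ ≤ _ := by gcongr
  have a6 := abs_le.1 (a3.trans (a4.trans a5))
  have a7 := h1 t (by linarith) (by linarith)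
  exact ⟨by linarith, by linarith, a3.trans a4, by linarith, by linarith, a7.1, a7.2,
    by linarith, by linarith⟩

theorem IsFinger.exists_near_knot (hF : IsFinger F) (hρ : IsRad ρ) {R d : ℝ} (hR : 0 < R)
    (hd : 0 < d) : ∃ δ > 0, ∀ t₀, 0 < t₀ → t₀ < δ → ∀ x ∈ emb ρ '' F,
      ‖x - (t₀, 0)‖ ≤ R * ρ t₀ → ∃ σ, ‖x.2 - ρ t₀ • knot σ‖ ≤ d * ρ t₀ := by
  obtain ⟨C, hC, htub⟩ := exists_tub_sub_knot_le
  obtain ⟨ε₁, h₁, thin⟩ := hF.thin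
  set M := 2 * C + 2 * R * (R + 2 * C) + 2 * R + 1 with hM
  have hM0 : 0 < M := by positivity
  set κ := min 1 d / M with hκ
  have hκ0 : 0 < κ := by positivity
  have hκM : κ * M = min 1 d := by rw [hκ]; field_simp
  have hκ1 : κ ≤ 1 := by
    refine (div_le_one hM0).2 ((min_le_left _ _).trans ?_)
    have : 0 ≤ 2 * C + 2 * R * (R + 2 * C) + 2 * R := by positivity
    linarith
  have hκR : R * κ ≤ 1 / 2 := by
    have h0 : 0 ≤ κ * (2 * C + 2 * R * (R + 2 * C) + 1) := by positivity
    have := min_le_left 1 d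
    rw [hM] at hκM
    linarith
  obtain ⟨δ, hδ, H⟩ := hρ.comparable hR hκ0 hκR
  refine ⟨min δ (ε₁ / 2), by positivity, ?_⟩
  rintro t₀ h0 ht₀ _ ⟨⟨t, y⟩, hp, rfl⟩ hx
  have h3 := hρ.pos t₀ h0
  obtain ⟨b1, b2, b3, b4, b5, -, b7, -, b9⟩ := H t₀ h0 (ht₀.trans_le (min_le_left _ _)) t
    ((norm_fst_le (emb ρ (t, y) - (t₀, 0))).trans hx)
  have htpos : 0 < t := by linarith
  have h4 := hρ.pos t htpos
  have hδ' := ht₀.trans_le (min_le_right _ _)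
  obtain ⟨-, -, y1, y2⟩ := thin _ hp (show t ≤ ε₁ by linarith)
    (fun h => htpos.ne' (congrArg Prod.fst h))
  dsimp only at y1 y2
  set r := ρ t with hr
  set ε := ρ t₀ with hε
  set σ := r⁻¹ * y 0 with hσ
  refine ⟨σ, ?_⟩
  have e2 : (emb ρ (t, y)).2 = r • tub (r⁻¹ • y) := rfl
  have hx2 : ‖(emb ρ (t, y)).2‖ ≤ R * ε := by
    have := (norm_snd_le (emb ρ (t, y) - (t₀, 0))).trans hx
    rwa [Prod.snd_sub, sub_zero] at this
  have t53 : t ^ 5 ≤ t ^ 3 := pow_le_pow_of_le_one htpos.le b9 (by norm_num)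
  have k1 : ‖r • tub (r⁻¹ • y) - r • knot σ‖ ≤ 2 * C * κ * ε := by
    have := htub (r⁻¹ • y) (r⁻¹ * t ^ 5)
      (by rw [Pi.smul_apply, smul_eq_mul, abs_mul, abs_of_pos (inv_pos.2 h4)]; gcongr)
      (by rw [Pi.smul_apply, smul_eq_mul, abs_mul, abs_of_pos (inv_pos.2 h4)]; gcongr)
    rw [← smul_sub, norm_smul, Real.norm_of_nonneg h4.le]
    calc _ ≤ r * (C * (r⁻¹ * t ^ 5)) := by gcongr; exact this
      _ = C * t ^ 5 := by field_simp
      _ ≤ C * (κ * (2 * ε)) := by gcongr; exact t53.trans (b7.trans (by gcongr))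
      _ = _ := by ring
  have k2 : ‖knot σ‖ ≤ 2 * (R + 2 * C) := by
    have k3 := norm_sub_norm_le (r • knot σ) (r • tub (r⁻¹ • y))
    rw [norm_sub_rev, norm_smul, Real.norm_of_nonneg h4.le, ← e2] at k3
    have k4 : 2 * C * κ * ε ≤ 2 * C * 1 * ε := by gcongr
    have k5 : ε / 2 * ‖knot σ‖ ≤ r * ‖knot σ‖ := by gcongr; linarith
    have k6 : ε * ‖knot σ‖ ≤ ε * (2 * (R + 2 * C)) := by
      rw [← e2] at k1
      linarith
    exact le_of_mul_le_mul_left k6 h3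
  rw [e2]
  refine (norm_sub_le_norm_sub_add_norm_sub _ (r • knot σ) _).trans ?_
  rw [← sub_smul, norm_smul, Real.norm_eq_abs]
  calc _ ≤ 2 * C * κ * ε + κ * (R * ε) * (2 * (R + 2 * C)) := by gcongr
    _ = κ * (2 * C + 2 * R * (R + 2 * C)) * ε := by ring
    _ ≤ κ * M * ε := by gcongr; linarith
    _ ≤ d * ε := by gcongr; rw [hκM]; exact min_le_right _ _

theorem IsFinger.exists_near_finger (hF : IsFinger F) (hρ : IsRad ρ) {R d : ℝ} (hR : 0 < R)
    (hd : 0 < d) : ∃ δ > 0, ∀ t₀, 0 < t₀ → t₀ < δ → ∀ x σ, ‖x - (t₀, 0)‖ ≤ R * ρ t₀ →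
      x.2 = ρ t₀ • knot σ → ∃ a ∈ emb ρ '' F, ‖x - a‖ < d * ρ t₀ := by
  obtain ⟨δ₁, c₁, L, hδ₁, -, -, hL, hemb⟩ := exists_emb_bilip
  obtain ⟨ε₁, h₁, hbi⟩ := hemb ρ hρ
  obtain ⟨ε₂, h₂, hsub⟩ := hF.subset_tubeSet hρ hδ₁
  obtain ⟨ε₃, h₃, thin⟩ := hF.thin
  obtain ⟨ε₄, h₄, dense⟩ := hF.dense
  obtain ⟨c, hc, hch⟩ := exists_knot_chord
  set S := (R + ‖knot 0‖) / c with hS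
  have hS0 : 0 < S := by positivity
  set M := 96 * L + R * R + 2 * R + S + 49 with hM
  have hM0 : 0 < M := by positivity
  set κ := min 1 d / 2 / M with hκ
  have hκ0 : 0 < κ := by positivity
  have hκM : κ * M = min 1 d / 2 := by rw [hκ]; field_simp
  have hκM1 : κ * M ≤ 1 / 2 := by rw [hκM]; linarith [min_le_left 1 d]
  have hκM' : κ * (96 * L) + κ * (R * R) + κ * (2 * R) + κ * S + κ * 49 = κ * M := by rw [hM]; ring
  have p1 : 0 ≤ κ * (96 * L) := by positivity
  have p2 : 0 ≤ κ * (R * R) := by positivity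
  have p3 : 0 ≤ κ * (2 * R) := by positivity
  have p4 : 0 ≤ κ * S := by positivity
  obtain ⟨δ, hδ, H⟩ := hρ.comparable hR hκ0 (by linarith)
  refine ⟨min δ (min ε₁ (min ε₂ (min ε₃ ε₄)) / 4), by positivity, ?_⟩
  rintro t₀ h0 ht₀ ⟨t, v⟩ σ hx hxσ
  dsimp only at hxσ
  have hε0 := hρ.pos t₀ h0
  obtain ⟨b1, b2, b3, b4, b5, b6, b7, b8, b9⟩ := H t₀ h0 (ht₀.trans_le (min_le_left _ _)) t
    ((norm_fst_le (((t, v) : ℝ × (Fin 3 → ℝ)) - (t₀, 0))).trans hx)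
  have htpos : 0 < t := by linarith
  have hr0 := hρ.pos t htpos
  have hmin := (lt_div_iff₀ (by norm_num)).1 (ht₀.trans_le (min_le_right _ _))
  obtain ⟨m1, m2, m3, m4⟩ : t₀ * 4 < ε₁ ∧ t₀ * 4 < ε₂ ∧ t₀ * 4 < ε₃ ∧ t₀ * 4 < ε₄ := by
    simpa [lt_min_iff] using hmin
  have nk : ‖knot σ‖ ≤ R := by
    have := (norm_snd_le (((t, v) : ℝ × (Fin 3 → ℝ)) - (t₀, 0))).trans hx
    rw [Prod.snd_sub, sub_zero, hxσ, norm_smul, Real.norm_of_nonneg hε0.le, mul_comm] at this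
    exact le_of_mul_le_mul_right this hε0
  have hσS : |σ| ≤ S := by
    have := hch σ 0
    rw [sub_zero] at this
    rw [hS, le_div_iff₀' hc]
    exact this.trans ((norm_sub_le _ _).trans (by linarith))
  set r := ρ t with hr
  set ε := ρ t₀ with hε
  have hs : |r * σ| ≤ t ^ 2 := by
    rw [abs_mul, abs_of_pos hr0]
    calc _ ≤ κ * t ^ 2 * S := by gcongr
      _ = κ * S * t ^ 2 := by ring
      _ ≤ 1 * t ^ 2 := by gcongr; linarith
      _ = _ := one_mul _
  obtain ⟨⟨t', y⟩, hp, hp0, q1, q2⟩ := dense t (r * σ) htpos (by linarith) hs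
  dsimp only at q1 q2
  have t3 : 48 * t ^ 3 ≤ t := by
    have : t * t ≤ κ * 1 := by gcongr
    nlinarith
  have q3 : t' ≤ 2 * t := by linarith [(abs_le.1 q1).2]
  obtain ⟨ht', -, y1, y2⟩ := thin _ hp (show t' ≤ ε₃ by linarith) hp0
  dsimp only at ht' y1 y2
  have t5 : t' ^ 5 ≤ 48 * t ^ 3 := by
    calc t' ^ 5 ≤ (2 * t) ^ 5 := by gcongr
      _ = 32 * t ^ 5 := by ring
      _ ≤ 48 * t ^ 3 := by
        have : t ^ 5 ≤ t ^ 3 := pow_le_pow_of_le_one htpos.le b9 (by norm_num)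
        have : 0 < t ^ 3 := by positivity
        linarith
  refine ⟨_, ⟨_, hp, rfl⟩, ?_⟩
  have hq : ((t, ![r * σ, 0, 0]) : ℝ × (Fin 3 → ℝ)) ∈ insert 0 (tubeSet ρ ε₁ δ₁) := by
    refine Or.inr ⟨htpos, by dsimp only; linarith, ?_, ?_⟩
    all_goals
      have : 0 ≤ δ₁ * r := by positivity
      simpa using this
  have hp' := (hsub (min ε₁ ε₂) (min_le_right _ _) _ hp
    (show t' ≤ min ε₁ ε₂ from le_min (by linarith) (by linarith))).1
  have hp'' : ((t', y) : ℝ × (Fin 3 → ℝ)) ∈ insert 0 (tubeSet ρ ε₁ δ₁) := by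
    rcases hp' with h | ⟨g1, g2, g3⟩
    · exact Or.inl h
    · exact Or.inr ⟨g1, g2.trans (min_le_left _ _), g3⟩
  have eq : emb ρ (t, ![r * σ, 0, 0]) = (t, r • knot σ) := by
    have : r⁻¹ • ![r * σ, 0, 0] = ![σ, 0, 0] := by
      ext i; fin_cases i <;> simp [hr0.ne']
    simp only [emb, stub, ← hr, this, tub_axis]
  have n1 := (hbi _ hq _ hp'').2
  have n2 : ‖((t, ![r * σ, 0, 0]) : ℝ × (Fin 3 → ℝ)) - (t', y)‖ ≤ 48 * t ^ 3 := by
    rw [norm_sub_rev]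
    refine prod_norm_le q1 (pi3_norm_le q2 ?_ ?_)
    · change |y 1 - 0| ≤ _
      rw [sub_zero]
      exact y1.trans t5
    · change |y 2 - 0| ≤ _
      rw [sub_zero]
      exact y2.trans t5
  have n3 : ‖((t, v) : ℝ × (Fin 3 → ℝ)) - emb ρ (t, ![r * σ, 0, 0])‖ ≤ κ * (R * ε) * R := by
    rw [eq, Prod.mk_sub_mk, sub_self, hxσ, ← sub_smul]
    refine prod_norm_le (by simp; positivity) ?_
    rw [norm_smul, Real.norm_eq_abs, abs_sub_comm]
    gcongr
  refine (norm_sub_le_norm_sub_add_norm_sub _ (emb ρ (t, ![r * σ, 0, 0])) _).trans_lt ?_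
  calc _ ≤ κ * (R * ε) * R + L * (48 * (κ * (2 * ε))) := by
        gcongr
        refine n1.trans ?_
        gcongr
        refine n2.trans ?_
        gcongr
        exact b7.trans (by gcongr)
    _ = (κ * (R * R) + κ * (96 * L)) * ε := by ring
    _ ≤ (min 1 d / 2) * ε := by gcongr; linarith
    _ < d * ε := by
      gcongr
      have := min_le_right 1 d
      linarith

/-- Among finger models, nonzero points near the origin are dominated by the first coordinate. -/
theorem IsFinger.norm_eq_fst (hF : IsFinger F) (hρ : IsRad ρ) : ∃ δ > 0, ∀ x ∈ emb ρ '' F,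
    ‖x‖ < δ → ‖x‖ = x.1 := by
  obtain ⟨C, hC, hst⟩ := exists_stub_sub_le
  obtain ⟨ε₁, h₁, hsub⟩ := hF.subset_tubeSet hρ one_pos
  obtain ⟨ε₂, h₂, thin⟩ := hF.thin
  obtain ⟨ε₃, h₃, h₃1, hsq, -⟩ := hρ.small one_pos
  refine ⟨min (1 / (C + 49)) (min ε₁ (min ε₂ ε₃)), by positivity, ?_⟩
  rintro _ ⟨⟨t, y⟩, hp, rfl⟩ hx
  have ht := (le_abs_self t).trans (norm_fst_le (emb ρ (t, y)))
  obtain ⟨m0, m1, m2, m3⟩ : t < 1 / (C + 49) ∧ t < ε₁ ∧ t < ε₂ ∧ t < ε₃ := by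
    simpa [lt_min_iff] using ht.trans_lt hx
  by_cases hp0 : ((t, y) : ℝ × (Fin 3 → ℝ)) = 0
  · rw [hp0, emb_zero hρ, norm_zero]; rfl
  obtain ⟨htpos, y0, y1, y2⟩ := thin _ hp m2.le hp0
  have hy := (hsub ε₁ le_rfl _ hp m1.le).2
  dsimp only at htpos y0 y1 y2 hy
  have hs := hst (ρ t) y (hρ.pos t htpos) hy
  have hsq := (hsq t htpos m3.le).1
  rw [lt_div_iff₀ (by positivity)] at m0
  have t53 : t ^ 5 ≤ t ^ 3 := pow_le_pow_of_le_one htpos.le (by linarith) (by norm_num)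
  have t32 : t ^ 3 ≤ t ^ 2 := pow_le_pow_of_le_one htpos.le (by linarith) (by norm_num)
  have t2 : 0 < t ^ 2 := by positivity
  have ny : ‖y‖ ≤ 49 * t ^ 2 := pi3_norm_le (by linarith) (by linarith) (by linarith)
  have k := norm_le_norm_add_norm_sub' (stub (ρ t) y) y
  have k2 : ‖stub (ρ t) y‖ ≤ t := by
    calc _ ≤ 49 * t ^ 2 + C * (1 * t ^ 2) := by
          refine k.trans (add_le_add ny (hs.trans ?_)); gcongr
      _ = t * (C + 49) * t := by ring
      _ ≤ 1 * t := by gcongr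
      _ = t := one_mul t
  change max |t| ‖stub (ρ t) y‖ = t
  rw [abs_of_pos htpos, max_eq_left k2]

set_option maxHeartbeats 1600000 in
/-- At a scale larger than its own radius, a finger model looks like a plane strip. -/
theorem IsFinger.exists_near_strip (hF : IsFinger F) (hρ : IsRad ρ) {ρ' : ℝ → ℝ}
    (hρ' : IsRad ρ')
    (hsmall : ∀ K κ, 0 < K → 0 < κ → ∃ δ > 0, ∀ t₀, 0 < t₀ → t₀ < δ → ∀ t, 0 < t → t ≤ K * t₀ →
      ρ' t ≤ κ * ρ t₀) {K R η : ℝ} (hK : 1 ≤ K) (hR : 0 < R) (hη : 0 < η) :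
    ∃ δ > 0, ∀ t₀, 0 < t₀ → t₀ < δ → ∀ t₁, t₀ ≤ K * t₁ → t₁ ≤ K * t₀ →
      (∀ x ∈ emb ρ' '' F, |x.1 - t₁| ≤ R * ρ t₀ → |x.2 1| ≤ η * ρ t₀ ∧ |x.2 2| ≤ η * ρ t₀ ∧
        |x.2 0| ≤ t₁ ^ 2 + η * ρ t₀) ∧
      ∀ τ s, |τ - t₁| ≤ R * ρ t₀ → |s| ≤ t₁ ^ 2 →
        ∃ x ∈ emb ρ' '' F, ‖x - (τ, ![s, 0, 0])‖ ≤ η * ρ t₀ := by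
  obtain ⟨C, hC, hst⟩ := exists_stub_sub_le
  obtain ⟨ε₁, h₁, hsub⟩ := hF.subset_tubeSet hρ' one_pos
  obtain ⟨ε₂, h₂, thin⟩ := hF.thin
  obtain ⟨ε₃, h₃, dense⟩ := hF.dense
  have hK0 : 0 < K := by linarith
  set M := C + 49 * (8 * K ^ 3) + 3 * K * R + 2 * K * R + 1 with hM
  have hM0 : 0 < M := by positivity
  set κ := min 1 η / M with hκ
  have hκ0 : 0 < κ := by positivity
  have hκM : κ * C + κ * (49 * (8 * K ^ 3)) + κ * (3 * K * R) + κ * (2 * K * R) + κ = min 1 η := by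
    have : κ * M = min 1 η := by rw [hκ]; field_simp
    rw [← this, hM]; ring
  have p1 : 0 ≤ κ * C := by positivity
  have p2 : 0 ≤ κ * (49 * (8 * K ^ 3)) := by positivity
  have p3 : 0 ≤ κ * (3 * K * R) := by positivity
  have p4 : 0 ≤ κ * (2 * K * R) := by positivity
  have m1 := min_le_left 1 η
  have m2 := min_le_right 1 η
  obtain ⟨ε₄, h₄, h₄1, hsq, -⟩ := hρ.small hκ0
  obtain ⟨ε₅, h₅, hs5⟩ := hsmall (4 * K) κ (by positivity) hκ0
  refine ⟨min ε₅ (min ε₄ (min (min κ (1 / 100)) (min ε₁ (min ε₂ ε₃)) / (4 * K))),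
    by positivity, fun t₀ h0 ht₀ t₁ hK1 hK2 => ?_⟩
  obtain ⟨l5, l4, l⟩ : t₀ < ε₅ ∧ t₀ < ε₄ ∧
      t₀ < min (min κ (1 / 100)) (min ε₁ (min ε₂ ε₃)) / (4 * K) := by
    simpa only [lt_min_iff] using ht₀
  rw [lt_div_iff₀ (by positivity)] at l
  obtain ⟨⟨lκ, l100⟩, l1, l2, l3⟩ : (t₀ * (4 * K) < κ ∧ t₀ * (4 * K) < 1 / 100) ∧
      t₀ * (4 * K) < ε₁ ∧ t₀ * (4 * K) < ε₂ ∧ t₀ * (4 * K) < ε₃ := by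
    simpa only [lt_min_iff] using l
  have hε0 := hρ.pos t₀ h0
  obtain ⟨hs1, hs2⟩ := hsq t₀ h0 l4.le
  replace hs5 := hs5 t₀ h0 l5
  set ε := ρ t₀ with hε
  have hKt : t₀ ≤ t₀ * K := le_mul_of_one_le_right h0.le hK
  have ht1 : 0 < t₁ := by
    by_contra! h
    have := mul_nonpos_of_nonneg_of_nonpos hK0.le h
    linarith
  have hRε : R * ε ≤ t₁ / 2 := by
    calc R * ε ≤ R * (κ * t₀ ^ 2) := by gcongr
      _ = κ * (2 * K * R) * (t₀ / K) / 2 * t₀ := by field_simp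
      _ ≤ 1 * t₁ / 2 * 1 := by
        gcongr
        · linarith
        · rw [div_le_iff₀ hK0]; linarith
        · linarith
      _ = _ := by ring
  have cube : ∀ t, 0 < t → t ≤ 2 * (K * t₀) → t ^ 3 ≤ κ * (8 * K ^ 3) * ε := by
    intro t h h'
    calc t ^ 3 ≤ (2 * (K * t₀)) ^ 3 := by gcongr
      _ = 8 * K ^ 3 * t₀ ^ 3 := by ring
      _ ≤ 8 * K ^ 3 * (κ * ε) := by gcongr
      _ = _ := by ring
  have sq : ∀ t, |t - t₁| ≤ R * ε → |t ^ 2 - t₁ ^ 2| ≤ κ * (3 * K * R) * ε := by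
    intro t h
    have h2 : |t + t₁| ≤ 3 * (K * t₀) := by
      have := abs_le.1 h
      rw [abs_le]
      constructor <;> linarith
    rw [show t ^ 2 - t₁ ^ 2 = (t - t₁) * (t + t₁) by ring, abs_mul]
    calc _ ≤ R * ε * (3 * (K * t₀)) := by gcongr
      _ ≤ R * ε * (3 * (K * κ)) := by gcongr; linarith
      _ = _ := by ring
  have est : κ * (49 * (8 * K ^ 3)) = 49 * (κ * (8 * K ^ 3)) := by ring
  have near : ∀ t y, ((t, y) : ℝ × (Fin 3 → ℝ)) ∈ F → 0 < t → t ≤ 4 * K * t₀ →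
      ‖stub (ρ' t) y - y‖ ≤ κ * C * ε := by
    intro t y hp ht h
    have hy := (hsub ε₁ le_rfl _ hp (by dsimp only; linarith)).2
    refine (hst (ρ' t) y (hρ'.pos t ht) hy).trans ?_
    calc _ ≤ C * (κ * ε) := by gcongr; exact hs5 t ht h
      _ = _ := by ring
  have tot : (κ * C + κ * (49 * (8 * K ^ 3)) + κ * (3 * K * R)) * ε ≤ η * ε := by
    gcongr; linarith
  have q3 : 0 ≤ κ * (8 * K ^ 3) * ε := by positivity
  have q4 : 0 ≤ κ * (3 * K * R) * ε := by positivity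
  have q5 : 0 ≤ κ * C * ε := by positivity
  rw [add_mul, add_mul, est] at tot
  constructor
  · rintro _ ⟨⟨t, y⟩, hp, rfl⟩ hx
    change |t - t₁| ≤ R * ε at hx
    have hx' := abs_le.1 hx
    have htpos : 0 < t := by linarith
    have ht2 : t ≤ 2 * (K * t₀) := by linarith
    obtain ⟨-, y0, y1, y2⟩ := thin _ hp (show t ≤ ε₂ by linarith)
      (fun h => htpos.ne' (congrArg Prod.fst h))
    dsimp only at y0 y1 y2
    have t53 : t ^ 5 ≤ t ^ 3 := pow_le_pow_of_le_one htpos.le (by linarith) (by norm_num)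
    have c3 := cube t htpos ht2
    have hn := near t y hp htpos (by linarith)
    have hi : ∀ i, |stub (ρ' t) y i| ≤ |y i| + κ * C * ε := fun i => by
      have := (norm_le_pi_norm (stub (ρ' t) y - y) i).trans hn
      rw [Pi.sub_apply, Real.norm_eq_abs] at this
      have := abs_sub_abs_le_abs_sub (stub (ρ' t) y i) (y i)
      linarith
    have hsq := (abs_le.1 (sq t hx)).2
    refine ⟨(hi 1).trans ?_, (hi 2).trans ?_, (hi 0).trans ?_⟩ <;> linarith
  · intro τ s hτ hs
    have hτ' := abs_le.1 hτ
    have hτ0 : 0 < τ := by linarith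
    have hτ2 : τ ≤ 2 * (K * t₀) := by linarith
    have hsq := abs_le.1 (sq τ hτ)
    obtain ⟨s', hs', hss'⟩ : ∃ s', |s'| ≤ τ ^ 2 ∧ |s' - s| ≤ κ * (3 * K * R) * ε := by
      have hs' := abs_le.1 hs
      have hτ2 : 0 ≤ τ ^ 2 := by positivity
      refine ⟨max (-τ ^ 2) (min s (τ ^ 2)), ?_, ?_⟩
      · rw [abs_le]
        exact ⟨le_max_left _ _, max_le (by linarith) (min_le_right _ _)⟩
      · rw [abs_le]
        constructor
        · have : s - κ * (3 * K * R) * ε ≤ min s (τ ^ 2) := le_min (by linarith) (by linarith)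
          have := this.trans (le_max_right (-τ ^ 2) _)
          linarith
        · have : max (-τ ^ 2) (min s (τ ^ 2)) ≤ s + κ * (3 * K * R) * ε :=
            max_le (by linarith) ((min_le_left _ _).trans (by linarith))
          linarith
    obtain ⟨⟨t, y⟩, hp, hp0, q1, q2⟩ := dense τ s' hτ0 (by linarith) hs'
    dsimp only at q1 q2
    have t3 : 48 * τ ^ 3 ≤ τ := by
      have : τ * τ ≤ 1 / 100 * 1 := by gcongr <;> linarith
      nlinarith
    have q1' := abs_le.1 q1
    have ht2 : t ≤ 2 * τ := by linarith
    obtain ⟨htpos, -, y1, y2⟩ := thin _ hp (show t ≤ ε₂ by linarith) hp0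
    dsimp only at htpos y1 y2
    have c3 := cube τ hτ0 hτ2
    have t5 : t ^ 5 ≤ 48 * τ ^ 3 := by
      calc t ^ 5 ≤ (2 * τ) ^ 5 := by gcongr
        _ = 32 * τ ^ 5 := by ring
        _ ≤ 48 * τ ^ 3 := by
          have : τ ^ 5 ≤ τ ^ 3 := pow_le_pow_of_le_one hτ0.le (by linarith) (by norm_num)
          have : 0 < τ ^ 3 := by positivity
          linarith
    have hn := near t y hp htpos (by linarith)
    refine ⟨_, ⟨_, hp, rfl⟩, prod_norm_le (r := η * ε) ?_ ?_⟩
    · change |t - τ| ≤ _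
      linarith
    · change ‖stub (ρ' t) y - ![s, 0, 0]‖ ≤ _
      have : ‖y - ![s, 0, 0]‖ ≤ 48 * τ ^ 3 + κ * (3 * K * R) * ε := by
        refine pi3_norm_le ?_ ?_ ?_
        · change |y 0 - s| ≤ _
          have := abs_sub_le (y 0) s' s
          linarith
        · change |y 1 - 0| ≤ _
          rw [sub_zero]
          linarith
        · change |y 2 - 0| ≤ _
          rw [sub_zero]
          linarith
      have := norm_sub_le_norm_sub_add_norm_sub (stub (ρ' t) y) y ![s, 0, 0]
      linarith

end Asymptotics

section Inequivalence
open Filter Topology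

theorem rad_le_mul_rad {n m : ℕ} (hnm : n < m) {K κ : ℝ} (hK : 0 < K) (hκ : 0 < κ) :
    ∃ δ > 0, ∀ t₀, 0 < t₀ → t₀ < δ → ∀ t, 0 < t → t ≤ K * t₀ → rad n t ≤ κ * rad m t₀ := by
  set a : ℝ := 2 + 1 / ((n : ℝ) + 2) with ha
  set b : ℝ := 2 + 1 / ((m : ℝ) + 2) with hb
  have hab : b < a := by
    have : (n : ℝ) < m := by exact_mod_cast hnm
    rw [ha, hb]
    gcongr
  have ha0 : 0 < a := by positivity
  have hKa : 0 < K ^ a := Real.rpow_pos_of_pos hK _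
  have h := (tendsto_rpow_nhdsGT_zero (sub_pos.2 hab)).eventually (ge_mem_nhds (div_pos hκ hKa))
  obtain ⟨δ, hδ, h⟩ := (mem_nhdsGT_iff_exists_Ioo_subset).1 h
  refine ⟨δ, hδ, fun t₀ h0 h1 t ht htK => ?_⟩
  have h2 : t₀ ^ (a - b) ≤ κ / K ^ a := h ⟨h0, h1⟩
  rw [le_div_iff₀ hKa] at h2
  change (max t 0) ^ a ≤ κ * (max t₀ 0) ^ b
  rw [max_eq_left ht.le, max_eq_left h0.le]
  calc t ^ a ≤ (K * t₀) ^ a := by gcongr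
    _ = t₀ ^ (a - b) * K ^ a * t₀ ^ b := by
      rw [Real.mul_rpow hK.le h0.le, mul_right_comm, ← Real.rpow_add h0, sub_add_cancel, mul_comm]
    _ ≤ κ * t₀ ^ b := by gcongr

/-- A bi-Lipschitz map cannot carry a knotted finger to one with much smaller knots. -/
theorem IsFinger.not_bilipschitz {F : Set (ℝ × (Fin 3 → ℝ))} (hF : IsFinger F) {ρ ρ' : ℝ → ℝ}
    (hρ : IsRad ρ) (hρ' : IsRad ρ')
    (hsmall : ∀ K κ, 0 < K → 0 < κ → ∃ δ > 0, ∀ t₀, 0 < t₀ → t₀ < δ → ∀ t, 0 < t → t ≤ K * t₀ →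
      ρ' t ≤ κ * ρ t₀) {K r : ℝ} (hK : 1 ≤ K) (hr : 0 < r)
    {h g : ℝ × (Fin 3 → ℝ) → ℝ × (Fin 3 → ℝ)}
    (hh : ∀ x y, ‖x‖ < r → ‖y‖ < r → ‖h x - h y‖ ≤ K * ‖x - y‖)
    (hg : ∀ x y, ‖x‖ < r → ‖y‖ < r → ‖g x - g y‖ ≤ K * ‖x - y‖)
    (hgh : ∀ x, ‖x‖ < r → g (h x) = x) (hhg : ∀ x, ‖x‖ < r → h (g x) = x) (h0 : h 0 = 0)
    (hX : ∀ x ∈ emb ρ '' F, ‖x‖ < r → h x ∈ emb ρ' '' F)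
    (hX' : ∀ x ∈ emb ρ' '' F, ‖x‖ < r → g x ∈ emb ρ '' F) : False := by
  obtain ⟨d₁, hd₁, H⟩ := exists_scaled_obstruction hK
  have hK0 : 0 < K := by linarith
  set N := ‖knot 0‖ with hN
  have hN0 : 0 ≤ N := norm_nonneg _
  obtain ⟨R, η, d₂, hR, hη, hd₂, H⟩ := H (K * (N + 1) + 1) (by positivity)
  obtain ⟨δ₁, hδ₁, knotNear⟩ := hF.exists_near_knot hρ hR hd₁
  obtain ⟨δ₂, hδ₂, finger⟩ := hF.exists_near_finger hρ (R := R + N) (by positivity)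
    (show 0 < min d₂ 1 by positivity)
  obtain ⟨δ₃, hδ₃, strip⟩ := hF.exists_near_strip hρ hρ' hsmall (K := 2 * K) (by linarith) hR
    (show 0 < min η 1 by positivity)
  obtain ⟨δ₄, hδ₄, norm_eq⟩ := hF.norm_eq_fst hρ'
  set κ := 1 / (4 * K ^ 2 * R + 2 * (R + N + 1)) with hκ
  have hκ0 : 0 < κ := by positivity
  obtain ⟨δ₅, hδ₅, hδ₅1, hsq, -⟩ := hρ.small hκ0
  obtain ⟨t₀, ht₀, ht₀'⟩ := exists_between (show 0 < min δ₁ (min δ₂ (min δ₃ (min δ₅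
    (min r δ₄ / (4 * K))))) by positivity)
  obtain ⟨l1, l2, l3, l5, l⟩ : t₀ < δ₁ ∧ t₀ < δ₂ ∧ t₀ < δ₃ ∧ t₀ < δ₅ ∧ t₀ < min r δ₄ / (4 * K) := by
    simpa only [lt_min_iff] using ht₀'
  rw [lt_div_iff₀ (by positivity)] at l
  obtain ⟨lr, l4⟩ : t₀ * (4 * K) < r ∧ t₀ * (4 * K) < δ₄ := by simpa only [lt_min_iff] using l
  replace hsq := (hsq t₀ ht₀ l5.le).1
  replace finger := finger t₀ ht₀ l2
  replace knotNear := knotNear t₀ ht₀ l1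
  replace strip := strip t₀ ht₀ l3
  have hε := hρ.pos t₀ ht₀
  set ε := ρ t₀ with hεd
  have hκε : (4 * K ^ 2 * R + 2 * (R + N + 1)) * ε ≤ t₀ ^ 2 := by
    calc _ ≤ (4 * K ^ 2 * R + 2 * (R + N + 1)) * (κ * t₀ ^ 2) := by gcongr
      _ = _ := by rw [hκ]; field_simp
  have e1 : 4 * K ^ 2 * (R * ε) ≤ t₀ ^ 2 := by
    have : 0 ≤ 2 * (R + N + 1) * ε := by positivity
    linarith only [this, hκε]
  have e2 : (R + N + 1) * ε ≤ t₀ / 2 := by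
    have h1 : 0 ≤ 4 * K ^ 2 * R * ε := by positivity
    have h2 : t₀ ^ 2 ≤ t₀ * 1 := by rw [sq]; gcongr; linarith
    linarith only [h1, h2, hκε]
  have hRε : 0 ≤ R * ε := by positivity
  have hNε : 0 ≤ N * ε := by positivity
  have e3 : R * ε + N * ε + ε ≤ t₀ / 2 := by linarith only [e2]
  have hKt : t₀ ≤ t₀ * K := le_mul_of_one_le_right ht₀.le hK
  set p₀ : ℝ × (Fin 3 → ℝ) := (t₀, 0) with hp₀
  have np₀ : ‖p₀‖ = t₀ := by simp [hp₀, Prod.norm_def, abs_of_pos ht₀, ht₀.le]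
  obtain ⟨p₁, hp₁, hpp⟩ := finger (t₀, ε • knot 0) 0 (by
    rw [hp₀, Prod.mk_sub_mk, sub_self, sub_zero]
    refine prod_norm_le (by dsimp only; rw [abs_zero]; positivity) ?_
    rw [norm_smul, Real.norm_of_nonneg hε.le, mul_comm]
    gcongr
    linarith only [hR]) rfl
  have d1 : ‖p₀ - p₁‖ ≤ (N + 1) * ε := by
    have k1 : ‖p₀ - (t₀, ε • knot 0)‖ ≤ N * ε := by
      rw [hp₀, Prod.mk_sub_mk, sub_self, zero_sub]
      refine prod_norm_le (by dsimp only; rw [abs_zero]; positivity) ?_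
      rw [norm_neg, norm_smul, Real.norm_of_nonneg hε.le, mul_comm]
    have k2 : min d₂ 1 * ε ≤ 1 * ε := by gcongr; exact min_le_right _ _
    have := norm_sub_le_norm_sub_add_norm_sub p₀ (t₀, ε • knot 0) p₁
    linarith only [this, k1, k2, hpp]
  have n1 : ‖p₁‖ ≤ 2 * t₀ := by
    have := norm_le_norm_add_norm_sub p₀ p₁
    linarith only [this, d1, e3, hRε, np₀, ht₀]
  have n1' : t₀ / 2 ≤ ‖p₁‖ := by
    have := norm_le_norm_add_norm_sub' p₀ p₁
    linarith only [this, d1, e3, hRε, np₀]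
  have lp1 : ‖p₁‖ < r := by linarith only [n1, lr, hKt, ht₀]
  have l0 : ‖(0 : ℝ × (Fin 3 → ℝ))‖ < r := by rwa [norm_zero]
  set x₁ := h p₁ with hx₁
  have hx₁X : x₁ ∈ emb ρ' '' F := hX _ hp₁ lp1
  have n2 : ‖x₁‖ ≤ 2 * K * t₀ := by
    have := hh p₁ 0 lp1 l0
    rw [h0, sub_zero, sub_zero] at this
    calc _ ≤ K * ‖p₁‖ := this
      _ ≤ K * (2 * t₀) := by gcongr
      _ = _ := by ring
  have lx1 : ‖x₁‖ < r := by
    have : 0 < t₀ * K := by positivity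
    linarith only [n2, lr, this]
  have n2' : t₀ ≤ 2 * K * ‖x₁‖ := by
    have := hg x₁ 0 lx1 l0
    rw [← h0, hgh _ l0, hx₁, hgh _ lp1, h0, sub_zero, sub_zero, ← hx₁] at this
    linarith only [this, n1']
  have hx1 := norm_eq x₁ hx₁X (by
    have : 0 < t₀ * K := by positivity
    linarith only [n2, l4, this])
  rw [hx1] at n2 n2'
  set t₁ := x₁.1 with ht₁
  obtain ⟨strip₁, strip₂⟩ := strip t₁ n2' n2
  have ht₁0 : 0 < t₁ := by
    by_contra! hn
    have := mul_nonpos_of_nonneg_of_nonpos (show 0 ≤ 2 * K by positivity) hn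
    linarith only [this, n2', ht₀]
  obtain ⟨v1, v2, v0⟩ := strip₁ x₁ hx₁X (by rw [sub_self, abs_zero]; positivity)
  set s₁ := x₁.2 0 with hs₁
  have hηε : min η 1 * ε ≤ η * ε := by gcongr; exact min_le_left _ _
  have h1ε : min η 1 * ε ≤ ε := mul_le_of_le_one_left hε.le (min_le_right _ _)
  set c : ℝ × (Fin 3 → ℝ) := (t₁, ![s₁, 0, 0]) with hc
  have hxc : ‖x₁ - c‖ ≤ ε := by
    refine prod_norm_le ?_ (pi3_norm_le ?_ ?_ ?_)
    · change |t₁ - t₁| ≤ ε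
      rw [sub_self, abs_zero]; positivity
    · change |s₁ - s₁| ≤ ε
      rw [sub_self, abs_zero]; positivity
    · change |x₁.2 1 - 0| ≤ ε
      rw [sub_zero]; exact v1.trans h1ε
    · change |x₁.2 2 - 0| ≤ ε
      rw [sub_zero]; exact v2.trans h1ε
  have nc : ‖c‖ ≤ 2 * K * t₀ + ε := by
    have := norm_le_norm_add_norm_sub x₁ c
    rw [hx1] at this
    linarith only [this, hxc, n2]
  have lp : ∀ x : ℝ × (Fin 3 → ℝ), ‖x‖ ≤ R → ‖p₀ + ε • x‖ < r := by
    intro x hx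
    have k1 := norm_add_le p₀ (ε • x)
    rw [norm_smul, Real.norm_of_nonneg hε.le, np₀] at k1
    have k2 : ε * ‖x‖ ≤ ε * R := by gcongr
    linarith only [k1, k2, e3, hNε, hε, lr, hKt, ht₀]
  have lc : ∀ x : ℝ × (Fin 3 → ℝ), ‖x‖ ≤ R → ‖c + ε • x‖ < r := by
    intro x hx
    have k1 := norm_add_le c (ε • x)
    rw [norm_smul, Real.norm_of_nonneg hε.le] at k1
    have k2 : ε * ‖x‖ ≤ ε * R := by gcongr
    linarith only [k1, k2, nc, e3, hNε, hε, lr, hKt, ht₀]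
  have sc : ∀ a b : ℝ × (Fin 3 → ℝ), a + ε • ε⁻¹ • (b - a) = b := by
    intro a b
    rw [smul_inv_smul₀ hε.ne', add_sub_cancel]
  have sc' : ∀ a b : ℝ × (Fin 3 → ℝ), ε⁻¹ • (a + ε • b - a) = b := by
    intro a b
    rw [add_sub_cancel_left, inv_smul_smul₀ hε.ne']
  have lip : ∀ (f : ℝ × (Fin 3 → ℝ) → ℝ × (Fin 3 → ℝ)) (a b x y : ℝ × (Fin 3 → ℝ)),
      ‖f (a + ε • x) - f (a + ε • y)‖ ≤ K * ‖(a + ε • x) - (a + ε • y)‖ →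
      ‖ε⁻¹ • (f (a + ε • x) - b) - ε⁻¹ • (f (a + ε • y) - b)‖ ≤ K * ‖x - y‖ := by
    intro f a b x y hf
    rw [add_sub_add_left_eq_sub, ← smul_sub, norm_smul, Real.norm_of_nonneg hε.le] at hf
    rw [← smul_sub, sub_sub_sub_cancel_right, norm_smul, norm_inv, Real.norm_of_nonneg hε.le,
      inv_mul_le_iff₀ hε]
    linarith only [hf]
  have close : ∀ (a x b : ℝ × (Fin 3 → ℝ)), ‖x - ε⁻¹ • (b - a)‖ * ε = ‖a + ε • x - b‖ := by
    intro a x b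
    rw [mul_comm, ← abs_of_pos hε, ← Real.norm_eq_abs, ← norm_smul, Real.norm_of_nonneg hε.le,
      smul_sub, smul_inv_smul₀ hε.ne']
    congr 1
    abel
  refine H {x | p₀ + ε • x ∈ emb ρ '' F} {w | c + ε • w ∈ emb ρ' '' F}
    (fun x => ε⁻¹ • (h (p₀ + ε • x) - c)) (fun w => ε⁻¹ • (g (c + ε • w) - p₀))
    ((t₁ ^ 2 - s₁) / ε) ((t₁ ^ 2 + s₁) / ε) ?_ ?_ ?_ ?_ ?_ ?_ ?_ ?_ ?_ ?_ ?_ ?_ ?_ ?_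
  · exact fun x y hx hy => lip h p₀ c x y (hh _ _ (lp x hx) (lp y hy))
  · exact fun x y hx hy => lip g c p₀ x y (hg _ _ (lc x hx) (lc y hy))
  · intro x hx
    rw [sc, hgh _ (lp x hx), sc']
  · intro x hx
    rw [sc, hhg _ (lc x hx), sc']
  · intro x hxA hx
    change c + ε • ε⁻¹ • (h (p₀ + ε • x) - c) ∈ emb ρ' '' F
    rw [sc]
    exact hX _ hxA (lp x hx)
  · intro x hxA hx
    change p₀ + ε • ε⁻¹ • (g (c + ε • x) - p₀) ∈ emb ρ '' F
    rw [sc]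
    exact hX' _ hxA (lc x hx)
  · rw [smul_zero, add_zero, norm_smul, norm_inv, Real.norm_of_nonneg hε.le, inv_mul_le_iff₀ hε]
    have k1 := norm_sub_le_norm_sub_add_norm_sub (h p₀) x₁ c
    have k2 := hh p₀ p₁ (by linarith only [np₀, lr, hKt, ht₀]) lp1
    have k3 : K * ‖p₀ - p₁‖ ≤ K * ((N + 1) * ε) := by gcongr
    linarith only [k1, k2, k3, hxc]
  · intro a ha haR
    obtain ⟨σ, hσ⟩ := knotNear _ ha (by
      rw [add_sub_cancel_left, norm_smul, Real.norm_of_nonneg hε.le, mul_comm]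
      gcongr)
    refine ⟨σ, ?_⟩
    rw [Prod.snd_add, hp₀, zero_add, Prod.smul_snd, ← smul_sub, norm_smul,
      Real.norm_of_nonneg hε.le, mul_comm] at hσ
    exact le_of_mul_le_mul_right hσ hε
  · intro x σ hx hxσ
    obtain ⟨a, ha, hxa⟩ := finger (p₀ + ε • x) σ (by
      rw [add_sub_cancel_left, norm_smul, Real.norm_of_nonneg hε.le, mul_comm]
      gcongr
      linarith only [hx, hN0]) (by rw [Prod.snd_add, hp₀, zero_add, Prod.smul_snd, hxσ])
    refine ⟨ε⁻¹ • (a - p₀), ?_, ?_⟩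
    · change p₀ + ε • ε⁻¹ • (a - p₀) ∈ emb ρ '' F
      rwa [sc]
    · rw [← close] at hxa
      exact (lt_of_mul_lt_mul_right hxa hε.le).trans_le (min_le_left _ _)
  · rw [le_div_iff₀ hε]
    linarith only [(abs_le.1 v0).2, h1ε]
  · rw [le_div_iff₀ hε]
    linarith only [(abs_le.1 v0).1, h1ε]
  · rw [← add_div, le_div_iff₀ hε]
    have k1 : t₀ ^ 2 ≤ (2 * K * t₁) ^ 2 := by gcongr
    have k2 : 4 * K ^ 2 * (R * ε) ≤ 4 * K ^ 2 * t₁ ^ 2 := by linarith only [k1, e1]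
    have := le_of_mul_le_mul_left k2 (by positivity)
    linarith only [this]
  · intro w hw hwR
    have k := strip₁ _ hw (by
      rw [Prod.fst_add, hc, add_sub_cancel_left, Prod.smul_fst, smul_eq_mul, abs_mul,
        abs_of_pos hε, mul_comm]
      gcongr
      exact (norm_fst_le w).trans hwR)
    have a0 : (c + ε • w).2 0 = s₁ + ε * w.2 0 := rfl
    have a1 : (c + ε • w).2 1 = ε * w.2 1 := by
      change 0 + ε * w.2 1 = _
      rw [zero_add]
    have a2 : (c + ε • w).2 2 = ε * w.2 2 := by
      change 0 + ε * w.2 2 = _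
      rw [zero_add]
    rw [a0, a1, a2, abs_mul, abs_mul, abs_of_pos hε] at k
    obtain ⟨k1, k2, k3⟩ := k
    have k3 := abs_le.1 k3
    refine ⟨?_, ?_, ?_, ?_⟩
    · refine le_of_mul_le_mul_left ?_ hε
      linarith only [k1, hηε]
    · refine le_of_mul_le_mul_left ?_ hε
      linarith only [k2, hηε]
    · refine le_of_mul_le_mul_left ?_ hε
      have : ε * (-((t₁ ^ 2 + s₁) / ε) - η) = -(t₁ ^ 2 + s₁) - η * ε := by field_simp
      rw [this]
      linarith only [k3.1, hηε]
    · refine le_of_mul_le_mul_left ?_ hε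
      have : ε * ((t₁ ^ 2 - s₁) / ε + η) = t₁ ^ 2 - s₁ + η * ε := by field_simp
      rw [this]
      linarith only [k3.2, hηε]
  · intro τ σ hτ hσ h1 h2
    rw [neg_le, le_div_iff₀ hε] at h1
    rw [le_div_iff₀ hε] at h2
    obtain ⟨x, hx, hxn⟩ := strip₂ (t₁ + ε * τ) (s₁ + ε * σ) (by
      rw [add_sub_cancel_left, abs_mul, abs_of_pos hε, mul_comm]
      gcongr) (by
      rw [abs_le]
      constructor <;> linarith only [h1, h2])
    refine ⟨ε⁻¹ • (x - c), ?_, ?_⟩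
    · change c + ε • ε⁻¹ • (x - c) ∈ emb ρ' '' F
      rwa [sc]
    · have k := close c (τ, ![σ, 0, 0]) x
      have : c + ε • ((τ, ![σ, 0, 0]) : ℝ × (Fin 3 → ℝ)) =
          (t₁ + ε * τ, ![s₁ + ε * σ, 0, 0]) := by
        rw [hc]
        refine Prod.ext rfl ?_
        ext i
        fin_cases i <;> simp
      rw [this, norm_sub_rev _ x, norm_sub_rev] at k
      exact le_of_mul_le_mul_right (k.trans_le (hxn.trans hηε)) hε

theorem AmbientLipEquiv.symm {n : ℕ} {X Y : Set (EuclideanSpace ℝ (Fin n))}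
    (h₁ : AmbientLipEquiv X Y) : AmbientLipEquiv Y X := by
  obtain ⟨U, V, hU, hV, h0U, h0V, h, g, hm, gm, hgh, hhg, ⟨K, hK, hK'⟩, h0, him⟩ := h₁
  refine ⟨V, U, hV, hU, h0V, h0U, g, h, gm, hm, hhg, hgh, ⟨K, hK', hK⟩,
    by simpa [h0] using hgh 0 h0U, ?_⟩
  rw [← him, image_image]
  exact (image_congr fun x hx => hgh x hx.2).trans (image_id _)

theorem not_ambientLipEquiv_model_of_lt {F : Set (ℝ × (Fin 3 → ℝ))} (hF : IsFinger F) {n m : ℕ}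
    (hnm : n < m) : ¬ AmbientLipEquiv (model (rad m) F) (model (rad n) F) := by
  rintro ⟨U, V, hU, hV, h0U, h0V, h, g, hm, gm, hgh, hhg, ⟨L, hL, hL'⟩, h0, him⟩
  have hU' : split4 '' U ∈ 𝓝 0 :=
    (split4.toHomeomorph.isOpenMap _ hU).mem_nhds ⟨0, h0U, map_zero split4⟩
  have hV' : split4 '' V ∈ 𝓝 0 :=
    (split4.toHomeomorph.isOpenMap _ hV).mem_nhds ⟨0, h0V, map_zero split4⟩
  obtain ⟨r, hr, hrUV⟩ := Metric.mem_nhds_iff.1 (inter_mem hU' hV')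
  have inU : ∀ x, ‖x‖ < r → split4.symm x ∈ U := by
    intro x hx
    obtain ⟨u, hu, rfl⟩ := (hrUV (mem_ball_zero_iff.2 hx)).1
    rwa [ContinuousLinearEquiv.symm_apply_apply]
  have inV : ∀ x, ‖x‖ < r → split4.symm x ∈ V := by
    intro x hx
    obtain ⟨u, hu, rfl⟩ := (hrUV (mem_ball_zero_iff.2 hx)).2
    rwa [ContinuousLinearEquiv.symm_apply_apply]
  set A : E4 →L[ℝ] ℝ × (Fin 3 → ℝ) := split4.toContinuousLinearMap with hA
  set B : ℝ × (Fin 3 → ℝ) →L[ℝ] E4 := split4.symm.toContinuousLinearMap with hB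
  have lip : ∀ (f : E4 → E4) (s : Set E4), LipschitzOnWith L f s → ∀ x y,
      split4.symm x ∈ s → split4.symm y ∈ s →
      ‖split4 (f (split4.symm x)) - split4 (f (split4.symm y))‖ ≤
        max 1 (‖A‖ * (L * ‖B‖)) * ‖x - y‖ := by
    intro f s hf x y hx hy
    rw [← map_sub]
    calc _ ≤ ‖A‖ * ‖f (split4.symm x) - f (split4.symm y)‖ := A.le_opNorm _
      _ ≤ ‖A‖ * (L * ‖split4.symm x - split4.symm y‖) := by
        gcongr
        exact hf.norm_sub_le hx hy
      _ ≤ ‖A‖ * (L * (‖B‖ * ‖x - y‖)) := by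
        rw [← map_sub]
        gcongr
        exact B.le_opNorm _
      _ = ‖A‖ * (L * ‖B‖) * ‖x - y‖ := by ring
      _ ≤ _ := by gcongr; exact le_max_right _ _
  refine hF.not_bilipschitz (isRad_rad m) (isRad_rad n)
    (fun K κ hK hκ => rad_le_mul_rad hnm hK hκ) (le_max_left 1 (‖A‖ * (L * ‖B‖))) hr
    (h := fun x => split4 (h (split4.symm x))) (g := fun x => split4 (g (split4.symm x)))
    (fun x y hx hy => lip h U hL x y (inU x hx) (inU y hy))
    (fun x y hx hy => lip g V hL' x y (inV x hx) (inV y hy))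
    (fun x hx => ?_) (fun x hx => ?_) ?_ (fun x hx hxr => ?_) (fun x hx hxr => ?_)
  · simp [hgh _ (inU x hx)]
  · simp [hhg _ (inV x hx)]
  · simp [h0]
  · have : h (split4.symm x) ∈ model (rad n) F ∩ V :=
      him ▸ mem_image_of_mem h ⟨mem_image_of_mem _ hx, inU x hxr⟩
    obtain ⟨z, hz, hze⟩ := this.1
    rwa [← hze, ContinuousLinearEquiv.apply_symm_apply]
  · have : split4.symm x ∈ h '' (model (rad m) F ∩ U) :=
      him ▸ ⟨mem_image_of_mem _ hx, inV x hxr⟩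
    obtain ⟨z, ⟨⟨w, hw, rfl⟩, hzU⟩, hze⟩ := this
    rw [← hze, hgh _ hzU, ContinuousLinearEquiv.apply_symm_apply]
    exact hw

theorem not_ambientLipEquiv_model {F : Set (ℝ × (Fin 3 → ℝ))} (hF : IsFinger F) {n m : ℕ}
    (hnm : n ≠ m) : ¬ AmbientLipEquiv (model (rad n) F) (model (rad m) F) :=
  hnm.lt_or_gt.elim (fun h e => not_ambientLipEquiv_model_of_lt hF h e.symm)
    (fun h => not_ambientLipEquiv_model_of_lt hF h)

end Inequivalence

/-- Theorem 4.1: for every semialgebraic surface germ `(S,0) ⊆ ℝ⁴` there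
are infinitely many semialgebraic germs `(Xᵢ,0) ⊆ ℝ⁴`, all ambient topologically equivalent
to `(S,0)`, pairwise outer bi-Lipschitz equivalent, with pairwise ambient topologically
equivalent tangent cones at `0`, but pairwise NOT ambient Lipschitz equivalent. -/
theorem main_theorem (S : Set (EuclideanSpace ℝ (Fin 4)))
    (hsemi : IsSemialgebraic S) (h0S : 0 ∈ S)
    (hdim : ∃ ε₀ > (0 : ℝ), ∀ ε : ℝ, 0 < ε → ε ≤ ε₀ → dimH (S ∩ Metric.ball 0 ε) = 2) :
    ∃ X : ℕ → Set (EuclideanSpace ℝ (Fin 4)),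
      (∀ i, IsSemialgebraic (X i)) ∧ (∀ i, 0 ∈ X i) ∧
      (∀ i, AmbientTopEquiv (X i) S) ∧
      (∀ i j, OuterLipGermEquiv (X i) (X j)) ∧
      (∀ i j, AmbientTopEquiv (tangentConeAt ℝ (X i) 0) (tangentConeAt ℝ (X j) 0)) ∧
      (∀ i j, i ≠ j → ¬ AmbientLipEquiv (X i) (X j)) := by
  obtain ⟨Y, hY, hYS, hF⟩ := exists_isFinger hsemi h0S hdim
  refine ⟨fun i => model (rad i) (split4 '' Y), fun i => isSemialgebraic_model i hY,
    fun i => zero_mem_model (isRad_rad i) hF, fun i => ?_,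
    fun i j => outerLipGermEquiv_model (isRad_rad i) (isRad_rad j) hF, fun i j => ?_,
    fun i j hij => not_ambientLipEquiv_model hF hij⟩
  · have h := ambientTopEquiv_model (isRad_rad i) hF
    rw [image_image] at h
    simp only [ContinuousLinearEquiv.symm_apply_apply, image_id'] at h
    exact h.symm.trans hYS
  · rw [(tangentConeAt_model_subset (isRad_rad i) (isRad_rad j) hF).antisymm
      (tangentConeAt_model_subset (isRad_rad j) (isRad_rad i) hF)]
    exact .refl _
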